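/- Let I ⊂ ℝ be an interval and d, m ≥ 1. Assume all the hypotheses of the pointwise gradient estimate with J = I, namely: for some α ∈ (0,1), q_{ij} and the entries of B_i belong to C^{α/2,1+α}_loc(I×ℝ^d), the entries of C belong to C^{α/2,α}_loc(I×ℝ^d), Q, B_i, C are symmetric, ν₀ := inf_{I×ℝ^d} λ_Q > 0; B_i = b_i I_m + B̃_i with |(B̃_i)_{jk}(t,x)| ≤ ξ(t) λ_Q(t,x) for some ξ : I → (0,∞); for some β ≥ 1/4, sup_{I×ℝ^d}(Λ_C + β d m² ξ² λ_Q) < +∞; there exist λ > 0 and a positive φ ∈ C²(ℝ^d) blowing up at infinity with sup_{I×ℝ^d}(𝒜φ − λφ) < +∞; there exist γ ≥ 1/4 and k ≥ 0 with |D_x q_{ij}| ≤ k λ_Q on I×ℝ^d such that sup_{I×ℝ^d}[√d m ξ λ_Q + (∑_i |D_i C|²)^{1/2} + 2Λ_C] < +∞ and sup_{I×ℝ^d}[√d(∑_{i,j,l}|D_{il}q_{ij}|²)^{1/2} + (∑_{i,j}|D_j B̃_i|²)^{1/2} + Λ_{D_x b} + Λ_C + M_γ λ_Q + ½(∑_i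 |D_i C|²)^{1/2}] < +∞, where M_γ = γ(√d m ξ + d k)² + ½√d m ξ + 1/(4γ). Assume in addition Λ_C(t,x) ≤ −2γ d m² ξ(t)² λ_Q(t,x) for all (t,x) ∈ I×ℝ^d. Then for every p ≥ 1 + 1/(4(β∧γ)) there exist positive constants k_p and h_p such that for every f ∈ C_c^∞(ℝ^d;ℝ^m), every s < t in I, every bounded classical solution u of D_t u = 𝓐(·)u with u(s,·) = f and every bounded classical solution v of the scalar problem D_t v = 𝒜(·)v with v(s,·) = |f|^p, one has |D_x u(t,x)|^p ≤ k_p e^{h_p(t−s)} (t−s)^{−p/2} v(t,x) for all x ∈ ℝ^d. -/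

import Mathlib

open MeasureTheory Set Filter
open scoped BigOperators

/-- Partial derivative in the `i`-th coordinate direction. -/
noncomputable def pd {d : ℕ} {F : Type*} [NormedAddCommGroup F] [NormedSpace ℝ F]
    (f : EuclideanSpace ℝ (Fin d) → F) (x : EuclideanSpace ℝ (Fin d)) (i : Fin d) : F :=
  fderiv ℝ f x (EuclideanSpace.single i 1)

/-- `lam` is the minimum eigenvalue of the symmetric matrix `M` (via the Rayleigh quotient). -/
def IsMinEigen {n : ℕ} (M : Matrix (Fin n) (Fin n) ℝ) (lam : ℝ) : Prop :=
  (∀ w : Fin n → ℝ, lam * ∑ k, (w k) ^ 2 ≤ ∑ k, ∑ l, M k l * w k * w l) ∧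
    ∃ w : Fin n → ℝ, w ≠ 0 ∧ (∑ k, ∑ l, M k l * w k * w l) = lam * ∑ k, (w k) ^ 2

/-- `lam` is the maximum of the Rayleigh quotient of `M` (for symmetric `M`, the maximum
eigenvalue). -/
def IsMaxEigen {n : ℕ} (M : Matrix (Fin n) (Fin n) ℝ) (lam : ℝ) : Prop :=
  (∀ w : Fin n → ℝ, (∑ k, ∑ l, M k l * w k * w l) ≤ lam * ∑ k, (w k) ^ 2) ∧
    ∃ w : Fin n → ℝ, w ≠ 0 ∧ (∑ k, ∑ l, M k l * w k * w l) = lam * ∑ k, (w k) ^ 2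

/-- Local parabolic Hölder continuity of exponent `α/2` in time and `α` in space,
on `I × ℝ^d`. -/
def HolderLocPar (d : ℕ) (α : ℝ) (I : Set ℝ)
    (f : ℝ → EuclideanSpace ℝ (Fin d) → ℝ) : Prop :=
  ∀ K : Set (ℝ × EuclideanSpace ℝ (Fin d)), IsCompact K → (∀ pt ∈ K, pt.1 ∈ I) →
    ∃ c : ℝ, ∀ pt ∈ K, ∀ qt ∈ K,
      |f pt.1 pt.2 - f qt.1 qt.2| ≤ c * (|pt.1 - qt.1| ^ (α / 2) + ‖pt.2 - qt.2‖ ^ α)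

/-- Membership in `C^{α/2,1+α}_loc(I×ℝ^d)`: the function and its first-order spatial
derivatives are locally parabolic `α`-Hölder continuous. -/
def Cpar1 (d : ℕ) (α : ℝ) (I : Set ℝ)
    (f : ℝ → EuclideanSpace ℝ (Fin d) → ℝ) : Prop :=
  HolderLocPar d α I f ∧ (∀ t ∈ I, Differentiable ℝ (f t)) ∧
    ∀ i : Fin d, HolderLocPar d α I (fun t x => pd (f t) x i)

set_option linter.all false

section Development
open scoped ContDiff

abbrev EE (d : ℕ) := EuclideanSpace ℝ (Fin d)

/-- space-time coefficient types -/
abbrev CF (d : ℕ) := ℝ → EE d → ℝ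
abbrev CV (d : ℕ) := ℝ → EE d → Fin d → ℝ
abbrev CU (d m : ℕ) := ℝ → EE d → Fin m → ℝ
abbrev CQ (d : ℕ) := ℝ → EE d → Fin d → Fin d → ℝ
abbrev CM (d m : ℕ) := ℝ → EE d → Fin m → Fin m → ℝ
abbrev CA (d m : ℕ) := ℝ → EE d → Fin d → Fin m → Fin m → ℝ

abbrev MM (n : ℕ) := Fin n → Fin n → ℝ
abbrev MJ (d m : ℕ) := Fin d → Fin m → ℝ
abbrev MA (d m : ℕ) := Fin d → Fin m → Fin m → ℝ

open Finset (sum_comm sum_sub_distrib single_le_sum sum_mul abs_sum_le_sum_abs sum_le_card_nsmul sum_ite_eq sum_const card_univ sum_mul_sum sum_div)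
open Real (exp sqrt_nonneg sq_sqrt mul_self_sqrt exp_pos abs_le_sqrt)

local notation "pz" => by positivity

/-- second partial derivatives -/
local notation "pdd" f:max x:max i:max j:max => pd (fun y => pd f y i) x j

theorem sum_cg {ι M : Type*} [AddCommMonoid M] {s : Finset ι} {f g : ι → M} (h : ∀ i, f i = g i) : s.sum f = s.sum g := Finset.sum_congr rfl fun i _ => h i
theorem sum_le {ι : Type*} {s : Finset ι} {f g : ι → ℝ} (h : ∀ i, f i ≤ g i) : s.sum f ≤ s.sum g := Finset.sum_le_sum fun i _ => h i
theorem sum_nn {ι : Type*} {s : Finset ι} {f : ι → ℝ} (h : ∀ i, 0 ≤ f i) : 0 ≤ s.sum f := Finset.sum_nonneg fun i _ => h i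
theorem mul_le_l {a b c : ℝ} (h : b ≤ c) (ha : 0 ≤ a) : a * b ≤ a * c := mul_le_mul_of_nonneg_left h ha
theorem mul_le_r {a b c : ℝ} (h : b ≤ c) (ha : 0 ≤ a) : b * a ≤ c * a := mul_le_mul_of_nonneg_right h ha
theorem sum_ad {ι M : Type*} [AddCommMonoid M] {s : Finset ι} {f g : ι → M} : ∑ i ∈ s, (f i + g i) = ∑ i ∈ s, f i + ∑ i ∈ s, g i := Finset.sum_add_distrib
theorem mul_sm {ι : Type*} (s : Finset ι) (f : ι → ℝ) (b : ℝ) : b * ∑ i ∈ s, f i = ∑ i ∈ s, b * f i := Finset.mul_sum s f b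

section P1
variable {d : ℕ} {F : Type*} [NormedAddCommGroup F] [NormedSpace ℝ F]

theorem pd_eq_of_hasFDerivAt {f : EE d → F} {f' : EE d →L[ℝ] F} {x : EE d} (h : HasFDerivAt f f' x) (i : Fin d) :
    pd f x i = f' (EuclideanSpace.single i 1) := by
  rw [pd, h.fderiv]

theorem pd_add {f g : EE d → F} {x : EE d} (hf : DifferentiableAt ℝ f x) (hg : DifferentiableAt ℝ g x) (i : Fin d) :
    pd (fun y => f y + g y) x i = pd f x i + pd g x i := by
  rw [pd_eq_of_hasFDerivAt (hf.hasFDerivAt.fun_add hg.hasFDerivAt)]; rfl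

theorem pd_sub {f g : EE d → F} {x : EE d} (hf : DifferentiableAt ℝ f x) (hg : DifferentiableAt ℝ g x) (i : Fin d) :
    pd (fun y => f y - g y) x i = pd f x i - pd g x i := by
  rw [pd_eq_of_hasFDerivAt (hf.hasFDerivAt.fun_sub hg.hasFDerivAt)]; rfl

@[simp] theorem pd_const (c : F) (x : EE d) (i : Fin d) : pd (fun _ : EE d => c) x i = 0 := by
  simp [pd]

theorem pd_mul {f g : EE d → ℝ} {x : EE d} (hf : DifferentiableAt ℝ f x) (hg : DifferentiableAt ℝ g x) (i : Fin d) :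
    pd (fun y => f y * g y) x i = pd f x i * g x + f x * pd g x i := by
  rw [pd_eq_of_hasFDerivAt (hf.hasFDerivAt.fun_mul hg.hasFDerivAt)]
  simp [pd]; ring

theorem pd_const_mul {g : EE d → ℝ} {x : EE d} (c : ℝ) (hg : DifferentiableAt ℝ g x) (i : Fin d) :
    pd (fun y => c * g y) x i = c * pd g x i := by
  rw [pd_mul (differentiableAt_const c) hg]; simp

theorem pd_sum {κ : Type*} (s : Finset κ) {f : κ → EE d → F} {x : EE d}
    (hf : ∀ k ∈ s, DifferentiableAt ℝ (f k) x) (i : Fin d) :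
    pd (fun y => ∑ k ∈ s, f k y) x i = ∑ k ∈ s, pd (f k) x i := by
  rw [pd_eq_of_hasFDerivAt (HasFDerivAt.fun_sum fun k hk => (hf k hk).hasFDerivAt)]
  simp [pd]

theorem contDiff_pd {f : EE d → F} {n m : WithTop ℕ∞} (hf : ContDiff ℝ n f) (h : m + 1 ≤ n) (i : Fin d) :
    ContDiff ℝ m (fun x => pd f x i) :=
  (hf.fderiv_right h).clm_apply contDiff_const

theorem smooth_pd {f : EE d → F} (hf : ContDiff ℝ ∞ f) (i : Fin d) :
    ContDiff ℝ ∞ (fun x => pd f x i) := contDiff_pd hf (by simp) i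

theorem eu_decomp (a : EE d) : a = ∑ i, a i • EuclideanSpace.single i (1:ℝ) := by
  ext j; simp [Finset.sum_apply, Pi.single_apply]

theorem fderiv_eq_sum (f : EE d → F) (x a : EE d) : fderiv ℝ f x a = ∑ i, a i • pd f x i := by
  conv_lhs => rw [eu_decomp a]
  simp [pd]

theorem fderiv_eq_sum' (f : EE d → ℝ) (x a : EE d) : fderiv ℝ f x a = ∑ i, pd f x i * a i := by
  rw [fderiv_eq_sum]; exact sum_cg fun i => by rw [smul_eq_mul, mul_comm]

theorem hasDerivAt_line {f : EE d → ℝ} {x a : EE d} {t : ℝ} (hf : DifferentiableAt ℝ f (x + t • a)) :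
    HasDerivAt (fun τ : ℝ => f (x + τ • a)) (∑ i, pd f (x + t • a) i * a i) t := by
  have h1 : HasDerivAt (fun τ : ℝ => x + τ • a) a t := by
    simpa using ((hasDerivAt_id t).smul_const a).const_add x
  have h2 := hf.hasFDerivAt.comp_hasDerivAt t h1
  rw [fderiv_eq_sum'] at h2
  exact h2

theorem pd_comp {f : EE d → ℝ} {ψ : EE d → EE d} {x : EE d} (hf : DifferentiableAt ℝ f (ψ x))
    (hψ : DifferentiableAt ℝ ψ x) (l : Fin d) :
    pd (fun y => f (ψ y)) x l = ∑ i, pd f (ψ x) i * pd (fun y => ψ y i) x l := by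
  have h := hf.hasFDerivAt.comp x hψ.hasFDerivAt
  have h0 := pd_eq_of_hasFDerivAt h l
  rw [show (fun y => f (ψ y)) = f ∘ ψ from rfl, h0]
  rw [ContinuousLinearMap.comp_apply, fderiv_eq_sum']
  refine sum_cg fun i => ?_
  congr 1
  have h3 : HasFDerivAt (fun y => ψ y i) ((EuclideanSpace.proj i : EE d →L[ℝ] ℝ).comp (fderiv ℝ ψ x)) x :=
    (EuclideanSpace.proj i : EE d →L[ℝ] ℝ).hasFDerivAt.comp x hψ.hasFDerivAt
  rw [pd_eq_of_hasFDerivAt h3]; simp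

theorem pd_comp_real {f : ℝ → ℝ} {f' : ℝ} {g : EE d → ℝ} {x : EE d} (hf : HasDerivAt f f' (g x))
    (hg : DifferentiableAt ℝ g x) (l : Fin d) :
    pd (fun y => f (g y)) x l = f' * pd g x l := by
  have h := hf.comp_hasFDerivAt x hg.hasFDerivAt
  rw [show (fun y => f (g y)) = f ∘ g from rfl, pd_eq_of_hasFDerivAt h l]; simp [pd]

theorem pd_coord (x : EE d) (i l : Fin d) : pd (fun y : EE d => y i) x l = if i = l then 1 else 0 := by
  have h3 : HasFDerivAt (fun y : EE d => y i) (EuclideanSpace.proj i : EE d →L[ℝ] ℝ) x :=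
    (EuclideanSpace.proj i : EE d →L[ℝ] ℝ).hasFDerivAt
  rw [pd_eq_of_hasFDerivAt h3]; simp [Pi.single_apply]

theorem pd_pd_symm {f : EE d → ℝ} (hf : ContDiff ℝ 2 f) (x : EE d) (i j : Fin d) :
    pdd f x i j = pdd f x j i := by
  have hd : DifferentiableAt ℝ (fderiv ℝ f) x :=
    ((hf.fderiv_right (m := 1) (by norm_num)).differentiable (by norm_num)).differentiableAt
  have key : ∀ i j : Fin d, pdd f x i j
      = fderiv ℝ (fderiv ℝ f) x (EuclideanSpace.single j 1) (EuclideanSpace.single i 1) := by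
    intro i j
    have := (hd.hasFDerivAt.clm_apply (hasFDerivAt_const (EuclideanSpace.single i (1:ℝ)) x))
    have h2 := pd_eq_of_hasFDerivAt this j
    simp only [pd] at h2 ⊢
    rw [h2]; simp
  rw [key, key]
  have hs : IsSymmSndFDerivAt ℝ f x := (hf.contDiffAt).isSymmSndFDerivAt (by simp)
  exact hs _ _

/-- second derivative along a line -/
theorem hasDerivAt_line2 {f : EE d → ℝ} (hf : ContDiff ℝ 2 f) (x a : EE d) (t : ℝ) :
    HasDerivAt (fun τ : ℝ => ∑ i, pd f (x + τ • a) i * a i)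
      (∑ i, ∑ j, pdd f (x + t • a) i j * a i * a j) t := by
  refine HasDerivAt.fun_sum fun i _ => ?_
  have h1 : ContDiff ℝ 1 (fun y => pd f y i) := contDiff_pd hf (by norm_num) i
  have h := (hasDerivAt_line (f := fun y => pd f y i) (x := x) (a := a) (t := t)
    (h1.differentiable (by norm_num)).differentiableAt).mul_const (a i)
  refine h.congr_deriv ?_
  rw [sum_mul]
  exact sum_cg fun j => by ring

end P1

section BBsec
variable {d : ℕ} {Ω : Type*}

/-- families with uniformly bounded derivatives up to order `n`. -/
def BB : ℕ → (Ω → EE d → ℝ) → Prop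
  | 0, F => ∃ C, ∀ o x, |F o x| ≤ C
  | n+1, F => (∃ C, ∀ o x, |F o x| ≤ C) ∧ ∀ l, BB n (fun o x => pd (F o) x l)

theorem BB.bdd {n : ℕ} {F : Ω → EE d → ℝ} (h : BB n F) : ∃ C, 0 ≤ C ∧ ∀ o x, |F o x| ≤ C := by
  have : ∃ C, ∀ o x, |F o x| ≤ C := by cases n with
    | zero => exact h
    | succ n => exact h.1
  obtain ⟨C, hC⟩ := this
  exact ⟨max C 0, le_max_right _ _, fun o x => (hC o x).trans (le_max_left _ _)⟩

theorem BB.down {n : ℕ} {F : Ω → EE d → ℝ} (h : BB (n+1) F) : BB n F := by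
  induction n generalizing F with
  | zero => exact h.1
  | succ n ih => exact ⟨h.1, fun l => ih (h.2 l)⟩

theorem BB.pull {Ω' : Type*} (g : Ω' → Ω) {n : ℕ} {F : Ω → EE d → ℝ} (h : BB n F) :
    BB n (fun o' => F (g o')) := by
  induction n generalizing F with
  | zero => obtain ⟨C, hC⟩ := h; exact ⟨C, fun o x => hC _ x⟩
  | succ n ih =>
    refine ⟨?_, fun l => ih (h.2 l)⟩
    obtain ⟨C, hC⟩ := h.1; exact ⟨C, fun o x => hC _ x⟩

def Sm (F : Ω → EE d → ℝ) : Prop := ∀ o, ContDiff ℝ ∞ (F o)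

theorem smooth_diff {f : EE d → ℝ} (h : ContDiff ℝ ∞ f) (x : EE d) : DifferentiableAt ℝ f x :=
  (h.differentiable (by simp)).differentiableAt

theorem BB.add {n : ℕ} {F G : Ω → EE d → ℝ} (sF : Sm F) (sG : Sm G) (hF : BB n F) (hG : BB n G) :
    BB n (fun o x => F o x + G o x) := by
  have b : ∃ C, ∀ o x, |F o x + G o x| ≤ C := by
    obtain ⟨C, _, hC⟩ := hF.bdd; obtain ⟨D, _, hD⟩ := hG.bdd
    exact ⟨C + D, fun o x => (abs_add_le _ _).trans (add_le_add (hC o x) (hD o x))⟩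
  induction n generalizing F G with
  | zero => exact b
  | succ n ih =>
    refine ⟨b, fun l => ?_⟩
    have := ih (fun o => smooth_pd (sF o) l) (fun o => smooth_pd (sG o) l) (hF.2 l) (hG.2 l) ?_
    · convert this using 3 with o x
      exact pd_add (smooth_diff (sF o) x) (smooth_diff (sG o) x) l
    · obtain ⟨C, _, hC⟩ := (hF.2 l).bdd; obtain ⟨D, _, hD⟩ := (hG.2 l).bdd
      exact ⟨C + D, fun o x => (abs_add_le _ _).trans (add_le_add (hC o x) (hD o x))⟩

theorem BB.mul {n : ℕ} {F G : Ω → EE d → ℝ} (sF : Sm F) (sG : Sm G) (hF : BB n F) (hG : BB n G) :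
    BB n (fun o x => F o x * G o x) := by
  have b : ∃ C, ∀ o x, |F o x * G o x| ≤ C := by
    obtain ⟨C, hC0, hC⟩ := hF.bdd; obtain ⟨D, _, hD⟩ := hG.bdd
    exact ⟨C * D, fun o x => by
      rw [abs_mul]; exact mul_le_mul (hC o x) (hD o x) (abs_nonneg _) hC0⟩
  induction n generalizing F G with
  | zero => exact b
  | succ n ih =>
    refine ⟨b, fun l => ?_⟩
    have bb : ∀ {A B : Ω → EE d → ℝ}, BB n A → BB n B → ∃ C, ∀ o x, |A o x * B o x| ≤ C := by
      intro A B hA hB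
      obtain ⟨C, hC0, hC⟩ := hA.bdd; obtain ⟨D, _, hD⟩ := hB.bdd
      exact ⟨C * D, fun o x => by
        rw [abs_mul]; exact mul_le_mul (hC o x) (hD o x) (abs_nonneg _) hC0⟩
    have h1 := ih (fun o => smooth_pd (sF o) l) sG (hF.2 l) hG.down (bb (hF.2 l) hG.down)
    have h2 := ih sF (fun o => smooth_pd (sG o) l) hF.down (hG.2 l) (bb hF.down (hG.2 l))
    have := BB.add (fun o => (smooth_pd (sF o) l).mul (sG o)) (fun o => (sF o).mul (smooth_pd (sG o) l)) h1 h2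
    convert this using 3 with o x
    exact pd_mul (smooth_diff (sF o) x) (smooth_diff (sG o) x) l

theorem BB.const {n : ℕ} {c : Ω → ℝ} {C : ℝ} (hc : ∀ o, |c o| ≤ C) : BB n (fun o (_ : EE d) => c o) := by
  induction n generalizing c C with
  | zero => exact ⟨C, fun o _ => hc o⟩
  | succ n ih => 
    refine ⟨⟨C, fun o _ => hc o⟩, fun l => ?_⟩
    have := ih (c := fun _ => 0) (C := 0) (by simp)
    simpa using this

/-- smooth, with all derivatives uniformly bounded -/
structure SB (F : Ω → EE d → ℝ) : Prop where
  sm : Sm F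
  bb : ∀ n, BB n F

theorem SB.diff {F : Ω → EE d → ℝ} (h : SB F) (o : Ω) (x : EE d) : DifferentiableAt ℝ (F o) x :=
  smooth_diff (h.sm o) x
theorem SB.bdd {F : Ω → EE d → ℝ} (h : SB F) : ∃ C, 0 ≤ C ∧ ∀ o x, |F o x| ≤ C := (h.bb 0).bdd
theorem SB.pd {F : Ω → EE d → ℝ} (h : SB F) (l : Fin d) : SB (fun o x => pd (F o) x l) :=
  ⟨fun o => smooth_pd (h.sm o) l, fun n => (h.bb (n+1)).2 l⟩
theorem SB.add {F G : Ω → EE d → ℝ} (h : SB F) (h' : SB G) : SB (fun o x => F o x + G o x) :=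
  ⟨fun o => (h.sm o).add (h'.sm o), fun n => (h.bb n).add h.sm h'.sm (h'.bb n)⟩
theorem SB.mul {F G : Ω → EE d → ℝ} (h : SB F) (h' : SB G) : SB (fun o x => F o x * G o x) :=
  ⟨fun o => (h.sm o).mul (h'.sm o), fun n => (h.bb n).mul h.sm h'.sm (h'.bb n)⟩
theorem SB.const {c : Ω → ℝ} {C : ℝ} (hc : ∀ o, |c o| ≤ C) : SB (fun o (_ : EE d) => c o) :=
  ⟨fun _ => contDiff_const, fun _ => BB.const hc⟩
theorem SB.cst (c : ℝ) : SB (fun (_ : Ω) (_ : EE d) => c) := SB.const (C := |c|) fun _ => le_rfl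
theorem SB.pull {Ω' : Type*} (g : Ω' → Ω) {F : Ω → EE d → ℝ} (h : SB F) :
    SB (fun o' => F (g o')) := ⟨fun o => h.sm _, fun n => (h.bb n).pull g⟩
theorem SB.neg {F : Ω → EE d → ℝ} (h : SB F) : SB (fun o x => - F o x) := by
  have := (SB.cst (-1)).mul h
  simpa using this
theorem SB.sub {F G : Ω → EE d → ℝ} (h : SB F) (h' : SB G) : SB (fun o x => F o x - G o x) := by
  have := h.add h'.neg
  simpa [sub_eq_add_neg] using this
theorem SB.sum {κ : Type*} (s : Finset κ) {F : κ → Ω → EE d → ℝ} (h : ∀ k ∈ s, SB (F k)) :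
    SB (fun o x => ∑ k ∈ s, F k o x) := by
  classical
  induction s using Finset.induction_on with
  | empty => simpa using SB.cst 0
  | insert a s ha ih =>
    have := (h a (by simp)).add (ih fun k hk => h k (by simp [hk]))
    simpa [Finset.sum_insert ha] using this

theorem compactSupport_pd {f : EE d → ℝ} (h : HasCompactSupport f) (l : Fin d) :
    HasCompactSupport (fun x => pd f x l) := (h.fderiv ℝ).comp_left (g := fun L : EE d →L[ℝ] ℝ => L (EuclideanSpace.single l 1)) (by simp)

theorem SB.of_compact {f : EE d → ℝ} (h : ContDiff ℝ ∞ f) (hc : HasCompactSupport f) :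
    SB (fun (_ : Ω) => f) := by
  refine ⟨fun _ => h, fun n => ?_⟩
  have b : ∀ {f : EE d → ℝ}, ContDiff ℝ ∞ f → HasCompactSupport f → ∃ C, ∀ (_ : Ω) x, |f x| ≤ C := by
    intro f h hc
    obtain ⟨C, hC⟩ := hc.exists_bound_of_continuous h.continuous
    exact ⟨C, fun _ x => hC x⟩
  induction n generalizing f with
  | zero => exact b h hc
  | succ n ih => exact ⟨b h hc, fun l => ih (smooth_pd h l) (compactSupport_pd hc l)⟩

end BBsec

/-- parameters in `[-1,1]` -/
abbrev RR := {r : ℝ // |r| ≤ 1}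
def ng (r : RR) : RR := ⟨-r.1, by simpa using r.2⟩

noncomputable def vec {d : ℕ} (f : Fin d → ℝ) : EE d := WithLp.toLp 2 f
@[simp] theorem vec_apply {d : ℕ} (f : Fin d → ℝ) (i : Fin d) : (vec f) i = f i := rfl

noncomputable def dl {ι : Type} [DecidableEq ι] (a b : ι) : ℝ := if a = b then 1 else 0

structure Sch (d : ℕ) (A ι κ : Type) where
  η : A → κ → EE d → Fin d → ℝ
  β : κ → EE d → Fin d → ℝ
  N : A → κ → EE d → ι → ι → ℝ
  R : A → κ × RR → EE d → ι → ι → ℝ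
  hη : ∀ α i, SB (fun k x => η α k x i)
  hβ : ∀ i, SB (fun k x => β k x i)
  hN : ∀ α a b, SB (fun k x => N α k x a b)
  hR : ∀ α a b, SB (fun k x => R α k x a b)

namespace Sch
variable {d : ℕ} {A ι κ : Type} [Fintype A] [Fintype ι] [DecidableEq ι] (S : Sch d A ι κ)

noncomputable def sh (α : A) (k : κ) (r : RR) (x : EE d) : EE d :=
  x + vec (fun i => r.1 * S.η α k x i + r.1 ^ 2 * S.β k x i)

noncomputable def M (α : A) (k : κ) (r : RR) (x : EE d) (a b : ι) : ℝ :=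
  dl a b + r.1 * S.N α k x a b + r.1 ^ 2 * S.R α (k, r) x a b

noncomputable def H (α : A) (k : κ) (r : RR) (U : EE d → ι → ℝ) (x : EE d) (a : ι) : ℝ :=
  ∑ b, S.M α k r x a b * U (S.sh α k r x) b

noncomputable def step (k : κ) (r : RR) (U : EE d → ι → ℝ) (x : EE d) (a : ι) : ℝ :=
  (1 / (Fintype.card A : ℝ)) * ∑ α, (1 / 2) * (S.H α k r U x a + S.H α k (ng r) U x a)

theorem SB_r {Ω : Type*} (g : Ω → RR) : SB (fun (o : Ω) (_ : EE d) => (g o).1) := SB.const (C := 1) fun o => (g o).2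

theorem sb_mul_r {F : κ × RR → EE d → ℝ} (h : SB F) : SB (fun o x => o.2.1 * F o x) :=
  (SB_r (fun o : κ × RR => o.2)).mul h

theorem sb_dl (a b : ι) : SB (fun (_ : κ × RR) (_ : EE d) => dl a b) := SB.cst _

/-- the prolonged scheme, acting on `(U, D U)` -/
noncomputable def pro : Sch d A (Option (Fin d) × ι) κ where
  η := S.η
  β := S.β
  N := fun α k x p q => match p, q with
    | (none, a), (none, b) => S.N α k x a b
    | (none, _), (some _, _) => 0
    | (some l, a), (none, b) => pd (fun y => S.N α k y a b) x l
    | (some l, a), (some i, b) => S.N α k x a b * dl l i + dl a b * pd (fun y => S.η α k y i) x l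
  R := fun α k x p q => match p, q with
    | (none, a), (none, b) => S.R α k x a b
    | (none, _), (some _, _) => 0
    | (some l, a), (none, b) => pd (fun y => S.R α k y a b) x l
    | (some l, a), (some i, b) => S.R α k x a b * dl l i + dl a b * pd (fun y => S.β k.1 y i) x l
        + S.N α k.1 x a b * pd (fun y => S.η α k.1 y i) x l
        + k.2.1 * (S.N α k.1 x a b * pd (fun y => S.β k.1 y i) x l)
        + k.2.1 * (S.R α k x a b * pd (fun y => S.η α k.1 y i) x l)
        + k.2.1 * (k.2.1 * (S.R α k x a b * pd (fun y => S.β k.1 y i) x l))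
  hη := S.hη
  hβ := S.hβ
  hN := by
    rintro α ⟨_ | l, a⟩ ⟨_ | i, b⟩
    · exact S.hN α a b
    · exact SB.cst 0
    · exact (S.hN α a b).pd l
    · exact ((S.hN α a b).mul (SB.cst _)).add ((SB.cst _).mul ((S.hη α i).pd l))
  hR := by
    rintro α ⟨_ | l, a⟩ ⟨_ | i, b⟩
    · exact S.hR α a b
    · exact SB.cst 0
    · exact (S.hR α a b).pd l
    · have hη := ((S.hη α i).pd l).pull (Ω' := κ × RR) Prod.fst
      have hβ := ((S.hβ i).pd l).pull (Ω' := κ × RR) Prod.fst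
      have hN := (S.hN α a b).pull (Ω' := κ × RR) Prod.fst
      have hR := S.hR α a b
      exact (((((hR.mul (sb_dl l i)).add ((sb_dl a b).mul hβ)).add (hN.mul hη)).add
        (sb_mul_r (hN.mul hβ))).add (sb_mul_r (hR.mul hη))).add (sb_mul_r (sb_mul_r (hR.mul hβ)))

noncomputable def hat (U : EE d → ι → ℝ) (x : EE d) : Option (Fin d) × ι → ℝ := fun p =>
  match p with
  | (none, a) => U x a
  | (some l, a) => pd (fun y => U y a) x l

def SmV (U : EE d → ι → ℝ) : Prop := ∀ a, ContDiff ℝ ∞ (fun x => U x a)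

theorem smooth_vec {ψ : EE d → Fin d → ℝ} (h : ∀ i, ContDiff ℝ ∞ (fun x => ψ x i)) :
    ContDiff ℝ ∞ (fun x => vec (ψ x)) := by
  rw [contDiff_euclidean]; exact h

theorem smooth_sh (α : A) (k : κ) (r : RR) : ContDiff ℝ ∞ (S.sh α k r) := by
  refine contDiff_id.add (smooth_vec fun i => ?_)
  exact (contDiff_const.mul ((S.hη α i).sm k)).add (contDiff_const.mul ((S.hβ i).sm k))

theorem smooth_M (α : A) (k : κ) (r : RR) (a b : ι) : ContDiff ℝ ∞ (fun x => S.M α k r x a b) :=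
  (contDiff_const.add (contDiff_const.mul ((S.hN α a b).sm k))).add (contDiff_const.mul ((S.hR α a b).sm (k, r)))

theorem smooth_H {U : EE d → ι → ℝ} (hU : SmV U) (α : A) (k : κ) (r : RR) : SmV (S.H α k r U) := by
  intro a
  refine ContDiff.sum fun b _ => ?_
  exact (S.smooth_M α k r a b).mul ((hU b).comp (S.smooth_sh α k r))

theorem smooth_step {U : EE d → ι → ℝ} (hU : SmV U) (k : κ) (r : RR) : SmV (S.step k r U) := by
  intro a
  refine contDiff_const.mul (ContDiff.sum fun α _ => contDiff_const.mul ?_)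
  exact (S.smooth_H hU α k r a).add (S.smooth_H hU α k (ng r) a)

theorem pd_sh (α : A) (k : κ) (r : RR) (x : EE d) (i l : Fin d) :
    pd (fun y => S.sh α k r y i) x l = dl l i + r.1 * pd (fun y => S.η α k y i) x l
      + r.1 ^ 2 * pd (fun y => S.β k y i) x l := by
  have e : (fun y => S.sh α k r y i) = fun y => y i + (r.1 * S.η α k y i + r.1 ^ 2 * S.β k y i) := by
    funext y; simp [sh]
  have h1 := (S.hη α i).diff k x
  have h2 := (S.hβ i).diff k x
  have h3 : DifferentiableAt ℝ (fun y : EE d => y i) x := (EuclideanSpace.proj i : EE d →L[ℝ] ℝ).differentiableAt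
  rw [e, pd_add h3 ((h1.const_mul _).fun_add (h2.const_mul _)), pd_add (h1.const_mul _) (h2.const_mul _),
    pd_const_mul _ h1, pd_const_mul _ h2, pd_coord]
  simp only [dl, eq_comm (a := i) (b := l)]; ring

theorem pd_M (α : A) (k : κ) (r : RR) (x : EE d) (a b : ι) (l : Fin d) :
    pd (fun y => S.M α k r y a b) x l = r.1 * pd (fun y => S.N α k y a b) x l
      + r.1 ^ 2 * pd (fun y => S.R α (k, r) y a b) x l := by
  have h1 := (S.hN α a b).diff k x
  have h2 := (S.hR α a b).diff (k, r) x
  unfold M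
  rw [pd_add ((differentiableAt_const _).fun_add (h1.const_mul _)) (h2.const_mul _), 
    pd_add (differentiableAt_const _) (h1.const_mul _), pd_const_mul _ h1, pd_const_mul _ h2]
  simp

theorem hat_H {U : EE d → ι → ℝ} (hU : SmV U) (α : A) (k : κ) (r : RR) (x : EE d) :
    hat (S.H α k r U) x = S.pro.H α k r (hat U) x := by
  funext p
  have hs : S.pro.sh α k r x = S.sh α k r x := rfl
  rcases p with ⟨_ | l, a⟩
  · simp only [hat, H, Fintype.sum_prod_type, Fintype.sum_option, hs]
    simp [M, pro, dl]
  · simp only [hat, H]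
    have hc : ∀ b, DifferentiableAt ℝ (fun y => U (S.sh α k r y) b) x := fun b =>
      smooth_diff ((hU b).comp (S.smooth_sh α k r)) x
    rw [pd_sum _ fun b _ => (smooth_diff (S.smooth_M α k r a b) x).fun_mul (hc b)]
    rw [Fintype.sum_prod_type, Fintype.sum_option, sum_comm, ← sum_ad]
    refine sum_cg fun b => ?_
    rw [pd_mul (smooth_diff (S.smooth_M α k r a b) x) (hc b)]
    rw [hs]
    have h1 : S.pro.M α k r x (some l, a) (none, b) = pd (fun y => S.M α k r y a b) x l := by
      rw [pd_M]; simp [M, pro, dl]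
    have h2 : ∀ i, S.pro.M α k r x (some l, a) (some i, b) =
        S.M α k r x a b * pd (fun y => S.sh α k r y i) x l := by
      intro i
      rw [pd_sh]; simp only [M, pro]
      have : dl ((some l, a) : Option (Fin d) × ι) (some i, b) = dl a b * dl l i := by
        simp only [dl, Prod.mk.injEq, Option.some.injEq]
        split_ifs <;> simp_all
      rw [this]; ring
    rw [h1]
    have h3 := pd_comp (f := fun y => U y b) (ψ := S.sh α k r) (x := x) (smooth_diff (hU b) _)
      ((S.smooth_sh α k r).differentiable (by simp)).differentiableAt l
    simp only [h2]
    congr 1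
    rw [h3, mul_sm]
    exact sum_cg fun i => by ring

theorem hat_step {U : EE d → ι → ℝ} (hU : SmV U) (k : κ) (r : RR) (x : EE d) :
    hat (S.step k r U) x = S.pro.step k r (hat U) x := by
  funext p
  have hH := S.hat_H hU
  unfold step
  simp only [← hH]
  rcases p with ⟨_ | l, a⟩
  · simp [hat]
  · simp only [hat]
    have hd : ∀ α, ∀ r, DifferentiableAt ℝ (fun y => S.H α k r U y a) x := fun α r =>
      smooth_diff (S.smooth_H hU α k r a) x
    rw [pd_const_mul _ (DifferentiableAt.fun_sum fun α _ => ((hd α r).fun_add (hd α (ng r))).const_mul _)]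
    rw [pd_sum _ fun α _ => ((hd α r).fun_add (hd α (ng r))).const_mul _]
    congr 1
    refine sum_cg fun α => ?_
    rw [pd_const_mul _ ((hd α r).fun_add (hd α (ng r))), pd_add (hd α r) (hd α (ng r))]

end Sch

theorem fin_bdd {d : ℕ} {Ω : Type*} {J : Type*} [Finite J] {F : J → Ω → EE d → ℝ} (h : ∀ j, ∃ C, 0 ≤ C ∧ ∀ o x, |F j o x| ≤ C) :
    ∃ C, 0 ≤ C ∧ ∀ j o x, |F j o x| ≤ C := by
  have := Fintype.ofFinite J
  choose c hc hb using h
  exact ⟨∑ j, c j, sum_nn fun j => hc j, fun j o x =>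
    (hb j o x).trans (single_le_sum (f := c) (fun j _ => hc j) (Finset.mem_univ j))⟩

theorem sq_sum_le {J : Type*} [Fintype J] (z n : J → ℝ) {c : ℝ} (hn : ∀ j, |n j| ≤ c) :
    (∑ j, z j * n j) ^ 2 ≤ (Fintype.card J * c ^ 2) * ∑ j, z j ^ 2 := by
  refine (Finset.sum_mul_sq_le_sq_mul_sq _ _ _).trans ?_
  rw [mul_comm]
  refine mul_le_r ?_ (sum_nn fun j => sq_nonneg _)
  calc ∑ j, n j ^ 2 ≤ ∑ _j : J, c ^ 2 := sum_le fun j => sq_le_sq' (by linarith [abs_le.1 (hn j)]) (abs_le.1 (hn j)).2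
    _ = _ := by simp

namespace Sch
variable {d : ℕ} {A ι κ : Type} [Fintype A] [Fintype ι] [DecidableEq ι] (S : Sch d A ι κ)

theorem bounds : ∃ C, 0 ≤ C ∧ (∀ α k x a b, |S.N α k x a b| ≤ C) ∧ (∀ α k x a b, |S.R α k x a b| ≤ C) ∧
    (∀ α k x i, |S.η α k x i| ≤ C) ∧ (∀ k x i, |S.β k x i| ≤ C) := by
  obtain ⟨C1, h1, H1⟩ := fin_bdd (J := A × ι × ι) (F := fun j k x => S.N j.1 k x j.2.1 j.2.2) fun j => (S.hN _ _ _).bdd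
  obtain ⟨C2, h2, H2⟩ := fin_bdd (J := A × ι × ι) (F := fun j k x => S.R j.1 k x j.2.1 j.2.2) fun j => (S.hR _ _ _).bdd
  obtain ⟨C3, h3, H3⟩ := fin_bdd (J := A × Fin d) (F := fun j k x => S.η j.1 k x j.2) fun j => (S.hη _ _).bdd
  obtain ⟨C4, h4, H4⟩ := fin_bdd (J := Fin d) (F := fun j k x => S.β k x j) fun j => (S.hβ _).bdd
  refine ⟨C1 + C2 + C3 + C4, pz, fun α k x a b => ?_, fun α k x a b => ?_, fun α k x i => ?_, fun k x i => ?_⟩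
  · linarith [H1 (α, a, b) k x]
  · linarith [H2 (α, a, b) k x]
  · linarith [H3 (α, i) k x]
  · linarith [H4 i k x]

theorem r2_le (r : RR) : r.1 ^ 2 ≤ 1 := by
  have := r.2; rw [← sq_abs]; nlinarith [abs_nonneg r.1]

theorem crude_alg {z n s t r K Z : ℝ} (hr : r ^ 2 ≤ 1) (hz : z ^ 2 ≤ Z) (hn : n ^ 2 ≤ K * Z) (hs : s ^ 2 ≤ K * Z) (ht : t ^ 2 ≤ K * Z) :
    (z + r * n + r ^ 2 * s) ^ 2 + (z - r * n + r ^ 2 * t) ^ 2 ≤ 2 * z ^ 2 + r ^ 2 * ((10 * K + 2) * Z) := by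
  have e : (z + r * n + r ^ 2 * s) ^ 2 + (z - r * n + r ^ 2 * t) ^ 2
    = 2 * z ^ 2 + r ^ 2 * (2 * n ^ 2 + 2 * z * s + 2 * z * t + 2 * (r * n) * s - 2 * (r * n) * t + r ^ 2 * (s ^ 2 + t ^ 2)) := by ring
  rw [e]
  have h1 : 2 * z * s ≤ z ^ 2 + s ^ 2 := by nlinarith [sq_nonneg (z - s)]
  have h2 : 2 * z * t ≤ z ^ 2 + t ^ 2 := by nlinarith [sq_nonneg (z - t)]
  have hrn : (r * n) ^ 2 ≤ n ^ 2 := by rw [mul_pow]; nlinarith [sq_nonneg n]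
  have h3 : 2 * (r * n) * s ≤ (r * n) ^ 2 + s ^ 2 := by nlinarith [sq_nonneg (r * n - s)]
  have h4 : - (2 * (r * n) * t) ≤ (r * n) ^ 2 + t ^ 2 := by nlinarith [sq_nonneg (r * n + t)]
  have h5 : r ^ 2 * (s ^ 2 + t ^ 2) ≤ s ^ 2 + t ^ 2 := by nlinarith [sq_nonneg s, sq_nonneg t]
  have := mul_le_l (a := r ^ 2) (by linarith : (2 * n ^ 2 + 2 * z * s + 2 * z * t + 2 * (r * n) * s - 2 * (r * n) * t + r ^ 2 * (s ^ 2 + t ^ 2)) ≤ (10 * K + 2) * Z) (sq_nonneg r)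
  linarith

theorem step_bound [Nonempty A] : ∃ C, 0 ≤ C ∧ ∀ (k : κ) (r : RR) (U : EE d → ι → ℝ) (m0 : ℝ),
    (∀ x, ∑ a, U x a ^ 2 ≤ m0) → ∀ x, ∑ a, S.step k r U x a ^ 2 ≤ (1 + C * r.1 ^ 2) * m0 := by
  obtain ⟨c, hc, hN, hR, -, -⟩ := S.bounds
  set K : ℝ := Fintype.card ι * c ^ 2 with hK
  have hK0 : 0 ≤ K := pz
  refine ⟨Fintype.card ι * (5 * K + 1), pz, fun k r U m0 hU x => ?_⟩
  set D : ℝ := 1 + Fintype.card ι * (5 * K + 1) * r.1 ^ 2 with hD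
  have hD1 : 0 < D := pz
  set ζ := S.step k r U x with hζ
  set Z := ∑ a, ζ a ^ 2 with hZ
  have hn : (0:ℝ) < Fintype.card A := by exact_mod_cast Fintype.card_pos
  set p : A → RR → ι → ℝ := fun α ρ b => ∑ a, ζ a * S.M α k ρ x a b with hp
  have pform : ∀ α ρ b, p α ρ b = ζ b + ρ.1 * (∑ a, ζ a * S.N α k x a b) + ρ.1 ^ 2 * ∑ a, ζ a * S.R α (k, ρ) x a b := by
    intro α ρ b
    simp only [hp, M, mul_add, sum_ad, mul_sm]
    congr 1
    · congr 1
      · simp [dl]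
      · exact sum_cg fun a => by ring
    · exact sum_cg fun a => by ring
  have hz : ∀ b, ζ b ^ 2 ≤ Z := fun b => single_le_sum (f := fun a => ζ a ^ 2) (fun a _ => sq_nonneg _) (Finset.mem_univ b)
  have psum : ∀ α, ∑ b, p α r b ^ 2 + ∑ b, p α (ng r) b ^ 2 ≤ 2 * D * Z := by
    intro α
    rw [← sum_ad]
    calc ∑ b, (p α r b ^ 2 + p α (ng r) b ^ 2) ≤ ∑ b, (2 * ζ b ^ 2 + r.1 ^ 2 * ((10 * K + 2) * Z)) := by
          refine sum_le fun b => ?_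
          have := crude_alg (r2_le r) (hz b) (n := ∑ a, ζ a * S.N α k x a b) (sq_sum_le _ _ fun a => hN α k x a b)
            (sq_sum_le _ _ fun a => hR α (k, r) x a b) (sq_sum_le _ _ fun a => hR α (k, ng r) x a b)
          rw [pform, pform]
          refine le_trans (le_of_eq ?_) this
          have hng : (ng r).1 = - r.1 := rfl
          rw [hng]; ring
      _ = 2 * D * Z := by
          rw [sum_ad, ← mul_sm]; simp [hD]; ring
  have hH : ∀ α ρ, ∑ a, ζ a * S.H α k ρ U x a = ∑ b, p α ρ b * U (S.sh α k ρ x) b := by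
    intro α ρ
    simp only [H, hp, mul_sm, sum_mul]
    rw [sum_comm]
    exact sum_cg fun a => sum_cg fun b => by ring
  have young : ∀ α ρ, ∑ a, ζ a * S.H α k ρ U x a ≤ (1 / 2) * ((∑ b, p α ρ b ^ 2) / D + D * m0) := by
    intro α ρ
    rw [hH]
    calc ∑ b, p α ρ b * U (S.sh α k ρ x) b ≤ ∑ b, (1 / 2) * (p α ρ b ^ 2 / D + D * U (S.sh α k ρ x) b ^ 2) := by
          refine sum_le fun b => ?_
          have : 0 ≤ (p α ρ b - D * U (S.sh α k ρ x) b) ^ 2 / D := pz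
          have e : (p α ρ b - D * U (S.sh α k ρ x) b) ^ 2 / D = p α ρ b ^ 2 / D + D * U (S.sh α k ρ x) b ^ 2 - 2 * (p α ρ b * U (S.sh α k ρ x) b) := by
            field_simp; ring
          linarith
      _ = (1 / 2) * ((∑ b, p α ρ b ^ 2) / D + D * ∑ b, U (S.sh α k ρ x) b ^ 2) := by
          rw [← mul_sm, sum_ad, sum_div, mul_sm]
      _ ≤ _ := by
          have := mul_le_l (hU (S.sh α k ρ x)) hD1.le
          linarith
  have hZe : Z = (1 / (Fintype.card A : ℝ)) * ∑ α, (1 / 2) * ((∑ a, ζ a * S.H α k r U x a) + ∑ a, ζ a * S.H α k (ng r) U x a) := by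
    have : ∀ a, ζ a ^ 2 = (1 / (Fintype.card A : ℝ)) * ∑ α, (1 / 2) * (ζ a * S.H α k r U x a + ζ a * S.H α k (ng r) U x a) := by
      intro a
      have : ζ a ^ 2 = ζ a * S.step k r U x a := by rw [hζ]; ring
      rw [this, step]
      simp only [mul_sm]
      exact sum_cg fun b => by ring
    rw [hZ, sum_cg fun a => this a, ← mul_sm, sum_comm]
    congr 1
    refine sum_cg fun α => ?_
    rw [← mul_sm, sum_ad]
  have key : Z ≤ (1 / (Fintype.card A : ℝ)) * ∑ _α : A, ((1 / 2) * Z + (1 / 2) * D * m0) := by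
    conv_lhs => rw [hZe]
    refine mul_le_l (sum_le fun α => ?_) (pz)
    have h1 := young α r
    have h2 := young α (ng r)
    have h3 : (∑ b, p α r b ^ 2) / D + (∑ b, p α (ng r) b ^ 2) / D ≤ 2 * Z := by
      rw [← add_div, div_le_iff₀ hD1]; linarith [psum α]
    linarith
  rw [sum_const, card_univ, nsmul_eq_mul, ← mul_assoc, one_div, inv_mul_cancel₀ hn.ne', one_mul] at key
  linarith

/-- iterates -/
noncomputable def it (ks : ℕ → κ) (r : RR) (f : EE d → ι → ℝ) : ℕ → EE d → ι → ℝ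
  | 0 => f
  | j+1 => S.step (ks j) r (it ks r f j)

theorem it_sm {f : EE d → ι → ℝ} (hf : SmV f) (ks : ℕ → κ) (r : RR) (j : ℕ) : SmV (S.it ks r f j) := by
  induction j with
  | zero => exact hf
  | succ j ih => exact S.smooth_step ih _ _

theorem it_hat {f : EE d → ι → ℝ} (hf : SmV f) (ks : ℕ → κ) (r : RR) (j : ℕ) :
    hat (S.it ks r f j) = S.pro.it ks r (hat f) j := by
  induction j with
  | zero => rfl
  | succ j ih =>
    show hat (S.step _ _ _) = S.pro.step _ _ _
    rw [← ih]; funext x; exact S.hat_step (S.it_sm hf ks r j) _ _ x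

theorem it_bdd [Nonempty A] (T : ℝ) {f : EE d → ι → ℝ} {m0 : ℝ} (hf : ∀ x, ∑ a, f x a ^ 2 ≤ m0) :
    ∃ B, ∀ (ks : ℕ → κ) (r : RR) (j : ℕ), (j : ℝ) * r.1 ^ 2 ≤ T → ∀ x, ∑ a, S.it ks r f j x a ^ 2 ≤ B := by
  obtain ⟨C, hC, h⟩ := S.step_bound
  have hm0 : 0 ≤ m0 := (sum_nn fun a => sq_nonneg _).trans (hf 0)
  refine ⟨exp (C * T) * m0, fun ks r j hj x => ?_⟩
  have : ∀ j : ℕ, ∀ x, ∑ a, S.it ks r f j x a ^ 2 ≤ (1 + C * r.1 ^ 2) ^ j * m0 := by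
    intro j
    induction j with
    | zero => simpa [it] using hf
    | succ j ih =>
      intro x
      have := h (ks j) r _ _ ih x
      refine this.trans (le_of_eq ?_)
      ring
  refine (this j x).trans (mul_le_r ?_ hm0)
  calc (1 + C * r.1 ^ 2) ^ j ≤ (exp (C * r.1 ^ 2)) ^ j := by
        refine pow_le_pow_left₀ (pz) ?_ j
        linarith [Real.add_one_le_exp (C * r.1 ^ 2)]
    _ = exp (C * (j * r.1 ^ 2)) := by rw [← Real.exp_nat_mul]; congr 1; ring
    _ ≤ _ := Real.exp_le_exp.2 (mul_le_l hj hC)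

/-- parameters of the iterates -/
def Par (κ : Type) (T : ℝ) := {o : (ℕ → κ) × RR × ℕ // (o.2.2 : ℝ) * o.2.1.1 ^ 2 ≤ T}

theorem hat_bdd {f : EE d → ι → ℝ} (hf : ∀ a, SB (fun (_ : Unit) x => f x a)) : 
    ∀ p, SB (fun (_ : Unit) x => hat f x p) := by
  rintro ⟨_ | l, a⟩
  · exact hf a
  · exact (hf a).pd l

theorem it_BB [Nonempty A] (T : ℝ) (n : ℕ) : ∀ {ι : Type} [Fintype ι] [DecidableEq ι] (S : Sch d A ι κ) {f : EE d → ι → ℝ}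
    (_ : ∀ a, SB (fun (_ : Unit) x => f x a)) (a : ι),
    BB n (fun (o : Par κ T) x => S.it o.1.1 o.1.2.1 f o.1.2.2 x a) := by
  have zero : ∀ {ι : Type} [Fintype ι] [DecidableEq ι] (S : Sch d A ι κ) {f : EE d → ι → ℝ}
    (_ : ∀ a, SB (fun (_ : Unit) x => f x a)) (a : ι), ∃ C, ∀ (o : Par κ T) x, |S.it o.1.1 o.1.2.1 f o.1.2.2 x a| ≤ C := by
    intro ι _ _ S f hf a
    obtain ⟨C, hC0, hC⟩ := fin_bdd (F := fun a (_ : Unit) x => f x a) fun a => (hf a).bdd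
    obtain ⟨B, hB⟩ := S.it_bdd (m0 := ∑ _a : ι, C ^ 2) T (f := f) (fun x => sum_le fun a => by
      rw [← sq_abs]; exact pow_le_pow_left₀ (abs_nonneg _) (hC a () x) 2)
    refine ⟨√B, fun o x => abs_le_sqrt ?_⟩
    exact (single_le_sum (f := fun a => S.it o.1.1 o.1.2.1 f o.1.2.2 x a ^ 2) (fun a _ => sq_nonneg _) (Finset.mem_univ a)).trans
      (hB _ _ _ o.2 x)
  induction n with
  | zero => exact zero
  | succ n ih =>
    intro ι _ _ S f hf a
    refine ⟨zero S hf a, fun l => ?_⟩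
    have := ih S.pro (hat_bdd hf) (some l, a)
    convert this using 3 with o x
    rw [← S.it_hat (fun a => (hf a).sm ())]
    rfl

theorem it_SB [Nonempty A] (T : ℝ) {f : EE d → ι → ℝ}
    (hf : ∀ a, SB (fun (_ : Unit) x => f x a)) (a : ι) :
    SB (fun (o : Par κ T) x => S.it o.1.1 o.1.2.1 f o.1.2.2 x a) :=
  ⟨fun o => S.it_sm (fun a => (hf a).sm ()) _ _ _ a, fun n => it_BB T n S hf a⟩

end Sch

theorem mvt01 {φ φ' : ℝ → ℝ} {K : ℝ} (h : ∀ t ∈ Icc (0:ℝ) 1, HasDerivAt φ (φ' t) t) (h0 : φ 0 = 0)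
    (hK : ∀ t ∈ Icc (0:ℝ) 1, |φ' t| ≤ K) : ∀ t ∈ Icc (0:ℝ) 1, |φ t| ≤ K := by
  intro t ht
  have := Convex.norm_image_sub_le_of_norm_hasDerivWithin_le (s := Icc (0:ℝ) 1) (f := φ) (f' := φ') (C := K)
    (fun x hx => (h x hx).hasDerivWithinAt) (fun x hx => by simpa using hK x hx) (convex_Icc 0 1)
    (left_mem_Icc.2 zero_le_one) ht
  rw [h0, sub_zero, sub_zero, Real.norm_eq_abs, Real.norm_eq_abs, abs_of_nonneg ht.1] at this
  have hK0 : 0 ≤ K := (abs_nonneg _).trans (hK t ht)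
  nlinarith [ht.2]

theorem abs_sum_le_card {J : Type*} [Fintype J] {f : J → ℝ} {c : ℝ} (h : ∀ j, |f j| ≤ c) :
    |∑ j, f j| ≤ Fintype.card J * c := by
  refine (abs_sum_le_sum_abs _ _).trans ((sum_le fun j => h j).trans ?_)
  simp

theorem taylor3 {d : ℕ} {f : EE d → ℝ} (hf : ContDiff ℝ ∞ f) {C B : ℝ} (hB : 0 ≤ B)
    (hC : ∀ y i j k, |pdd (fun y => pd f y i) y j k| ≤ C) (x a : EE d) (ha : ∀ i, |a i| ≤ B) :
    |f (x + a) - f x - ∑ i, pd f x i * a i - 1 / 2 * ∑ i, ∑ j, pdd f x i j * a i * a j| ≤ C * (d * B) ^ 3 := by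
  set g1 : ℝ → ℝ := fun t => ∑ i, pd f (x + t • a) i * a i with hg1
  set g2 : ℝ → ℝ := fun t => ∑ i, ∑ j, pdd f (x + t • a) i j * a i * a j with hg2
  set g3 : ℝ → ℝ := fun t => ∑ i, ∑ j, ∑ k, pdd (fun y => pd f y i) (x + t • a) j k * a i * a j * a k with hg3
  have d0 : ∀ t, HasDerivAt (fun t : ℝ => f (x + t • a)) (g1 t) t := fun t => hasDerivAt_line (smooth_diff hf _)
  have d1 : ∀ t, HasDerivAt g1 (g2 t) t := fun t => hasDerivAt_line2 (contDiff_infty.1 hf 2) x a t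
  have d2 : ∀ t, HasDerivAt g2 (g3 t) t := by
    intro t
    refine HasDerivAt.fun_sum fun i _ => HasDerivAt.fun_sum fun j _ => ?_
    have := ((hasDerivAt_line (x := x) (a := a) (t := t) (smooth_diff (smooth_pd (smooth_pd hf i) j) _)).mul_const (a i)).mul_const (a j)
    refine this.congr_deriv ?_
    rw [sum_mul, sum_mul]
    exact sum_cg fun k => by ring
  have b3 : ∀ t, |g3 t| ≤ C * (d * B) ^ 3 := by
    intro t
    have : C * (d * B) ^ 3 = (Fintype.card (Fin d)) * ((Fintype.card (Fin d)) * ((Fintype.card (Fin d)) * (C * B * B * B))) := by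
      simp; ring
    rw [this]
    refine abs_sum_le_card fun i => abs_sum_le_card fun j => abs_sum_le_card fun k => ?_
    have h0 := hC (x + t • a) i j k
    have hC0 := (abs_nonneg _).trans h0
    simp only [abs_mul]
    gcongr <;> apply ha
  have s2 := mvt01 (φ := fun t => g2 t - g2 0) (φ' := g3) (fun t _ => (d2 t).sub_const _) (by simp) (fun t _ => b3 t)
  have s1 := mvt01 (φ := fun t => g1 t - g1 0 - t * g2 0) (φ' := fun t => g2 t - g2 0)
    (fun t _ => by
      have := ((d1 t).sub_const (g1 0)).fun_sub ((hasDerivAt_id t).mul_const (g2 0))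
      refine this.congr_deriv ?_
      simp) (by simp) s2
  have s0 := mvt01 (φ := fun t => f (x + t • a) - f x - t * g1 0 - 1 / 2 * (t ^ 2 * g2 0)) (φ' := fun t => g1 t - g1 0 - t * g2 0)
    (fun t _ => by
      have := (((d0 t).sub_const (f x)).fun_sub ((hasDerivAt_id t).mul_const (g1 0))).fun_sub
        ((((hasDerivAt_id t).pow 2).mul_const (g2 0)).const_mul (1 / 2))
      refine this.congr_deriv ?_
      simp; ring) (by simp) s1 1 (by simp)
  simpa [hg1, hg2] using s0

theorem ab2 {x y p q : ℝ} (hx : |x| ≤ p) (hy : |y| ≤ q) : |x * y| ≤ p * q := by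
  rw [abs_mul]; exact mul_le_mul hx hy (abs_nonneg _) ((abs_nonneg _).trans hx)

theorem ab6 {a b c d e f A B C D E F : ℝ} (ha : |a| ≤ A) (hb : |b| ≤ B) (hc : |c| ≤ C) (hd : |d| ≤ D) (he : |e| ≤ E) (hf : |f| ≤ F) :
    |a + b + c + d + e + f| ≤ A + B + C + D + E + F := by
  rw [abs_le] at *; constructor <;> linarith

theorem cons_alg {δ N R₁ R₂ U De Db A B G e₁ e₂ ρ c c2 c3 V₁ V₂ : ℝ} (hρ : |ρ| ≤ 1) (hδ : |δ| ≤ 1)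
    (hN : |N| ≤ c) (hR₁ : |R₁| ≤ c) (hR₂ : |R₂| ≤ c) (hDe : |De| ≤ c2) (hDb : |Db| ≤ c2) (hA : |A| ≤ c2)
    (hB : |B| ≤ c2) (hG : |G| ≤ c2) (he₁ : |e₁| ≤ c3 * |ρ| ^ 3) (he₂ : |e₂| ≤ c3 * |ρ| ^ 3)
    (hV₁ : V₁ = U + ρ * De + ρ ^ 2 * Db + 1 / 2 * (ρ ^ 2 * A + 2 * ρ ^ 3 * B + ρ ^ 4 * G) + e₁)
    (hV₂ : V₂ = U - ρ * De + ρ ^ 2 * Db + 1 / 2 * (ρ ^ 2 * A - 2 * ρ ^ 3 * B + ρ ^ 4 * G) + e₂) :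
    |(δ + ρ * N + ρ ^ 2 * R₁) * V₁ + (δ - ρ * N + ρ ^ 2 * R₂) * V₂ - δ * (2 * U + 2 * ρ ^ 2 * Db + ρ ^ 2 * A)
      - 2 * ρ ^ 2 * (N * De) - ρ ^ 2 * ((R₁ + R₂) * U)| ≤ (c2 + 2 * c * c2 + 2 * (1 + c) * c3 + 2 * c * (4 * c2 + c3)) * |ρ| ^ 3 := by
  have r0 := abs_nonneg ρ
  have hc : 0 ≤ c := (abs_nonneg _).trans hN
  have hc2 : 0 ≤ c2 := (abs_nonneg _).trans hDe
  have r3 : |ρ| ^ 3 ≤ |ρ| := pow_le_of_le_one r0 hρ (by norm_num)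
  have r2 : |ρ| ^ 2 ≤ |ρ| := pow_le_of_le_one r0 hρ (by norm_num)
  have r4 : |ρ| ^ 4 ≤ |ρ| := pow_le_of_le_one r0 hρ (by norm_num)
  have r43 : |ρ| ^ 4 ≤ |ρ| ^ 3 := by nlinarith [pow_nonneg r0 3]
  have hc3 : 0 ≤ c3 * |ρ| ^ 3 := (abs_nonneg _).trans he₁
  have hc3' : c3 * |ρ| ^ 3 ≤ |c3| * |ρ| := (le_abs_self _).trans (by
    rw [abs_mul, abs_of_nonneg (pow_nonneg r0 3)]; exact mul_le_l r3 (abs_nonneg _))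
  by_cases hρ0 : ρ = 0
  · subst hρ0
    have : e₁ = 0 := by simpa using he₁
    have h' : e₂ = 0 := by simpa using he₂
    simp [hV₁, hV₂, this, h']; ring_nf
  have hc30 : 0 ≤ c3 := by
    by_contra hneg
    have : 0 < |ρ| ^ 3 := pz
    nlinarith
  rw [abs_of_nonneg hc30] at hc3'
  have ab : ∀ {p x : ℝ} {n : ℕ}, |x| ≤ c2 → |ρ ^ n * x| ≤ |ρ| ^ n * c2 := by
    intro p x n hx
    rw [abs_mul, abs_pow]; exact mul_le_l hx (pz)
  have a1 := ab (n := 1) (p := 0) hDe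
  have a2 := ab (n := 2) (p := 0) hDb
  have a3 := ab (n := 2) (p := 0) hA
  have a4 := ab (n := 3) (p := 0) hB
  have a5 := ab (n := 4) (p := 0) hG
  have m1 : |ρ| ^ 2 * c2 ≤ |ρ| * c2 := mul_le_r r2 hc2
  have m2 : |ρ| ^ 3 * c2 ≤ |ρ| * c2 := mul_le_r r3 hc2
  have m3 : |ρ| ^ 4 * c2 ≤ |ρ| * c2 := mul_le_r r4 hc2
  rw [pow_one, pow_one] at a1
  rw [abs_le] at a1 a2 a3 a4 a5
  have v1 : |V₁ - U| ≤ |ρ| * (4 * c2 + c3) := by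
    rw [abs_le] at he₁ ⊢; constructor <;> rw [hV₁] <;> linarith
  have v2 : |V₂ - U| ≤ |ρ| * (4 * c2 + c3) := by
    rw [abs_le] at he₂ ⊢; constructor <;> rw [hV₂] <;> linarith
  have e : (δ + ρ * N + ρ ^ 2 * R₁) * V₁ + (δ - ρ * N + ρ ^ 2 * R₂) * V₂ - δ * (2 * U + 2 * ρ ^ 2 * Db + ρ ^ 2 * A)
      - 2 * ρ ^ 2 * (N * De) - ρ ^ 2 * ((R₁ + R₂) * U) = δ * (ρ ^ 4 * G) + 2 * (N * (ρ ^ 4 * B)) + (δ + ρ * N) * e₁ + (δ - ρ * N) * e₂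
        + ρ ^ 2 * (R₁ * (V₁ - U)) + ρ ^ 2 * (R₂ * (V₂ - U)) := by
    rw [hV₁, hV₂]; ring
  rw [e]
  have p4 : |ρ ^ 4| ≤ |ρ| ^ 3 := by rw [abs_pow]; exact r43
  have p2 : |ρ ^ 2| ≤ |ρ| ^ 2 := by rw [abs_pow]
  have t1 := ab2 hδ (ab2 p4 hG)
  have t2 := ab2 (le_of_eq (abs_two (α := ℝ))) (ab2 hN (ab2 p4 hB))
  have n1 : |ρ * N| ≤ c := by have := ab2 hρ hN; rwa [one_mul] at this
  have t3 := ab2 ((abs_add_le δ (ρ * N)).trans (add_le_add hδ n1)) he₁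
  have t4 := ab2 ((abs_sub δ (ρ * N)).trans (add_le_add hδ n1)) he₂
  have t5 := ab2 p2 (ab2 hR₁ v1)
  have t6 := ab2 p2 (ab2 hR₂ v2)
  refine (ab6 t1 t2 t3 t4 t5 t6).trans (le_of_eq ?_)
  ring

namespace Sch
variable {d : ℕ} {A ι κ : Type} [Fintype A] [Fintype ι] [DecidableEq ι] (S : Sch d A ι κ)

noncomputable def gen1 (α : A) (k : κ) (r : RR) (U : EE d → ι → ℝ) (x : EE d) (a : ι) : ℝ :=
  1 / 2 * (∑ i, ∑ j, pdd (fun z => U z a) x i j * S.η α k x i * S.η α k x j)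
    + ∑ b, S.N α k x a b * (∑ i, pd (fun z => U z b) x i * S.η α k x i)
    + 1 / 2 * ∑ b, (S.R α (k, r) x a b + S.R α (k, ng r) x a b) * U x b
    + ∑ i, pd (fun z => U z a) x i * S.β k x i

noncomputable def gen (k : κ) (r : RR) (U : EE d → ι → ℝ) (x : EE d) (a : ι) : ℝ :=
  (1 / (Fintype.card A : ℝ)) * ∑ α, S.gen1 α k r U x a

theorem taylor_sh {f : EE d → ℝ} (hf : ContDiff ℝ ∞ f) {c C : ℝ} (hc : 0 ≤ c)
    (hC : ∀ y i j k, |pdd (fun y => pd f y i) y j k| ≤ C)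
    (hη : ∀ α k x i, |S.η α k x i| ≤ c) (hβ : ∀ k x i, |S.β k x i| ≤ c) (α : A) (k : κ) (r : RR) (x : EE d) :
    ∃ e, |e| ≤ C * (d * (2 * c)) ^ 3 * |r.1| ^ 3 ∧ f (S.sh α k r x) = f x + r.1 * (∑ i, pd f x i * S.η α k x i)
      + r.1 ^ 2 * (∑ i, pd f x i * S.β k x i)
      + 1 / 2 * (r.1 ^ 2 * (∑ i, ∑ j, pdd f x i j * S.η α k x i * S.η α k x j)
        + 2 * r.1 ^ 3 * (1 / 2 * (∑ i, ∑ j, pdd f x i j * S.η α k x i * S.β k x j)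
           + 1 / 2 * (∑ i, ∑ j, pdd f x i j * S.β k x i * S.η α k x j))
        + r.1 ^ 4 * (∑ i, ∑ j, pdd f x i j * S.β k x i * S.β k x j)) + e := by
  have h := taylor3 hf (B := 2 * c * |r.1|) (pz) hC x (vec (fun i => r.1 * S.η α k x i + r.1 ^ 2 * S.β k x i)) (by
    intro i
    rw [vec_apply]
    refine (abs_add_le _ _).trans ?_
    have a1 := ab2 (le_refl |r.1|) (hη α k x i)
    have a2 := ab2 (le_refl |r.1|) (ab2 r.2 (hβ k x i))
    rw [show r.1 ^ 2 * S.β k x i = r.1 * (r.1 * S.β k x i) by ring]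
    linarith)
  refine ⟨_, h.trans (le_of_eq (by ring)), ?_⟩
  simp only [vec_apply, Sch.sh, mul_sm]
  have e1 : ∀ p q : MM d, (∑ i, ∑ j, p i j) + (∑ i, ∑ j, q i j) = ∑ i, ∑ j, (p i j + q i j) := fun p q => by
    simp only [sum_ad]
  have e2 : (∑ i, ∑ j, 1 / 2 * (pdd f x i j * (r.1 * S.η α k x i + r.1 ^ 2 * S.β k x i) * (r.1 * S.η α k x j + r.1 ^ 2 * S.β k x j)))
     = 1 / 2 * (r.1 ^ 2 * (∑ i, ∑ j, pdd f x i j * S.η α k x i * S.η α k x j)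
        + 2 * r.1 ^ 3 * (1 / 2 * (∑ i, ∑ j, pdd f x i j * S.η α k x i * S.β k x j)
           + 1 / 2 * (∑ i, ∑ j, pdd f x i j * S.β k x i * S.η α k x j))
        + r.1 ^ 4 * (∑ i, ∑ j, pdd f x i j * S.β k x i * S.β k x j)) := by
    simp only [mul_sm, e1]
    exact sum_cg fun i => sum_cg fun j => by ring
  have e3 : (∑ i, pd f x i * (r.1 * S.η α k x i + r.1 ^ 2 * S.β k x i)) = r.1 * (∑ i, pd f x i * S.η α k x i)
      + r.1 ^ 2 * (∑ i, pd f x i * S.β k x i) := by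
    simp only [mul_sm, ← sum_ad]
    exact sum_cg fun i => by ring
  simp only [mul_sm] at e2 e3
  rw [e2, e3]
  ring

theorem cons {Ω : Type*} {U : Ω → EE d → ι → ℝ} [Nonempty A] (hU : ∀ a, SB (fun o x => U o x a)) :
    ∃ C, 0 ≤ C ∧ ∀ o k (r : RR) x a, |S.step k r (U o) x a - U o x a - r.1 ^ 2 * S.gen k r (U o) x a| ≤ C * |r.1| ^ 3 := by
  obtain ⟨c, hc, hN, hR, hη, hβ⟩ := S.bounds
  obtain ⟨C1, h1, H1⟩ := fin_bdd (J := ι × Fin d) (F := fun j o x => pd (fun z => U o z j.1) x j.2) fun j => ((hU _).pd _).bdd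
  obtain ⟨C2, h2, H2⟩ := fin_bdd (J := ι × Fin d × Fin d) (F := fun j o x => pd (fun y => pd (fun z => U o z j.1) y j.2.1) x j.2.2)
    fun j => (((hU _).pd _).pd _).bdd
  obtain ⟨C3, h3, H3⟩ := fin_bdd (J := ι × Fin d × Fin d × Fin d)
    (F := fun j o x => pd (fun y => pd (fun y => pd (fun z => U o z j.1) y j.2.1) y j.2.2.1) x j.2.2.2)
    fun j => ((((hU _).pd _).pd _).pd _).bdd
  set c2 : ℝ := d * (C1 * c) + d * (d * (C2 * c * c)) with hc2
  set c3 : ℝ := C3 * (d * (2 * c)) ^ 3 with hc3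
  set K : ℝ := (c2 + 2 * c * c2 + 2 * (1 + c) * c3 + 2 * c * (4 * c2 + c3)) with hK
  have hK0 : 0 ≤ K := pz
  refine ⟨Fintype.card ι * K, pz, fun o k r x a => ?_⟩
  have q1 : 0 ≤ d * (C1 * c) := pz
  have q2 : 0 ≤ d * (d * (C2 * c * c)) := pz
  have s1 : ∀ b (g : Fin d → ℝ), (∀ i, |g i| ≤ c) → |∑ i, pd (fun z => U o z b) x i * g i| ≤ c2 := by
    intro b g hg
    have := abs_sum_le_card (f := fun i => pd (fun z => U o z b) x i * g i) (c := C1 * c) fun i => ab2 (H1 (b, i) o x) (hg i)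
    rw [Fintype.card_fin] at this
    linarith
  have s2 : ∀ b (g g' : Fin d → ℝ), (∀ i, |g i| ≤ c) → (∀ i, |g' i| ≤ c) → |∑ i, ∑ j, pdd (fun z => U o z b) x i j * g i * g' j| ≤ c2 := by
    intro b g g' hg hg'
    have := abs_sum_le_card (f := fun i => ∑ j, pdd (fun z => U o z b) x i j * g i * g' j) (c := d * (C2 * c * c)) fun i => by
      have := abs_sum_le_card (f := fun j => pdd (fun z => U o z b) x i j * g i * g' j) (c := C2 * c * c) fun j =>
        ab2 (ab2 (H2 (b, i, j) o x) (hg i)) (hg' j)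
      rwa [Fintype.card_fin] at this
    rw [Fintype.card_fin] at this
    linarith
  have key : ∀ α, |S.H α k r (U o) x a + S.H α k (ng r) (U o) x a - 2 * U o x a - 2 * r.1 ^ 2 * S.gen1 α k r (U o) x a| ≤ Fintype.card ι * (K * |r.1| ^ 3) := by
    intro α
    have hb : ∀ b, |S.M α k r x a b * U o (S.sh α k r x) b + S.M α k (ng r) x a b * U o (S.sh α k (ng r) x) b
        - dl a b * (2 * U o x b + 2 * r.1 ^ 2 * (∑ i, pd (fun z => U o z b) x i * S.β k x i)
          + r.1 ^ 2 * (∑ i, ∑ j, pdd (fun z => U o z b) x i j * S.η α k x i * S.η α k x j))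
        - 2 * r.1 ^ 2 * (S.N α k x a b * (∑ i, pd (fun z => U o z b) x i * S.η α k x i))
        - r.1 ^ 2 * ((S.R α (k, r) x a b + S.R α (k, ng r) x a b) * U o x b)| ≤ K * |r.1| ^ 3 := by
      intro b
      obtain ⟨e₁, he₁, E₁⟩ := S.taylor_sh ((hU b).sm o) hc (fun y i j k => H3 (b, i, j, k) o y) hη hβ α k r x
      obtain ⟨e₂, he₂, E₂⟩ := S.taylor_sh ((hU b).sm o) hc (fun y i j k => H3 (b, i, j, k) o y) hη hβ α k (ng r) x
      have hng : (ng r).1 = - r.1 := rfl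
      rw [hng, abs_neg] at he₂
      rw [hng] at E₂
      have := cons_alg (δ := dl a b) (N := S.N α k x a b) (R₁ := S.R α (k, r) x a b) (R₂ := S.R α (k, ng r) x a b) r.2
        (by unfold dl; split_ifs <;> simp) (hN α k x a b) (hR _ _ _ _ _) (hR _ _ _ _ _) (s1 b _ (hη α k x)) (s1 b _ (hβ k x))
        (s2 b _ _ (hη α k x) (hη α k x))
        (B := 1 / 2 * (∑ i, ∑ j, pdd (fun z => U o z b) x i j * S.η α k x i * S.β k x j)
           + 1 / 2 * (∑ i, ∑ j, pdd (fun z => U o z b) x i j * S.β k x i * S.η α k x j)) (by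
          have := s2 b _ _ (hη α k x) (hβ k x)
          have := s2 b _ _ (hβ k x) (hη α k x)
          rw [abs_le] at *; constructor <;> linarith) (s2 b _ _ (hβ k x) (hβ k x)) he₁ he₂ E₁ (E₂.trans (by ring))
      simp only [Sch.M, hng]
      refine le_trans (le_of_eq ?_) this
      congr 1
      ring
    refine le_trans (le_of_eq ?_) (abs_sum_le_card hb)
    congr 1
    simp only [sum_sub_distrib, sum_ad, Sch.H, Sch.gen1, dl, ite_mul, one_mul, zero_mul, sum_ite_eq, Finset.mem_univ, if_true,
      ← mul_sm]
    ring
  have hn : (Fintype.card A : ℝ) ≠ 0 := by simp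
  have e : S.step k r (U o) x a - U o x a - r.1 ^ 2 * S.gen k r (U o) x a = (1 / (Fintype.card A : ℝ)) * ∑ α, 1 / 2 * (S.H α k r (U o) x a + S.H α k (ng r) (U o) x a - 2 * U o x a - 2 * r.1 ^ 2 * S.gen1 α k r (U o) x a) := by
    simp only [Sch.step, Sch.gen, ← mul_sm, sum_sub_distrib, sum_const, card_univ, nsmul_eq_mul]
    field_simp
  rw [e, abs_mul, abs_of_nonneg (pz)]
  have := abs_sum_le_card (f := fun α => 1 / 2 * (S.H α k r (U o) x a + S.H α k (ng r) (U o) x a - 2 * U o x a - 2 * r.1 ^ 2 * S.gen1 α k r (U o) x a))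
    (c := 1 / 2 * (Fintype.card ι * (K * |r.1| ^ 3))) fun α => ab2 (by norm_num) (key α)
  have hn' : (0:ℝ) < Fintype.card A := pz
  calc _ ≤ (1 / (Fintype.card A : ℝ)) * (Fintype.card A * (1 / 2 * (Fintype.card ι * (K * |r.1| ^ 3)))) := by gcongr
    _ = 1 / 2 * (Fintype.card ι * (K * |r.1| ^ 3)) := by field_simp
    _ ≤ _ := by
      have : 0 ≤ Fintype.card ι * (K * |r.1| ^ 3) := pz
      linarith

end Sch

theorem interp1 {d : ℕ} {f : EE d → ℝ} (hf : ContDiff ℝ ∞ f) {A B h : ℝ} (hh : 0 < h) (hA : ∀ x, |f x| ≤ A)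
    (l : Fin d) (hB : ∀ x, |pdd f x l l| ≤ B) (x : EE d) : |pd f x l| ≤ 2 * A / h + B * h := by
  set a : EE d := EuclideanSpace.single l 1 with ha
  have hd : ∀ t : ℝ, HasDerivAt (fun t : ℝ => f (x + t • a)) (pd f (x + t • a) l) t := by
    intro t
    have := hasDerivAt_line (x := x) (a := a) (t := t) (smooth_diff hf _)
    simpa [ha, Pi.single_apply] using this
  have hd2 : ∀ t : ℝ, HasDerivAt (fun t : ℝ => pd f (x + t • a) l) (pdd f (x + t • a) l l) t := by
    intro t
    have := hasDerivAt_line (x := x) (a := a) (t := t) (smooth_diff (smooth_pd hf l) _)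
    simpa [ha, Pi.single_apply] using this
  obtain ⟨c, hc, e⟩ := exists_hasDerivAt_eq_slope (fun t : ℝ => f (x + t • a)) (fun t => pd f (x + t • a) l) hh
    (fun t _ => (hd t).continuousAt.continuousWithinAt) (fun t _ => hd t)
  have h2 := Convex.norm_image_sub_le_of_norm_hasDerivWithin_le (s := (univ : Set ℝ)) (C := B)
    (fun t _ => (hd2 t).hasDerivWithinAt) (fun t _ => hB _) convex_univ (mem_univ c) (mem_univ 0)
  simp only [zero_smul, add_zero, Real.norm_eq_abs, zero_sub, abs_neg, abs_of_pos hc.1] at h2 e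
  have hB0 : 0 ≤ B := (abs_nonneg _).trans (hB x)
  have h3 : |pd f (x + c • a) l| ≤ 2 * A / h := by
    rw [e, sub_zero, abs_div, abs_of_pos hh]
    gcongr
    have := abs_sub (f (x + h • a)) (f x)
    linarith [hA x, hA (x + h • a)]
  have h4 : B * c ≤ B * h := mul_le_l hc.2.le hB0
  have := abs_le.1 h2
  rw [abs_le] at h3 ⊢
  constructor <;> linarith

theorem interp {d : ℕ} {Ω : Type*} {F : Ω → EE d → ℝ} (hF : SB F) {ε : ℝ} (hε : 0 < ε) : ∃ ε' > 0, ∀ o, (∀ x, |F o x| ≤ ε') →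
    ∀ x l, |pd (F o) x l| ≤ ε := by
  obtain ⟨B, hB0, hB⟩ := fin_bdd (J := Fin d) (F := fun j o x => pdd (F o) x j j) fun j => ((hF.pd j).pd j).bdd
  have h1 : 0 < ε / (2 * (B + 1)) := pz
  refine ⟨ε / 4 * (ε / (2 * (B + 1))), pz, fun o ho x l => ?_⟩
  refine (interp1 (hF.sm o) h1 ho l (fun x => hB l o x) x).trans ?_
  have : 2 * (ε / 4 * (ε / (2 * (B + 1)))) / (ε / (2 * (B + 1))) = ε / 2 := by field_simp; ring
  rw [this]
  have : B * (ε / (2 * (B + 1))) ≤ ε / 2 := by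
    rw [mul_div_assoc', div_le_div_iff₀ (pz) (pz)]
    nlinarith
  linarith

/-- bounded, and uniformly continuous in time -/
def UC {κ X : Type*} [PseudoMetricSpace κ] (F : κ → X → ℝ) : Prop :=
  (∃ C, 0 ≤ C ∧ ∀ k x, |F k x| ≤ C) ∧ ∀ ε > 0, ∃ δ > 0, ∀ k k', dist k k' < δ → ∀ x, |F k x - F k' x| ≤ ε

namespace UC
variable {κ X : Type*} [PseudoMetricSpace κ] {F G : κ → X → ℝ}
theorem add (hF : UC F) (hG : UC G) : UC (fun k x => F k x + G k x) := by
  obtain ⟨⟨C, hC0, hC⟩, h1⟩ := hF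
  obtain ⟨⟨D, hD0, hD⟩, h2⟩ := hG
  refine ⟨⟨C + D, pz, fun k x => (abs_add_le _ _).trans (add_le_add (hC k x) (hD k x))⟩, fun ε hε => ?_⟩
  obtain ⟨δ1, hδ1, a1⟩ := h1 (ε / 2) (pz)
  obtain ⟨δ2, hδ2, a2⟩ := h2 (ε / 2) (pz)
  refine ⟨min δ1 δ2, pz, fun k k' hk x => ?_⟩
  have b1 := a1 k k' (hk.trans_le (min_le_left _ _)) x
  have b2 := a2 k k' (hk.trans_le (min_le_right _ _)) x
  rw [abs_le] at *; constructor <;> linarith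
theorem mul (hF : UC F) (hG : UC G) : UC (fun k x => F k x * G k x) := by
  obtain ⟨⟨C, hC0, hC⟩, h1⟩ := hF
  obtain ⟨⟨D, hD0, hD⟩, h2⟩ := hG
  refine ⟨⟨C * D, pz, fun k x => ab2 (hC k x) (hD k x)⟩, fun ε hε => ?_⟩
  obtain ⟨δ1, hδ1, a1⟩ := h1 (ε / (2 * (D + 1))) (pz)
  obtain ⟨δ2, hδ2, a2⟩ := h2 (ε / (2 * (C + 1))) (pz)
  refine ⟨min δ1 δ2, pz, fun k k' hk x => ?_⟩
  have b1 := ab2 (a1 k k' (hk.trans_le (min_le_left _ _)) x) (hD k x)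
  have b2 := ab2 (hC k' x) (a2 k k' (hk.trans_le (min_le_right _ _)) x)
  have e : F k x * G k x - F k' x * G k' x = (F k x - F k' x) * G k x + F k' x * (G k x - G k' x) := by ring
  rw [e]
  refine (abs_add_le _ _).trans ?_
  have c1 : ε / (2 * (D + 1)) * D ≤ ε / 2 := by
    rw [div_mul_eq_mul_div, div_le_div_iff₀ (pz) (pz)]; nlinarith
  have c2 : C * (ε / (2 * (C + 1))) ≤ ε / 2 := by
    rw [mul_div_assoc', div_le_div_iff₀ (pz) (pz)]; nlinarith
  linarith
theorem of_const {f : X → ℝ} {C : ℝ} (h : ∀ x, |f x| ≤ C) : UC (fun (_ : κ) x => f x) :=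
  ⟨⟨|C|, abs_nonneg _, fun _ x => (h x).trans (le_abs_self _)⟩, fun ε hε => ⟨1, one_pos, fun _ _ _ x => by simpa using hε.le⟩⟩
theorem sum {J : Type*} [Fintype J] {F : J → κ → X → ℝ} (h : ∀ j, UC (F j)) : UC (fun k x => ∑ j, F j k x) := by
  classical
  have : ∀ s : Finset J, UC (fun k x => ∑ j ∈ s, F j k x) := by
    intro s
    induction s using Finset.induction_on with
    | empty => simpa using of_const (κ := κ) (X := X) (f := fun _ => 0) (C := 0) (by simp)
    | insert a s ha ih => simpa [Finset.sum_insert ha] using (h a).add ih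
  exact this _
theorem pullX {Y : Type*} (g : Y → X) (h : UC F) : UC (fun k y => F k (g y)) := by
  obtain ⟨⟨C, hC0, hC⟩, h1⟩ := h
  refine ⟨⟨C, hC0, fun k y => hC _ _⟩, fun ε hε => ?_⟩
  obtain ⟨δ, hδ, a⟩ := h1 ε hε
  exact ⟨δ, hδ, fun k k' hk x => a k k' hk _⟩
end UC

namespace Sch
variable {d : ℕ} {A ι κ : Type} [Fintype A] [Fintype ι] [DecidableEq ι] (S : Sch d A ι κ)

theorem gen_SB {Ω : Type*} {U : Ω → EE d → ι → ℝ} (hU : ∀ a, SB (fun o x => U o x a)) (a : ι) :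
    SB (fun (o : Ω × κ × RR) x => S.gen o.2.1 o.2.2 (U o.1) x a) := by
  have hη := fun α i => (S.hη α i).pull (Ω' := Ω × κ × RR) (fun o => o.2.1)
  have hβ := fun i => (S.hβ i).pull (Ω' := Ω × κ × RR) (fun o => o.2.1)
  have hN := fun α a b => (S.hN α a b).pull (Ω' := Ω × κ × RR) (fun o => o.2.1)
  have hR := fun α a b => (S.hR α a b).pull (Ω' := Ω × κ × RR) (fun o => (o.2.1, o.2.2))
  have hR' := fun α a b => (S.hR α a b).pull (Ω' := Ω × κ × RR) (fun o => (o.2.1, ng o.2.2))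
  have hu := fun a => (hU a).pull (Ω' := Ω × κ × RR) (fun o => o.1)
  unfold gen gen1
  refine (SB.cst _).mul (SB.sum _ fun α _ => ?_)
  refine ((SB.add ?_ ?_).add ?_).add ?_
  · exact (SB.cst _).mul (SB.sum _ fun i _ => SB.sum _ fun j _ => ((((hu a).pd i).pd j).mul (hη α i)).mul (hη α j))
  · exact SB.sum _ fun b _ => (hN α a b).mul (SB.sum _ fun i _ => ((hu b).pd i).mul (hη α i))
  · exact (SB.cst _).mul (SB.sum _ fun b _ => ((hR α a b).add (hR' α a b)).mul (hu b))
  · exact SB.sum _ fun i _ => ((hu a).pd i).mul (hβ i)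

theorem gen_UC [PseudoMetricSpace κ] (tη : ∀ α i, UC (fun k x => S.η α k x i)) (tβ : ∀ i, UC (fun k x => S.β k x i))
    (tN : ∀ α a b, UC (fun k x => S.N α k x a b)) (tR : ∀ α a b, UC (fun k (x : RR × EE d) => S.R α (k, x.1) x.2 a b))
    {Ω : Type*} {U : Ω → EE d → ι → ℝ} (hU : ∀ a, SB (fun o x => U o x a)) (a : ι) :
    UC (fun k (o : Ω × RR × EE d) => S.gen k o.2.1 (U o.1) o.2.2 a) := by
  have hη := fun α i => (tη α i).pullX (fun o : Ω × RR × EE d => o.2.2)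
  have hβ := fun i => (tβ i).pullX (fun o : Ω × RR × EE d => o.2.2)
  have hN := fun α a b => (tN α a b).pullX (fun o : Ω × RR × EE d => o.2.2)
  have hR := fun α a b => (tR α a b).pullX (fun o : Ω × RR × EE d => o.2)
  have hR' := fun α a b => (tR α a b).pullX (fun o : Ω × RR × EE d => (ng o.2.1, o.2.2))
  have cc : ∀ c : ℝ, UC (fun (_ : κ) (o : Ω × RR × EE d) => c) := fun c => UC.of_const (C := |c|) fun _ => le_rfl
  have cu : ∀ {F : Ω → EE d → ℝ}, SB F → UC (fun (_ : κ) (o : Ω × RR × EE d) => F o.1 o.2.2) := fun h => by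
    obtain ⟨C, _, hC⟩ := h.bdd
    exact UC.of_const (C := C) fun o => hC _ _
  unfold gen gen1
  refine (cc _).mul (UC.sum fun α => ?_)
  refine ((UC.add ?_ ?_).add ?_).add ?_
  · exact (cc _).mul (UC.sum fun i => UC.sum fun j => ((cu (((hU a).pd i).pd j)).mul (hη α i)).mul (hη α j))
  · exact UC.sum fun b => (hN α a b).mul (UC.sum fun i => (cu ((hU b).pd i)).mul (hη α i))
  · exact (cc _).mul (UC.sum fun b => ((hR α a b).add (hR' α a b)).mul (cu (hU b)))
  · exact UC.sum fun i => (cu ((hU a).pd i)).mul (hβ i)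

theorem gen_lin {U V : EE d → ι → ℝ} (hU : SmV U) (hV : SmV V) (c : ℝ) (k : κ) (r : RR) (x : EE d) (a : ι) :
    S.gen k r (fun x a => U x a + c * V x a) x a = S.gen k r U x a + c * S.gen k r V x a := by
  have p1 : ∀ b x i, pd (fun z => U z b + c * V z b) x i = pd (fun z => U z b) x i + c * pd (fun z => V z b) x i := fun b x i => by
    rw [pd_add (smooth_diff (hU b) x) ((smooth_diff (hV b) x).const_mul c), pd_const_mul _ (smooth_diff (hV b) x)]
  have p2 : ∀ b x i j, pdd (fun z => U z b + c * V z b) x i j = pdd (fun z => U z b) x i j + c * pdd (fun z => V z b) x i j := fun b x i j => by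
    simp only [p1]
    rw [pd_add (smooth_diff (smooth_pd (hU b) i) x) ((smooth_diff (smooth_pd (hV b) i) x).const_mul c), pd_const_mul _ (smooth_diff (smooth_pd (hV b) i) x)]
  unfold gen
  rw [mul_left_comm c, ← mul_add, mul_sm _ _ c, ← sum_ad]
  congr 1
  refine sum_cg fun α => ?_
  unfold gen1
  simp only [p2]
  simp only [p1, mul_add, add_mul, sum_ad, mul_sm, mul_assoc, mul_left_comm c]
  ring

noncomputable def dq (k : κ) (r : RR) (U : EE d → ι → ℝ) (x : EE d) (a : ι) : ℝ :=
  (r.1 ^ 2)⁻¹ * (S.step k r U x a - U x a)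

theorem hat_dq {U : EE d → ι → ℝ} (hU : SmV U) (k : κ) (r : RR) (x : EE d) (p) :
    hat (S.dq k r U) x p = S.pro.dq k r (hat U) x p := by
  unfold dq
  rw [← S.hat_step hU]
  rcases p with ⟨_ | l, a⟩
  · rfl
  · simp only [hat]
    rw [pd_const_mul _ ((smooth_diff (S.smooth_step hU k r a) x).fun_sub (smooth_diff (hU a) x)),
      pd_sub (smooth_diff (S.smooth_step hU k r a) x) (smooth_diff (hU a) x)]

theorem dq_zero [Nonempty A] {Ω : Type*} {U : Ω → EE d → ι → ℝ} (hU : ∀ a, SB (fun o x => U o x a)) (a : ι) :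
    ∃ C, ∀ (o : Ω × κ × RR) x, |S.dq o.2.1 o.2.2 (U o.1) x a| ≤ C := by
  obtain ⟨C, hC0, hC⟩ := S.cons hU
  obtain ⟨D, hD0, hD⟩ := (S.gen_SB hU a).bdd
  refine ⟨C + D, fun o x => ?_⟩
  have h1 := hC o.1 o.2.1 o.2.2 x a
  have h2 := hD o x
  unfold dq
  by_cases hr : o.2.2.1 = 0
  · rw [hr]; simp; positivity
  have hr2 : 0 < o.2.2.1 ^ 2 := pz
  rw [abs_mul, abs_of_pos (inv_pos.2 hr2), inv_mul_le_iff₀ hr2]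
  have h3 : |o.2.2.1| ^ 3 ≤ o.2.2.1 ^ 2 := by
    rw [← sq_abs]; exact pow_le_pow_of_le_one (abs_nonneg _) o.2.2.2 (by norm_num)
  have h4 : |o.2.2.1 ^ 2 * S.gen o.2.1 o.2.2 (U o.1) x a| ≤ o.2.2.1 ^ 2 * D := ab2 (le_of_eq (abs_of_pos hr2)) h2
  have h5 : C * |o.2.2.1| ^ 3 ≤ C * o.2.2.1 ^ 2 := mul_le_l h3 hC0
  rw [abs_le] at *
  constructor <;> linarith

theorem dq_BB [Nonempty A] {Ω : Type*} (n : ℕ) : ∀ {ι : Type} [Fintype ι] [DecidableEq ι] (S : Sch d A ι κ) {U : Ω → EE d → ι → ℝ}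
    (_ : ∀ a, SB (fun o x => U o x a)) (a : ι), BB n (fun (o : Ω × κ × RR) x => S.dq o.2.1 o.2.2 (U o.1) x a) := by
  induction n with
  | zero => intro ι _ _ S U hU a; exact S.dq_zero hU a
  | succ n ih =>
    intro ι _ _ S U hU a
    refine ⟨S.dq_zero hU a, fun l => ?_⟩
    have := ih S.pro (U := fun o => hat (U o)) (by
      rintro ⟨_ | l, a⟩
      · exact hU a
      · exact (hU a).pd l) (some l, a)
    refine Eq.mp (congrArg (BB n) ?_) this
    funext o x
    rw [← S.hat_dq fun a => (hU a).sm _]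
    rfl

theorem dq_SB [Nonempty A] {Ω : Type*} {U : Ω → EE d → ι → ℝ}
    (hU : ∀ a, SB (fun o x => U o x a)) (a : ι) : SB (fun (o : Ω × κ × RR) x => S.dq o.2.1 o.2.2 (U o.1) x a) :=
  ⟨fun o => contDiff_const.mul ((S.smooth_step (fun a => (hU a).sm _) _ _ a).sub ((hU a).sm _)), fun n => dq_BB n S hU a⟩

end Sch

noncomputable def cl (y : ℝ) : ℝ := max 0 (min 1 y)
theorem cl_of_le {y : ℝ} (h : y ≤ 0) : cl y = 0 := by unfold cl; rw [min_eq_right (by linarith), max_eq_left h]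
theorem cl_of_ge {y : ℝ} (h : 1 ≤ y) : cl y = 1 := by unfold cl; rw [min_eq_left h]; simp
theorem cl_of_mem {y : ℝ} (h : 0 ≤ y) (h' : y ≤ 1) : cl y = y := by unfold cl; rw [min_eq_right h', max_eq_right h]
theorem cl_cont : Continuous cl := by unfold cl; fun_prop

theorem cl_sum (U : ℕ → ℝ) {J i : ℕ} (hi : i < J) {ρ : ℝ} (h1 : i ≤ ρ) (h2 : ρ ≤ i + 1) :
    U 0 + ∑ j ∈ Finset.range J, cl (ρ - j) * (U (j + 1) - U j) = U i + (ρ - i) * (U (i + 1) - U i) := by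
  have e : ∑ j ∈ Finset.range J, cl (ρ - j) * (U (j + 1) - U j) = ∑ j ∈ Finset.range (i + 1), cl (ρ - j) * (U (j + 1) - U j) := by
    symm
    refine Finset.sum_subset (fun j hj => by simp at hj ⊢; omega) fun j _ hj => ?_
    have : i + 1 ≤ j := by simpa using hj
    have : (i : ℝ) + 1 ≤ j := by exact_mod_cast this
    rw [cl_of_le (by linarith), zero_mul]
  rw [e, Finset.sum_range_succ, cl_of_mem (by linarith) (by linarith)]
  have : ∑ j ∈ Finset.range i, cl (ρ - j) * (U (j + 1) - U j) = ∑ j ∈ Finset.range i, (U (j + 1) - U j) := by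
    refine Finset.sum_congr rfl fun j hj => ?_
    have : j + 1 ≤ i := by simpa using hj
    have : (j : ℝ) + 1 ≤ i := by exact_mod_cast this
    rw [cl_of_ge (by linarith), one_mul]
  rw [this, Finset.sum_range_sub]; ring

def r0 : RR := ⟨0, by simp⟩

namespace Sch
variable {d : ℕ} {A ι : Type} [Fintype A] [Fintype ι] [DecidableEq ι] {s T : ℝ} (S : Sch d A ι (Icc s T))

theorem gen_r0 {κ : Type} (S : Sch d A ι κ) (hR : ∀ α k r x a b, S.R α (k, r) x a b = S.R α (k, r0) x a b) (k : κ) (r : RR) (U : EE d → ι → ℝ) (x : EE d) (a : ι) :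
    S.gen k r U x a = S.gen k r0 U x a := by
  unfold gen gen1
  simp only [hR _ _ r, hR _ _ (ng r), hR _ _ (ng r0)]

set_option maxHeartbeats 1000000 in
theorem EX [Nonempty A] [Nonempty ι] (hsT : s < T) (hR : ∀ α k r x a b, S.R α (k, r) x a b = S.R α (k, r0) x a b)
    (tη : ∀ α i, UC (fun k x => S.η α k x i)) (tβ : ∀ i, UC (fun k x => S.β k x i))
    (tN : ∀ α a b, UC (fun k x => S.N α k x a b)) (tR : ∀ α a b, UC (fun k (x : RR × EE d) => S.R α (k, x.1) x.2 a b))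
    {f : EE d → ι → ℝ} (hf : ∀ a, SB (fun (_ : Unit) x => f x a)) :
    ∃ M : ℝ, ∀ κ > 0, ∃ u : ℝ → EE d → ι → ℝ, (∀ x, u s x = f x) ∧
      (∀ a, Continuous (fun p : ℝ × EE d => u p.1 p.2 a)) ∧
      (∀ a l, Continuous (fun p : ℝ × EE d => pd (fun z => u p.1 z a) p.2 l)) ∧
      (∀ t a, ContDiff ℝ ∞ (fun x => u t x a)) ∧
      (∀ t ∈ Icc s T, ∀ x a, |u t x a| ≤ M ∧ ∀ l, |pd (fun z => u t z a) x l| ≤ M) ∧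
      ∀ t, ∀ ht : t ∈ Ioc s T, ∃ G : EE d → ι → ℝ, (∀ a, ContDiff ℝ ∞ (fun x => G x a)) ∧
        (∀ x a, HasDerivWithinAt (fun τ => u τ x a) (G x a) (Iic t) t) ∧
        (∀ x a l, HasDerivWithinAt (fun τ => pd (fun z => u τ z a) x l) (pd (fun z => G z a) x l) (Iic t) t) ∧
        (∀ x a, |G x a - S.gen ⟨t, ht.1.le, ht.2⟩ r0 (u t) x a| ≤ κ) ∧
        (∀ x a l, |pd (fun y => G y a - S.gen ⟨t, ht.1.le, ht.2⟩ r0 (u t) y a) x l| ≤ κ) := by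
  -- the families
  set L := T - s with hL
  have hL0 : 0 < L := by rw [hL]; linarith
  let Ω := Par (Icc s T) L
  let U : Ω → EE d → ι → ℝ := fun o => S.it o.1.1 o.1.2.1 f o.1.2.2
  have hU : ∀ a, SB (fun o x => U o x a) := fun a => S.it_SB L hf a
  let Ω' := Ω × (Icc s T) × RR
  let V : Ω' → EE d → ι → ℝ := fun o => S.dq o.2.1 o.2.2 (U o.1)
  have hV : ∀ a, SB (fun o x => V o x a) := fun a => S.dq_SB hU a
  let Θ := {θ : ℝ // |θ| ≤ 1}
  let W : Ω' × Θ → EE d → ι → ℝ := fun o x a => U o.1.1 x a + (o.2.1 * o.1.2.2.1 ^ 2) * V o.1 x a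
  have hW : ∀ a, SB (fun o x => W o x a) := fun a => by
    refine ((hU a).pull fun o : Ω' × Θ => o.1.1).add (SB.mul ?_ ((hV a).pull fun o : Ω' × Θ => o.1))
    exact SB.const (C := 1 * 1) fun o => ab2 o.2.2 (by rw [abs_of_nonneg (sq_nonneg _)]; exact r2_le _)
  let F : ι → (Ω' × Θ) × (Icc s T) × RR → EE d → ℝ := fun a o x => V o.1.1 x a - S.gen o.2.1 o.2.2 (W o.1) x a
  have hF : ∀ a, SB (F a) := fun a => ((hV a).pull fun o => o.1.1).sub (S.gen_SB hW a)
  obtain ⟨M0, hM00, hM0⟩ := fin_bdd (J := ι) (F := fun a o x => W o x a) fun a => (hW a).bdd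
  obtain ⟨M1, hM10, hM1⟩ := fin_bdd (J := ι × Fin d) (F := fun j o x => pd (fun z => W o z j.1) x j.2) fun j => ((hW j.1).pd j.2).bdd
  obtain ⟨Cc, hCc0, hCc⟩ := S.cons hU
  obtain ⟨Cg, hCg0, hCg⟩ := fin_bdd (J := ι) (F := fun a (o : Ω' × Icc s T × RR) x => S.gen o.2.1 o.2.2 (V o.1) x a) fun a => (S.gen_SB hV a).bdd
  refine ⟨M0 + M1, fun κ hκ => ?_⟩
  have hintv : ∀ a, ∃ ε' > 0, ∀ o, (∀ x, |F a o x| ≤ ε') → ∀ x l, |pd (F a o) x l| ≤ κ := fun a => interp (hF a) hκ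
  choose e1 he1 he1' using hintv
  obtain ⟨ε, hε0, hεκ, hε1⟩ : ∃ ε > 0, ε ≤ κ ∧ ∀ a, ε ≤ e1 a := by
    refine ⟨min κ (Finset.univ.inf' Finset.univ_nonempty e1), lt_min hκ ?_, min_le_left _ _, fun a => (min_le_right _ _).trans (Finset.inf'_le _ (Finset.mem_univ a))⟩
    rw [Finset.lt_inf'_iff]; exact fun a _ => he1 a
  have huc : ∀ a, ∃ δ > 0, ∀ k k', dist k k' < δ → ∀ x : Ω × RR × EE d, |S.gen k x.2.1 (U x.1) x.2.2 a - S.gen k' x.2.1 (U x.1) x.2.2 a| ≤ ε / 3 :=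
    fun a => (S.gen_UC tη tβ tN tR hU a).2 _ (pz)
  choose dd hdd hdd' using huc
  obtain ⟨δ, hδ0, hδ⟩ : ∃ δ > 0, ∀ a, δ ≤ dd a := by
    refine ⟨(Finset.univ.inf' Finset.univ_nonempty dd), ?_, fun a => (Finset.inf'_le _ (Finset.mem_univ a))⟩
    rw [gt_iff_lt, Finset.lt_inf'_iff]; exact fun a _ => hdd a
  -- choose the number of steps
  obtain ⟨J, hJ0, hJ⟩ : ∃ J : ℕ, 0 < J ∧ L / J ≤ min 1 (min (δ / 2) (min ((ε / (3 * (Cc + 1))) ^ 2) (ε / (3 * (Cg + 1))))) := by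
    set η := min 1 (min (δ / 2) (min ((ε / (3 * (Cc + 1))) ^ 2) (ε / (3 * (Cg + 1))))) with hη
    have hη0 : 0 < η := pz
    obtain ⟨J, hJ⟩ := exists_nat_gt (L / η)
    have hJ0 : (0:ℝ) < J := lt_trans (pz) hJ
    refine ⟨J, by exact_mod_cast hJ0, ?_⟩
    rw [div_lt_iff₀ hη0] at hJ
    rw [div_le_iff₀ hJ0]; linarith
  set τ := L / J with hτ
  have hJR : (0:ℝ) < J := by exact_mod_cast hJ0
  have hτ0 : 0 < τ := pz
  have hτ1 : τ ≤ 1 := hJ.trans (min_le_left _ _)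
  have hτδ : τ < δ := by
    have := hJ.trans ((min_le_right _ _).trans (min_le_left _ _)); linarith
  have hτc : τ ≤ (ε / (3 * (Cc + 1))) ^ 2 := hJ.trans ((min_le_right _ _).trans ((min_le_right _ _).trans (min_le_left _ _)))
  have hτg : τ ≤ ε / (3 * (Cg + 1)) := hJ.trans ((min_le_right _ _).trans ((min_le_right _ _).trans (min_le_right _ _)))
  let r : RR := ⟨√τ, by rw [abs_of_nonneg (sqrt_nonneg _)]; exact Real.sqrt_le_one.2 hτ1⟩
  have hr2 : r.1 ^ 2 = τ := sq_sqrt hτ0.le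
  have hr0 : 0 < r.1 := Real.sqrt_pos.2 hτ0
  have hrc : r.1 ≤ ε / (3 * (Cc + 1)) := by
    refine Real.sqrt_le_iff.2 ⟨pz, hτc⟩
  let ks : ℕ → Icc s T := fun j => projIcc s T hsT.le (s + j * τ)
  let X : ℕ → EE d → ι → ℝ := S.it ks r f
  have hX : ∀ j a, ContDiff ℝ ∞ (fun x => X j x a) := fun j a => S.it_sm (fun a => (hf a).sm ()) ks r j a
  let u : ℝ → EE d → ι → ℝ := fun t x a => X 0 x a + ∑ j ∈ Finset.range J, cl ((t - s) / τ - j) * (X (j + 1) x a - X j x a)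
  have hpd : ∀ t a l x, pd (fun z => u t z a) x l = pd (fun z => X 0 z a) x l + ∑ j ∈ Finset.range J, cl ((t - s) / τ - j) * (pd (fun z => X (j + 1) z a) x l - pd (fun z => X j z a) x l) := by
    intro t a l x
    have hd : ∀ j, DifferentiableAt ℝ (fun z => X (j + 1) z a - X j z a) x := fun j => smooth_diff ((hX (j+1) a).sub (hX j a)) x
    show pd (fun z => X 0 z a + ∑ j ∈ Finset.range J, cl ((t - s) / τ - j) * (X (j + 1) z a - X j z a)) x l = _
    rw [pd_add (smooth_diff (hX 0 a) x) (DifferentiableAt.fun_sum fun j _ => (hd j).const_mul _),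
      pd_sum _ fun j _ => (hd j).const_mul _]
    congr 1
    refine sum_cg fun j => ?_
    rw [pd_const_mul _ (hd j), pd_sub (smooth_diff (hX (j+1) a) x) (smooth_diff (hX j a) x)]
  -- step formula
  have hG : ∀ j, ∀ x a, X (j + 1) x a - X j x a = τ * S.dq (ks j) r (X j) x a := by
    intro j x a
    show S.step (ks j) r (X j) x a - X j x a = _
    unfold dq; rw [hr2, mul_inv_cancel_left₀ hτ0.ne']
  have hidx : ∀ t ∈ Ioc s T, ∃ i : ℕ, i < J ∧ (i : ℝ) < (t - s) / τ ∧ (t - s) / τ ≤ i + 1 := by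
    intro t ht
    have h0 : 0 < (t - s) / τ := div_pos (by linarith [ht.1]) hτ0
    obtain ⟨n, hn⟩ : ∃ n, ⌈(t - s) / τ⌉₊ = n + 1 := Nat.exists_eq_succ_of_ne_zero (Nat.ceil_pos.2 h0).ne'
    refine ⟨n, ?_, ?_, ?_⟩
    · have : ⌈(t - s) / τ⌉₊ ≤ J := by
        rw [Nat.ceil_le, div_le_iff₀ hτ0, hτ, mul_div_cancel₀ _ hJR.ne']; linarith [ht.2]
      omega
    · exact Nat.lt_ceil.1 (by omega)
    · have := Nat.le_ceil ((t - s) / τ); rw [hn] at this; exact_mod_cast this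
  have hjL : ∀ j : ℕ, j ≤ J → (j : ℝ) * r.1 ^ 2 ≤ L := by
    intro j hj
    have : (j : ℝ) ≤ J := by exact_mod_cast hj
    rw [hr2]
    calc (j:ℝ) * τ ≤ J * τ := by gcongr
      _ = L := by rw [hτ]; field_simp
  have hrep : ∀ t ∈ Ioc s T, ∃ i : ℕ, ∃ θ : Θ, ∃ o : Ω, o.1 = (ks, r, i) ∧ (i : ℝ) < (t - s) / τ ∧ (t - s) / τ ≤ i + 1 ∧ i < J ∧ u t = W ((o, ks i, r), θ) := by
    intro t ht
    obtain ⟨i, hi, h1, h2⟩ := hidx t ht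
    refine ⟨i, ⟨(t - s) / τ - i, by rw [abs_le]; constructor <;> linarith⟩, ⟨(ks, r, i), hjL i hi.le⟩, rfl, h1, h2, hi, ?_⟩
    funext x a
    show X 0 x a + ∑ j ∈ Finset.range J, cl ((t - s) / τ - j) * (X (j + 1) x a - X j x a) = _
    rw [cl_sum (fun j => X j x a) hi h1.le h2, hG]
    show _ = X i x a + ((t - s) / τ - i) * r.1 ^ 2 * S.dq (ks i) r (X i) x a
    rw [hr2]; ring
  have hus : ∀ x, u s x = f x := by
    intro x; funext a
    show X 0 x a + ∑ j ∈ Finset.range J, cl ((s - s) / τ - j) * (X (j + 1) x a - X j x a) = _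
    rw [Finset.sum_eq_zero]
    · simp; rfl
    · intro j _
      rw [cl_of_le (by simp), zero_mul]
  refine ⟨u, hus, ?_, ?_, ?_, ?_, ?_⟩
  · intro a
    have : ∀ j, Continuous (fun p : ℝ × EE d => X j p.2 a) := fun j => (hX j a).continuous.comp continuous_snd
    refine (this 0).add (continuous_finset_sum _ fun j _ => ?_)
    exact (cl_cont.comp (by fun_prop)).mul ((this _).sub (this _))
  · intro a l
    simp only [hpd]
    have : ∀ j, Continuous (fun p : ℝ × EE d => pd (fun z => X j z a) p.2 l) := fun j => (smooth_pd (hX j a) l).continuous.comp continuous_snd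
    refine (this 0).add (continuous_finset_sum _ fun j _ => ?_)
    exact (cl_cont.comp (by fun_prop)).mul ((this _).sub (this _))
  · intro t a
    exact (hX 0 a).add (ContDiff.sum fun j _ => contDiff_const.mul ((hX _ a).sub (hX _ a)))
  · intro t ht x a
    rcases eq_or_lt_of_le ht.1 with h | h
    · subst h
      have hw : u s = W ((⟨(ks, r, 0), by simpa using hL0.le⟩, ks 0, r), ⟨0, by simp⟩) := by
        funext x a
        rw [hus]
        show _ = f x a + 0 * r.1 ^ 2 * _
        ring
      rw [hw]
      exact ⟨(hM0 a _ x).trans (by linarith), fun l => (hM1 (a, l) _ x).trans (by linarith)⟩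
    · obtain ⟨i, θ, o, ho, h1, h2, hi, hw⟩ := hrep t ⟨h, ht.2⟩
      rw [hw]
      exact ⟨(hM0 a _ x).trans (by linarith), fun l => (hM1 (a, l) _ x).trans (by linarith)⟩
  · intro t ht
    obtain ⟨i, θ, o, ho, h1, h2, hi, hw⟩ := hrep t ht
    have hUo : U o = X i := by
      show S.it o.1.1 o.1.2.1 f o.1.2.2 = _
      rw [ho]
    set k : Icc s T := ⟨t, ht.1.le, ht.2⟩ with hk
    have hGs : ∀ a, ContDiff ℝ ∞ (fun x => S.dq (ks i) r (X i) x a) := fun a => by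
      have := (hV a).sm (o, ks i, r)
      simpa only [V, hUo] using this
    have hsmall : ∀ a x, |F a (((o, ks i, r), θ), k, r) x| ≤ ε := by
      intro a x
      have c1 := hCc o (ks i) r x a
      have c2 := hdd' a (ks i) k (lt_of_lt_of_le (by
        have hm : s + i * τ ∈ Icc s T := by
          have : (i:ℝ) * τ < t - s := by rwa [lt_div_iff₀ hτ0] at h1
          exact ⟨by nlinarith [Nat.cast_nonneg (α := ℝ) i], by linarith [ht.2]⟩
        show dist (projIcc s T hsT.le (s + i * τ)) k < δ
        rw [projIcc_of_mem hsT.le hm, Subtype.dist_eq, Real.dist_eq]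
        have e1 : (i:ℝ) * τ < t - s := by rwa [lt_div_iff₀ hτ0] at h1
        have e2 : t - s ≤ (i + 1) * τ := by rwa [div_le_iff₀ hτ0] at h2
        rw [hk, abs_lt]; constructor <;> simp only <;> nlinarith) (hδ a)) (o, r, x)
      have c3 := hCg a ((o, ks i, r), k, r) x
      have c4 := S.gen_lin (U := U o) (V := V (o, ks i, r)) (fun a => (hU a).sm _) (fun a => (hV a).sm _) (θ.1 * r.1 ^ 2) k r x a
      show |V (o, ks i, r) x a - S.gen k r (W ((o, ks i, r), θ)) x a| ≤ ε
      have c5 : S.gen k r (W ((o, ks i, r), θ)) x a = S.gen k r (U o) x a + (θ.1 * r.1 ^ 2) * S.gen k r (V (o, ks i, r)) x a := c4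
      rw [c5]
      have c6 : |(θ.1 * r.1 ^ 2) * S.gen k r (V (o, ks i, r)) x a| ≤ ε / 3 := by
        have := ab2 (ab2 θ.2 (le_of_eq (abs_of_nonneg (sq_nonneg r.1)))) c3
        refine this.trans ?_
        rw [hr2, one_mul]
        calc τ * Cg ≤ ε / (3 * (Cg + 1)) * Cg := by gcongr
          _ ≤ ε / 3 := by
            rw [div_mul_eq_mul_div, div_le_div_iff₀ (pz) (pz)]; nlinarith
      have c7 : |V (o, ks i, r) x a - S.gen (ks i) r (U o) x a| ≤ ε / 3 := by
        have e : V (o, ks i, r) x a - S.gen (ks i) r (U o) x a = (r.1 ^ 2)⁻¹ * (S.step (ks i) r (U o) x a - U o x a - r.1 ^ 2 * S.gen (ks i) r (U o) x a) := by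
          show (r.1 ^ 2)⁻¹ * (S.step (ks i) r (U o) x a - U o x a) - _ = _
          field_simp
        rw [e, abs_mul, abs_of_pos (pz), inv_mul_le_iff₀ (pz)]
        refine c1.trans ?_
        rw [abs_of_pos hr0]
        have : r.1 * Cc ≤ ε / 3 := by
          calc r.1 * Cc ≤ ε / (3 * (Cc + 1)) * Cc := by gcongr
            _ ≤ ε / 3 := by
              rw [div_mul_eq_mul_div, div_le_div_iff₀ (pz) (pz)]; nlinarith
        calc Cc * r.1 ^ 3 = r.1 ^ 2 * (r.1 * Cc) := by ring
          _ ≤ r.1 ^ 2 * (ε / 3) := by gcongr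
      simp only at c2
      rw [abs_le] at *; constructor <;> linarith
    have hFeq : ∀ a, F a (((o, ks i, r), θ), k, r) = fun y => S.dq (ks i) r (X i) y a - S.gen k r0 (u t) y a := by
      intro a; funext y
      show V (o, ks i, r) y a - S.gen k r (W ((o, ks i, r), θ)) y a = _
      rw [S.gen_r0 hR, hw]
      show S.dq (ks i) r (U o) y a - _ = _
      rw [hUo]
    -- local formula
    have hev : ∀ᶠ t' in nhdsWithin t (Iic t), (i : ℝ) ≤ (t' - s) / τ ∧ (t' - s) / τ ≤ i + 1 := by
      have hc : ContinuousAt (fun t' : ℝ => (t' - s) / τ) t := by fun_prop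
      have h3 := (hc.eventually (lt_mem_nhds h1)).filter_mono (nhdsWithin_le_nhds (s := Iic t))
      filter_upwards [h3, self_mem_nhdsWithin] with t' a1 a2
      refine ⟨a1.le, le_trans ?_ h2⟩
      have : t' ≤ t := a2
      gcongr
    have hlin : ∀ (c0 c1 : ℝ), HasDerivWithinAt (fun t' => c0 + ((t' - s) / τ - i) * (τ * c1)) c1 (Iic t) t := by
      intro c0 c1
      have := ((((hasDerivAt_id t).sub_const s).div_const τ).sub_const (i:ℝ)).mul_const (τ * c1)
      refine ((this.const_add c0).congr_deriv ?_).hasDerivWithinAt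
      field_simp
    refine ⟨S.dq (ks i) r (X i), hGs, ?_, ?_, ?_, ?_⟩
    · intro x a
      have key : ∀ t', (i : ℝ) ≤ (t' - s) / τ ∧ (t' - s) / τ ≤ i + 1 → u t' x a = X i x a + ((t' - s) / τ - i) * (τ * S.dq (ks i) r (X i) x a) := by
        intro t' h
        rw [← hG]
        exact cl_sum (fun j => X j x a) hi h.1 h.2
      refine (hlin (X i x a) _).congr_of_eventuallyEq ?_ (key t ⟨h1.le, h2⟩)
      filter_upwards [hev] with t' h using key t' h
    · intro x a l
      have hpG : pd (fun z => X (i + 1) z a) x l - pd (fun z => X i z a) x l = τ * pd (fun z => S.dq (ks i) r (X i) z a) x l := by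
        rw [← pd_sub (smooth_diff (hX (i+1) a) x) (smooth_diff (hX i a) x), ← pd_const_mul _ (smooth_diff (hGs a) x)]
        simp only [hG]
      have key : ∀ t', (i : ℝ) ≤ (t' - s) / τ ∧ (t' - s) / τ ≤ i + 1 → pd (fun z => u t' z a) x l = pd (fun z => X i z a) x l + ((t' - s) / τ - i) * (τ * pd (fun z => S.dq (ks i) r (X i) z a) x l) := by
        intro t' h
        rw [← hpG, hpd]
        exact cl_sum (fun j => pd (fun z => X j z a) x l) hi h.1 h.2
      refine (hlin _ _).congr_of_eventuallyEq ?_ (key t ⟨h1.le, h2⟩)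
      filter_upwards [hev] with t' h using key t' h
    · intro x a
      have := hsmall a x
      rw [hFeq] at this
      exact this.trans hεκ
    · intro x a l
      have := he1' a _ (fun x => (hsmall a x).trans (hε1 a)) x l
      rwa [hFeq] at this

end Sch

structure Alg {X : Type*} (c : ℝ) (P : (X → ℝ) → Prop) : Prop where
  add : ∀ {f g}, P f → P g → P (fun x => f x + g x)
  mul : ∀ {f g}, P f → P g → P (fun x => f x * g x)
  cst : ∀ r, P (fun _ => r)
  inv : ∀ {f}, P f → (∀ x, c ≤ f x) → P (fun x => (f x)⁻¹)
  sqrt : ∀ {f}, P f → (∀ x, c ≤ f x) → P (fun x => √(f x))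

theorem chol {X : Type*} {c : ℝ} (hc : 0 < c) {P : (X → ℝ) → Prop} (hP : Alg c P) : ∀ (n : ℕ) (Q : X → MM n),
    (∀ i j, P (fun x => Q x i j)) → (∀ x i j, Q x i j = Q x j i) →
    (∀ x (w : Fin n → ℝ), c * ∑ i, w i ^ 2 ≤ ∑ i, ∑ j, Q x i j * w i * w j) →
    ∃ W : X → MM n, (∀ i a, P (fun x => W x i a)) ∧ ∀ x i j, Q x i j = ∑ a, W x i a * W x j a := by
  intro n
  induction n with
  | zero => intro Q _ _ _; exact ⟨fun _ i => i.elim0, fun i => i.elim0, fun _ i => i.elim0⟩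
  | succ n ih =>
    intro Q hQ hs hpos
    have ha : ∀ x, c ≤ Q x 0 0 := by
      intro x
      have := hpos x (fun i => if i = 0 then 1 else 0)
      simpa using this
    have ha0 : ∀ x, 0 < Q x 0 0 := fun x => hc.trans_le (ha x)
    set Q' : X → MM n := fun x i j => Q x i.succ j.succ + (-1) * (Q x i.succ 0 * Q x j.succ 0 * (Q x 0 0)⁻¹) with hQ'
    obtain ⟨W, hW, hWQ⟩ := ih Q' (fun i j => hP.add (hQ _ _) (hP.mul (hP.cst _) (hP.mul (hP.mul (hQ _ _) (hQ _ _)) (hP.inv (hQ 0 0) ha))))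
      (fun x i j => by simp only [hQ']; rw [hs x i.succ j.succ]; ring) (fun x w => by
        set w0 : ℝ := -(∑ i, Q x i.succ 0 * w i) * (Q x 0 0)⁻¹ with hw0
        have h := hpos x (Fin.cons w0 w)
        simp only [Fin.sum_univ_succ, Fin.cons_zero, Fin.cons_succ] at h
        set v := ∑ i, Q x i.succ 0 * w i with hv
        have e1 : ∑ i : Fin n, Q x 0 i.succ * w0 * w i = w0 * v := by
          rw [hv, mul_sm]; exact sum_cg fun i => by rw [hs x 0]; ring
        have e2 : ∑ i : Fin n, (Q x i.succ 0 * w i * w0 + ∑ j : Fin n, Q x i.succ j.succ * w i * w j) = w0 * v + ∑ i : Fin n, ∑ j : Fin n, Q x i.succ j.succ * w i * w j := by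
          rw [sum_ad, hv, mul_sm]; congr 1; exact sum_cg fun i => by ring
        rw [e1, e2] at h
        have e3 : ∑ i, ∑ j, Q' x i j * w i * w j = (∑ i : Fin n, ∑ j : Fin n, Q x i.succ j.succ * w i * w j) - v * v * (Q x 0 0)⁻¹ := by
          rw [hv, sum_mul_sum, sum_mul, ← sum_sub_distrib]
          refine sum_cg fun i => ?_
          rw [sum_mul, ← sum_sub_distrib]
          exact sum_cg fun j => by simp only [hQ']; ring
        rw [e3]
        have e4 : Q x 0 0 * w0 * w0 + w0 * v + w0 * v = - (v * v * (Q x 0 0)⁻¹) := by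
          rw [hw0]; have := (ha0 x).ne'; field_simp; ring
        nlinarith [sq_nonneg w0])
    set s : X → ℝ := fun x => √(Q x 0 0) with hsdef
    have hsP : P s := hP.sqrt (hQ 0 0) ha
    have hs0 : ∀ x, 0 < s x := fun x => Real.sqrt_pos.2 (ha0 x)
    have hs2 : ∀ x, s x * s x = Q x 0 0 := fun x => mul_self_sqrt (ha0 x).le
    refine ⟨fun x => Fin.cons (Fin.cons (s x) (fun _ => 0)) (fun i => Fin.cons (Q x i.succ 0 * (s x * (Q x 0 0)⁻¹)) (W x i)), ?_, ?_⟩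
    · intro i a
      refine Fin.cases ?_ (fun i => ?_) i <;> refine Fin.cases ?_ (fun a => ?_) a
      · simpa using hsP
      · simpa using hP.cst 0
      · simpa using hP.mul (hQ _ _) (hP.mul hsP (hP.inv (hQ 0 0) ha))
      · simpa using hW i a
    · intro x i j
      have h0 := (ha0 x).ne'
      refine Fin.cases ?_ (fun i => ?_) i <;> refine Fin.cases ?_ (fun j => ?_) j
      · simp [Fin.sum_univ_succ, hs2]
      · simp only [Fin.sum_univ_succ, Fin.cons_zero, Fin.cons_succ, zero_mul, Finset.sum_const_zero, add_zero]
        rw [show s x * (Q x j.succ 0 * (s x * (Q x 0 0)⁻¹)) = (s x * s x) * Q x j.succ 0 * (Q x 0 0)⁻¹ by ring, hs2, hs x 0]; field_simp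
      · simp only [Fin.sum_univ_succ, Fin.cons_zero, Fin.cons_succ, mul_zero, Finset.sum_const_zero, add_zero]
        rw [show (Q x i.succ 0 * (s x * (Q x 0 0)⁻¹)) * s x = (s x * s x) * Q x i.succ 0 * (Q x 0 0)⁻¹ by ring, hs2]; field_simp
      · simp only [Fin.sum_univ_succ, Fin.cons_zero, Fin.cons_succ, ← hWQ, hQ']
        rw [show (Q x i.succ 0 * (s x * (Q x 0 0)⁻¹)) * (Q x j.succ 0 * (s x * (Q x 0 0)⁻¹)) = (s x * s x) * (Q x i.succ 0 * Q x j.succ 0 * (Q x 0 0)⁻¹ * (Q x 0 0)⁻¹) by ring, hs2]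
        field_simp; ring

theorem SB_inv {d : ℕ} {Ω : Type*} {F : Ω → EE d → ℝ} {c : ℝ} (hc : 0 < c) (h : SB F) (hF : ∀ o x, c ≤ F o x) : SB (fun o x => (F o x)⁻¹) := by
  have sm : Sm (fun o x => (F o x)⁻¹) := fun o => (h.sm o).inv fun x => (hc.trans_le (hF o x)).ne'
  have hpd : ∀ o x l, pd (fun y => (F o y)⁻¹) x l = (-1) * (pd (F o) x l * ((F o x)⁻¹ * (F o x)⁻¹)) := by
    intro o x l
    have h0 := (hc.trans_le (hF o x)).ne'
    rw [pd_comp_real (f := fun y => y⁻¹) (hasDerivAt_inv h0) (h.diff o x)]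
    field_simp
  have b : ∃ C, ∀ o x, |(F o x)⁻¹| ≤ C := ⟨c⁻¹, fun o x => by
    rw [abs_of_pos (inv_pos.2 (hc.trans_le (hF o x)))]; exact inv_anti₀ hc (hF o x)⟩
  refine ⟨sm, fun n => ?_⟩
  induction n with
  | zero => exact b
  | succ n ih =>
    refine ⟨b, fun l => ?_⟩
    simp only [hpd]
    exact BB.mul (fun o => contDiff_const) (fun o => ((h.pd l).sm o).mul ((sm o).mul (sm o))) ((SB.cst (-1)).bb n)
      (BB.mul (h.pd l).sm (fun o => (sm o).mul (sm o)) ((h.pd l).bb n) (BB.mul sm sm ih ih))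

theorem SB_sqrt {d : ℕ} {Ω : Type*} {F : Ω → EE d → ℝ} {c : ℝ} (hc : 0 < c) (h : SB F) (hF : ∀ o x, c ≤ F o x) : SB (fun o x => √(F o x)) := by
  have sm : Sm (fun o x => √(F o x)) := fun o => (h.sm o).sqrt fun x => (hc.trans_le (hF o x)).ne'
  have hi := SB_inv hc h hF
  have hpd : ∀ o x l, pd (fun y => √(F o y)) x l = (1/2) * (pd (F o) x l * ((F o x)⁻¹ * (√(F o x)))) := by
    intro o x l
    have h0 := (hc.trans_le (hF o x))
    rw [pd_comp_real (f := fun y => √y) (Real.hasDerivAt_sqrt h0.ne') (h.diff o x)]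
    have h1 := Real.sqrt_pos.2 h0
    have h2 := sq_sqrt h0.le
    have : (F o x)⁻¹ * √(F o x) = (√(F o x))⁻¹ := by
      nth_rewrite 1 [← h2]; field_simp
    rw [this]; field_simp
  have b : ∃ C, ∀ o x, |√(F o x)| ≤ C := by
    obtain ⟨C, hC0, hC⟩ := h.bdd
    refine ⟨√C, fun o x => ?_⟩
    rw [abs_of_nonneg (sqrt_nonneg _)]; exact Real.sqrt_le_sqrt ((le_abs_self _).trans (hC o x))
  refine ⟨sm, fun n => ?_⟩
  induction n with
  | zero => exact b
  | succ n ih =>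
    refine ⟨b, fun l => ?_⟩
    simp only [hpd]
    exact BB.mul (fun o => contDiff_const) (fun o => ((h.pd l).sm o).mul ((hi.sm o).mul (sm o))) ((SB.cst (1/2)).bb n)
      (BB.mul (h.pd l).sm (fun o => (hi.sm o).mul (sm o)) ((h.pd l).bb n) (BB.mul hi.sm sm (hi.bb n) ih))

theorem inv_lip {c a b : ℝ} (hc : 0 < c) (ha : c ≤ a) (hb : c ≤ b) : |a⁻¹ - b⁻¹| ≤ |a - b| / c ^ 2 := by
  have h1 : 0 < a := hc.trans_le ha
  have h2 : 0 < b := hc.trans_le hb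
  rw [inv_sub_inv h1.ne' h2.ne', abs_div, abs_sub_comm b a, abs_of_pos (mul_pos h1 h2)]
  gcongr
  nlinarith

theorem sqrt_lip {c a b : ℝ} (hc : 0 < c) (ha : c ≤ a) (hb : c ≤ b) : |√a - √b| ≤ |a - b| / √c := by
  have h1 : 0 < a := hc.trans_le ha
  have h2 : 0 < b := hc.trans_le hb
  have h3 := Real.sqrt_pos.2 hc
  rw [le_div_iff₀ h3]
  have e : a - b = (√a - √b) * (√a + √b) := by
    nlinarith [mul_self_sqrt h1.le, mul_self_sqrt h2.le]
  rw [e, abs_mul]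
  gcongr
  rw [abs_of_nonneg (pz)]
  linarith [Real.sqrt_le_sqrt ha, sqrt_nonneg b]

theorem UC.comp {κ X : Type*} [PseudoMetricSpace κ] {F : κ → X → ℝ} {g : ℝ → ℝ} {c L : ℝ} (h : UC F) (hF : ∀ k x, c ≤ F k x) (hL : 0 ≤ L)
    (hg : ∀ a b, c ≤ a → c ≤ b → |g a - g b| ≤ |a - b| * L) : UC (fun k x => g (F k x)) := by
  obtain ⟨⟨C, hC0, hC⟩, h1⟩ := h
  refine ⟨⟨|g c| + (C + |c|) * L, pz, fun k x => ?_⟩, fun ε hε => ?_⟩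
  · have := hg _ _ (hF k x) le_rfl
    have h2 : |F k x - c| ≤ C + |c| := (abs_sub _ _).trans (by linarith [hC k x])
    have h3 : |F k x - c| * L ≤ (C + |c|) * L := by gcongr
    have h4 := abs_sub_abs_le_abs_sub (g (F k x)) (g c)
    linarith
  · obtain ⟨δ, hδ, a⟩ := h1 (ε / (L + 1)) (pz)
    refine ⟨δ, hδ, fun k k' hk x => (hg _ _ (hF k x) (hF k' x)).trans ?_⟩
    calc _ ≤ ε / (L + 1) * L := by gcongr; exact a k k' hk x
      _ ≤ ε := by rw [div_mul_eq_mul_div, div_le_iff₀ (pz)]; nlinarith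

/-- smooth bounded, with time continuity -/
def SU {d : ℕ} {κ : Type*} [PseudoMetricSpace κ] (F : κ → EE d → ℝ) : Prop := SB F ∧ UC F

theorem SU.alg {d : ℕ} {κ : Type*} [PseudoMetricSpace κ] {c : ℝ} (hc : 0 < c) : Alg (X := κ × EE d) c (fun f => SU (fun k x => f (k, x))) where
  add := fun h h' => ⟨h.1.add h'.1, h.2.add h'.2⟩
  mul := fun h h' => ⟨h.1.mul h'.1, h.2.mul h'.2⟩
  cst := fun r => ⟨SB.cst r, UC.of_const (C := |r|) fun _ => le_rfl⟩
  inv := fun h hf => ⟨SB_inv hc h.1 fun k x => hf (k, x), UC.comp (g := fun y => y⁻¹) (L := (c ^ 2)⁻¹) h.2 (fun k x => hf (k, x)) (pz)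
    fun a b ha hb => by simpa [div_eq_mul_inv] using inv_lip hc ha hb⟩
  sqrt := fun h hf => ⟨SB_sqrt hc h.1 fun k x => hf (k, x), UC.comp (g := Real.sqrt) (L := (√c)⁻¹) h.2 (fun k x => hf (k, x)) (pz)
    fun a b ha hb => by simpa [div_eq_mul_inv] using sqrt_lip hc ha hb⟩

/-- bounded Lipschitz functions w.r.t. a 'distance' -/
def LP {X : Type*} (ρ : X → X → ℝ) (f : X → ℝ) : Prop := (∃ C, 0 ≤ C ∧ ∀ x, |f x| ≤ C) ∧ ∃ L, 0 ≤ L ∧ ∀ x y, |f x - f y| ≤ L * ρ x y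

theorem LP.comp {X : Type*} {ρ : X → X → ℝ} (hρ : ∀ x y, 0 ≤ ρ x y) {F : X → ℝ} {g : ℝ → ℝ} {c L : ℝ} (h : LP ρ F) (hF : ∀ x, c ≤ F x) (hL : 0 ≤ L)
    (hg : ∀ a b, c ≤ a → c ≤ b → |g a - g b| ≤ |a - b| * L) : LP ρ (fun x => g (F x)) := by
  obtain ⟨⟨C, hC0, hC⟩, K, hK0, hK⟩ := h
  refine ⟨⟨|g c| + (C + |c|) * L, pz, fun x => ?_⟩, K * L, pz, fun x y => ?_⟩
  · have := hg _ _ (hF x) le_rfl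
    have h2 : |F x - c| ≤ C + |c| := (abs_sub _ _).trans (by linarith [hC x])
    have h3 : |F x - c| * L ≤ (C + |c|) * L := by gcongr
    have h4 := abs_sub_abs_le_abs_sub (g (F x)) (g c)
    linarith
  · refine (hg _ _ (hF x) (hF y)).trans ?_
    calc _ ≤ K * ρ x y * L := by gcongr; exact hK x y
      _ = _ := by ring

theorem LP.alg {X : Type*} {ρ : X → X → ℝ} (hρ : ∀ x y, 0 ≤ ρ x y) {c : ℝ} (hc : 0 < c) : Alg c (LP ρ) where
  add := by
    rintro f g ⟨⟨C, hC0, hC⟩, K, hK0, hK⟩ ⟨⟨C', hC0', hC'⟩, K', hK0', hK'⟩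
    refine ⟨⟨C + C', pz, fun x => (abs_add_le _ _).trans (add_le_add (hC x) (hC' x))⟩, K + K', pz, fun x y => ?_⟩
    have := hK x y; have := hK' x y
    rw [abs_le] at *; constructor <;> linarith
  mul := by
    rintro f g ⟨⟨C, hC0, hC⟩, K, hK0, hK⟩ ⟨⟨C', hC0', hC'⟩, K', hK0', hK'⟩
    refine ⟨⟨C * C', pz, fun x => ab2 (hC x) (hC' x)⟩, K * C' + C * K', pz, fun x y => ?_⟩
    have e : f x * g x - f y * g y = (f x - f y) * g x + f y * (g x - g y) := by ring
    rw [e]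
    refine (abs_add_le _ _).trans ((add_le_add (ab2 (hK x y) (hC' x)) (ab2 (hC y) (hK' x y))).trans (le_of_eq ?_))
    ring
  cst := fun r => ⟨⟨|r|, abs_nonneg _, fun _ => le_rfl⟩, 0, le_rfl, fun _ _ => by simp⟩
  inv := fun h hf => LP.comp hρ (g := fun y => y⁻¹) (L := (c ^ 2)⁻¹) h hf (pz)
    fun a b ha hb => by simpa [div_eq_mul_inv] using inv_lip hc ha hb
  sqrt := fun h hf => LP.comp hρ (g := Real.sqrt) (L := (√c)⁻¹) h hf (pz)
    fun a b ha hb => by simpa [div_eq_mul_inv] using sqrt_lip hc ha hb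

/-- a Lipschitz square root -/
theorem lip_root (n : ℕ) {c : ℝ} (hc : 0 < c) (C : ℝ) : ∃ (W : (MM n) → MM n) (L : ℝ), 0 ≤ L ∧
    (∀ Q : MM n, (∀ i j, Q i j = Q j i) → (∀ i j, |Q i j| ≤ C) → (∀ w : Fin n → ℝ, c * ∑ i, w i ^ 2 ≤ ∑ i, ∑ j, Q i j * w i * w j) →
      ∀ i j, Q i j = ∑ a, W Q i a * W Q j a) ∧
    (∀ Q Q' : MM n, (∀ i j, Q i j = Q j i) → (∀ i j, |Q i j| ≤ C) → (∀ w : Fin n → ℝ, c * ∑ i, w i ^ 2 ≤ ∑ i, ∑ j, Q i j * w i * w j) →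
      (∀ i j, Q' i j = Q' j i) → (∀ i j, |Q' i j| ≤ C) → (∀ w : Fin n → ℝ, c * ∑ i, w i ^ 2 ≤ ∑ i, ∑ j, Q' i j * w i * w j) →
      ∀ i a, |W Q i a - W Q' i a| ≤ L * ∑ i, ∑ j, |Q i j - Q' i j|) := by
  classical
  let X := {Q : MM n // (∀ i j, Q i j = Q j i) ∧ (∀ i j, |Q i j| ≤ C) ∧ (∀ w : Fin n → ℝ, c * ∑ i, w i ^ 2 ≤ ∑ i, ∑ j, Q i j * w i * w j)}
  let ρ : X → X → ℝ := fun Q Q' => ∑ i, ∑ j, |Q.1 i j - Q'.1 i j|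
  have hρ : ∀ x y, 0 ≤ ρ x y := fun x y => sum_nn fun i => sum_nn fun j => abs_nonneg _
  obtain ⟨W, hW, hQ⟩ := chol hc (LP.alg (ρ := ρ) hρ hc) n (fun x => x.1) (fun i j => by
    refine ⟨⟨|C|, abs_nonneg _, fun x => (x.2.2.1 i j).trans (le_abs_self _)⟩, 1, zero_le_one, fun x y => ?_⟩
    rw [one_mul]
    refine le_trans ?_ (single_le_sum (f := fun i => ∑ j, |x.1 i j - y.1 i j|) (fun i _ => sum_nn fun j => abs_nonneg _) (Finset.mem_univ i))
    exact single_le_sum (f := fun j => |x.1 i j - y.1 i j|) (fun i _ => abs_nonneg _) (Finset.mem_univ j)) (fun x => x.2.1) (fun x => x.2.2.2)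
  choose K hK0 hK using fun i a => (hW i a).2
  have hKs : ∀ i a, K i a ≤ ∑ i, ∑ a, K i a := fun i a =>
    (single_le_sum (f := fun a => K i a) (fun a _ => hK0 i a) (Finset.mem_univ a)).trans
      (single_le_sum (f := fun i => ∑ a, K i a) (fun i _ => sum_nn fun a => hK0 i a) (Finset.mem_univ i))
  refine ⟨fun Q => if h : (∀ i j, Q i j = Q j i) ∧ (∀ i j, |Q i j| ≤ C) ∧ (∀ w : Fin n → ℝ, c * ∑ i, w i ^ 2 ≤ ∑ i, ∑ j, Q i j * w i * w j) then W ⟨Q, h⟩ else 0,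
    ∑ i, ∑ a, K i a, sum_nn fun i => sum_nn fun a => hK0 i a, ?_, ?_⟩
  · intro Q h1 h2 h3 i j
    simp only [dif_pos (show (∀ i j, Q i j = Q j i) ∧ (∀ i j, |Q i j| ≤ C) ∧ (∀ w : Fin n → ℝ, c * ∑ i, w i ^ 2 ≤ ∑ i, ∑ j, Q i j * w i * w j) from ⟨h1, h2, h3⟩)]
    exact hQ ⟨Q, h1, h2, h3⟩ i j
  · intro Q Q' h1 h2 h3 h1' h2' h3' i a
    simp only [dif_pos (show (∀ i j, Q i j = Q j i) ∧ (∀ i j, |Q i j| ≤ C) ∧ (∀ w : Fin n → ℝ, c * ∑ i, w i ^ 2 ≤ ∑ i, ∑ j, Q i j * w i * w j) from ⟨h1, h2, h3⟩),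
      dif_pos (show (∀ i j, Q' i j = Q' j i) ∧ (∀ i j, |Q' i j| ≤ C) ∧ (∀ w : Fin n → ℝ, c * ∑ i, w i ^ 2 ≤ ∑ i, ∑ j, Q' i j * w i * w j) from ⟨h1', h2', h3'⟩)]
    refine (hK i a ⟨Q, h1, h2, h3⟩ ⟨Q', h1', h2', h3'⟩).trans ?_
    exact mul_le_r (hKs i a) (hρ _ _)

/-- the second order operator with matrix first order coefficients -/
noncomputable def opL {d m : ℕ} (Q : EE d → MM d) (A : EE d → MA d m) (C : EE d → MM m)
    (U : EE d → Fin m → ℝ) (x : EE d) (a : Fin m) : ℝ :=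
  (∑ i, ∑ j, Q x i j * pdd (fun z => U z a) x i j) + (∑ i, ∑ b, A x i a b * pd (fun z => U z b) x i) + ∑ b, C x a b * U x b

/-- approximate solutions -/
structure AppSol {d m : ℕ} (s T : ℝ) (Q : Icc s T → EE d → MM d) (A : Icc s T → EE d → MA d m)
    (C : Icc s T → EE d → MM m) (f : EE d → Fin m → ℝ) (M κ : ℝ) (u : CU d m) : Prop where
  ini : ∀ x, u s x = f x
  cu : ∀ a, Continuous (fun p : ℝ × EE d => u p.1 p.2 a)
  cpd : ∀ a l, Continuous (fun p : ℝ × EE d => pd (fun z => u p.1 z a) p.2 l)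
  sm : ∀ t a, ContDiff ℝ ∞ (fun x => u t x a)
  bd : ∀ t ∈ Icc s T, ∀ x a, |u t x a| ≤ M ∧ ∀ l, |pd (fun z => u t z a) x l| ≤ M
  eq : ∀ t, ∀ ht : t ∈ Ioc s T, ∃ G : EE d → Fin m → ℝ, (∀ a, ContDiff ℝ ∞ (fun x => G x a)) ∧
        (∀ x a, HasDerivWithinAt (fun τ => u τ x a) (G x a) (Iic t) t) ∧
        (∀ x a l, HasDerivWithinAt (fun τ => pd (fun z => u τ z a) x l) (pd (fun z => G z a) x l) (Iic t) t) ∧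
        (∀ x a, |G x a - opL (Q ⟨t, ht.1.le, ht.2⟩) (A ⟨t, ht.1.le, ht.2⟩) (C ⟨t, ht.1.le, ht.2⟩) (u t) x a| ≤ κ) ∧
        (∀ x a l, |pd (fun y => G y a - opL (Q ⟨t, ht.1.le, ht.2⟩) (A ⟨t, ht.1.le, ht.2⟩) (C ⟨t, ht.1.le, ht.2⟩) (u t) y a) x l| ≤ κ)

theorem EX2 {d m : ℕ} (hd : 1 ≤ d) (hm : 1 ≤ m) {s T ν₀ : ℝ} (hsT : s < T) (hν : 0 < ν₀) (Q : Icc s T → EE d → MM d) (A : Icc s T → EE d → MA d m)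
    (C : Icc s T → EE d → MM m) (f : EE d → Fin m → ℝ) (hQ : ∀ i j, SU (fun k x => Q k x i j)) (hA : ∀ i a b, SU (fun k x => A k x i a b))
    (hC : ∀ a b, SU (fun k x => C k x a b)) (hs : ∀ k x i j, Q k x i j = Q k x j i)
    (hp : ∀ k x (w : Fin d → ℝ), ν₀ * ∑ i, w i ^ 2 ≤ ∑ i, ∑ j, Q k x i j * w i * w j)
    (hf : ∀ a, SB (fun (_ : Unit) x => f x a)) : ∃ M, ∀ κ > 0, ∃ u, AppSol s T Q A C f M κ u := by
  classical
  haveI : Nonempty (Fin d) := ⟨⟨0, hd⟩⟩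
  haveI : Nonempty (Fin m) := ⟨⟨0, hm⟩⟩
  obtain ⟨ν₁, hν₁⟩ : ∃ ν₁, ν₁ = ν₀ / 2 := ⟨_, rfl⟩
  have hν0 : 0 < ν₁ := by rw [hν₁]; linarith
  have hal := SU.alg (d := d) (κ := Icc s T) hν0
  obtain ⟨W, hW, hWQ⟩ := chol (X := Icc s T × EE d) hν0 hal d (fun x i j => Q x.1 x.2 i j + (if i = j then -ν₁ else 0))
    (fun i j => hal.add (f := fun x => Q x.1 x.2 i j) (g := fun _ => if i = j then -ν₁ else 0) (hQ i j) (hal.cst _)) (fun x i j => by rw [hs x.1 x.2 i j]; congr 1; by_cases h : i = j <;> simp [h, eq_comm])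
    (fun x w => by
      have h1 := hp x.1 x.2 w
      have h2 : ∑ i, ∑ j, (Q x.1 x.2 i j + (if i = j then -ν₁ else 0)) * w i * w j = (∑ i, ∑ j, Q x.1 x.2 i j * w i * w j) - ν₁ * ∑ i, w i ^ 2 := by
        simp only [add_mul, sum_ad, ite_mul, zero_mul, sum_ite_eq, Finset.mem_univ, if_true, mul_sm]
        rw [sub_eq_add_neg, ← Finset.sum_neg_distrib]; congr 1; exact sum_cg fun i => by ring
      rw [h2]
      have : ν₀ = 2 * ν₁ := by rw [hν₁]; ring
      rw [this] at h1; linarith)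
  obtain ⟨n, hn⟩ : ∃ n : ℝ, n = Fintype.card (Fin d ⊕ Fin d) := ⟨_, rfl⟩
  have hn0 : 0 < n := by rw [hn]; exact_mod_cast Fintype.card_pos
  obtain ⟨s1, h1, hs1⟩ : ∃ s1 : ℝ, 0 < s1 ∧ s1 * s1 = 2 * n := ⟨√(2 * n), pz, mul_self_sqrt (pz)⟩
  obtain ⟨s2, h2, hs2⟩ : ∃ s2 : ℝ, 0 < s2 ∧ s2 * s2 = 2 * n * ν₁ := ⟨√(2 * n * ν₁), pz, mul_self_sqrt (pz)⟩
  let S : Sch d (Fin d ⊕ Fin d) (Fin m) (Icc s T) :=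
    { η := fun α k x i => Sum.elim (fun a => s1 * W (k, x) i a) (fun l => if i = l then s2 else 0) α
      β := fun _ _ _ => 0
      N := fun α k x a b => Sum.elim (fun _ => 0) (fun l => (n / s2) * A k x l a b) α
      R := fun _ k x a b => C k.1 x a b
      hη := by rintro (a | l) i; exacts [(SB.cst s1).mul (hW i a).1, SB.cst _]
      hβ := fun i => SB.cst 0
      hN := by rintro (l | l) a b; exacts [SB.cst 0, (SB.cst (n / s2)).mul (hA l a b).1]
      hR := fun α a b => (hC a b).1.pull Prod.fst }
  have hcst : ∀ r : ℝ, UC (fun (_ : Icc s T) (_ : EE d) => r) := fun r => UC.of_const (C := |r|) fun _ => le_rfl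
  have key := S.EX hsT (fun _ _ _ _ _ _ => rfl) (by rintro (a | l) i; exacts [(hcst s1).mul (hW i a).2, hcst _]) (fun i => hcst 0)
    (by rintro (l | l) a b; exacts [hcst 0, (hcst (n / s2)).mul (hA l a b).2])
    (fun α a b => (hC a b).2.pullX (fun x : RR × EE d => x.2)) hf
  have hgen : ∀ k U x a, S.gen k r0 U x a = opL (Q k) (A k) (C k) U x a := by
    intro k U x a
    have hg1 : ∀ l, S.gen1 (Sum.inl l) k r0 U x a = n * (∑ i, ∑ j, W (k, x) i l * W (k, x) j l * pdd (fun z => U z a) x i j) + ∑ b, C k x a b * U x b := by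
      intro l
      show 1 / 2 * (∑ i, ∑ j, pdd (fun z => U z a) x i j * (s1 * W (k, x) i l) * (s1 * W (k, x) j l))
        + ∑ b, 0 * (∑ i, pd (fun z => U z b) x i * _) + 1 / 2 * ∑ b, (C k x a b + C k x a b) * U x b + ∑ i, pd (fun z => U z a) x i * 0 = _
      simp only [zero_mul, mul_zero, Finset.sum_const_zero, add_zero]
      rw [mul_sm, mul_sm, mul_sm]; congr 1
      · refine sum_cg fun i => ?_
        rw [mul_sm, mul_sm]
        refine sum_cg fun j => ?_
        linear_combination (1 / 2 * pdd (fun z => U z a) x i j * W (k, x) i l * W (k, x) j l) * hs1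
      · exact sum_cg fun i => by ring
    have hg2 : ∀ l, S.gen1 (Sum.inr l) k r0 U x a = n * (ν₁ * pdd (fun z => U z a) x l l) + n * (∑ b, A k x l a b * pd (fun z => U z b) x l) + ∑ b, C k x a b * U x b := by
      intro l
      show 1 / 2 * (∑ i, ∑ j, pdd (fun z => U z a) x i j * (if i = l then s2 else 0) * (if j = l then s2 else 0))
        + ∑ b, (n / s2) * A k x l a b * (∑ i, pd (fun z => U z b) x i * (if i = l then s2 else 0)) + 1 / 2 * ∑ b, (C k x a b + C k x a b) * U x b + ∑ i, pd (fun z => U z a) x i * 0 = _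
      simp only [zero_mul, mul_zero, Finset.sum_const_zero, add_zero, mul_ite, ite_mul, Finset.sum_ite_eq', Finset.mem_univ, if_true]
      rw [mul_sm, mul_sm]; congr 1; congr 1
      · linear_combination (1 / 2 * pdd (fun z => U z a) x l l) * hs2
      · refine sum_cg fun b => ?_
        field_simp
      · exact sum_cg fun i => by ring
    have hn2 : n = (d : ℝ) + d := by rw [hn]; simp
    unfold Sch.gen opL
    rw [Fintype.sum_sum_type]
    simp only [hg1, hg2, sum_ad, sum_const, card_univ, Fintype.card_fin, nsmul_eq_mul, ← mul_sm]
    rw [← hn]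
    have e1 : ∑ l, ∑ i, ∑ j, W (k, x) i l * W (k, x) j l * pdd (fun z => U z a) x i j
        = (∑ i, ∑ j, Q k x i j * pdd (fun z => U z a) x i j) - ν₁ * ∑ l, pdd (fun z => U z a) x l l := by
      rw [sum_comm]
      have : ∀ i, ∑ l, ∑ j, W (k, x) i l * W (k, x) j l * pdd (fun z => U z a) x i j =
          (∑ j, Q k x i j * pdd (fun z => U z a) x i j) - ν₁ * pdd (fun z => U z a) x i i := by
        intro i
        rw [sum_comm]
        simp only [← sum_mul]
        simp only [← hWQ (k, x), add_mul, sum_ad, ite_mul, zero_mul, sum_ite_eq, Finset.mem_univ, if_true]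
        ring
      rw [sum_cg fun i => this i, sum_sub_distrib, mul_sm]
    rw [e1]
    have hd' : (d : ℝ) = n / 2 := by rw [hn2]; ring
    rw [hd']
    field_simp
    ring
  obtain ⟨M, hM⟩ := key
  refine ⟨M, fun κ hκ => ?_⟩
  obtain ⟨u, a1, a2, a3, a4, a5, a6⟩ := hM κ hκ
  refine ⟨u, a1, a2, a3, a4, a5, fun t ht => ?_⟩
  obtain ⟨G, b1, b2, b3, b4, b5⟩ := a6 t ht
  refine ⟨G, b1, b2, b3, fun x a => by rw [← hgen]; exact b4 x a, fun x a l => ?_⟩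
  simp only [← hgen]; exact b5 x a l

section molsec
variable {d : ℕ}

noncomputable def mol (k g : EE d → ℝ) (x : EE d) : ℝ := ∫ y, k y * g (x - y)

open scoped Convolution in
theorem mol_conv (k g : EE d → ℝ) : mol k g = (k ⋆[ContinuousLinearMap.lsmul ℝ ℝ, volume] g) := by
  funext x; simp [mol, convolution]

theorem mol_smooth {k g : EE d → ℝ} (hk : ContDiff ℝ ∞ k) (hc : HasCompactSupport k) (hg : Continuous g) : ContDiff ℝ ∞ (mol k g) := by
  rw [mol_conv]
  exact hc.contDiff_convolution_left _ hk hg.locallyIntegrable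

open scoped Convolution in
theorem mol_pd {k g : EE d → ℝ} (hk : ContDiff ℝ ∞ k) (hc : HasCompactSupport k) (hg : Continuous g) (x : EE d) (l : Fin d) :
    pd (mol k g) x l = mol (fun y => pd k y l) g x := by
  have h := hc.hasFDerivAt_convolution_left (ContinuousLinearMap.lsmul ℝ ℝ) (μ := (volume : Measure (EE d))) (contDiff_infty.1 hk 1) hg.locallyIntegrable x
  rw [← mol_conv] at h
  rw [pd_eq_of_hasFDerivAt h, convolution_def, mol]
  rw [ContinuousLinearMap.integral_apply]
  · rfl
  · have h2 := hc.fderiv (𝕜 := ℝ)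
    have := h2.convolutionExists_left ((ContinuousLinearMap.lsmul ℝ ℝ).precompL (EE d)) (hk.continuous_fderiv (by simp)) (hg.locallyIntegrable (μ := volume)) x
    exact this

theorem mol_int {k g : EE d → ℝ} (hk : Continuous k) (hc : HasCompactSupport k) (hg : Continuous g) (x : EE d) : Integrable (fun y => k y * g (x - y)) := by
  apply Continuous.integrable_of_hasCompactSupport
  · fun_prop
  · exact hc.mul_right

theorem mol_bdd {k g : EE d → ℝ} (hk : Continuous k) (hc : HasCompactSupport k) {G : ℝ} (hG : ∀ x, |g x| ≤ G) (x : EE d) :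
    |mol k g x| ≤ (∫ y, |k y|) * G := by
  have hi : Integrable (fun y => |k y|) := (hk.integrable_of_hasCompactSupport hc).abs
  rw [← integral_mul_const]
  unfold mol
  rw [← Real.norm_eq_abs]
  refine norm_integral_le_of_norm_le (hi.mul_const G) (Eventually.of_forall fun y => ?_)
  rw [Real.norm_eq_abs, abs_mul]
  exact mul_le_l (hG _) (abs_nonneg _)

theorem mol_sub {k g g' : EE d → ℝ} (hk : Continuous k) (hc : HasCompactSupport k) (hg : Continuous g) (hg' : Continuous g') (x : EE d) :
    mol k g x - mol k g' x = mol k (fun y => g y - g' y) x := by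
  unfold mol
  rw [← integral_sub (mol_int hk hc hg x) (mol_int hk hc hg' x)]
  congr 1; funext y; ring

theorem mol_BB {Ω : Type*} {g : Ω → EE d → ℝ} {G : ℝ} (hG : ∀ o x, |g o x| ≤ G) (hg : ∀ o, Continuous (g o)) (n : ℕ) :
    ∀ k : EE d → ℝ, ContDiff ℝ ∞ k → HasCompactSupport k → BB n (fun o x => mol k (g o) x) := by
  induction n with
  | zero => exact fun k hk hc => ⟨_, fun o x => mol_bdd hk.continuous hc (hG o) x⟩
  | succ n ih =>
    refine fun k hk hc => ⟨⟨_, fun o x => mol_bdd hk.continuous hc (hG o) x⟩, fun l => ?_⟩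
    have := ih (fun y => pd k y l) (smooth_pd hk l) (compactSupport_pd hc l)
    convert this using 3
    exact mol_pd hk hc (hg _) _ l

theorem mol_SU {κ : Type*} [PseudoMetricSpace κ] {k : EE d → ℝ} (hk : ContDiff ℝ ∞ k) (hc : HasCompactSupport k) {g : κ → EE d → ℝ} (hg : ∀ t, Continuous (g t)) (hu : UC g) :
    SU (fun t x => mol k (g t) x) := by
  obtain ⟨⟨G, hG0, hG⟩, h⟩ := hu
  refine ⟨⟨fun t => mol_smooth hk hc (hg t), fun n => mol_BB hG hg n k hk hc⟩, ⟨_, ?_, fun t x => mol_bdd hk.continuous hc (hG t) x⟩, fun ε hε => ?_⟩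
  · exact mul_nonneg (integral_nonneg fun _ => abs_nonneg _) hG0
  · have hI : 0 ≤ ∫ y, |k y| := integral_nonneg fun _ => abs_nonneg _
    obtain ⟨δ, hδ, hd⟩ := h (ε / ((∫ y, |k y|) + 1)) (pz)
    refine ⟨δ, hδ, fun t t' htt x => ?_⟩
    rw [mol_sub hk.continuous hc (hg t) (hg t')]
    refine (mol_bdd hk.continuous hc (hd t t' htt) x).trans ?_
    rw [mul_div_assoc', div_le_iff₀ (pz)]; nlinarith

theorem mol_pd' {k g : EE d → ℝ} (hk : ContDiff ℝ ∞ k) (hc : HasCompactSupport k) {δ : ℝ} (hs : ∀ y, δ < ‖y‖ → k y = 0) (hg : Differentiable ℝ g) {x : EE d} {l : Fin d} {C : ℝ}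
    (hC : ∀ y, ‖y - x‖ ≤ δ → |pd g y l| ≤ C) : Integrable (fun y => k y * pd g (x - y) l) ∧ pd (mol k g) x l = ∫ y, k y * pd g (x - y) l := by
  set h : EE d → ℝ := fun y => g (x - y) with hh
  have hhd : Differentiable ℝ h := hg.comp (differentiable_id.const_sub x)
  have hfd : ∀ y v, fderiv ℝ h y v = - fderiv ℝ g (x - y) v := by
    intro y v
    have h1 : HasFDerivAt h ((fderiv ℝ g (x - y)).comp (-(ContinuousLinearMap.id ℝ (EE d)))) y := by
      refine HasFDerivAt.comp y (hg (x - y)).hasFDerivAt ?_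
      exact (hasFDerivAt_id y).const_sub x
    rw [h1.fderiv]; simp
  have hI : Integrable (fun y => k y * fderiv ℝ h y (EuclideanSpace.single l 1)) := by
    have hi : Integrable (fun y => |k y| * C) := ((hk.continuous.integrable_of_hasCompactSupport hc).abs).mul_const C
    refine hi.mono' ?_ (Eventually.of_forall fun y => ?_)
    · exact (hk.continuous.measurable.mul (measurable_fderiv_apply_const ℝ h _)).aestronglyMeasurable
    · rw [Real.norm_eq_abs, abs_mul]
      by_cases hy : δ < ‖y‖
      · simp [hs y hy]
      · refine mul_le_l ?_ (abs_nonneg _)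
        rw [hfd, abs_neg]
        exact hC (x - y) (by simpa using not_lt.1 hy)
  have hbp := integral_mul_fderiv_eq_neg_fderiv_mul_of_integrable (μ := (volume : Measure (EE d))) (f := k) (g := h) (v := EuclideanSpace.single l 1)
    (mol_int (smooth_pd hk l).continuous (compactSupport_pd hc l) hg.continuous x) hI (mol_int hk.continuous hc hg.continuous x)
    (fun y _ => smooth_diff hk y) (fun y _ => hhd y)
  simp only [hfd] at hbp hI
  constructor
  · have := hI.neg
    refine this.congr (Eventually.of_forall fun y => ?_)
    simp [pd]
  · rw [mol_pd hk hc hg.continuous, mol]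
    simp only [mul_neg, integral_neg, neg_inj] at hbp
    exact hbp.symm

/-- mollification kernels -/
structure IsKer (δ : ℝ) (k : EE d → ℝ) : Prop where
  sm : ContDiff ℝ ∞ k
  cs : HasCompactSupport k
  sp : ∀ y, δ < ‖y‖ → k y = 0
  nn : ∀ y, 0 ≤ k y
  int : ∫ y, k y = 1

theorem exists_ker (d : ℕ) {δ : ℝ} (hδ : 0 < δ) : ∃ k : EE d → ℝ, IsKer δ k := by
  let φ : ContDiffBump (0 : EE d) := ⟨δ / 2, δ, by linarith, by linarith⟩
  refine ⟨φ.normed volume, φ.contDiff_normed, φ.hasCompactSupport_normed, fun y hy => ?_, φ.nonneg_normed, φ.integral_normed⟩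
  have : y ∉ Function.support (φ.normed volume) := by
    rw [φ.support_normed_eq]; simp; exact hy.le
  simpa using this

theorem ker_le {δ : ℝ} {k : EE d → ℝ} (hk : IsKer δ k) {h : EE d → ℝ} (hi : Integrable (fun y => k y * h y)) {K : ℝ} (hh : ∀ y, ‖y‖ ≤ δ → h y ≤ K) : ∫ y, k y * h y ≤ K := by
  have hki : Integrable k := hk.sm.continuous.integrable_of_hasCompactSupport hk.cs
  calc ∫ y, k y * h y ≤ ∫ y, k y * K := by
        refine integral_mono hi (hki.mul_const K) fun y => ?_
        by_cases hy : δ < ‖y‖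
        · simp [hk.sp y hy]
        · exact mul_le_l (hh y (not_lt.1 hy)) (hk.nn y)
    _ = K := by rw [integral_mul_const, hk.int, one_mul]

theorem ker_close {δ : ℝ} {k : EE d → ℝ} (hk : IsKer δ k) {h : EE d → ℝ} (hi : Integrable (fun y => k y * h y)) {K c : ℝ} (hh : ∀ y, ‖y‖ ≤ δ → |h y - c| ≤ K) :
    |(∫ y, k y * h y) - c| ≤ K := by
  rw [abs_le]
  have h1 := ker_le hk hi (K := c + K) fun y hy => by linarith [(abs_le.1 (hh y hy)).2]
  have h2 := ker_le hk (h := fun y => - h y) (by simpa using hi.neg) (K := -c + K) fun y hy => by linarith [(abs_le.1 (hh y hy)).1]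
  simp only [mul_neg, integral_neg] at h2
  constructor <;> linarith

theorem mol_close {δ : ℝ} {k : EE d → ℝ} (hk : IsKer δ k) {g : EE d → ℝ} (hg : Continuous g) {x : EE d} {K c : ℝ} (hh : ∀ y, ‖y - x‖ ≤ δ → |g y - c| ≤ K) :
    |mol k g x - c| ≤ K :=
  ker_close hk (mol_int hk.sm.continuous hk.cs hg x) fun y hy => hh _ (by simpa using hy)

theorem mol_pd_close {δ : ℝ} {k : EE d → ℝ} (hk : IsKer δ k) {g : EE d → ℝ} (hg : Differentiable ℝ g) {x : EE d} {l : Fin d} {K c : ℝ} (hh : ∀ y, ‖y - x‖ ≤ δ → |pd g y l - c| ≤ K) :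
    |pd (mol k g) x l - c| ≤ K := by
  obtain ⟨hi, he⟩ := mol_pd' hk.sm hk.cs hk.sp hg (x := x) (l := l) (C := K + |c|) fun y hy => by
    have := hh y hy
    calc |pd g y l| = |(pd g y l - c) + c| := by ring_nf
      _ ≤ _ := (abs_add_le _ _).trans (by gcongr)
  rw [he]
  exact ker_close hk hi fun y hy => hh _ (by simpa using hy)

theorem mol_pd_sum_le {δ : ℝ} {k : EE d → ℝ} (hk : IsKer δ k) {J : Type*} [Fintype J] {g : J → EE d → ℝ} {c : J → ℝ} {l : J → Fin d} (hg : ∀ j, Differentiable ℝ (g j)) {x : EE d} {C K : ℝ}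
    (hC : ∀ j y, ‖y - x‖ ≤ δ → |pd (g j) y (l j)| ≤ C) (hK : ∀ y, ‖y - x‖ ≤ δ → ∑ j, c j * pd (g j) y (l j) ≤ K) :
    ∑ j, c j * pd (mol k (g j)) x (l j) ≤ K := by
  have h := fun j => mol_pd' hk.sm hk.cs hk.sp (hg j) (x := x) (l := l j) (C := C) (hC j)
  have e : ∑ j, c j * pd (mol k (g j)) x (l j) = ∫ y, k y * ∑ j, c j * pd (g j) (x - y) (l j) := by
    have : ∀ y, k y * ∑ j, c j * pd (g j) (x - y) (l j) = ∑ j, c j * (k y * pd (g j) (x - y) (l j)) := fun y => by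
      rw [mul_sm]; exact sum_cg fun j => by ring
    simp only [this]
    rw [integral_finsetSum _ fun j _ => (h j).1.const_mul _]
    exact sum_cg fun j => by rw [(h j).2, integral_const_mul]
  rw [e]
  refine ker_le hk ?_ fun y hy => hK _ (by simpa using hy)
  have : ∀ y, k y * ∑ j, c j * pd (g j) (x - y) (l j) = ∑ j, c j * (k y * pd (g j) (x - y) (l j)) := fun y => by
      rw [mul_sm]; exact sum_cg fun j => by ring
  simp only [this]
  exact integrable_finsetSum _ fun j _ => (h j).1.const_mul _
end molsec

section PB
variable {d m : ℕ}

noncomputable def qf (Q : MM d) (v w : Fin d → ℝ) : ℝ := ∑ i, ∑ j, Q i j * v i * w j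

theorem qf_root {Q W : MM d} (h : ∀ i j, Q i j = ∑ a, W i a * W j a) (v w : Fin d → ℝ) :
    qf Q v w = ∑ a, (∑ i, W i a * v i) * (∑ j, W j a * w j) := by
  unfold qf
  simp only [sum_mul_sum, h, sum_mul]
  conv_rhs => rw [sum_comm]
  refine sum_cg fun i => ?_
  rw [sum_comm]
  refine sum_cg fun j => ?_
  try rw [mul_sm]
  exact sum_cg fun a => by ring

theorem exists_root {Q : MM d} {c : ℝ} (hc : 0 < c) (hs : ∀ i j, Q i j = Q j i) (hp : ∀ w : Fin d → ℝ, c * ∑ i, w i ^ 2 ≤ ∑ i, ∑ j, Q i j * w i * w j) :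
    ∃ W : MM d, ∀ i j, Q i j = ∑ a, W i a * W j a := by
  obtain ⟨W, L, _, hW, _⟩ := lip_root d hc (∑ i, ∑ j, |Q i j|)
  refine ⟨W Q, hW Q hs (fun i j => ?_) hp⟩
  calc |Q i j| ≤ ∑ j, |Q i j| := single_le_sum (f := fun j => |Q i j|) (fun _ _ => abs_nonneg _) (Finset.mem_univ j)
    _ ≤ _ := single_le_sum (f := fun i => ∑ j, |Q i j|) (fun _ _ => sum_nn fun _ => abs_nonneg _) (Finset.mem_univ i)

theorem qcs {Q W : MM d} (h : ∀ i j, Q i j = ∑ a, W i a * W j a) {K : Type*} [Fintype K] (c : K → ℝ) (v : K → Fin d → ℝ) :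
    qf Q (fun i => ∑ k, c k * v k i) (fun i => ∑ k, c k * v k i) ≤ (∑ k, c k ^ 2) * ∑ k, qf Q (v k) (v k) := by
  simp only [qf_root h]
  rw [sum_comm, mul_sm]
  refine sum_le fun a => ?_
  have : ∑ i, W i a * ∑ k, c k * v k i = ∑ k, c k * ∑ i, W i a * v k i := by
    simp only [mul_sm]; rw [sum_comm]
    exact sum_cg fun i => sum_cg fun a => by ring
  rw [this, ← sq]
  refine (Finset.sum_mul_sq_le_sq_mul_sq _ _ _).trans (le_of_eq ?_)
  congr 1; exact sum_cg fun i => by ring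

/-- the pointwise structural condition -/
def Good (ν₀ γ K : ℝ) (Q : MM d) (A : MA d m) (C : MM m)
    (DQ : Fin d → MM d) (DA : Fin d → MA d m) (DC : MA d m) (V : Fin d → ℝ) : Prop :=
  ∃ lam X Y Lam : ℝ, ν₀ / 2 ≤ lam ∧ 0 < X ∧ 0 ≤ Y ∧ (∀ w : Fin d → ℝ, lam * ∑ i, w i ^ 2 ≤ ∑ i, ∑ j, Q i j * w i * w j) ∧
    (∀ (u : Fin m → ℝ) (J : MJ d m), ∀ r > 0, 2 * ∑ a, u a * ∑ i, ∑ b, (A i a b - V i * dl a b) * J i b ≤ X * (r * ∑ a, u a ^ 2 + (∑ i, ∑ a, J i a ^ 2) / r)) ∧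
    (∀ (J : MJ d m) (H : Fin d → MJ d m), ∀ r > 0, 2 * ∑ l, ∑ a, J l a * ∑ i, ∑ j, DQ l i j * H i j a ≤ Y * (r * ∑ i, ∑ a, J i a ^ 2 + (∑ i, ∑ j, ∑ a, H i j a ^ 2) / r)) ∧
    (∀ u : Fin m → ℝ, ∑ a, u a * ∑ b, C a b * u b ≤ Lam * ∑ a, u a ^ 2) ∧
    Lam ≤ -(2 * γ * X ^ 2 / lam) + 1 ∧
    (∀ (u : Fin m → ℝ) (J : MJ d m), (∑ l, ∑ a, J l a * ∑ i, ∑ b, DA l i a b * J i b) + ∑ l, ∑ a, J l a * ∑ b, DC l a b * u b ≤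
      (K - Lam - γ * (X + Y) ^ 2 / lam) * (∑ i, ∑ a, J i a ^ 2) + 1 / 2 * (K - 2 * Lam) * ∑ a, u a ^ 2)

theorem swap3 {ι : Type*} [Fintype ι] (Q : MM d) (f : ι → ℝ) (g : ι → MM d) :
    ∑ i, ∑ j, Q i j * ∑ a, f a * g a i j = ∑ a, f a * ∑ i, ∑ j, Q i j * g a i j := by
  simp only [mul_sm]
  conv_rhs => rw [sum_comm]
  refine sum_cg fun i => ?_
  rw [sum_comm]
  exact sum_cg fun i => sum_cg fun i => by ring

theorem swap2 {ι : Type*} [Fintype ι] (V : Fin d → ℝ) (f : ι → ℝ) (g : ι → Fin d → ℝ) :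
    ∑ i, V i * ∑ a, f a * g a i = ∑ a, f a * ∑ i, V i * g a i := by
  simp only [mul_sm]; rw [sum_comm]
  exact sum_cg fun i => sum_cg fun i => by ring

theorem lin4 (F1 F2 F3 F4 : MM d) (e : ℝ) : ∑ i, ∑ j, (2 * F1 i j + 2 * F2 i j + e * F3 i j + e * F4 i j) =
    2 * (∑ i, ∑ j, F1 i j) + 2 * (∑ i, ∑ j, F2 i j) + e * (∑ i, ∑ j, F3 i j) + e * ∑ i, ∑ j, F4 i j := by
  simp only [sum_ad, ← mul_sm]

set_option maxHeartbeats 2000000 in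
theorem PBscal {ν₀ γ K lam X Y Lam a th th' c w U N HH E0 E1 S1 S2 S3 S4 S5 S6 S7 S8 e1 e2 QW ε : ℝ} (hν : 0 < ν₀) (hγ : 0 < γ) (hK : 0 ≤ K) (hlam : ν₀ / 2 ≤ lam) (hX : 0 < X) (hY : 0 ≤ Y)
    (ha : 0 < a) (ha1 : a ≤ 1 / 3) (ha2 : a ≤ ν₀ / (16 * γ)) (ht : 0 ≤ th) (ht1 : th ≤ 1) (ht' : th' ≤ 1) (hc : 0 ≤ c) (hc1 : 1 / (2 * γ) ≤ 2 - 4 * c) (hε : 0 < ε)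
    (hU : 0 ≤ U) (hN : 0 ≤ N) (hHH : 0 ≤ HH) (he1 : 0 ≤ e1) (he2 : 0 ≤ e2) (hw : w = U + a * th * N + ε) (hE0 : lam * N ≤ E0) (hE1 : lam * HH ≤ E1)
    (hS1 : ∀ r > 0, 2 * S1 ≤ X * (r * U + N / r)) (hS46 : ∀ r > 0, 2 * (S4 + S6) ≤ (X + Y) * (r * N + HH / r)) (hS2 : S2 ≤ Lam * U) (hS7 : S7 ≤ Lam * N)
    (hS3 : 2 * S3 ≤ U + e1) (hS8 : 2 * S8 ≤ N + e2) (hL : Lam ≤ -(2 * γ * X ^ 2 / lam) + 1)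
    (hS5 : S5 ≤ (K - Lam - γ * (X + Y) ^ 2 / lam) * N + 1 / 2 * (K - 2 * Lam) * U) (hQW : QW ≤ 4 * w * (E0 + a * th * E1)) :
    2 * S1 + 2 * S2 + 2 * S3 + 2 * a * th * (S4 + S5 + S6 + S7 + S8) + a * th' * N - 2 * E0 - 2 * a * th * E1 + c * (QW / w) ≤ (3 + 2 * K) * w + (e1 + e2) := by
  have hl0 : 0 < lam := by linarith
  have hw0 : 0 < w := by rw [hw]; positivity
  have hat : 0 ≤ a * th := pz
  have hat1 : a * th ≤ 1 / 3 := by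
    have := mul_le_l ht1 ha.le
    linarith
  have h1 : c * (QW / w) ≤ 4 * c * (E0 + a * th * E1) := by
    have : QW / w ≤ 4 * (E0 + a * th * E1) := by rw [div_le_iff₀ hw0]; linarith
    have := mul_le_l this hc
    linarith
  have hEE : lam * (N + a * th * HH) ≤ E0 + a * th * E1 := by
    have := mul_le_l hE1 hat
    linarith
  have h2 : -(2 - 4 * c) * (E0 + a * th * E1) ≤ -(1 / (2 * γ)) * (lam * (N + a * th * HH)) := by
    have h0 : 0 ≤ lam * (N + a * th * HH) := pz
    have hz : 0 ≤ 1 / (2 * γ) := pz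
    linarith [mul_le_mul hc1 hEE h0 (hz.trans hc1)]
  have h3 : 2 * S1 ≤ 8 * γ / 3 * (X ^ 2 / lam) * U + 3 / (8 * γ) * lam * N := by
    have := hS1 (X * (8 * γ) / (3 * lam)) (pz)
    refine this.trans (le_of_eq ?_)
    field_simp
  have h4 : 2 * (S4 + S6) ≤ 2 * γ * ((X + Y) ^ 2 / lam) * N + lam / (2 * γ) * HH := by
    have hXY : 0 < X + Y := by linarith
    have := hS46 (2 * γ * (X + Y) / lam) (pz)
    refine this.trans (le_of_eq ?_)
    field_simp
  have h5 : a * th' * N ≤ 1 / (8 * γ) * lam * N := by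
    have : a * th' ≤ 1 / (8 * γ) * lam := by
      calc a * th' ≤ a := by
            have := mul_le_l ht' ha.le
            linarith
        _ ≤ ν₀ / (16 * γ) := ha2
        _ = 1 / (8 * γ) * (ν₀ / 2) := by field_simp; norm_num
        _ ≤ _ := by gcongr
    exact mul_le_r this hN
  have h6 : 8 * γ / 3 * (X ^ 2 / lam) ≤ 4 / 3 * (1 - Lam) := by
    have : 2 * γ * X ^ 2 / lam = 2 * γ * (X ^ 2 / lam) := by ring
    rw [this] at hL; linarith
  have hp : 0 ≤ γ * (X ^ 2 / lam) := pz
  have hL1 : Lam ≤ 1 := by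
    have : 2 * γ * X ^ 2 / lam = 2 * (γ * (X ^ 2 / lam)) := by ring
    rw [this] at hL; linarith
  have e1' : 3 / (8 * γ) * lam * N = 3 / 4 * (lam * N / (2 * γ)) := by field_simp; ring
  have e2' : 1 / (8 * γ) * lam * N = 1 / 4 * (lam * N / (2 * γ)) := by field_simp; ring
  have e3' : 1 / (2 * γ) * (lam * (N + a * th * HH)) = lam * N / (2 * γ) + a * th * (lam / (2 * γ) * HH) := by field_simp
  have e5 : γ * (X + Y) ^ 2 / lam = γ * ((X + Y) ^ 2 / lam) := by ring
  rw [e5] at hS5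
  set Z := (X + Y) ^ 2 / lam
  have h7 : a * th * (2 * (S4 + S6) + 2 * S5 + 2 * S7 + 2 * S8) ≤ a * th * (lam / (2 * γ) * HH + 2 * K * N + (K - 2 * Lam) * U + N + e2) :=
    mul_le_l (by linarith) hat
  have h8 : (8 * γ / 3 * (X ^ 2 / lam)) * U ≤ 4 / 3 * (1 - Lam) * U := mul_le_r h6 hU
  have h9 : a * th * e2 ≤ e2 := by
    have := mul_le_r hat1 he2
    linarith
  have h10 : (2 / 3 - 2 * (a * th)) * (1 - Lam) * U ≥ 0 := by
    apply mul_nonneg (mul_nonneg _ _) hU <;> linarith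
  rw [e1'] at h3
  rw [e2'] at h5
  have h2' : -(2 - 4 * c) * (E0 + a * th * E1) ≤ -(lam * N / (2 * γ) + a * th * (lam / (2 * γ) * HH)) := by
    rw [← e3']; linarith
  generalize lam * N / (2 * γ) = M at *
  generalize lam / (2 * γ) * HH = HM at *
  generalize 8 * γ / 3 * (X ^ 2 / lam) = PX at *
  have hL' : 2 * a * th * (S4 + S5 + S6 + S7 + S8) = a * th * (2 * (S4 + S6) + 2 * S5 + 2 * S7 + 2 * S8) := by ring
  rw [hL']
  generalize a * th * (2 * (S4 + S6) + 2 * S5 + 2 * S7 + 2 * S8) = SS at *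
  generalize c * (QW / w) = cq at *
  rw [show 2 * a * th * E1 = 2 * (a * th * E1) by ring]
  generalize a * th = at0 at *
  generalize a * th' * N = aN at *
  have h11 : 0 ≤ K * N * at0 := pz
  have h12 : at0 * K * U ≤ K * U := by
    have := mul_le_r hat1 (mul_nonneg hK hU)
    have := mul_nonneg hK hU
    linarith
  have h13 : 0 ≤ K * U := pz
  have h14 : 0 ≤ at0 * U := pz
  have h15 : 0 ≤ at0 * N := pz
  have h16 : 0 ≤ K * ε := pz
  have hu2 : at0 * U ≤ 1 / 3 * U := mul_le_r hat1 hU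
  have key : 2 * S1 + 2 * S2 + 2 * S3 + SS + aN - (2 - 4 * c) * (E0 + at0 * E1) ≤ (4 / 3 * (1 - Lam) + 2 * Lam + 1 + at0 * (K - 2 * Lam)) * U + at0 * (2 * K + 1) * N + (e1 + e2) := by
    linarith
  have key2 : (4 / 3 * (1 - Lam) + 2 * Lam + 1 + at0 * (K - 2 * Lam)) * U ≤ (3 + K) * U := by linarith
  rw [hw]
  linarith

set_option maxHeartbeats 800000 in
theorem PBalg {ν₀ γ K a th th' c ε : ℝ} (hν : 0 < ν₀) (hγ : 0 < γ) (hK : 0 ≤ K)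
    (ha : 0 < a) (ha1 : a ≤ 1 / 3) (ha2 : a ≤ ν₀ / (16 * γ)) (ht : 0 ≤ th) (ht1 : th ≤ 1) (ht' : th' ≤ 1) (hc : 0 ≤ c) (hc1 : 1 / (2 * γ) ≤ 2 - 4 * c) (hε : 0 < ε)
    {Q : MM d} {A : MA d m} {C : MM m}
    {DQ : Fin d → MM d} {DA : Fin d → MA d m} {DC : MA d m} {V : Fin d → ℝ}
    (hs : ∀ i j, Q i j = Q j i) (hg : Good ν₀ γ K Q A C DQ DA DC V)
    {u G e : Fin m → ℝ} {J GJ e' : MJ d m} {H : Fin d → MJ d m} {T : Fin d → Fin d → MJ d m}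
    (hG : ∀ a, G a = (∑ i, ∑ j, Q i j * H i j a) + (∑ i, ∑ b, A i a b * J i b) + (∑ b, C a b * u b) + e a)
    (hGJ : ∀ l a, GJ l a = (∑ i, ∑ j, (DQ l i j * H i j a + Q i j * T l i j a)) + (∑ i, ∑ b, (DA l i a b * J i b + A i a b * H l i b)) + (∑ b, (DC l a b * u b + C a b * J l b)) + e' l a)
    {w wt : ℝ} {wi : Fin d → ℝ} {wij : MM d} (hw : w = (∑ a, u a ^ 2) + a * th * (∑ l, ∑ a, J l a ^ 2) + ε)
    (hwt : wt = 2 * (∑ a, u a * G a) + 2 * a * th * (∑ l, ∑ a, J l a * GJ l a) + a * th' * ∑ l, ∑ a, J l a ^ 2)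
    (hwi : ∀ i, wi i = 2 * (∑ a, u a * J i a) + 2 * a * th * ∑ l, ∑ a, J l a * H l i a)
    (hwij : ∀ i j, wij i j = 2 * (∑ a, (J i a * J j a + u a * H i j a)) + 2 * a * th * ∑ l, ∑ a, (H l i a * H l j a + J l a * T l i j a)) :
    wt - (∑ i, ∑ j, Q i j * wij i j) - (∑ i, V i * wi i) + c * ((∑ i, ∑ j, Q i j * wi i * wi j) / w) ≤ (3 + 2 * K) * w + ((∑ a, e a ^ 2) + ∑ l, ∑ a, e' l a ^ 2) := by
  classical
  obtain ⟨lam, X, Y, Lam, hlam, hX, hY, g1, g2, g3, g4, g5, g6⟩ := hg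
  have hl0 : 0 < lam := by linarith
  obtain ⟨W, hW⟩ := exists_root hl0 hs g1
  obtain ⟨E0, hE0⟩ : ∃ E0, E0 = ∑ a, qf Q (fun i => J i a) (fun i => J i a) := ⟨_, rfl⟩
  obtain ⟨E1, hE1⟩ : ∃ E1, E1 = ∑ l, ∑ a, qf Q (fun i => H l i a) (fun i => H l i a) := ⟨_, rfl⟩
  have hat : 0 ≤ a * th := pz
  have key := PBscal (lam := lam) (X := X) (Y := Y) (Lam := Lam) (U := ∑ a, u a ^ 2) (N := ∑ l, ∑ a, J l a ^ 2) (HH := ∑ i, ∑ j, ∑ a, H i j a ^ 2) (E0 := E0) (E1 := E1)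
    (S1 := ∑ a, u a * ∑ i, ∑ b, (A i a b - V i * dl a b) * J i b) (S2 := ∑ a, u a * ∑ b, C a b * u b) (S3 := ∑ a, u a * e a)
    (S4 := ∑ l, ∑ a, J l a * ∑ i, ∑ j, DQ l i j * H i j a)
    (S5 := (∑ l, ∑ a, J l a * ∑ i, ∑ b, DA l i a b * J i b) + ∑ l, ∑ a, J l a * ∑ b, DC l a b * u b)
    (S6 := ∑ l, ∑ a, J l a * ∑ i, ∑ b, (A i a b - V i * dl a b) * H l i b)
    (S7 := ∑ l, ∑ a, J l a * ∑ b, C a b * J l b) (S8 := ∑ l, ∑ a, J l a * e' l a) (e1 := ∑ a, e a ^ 2) (e2 := ∑ l, ∑ a, e' l a ^ 2) (QW := ∑ i, ∑ j, Q i j * wi i * wi j)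
    hν hγ hK hlam hX hY ha ha1 ha2 ht ht1 ht' hc hc1 hε (pz) (pz) (pz) (pz) (pz) hw
    (by
      rw [hE0, sum_comm, mul_sm]
      exact sum_le fun a => g1 (fun i => J i a))
    (by
      rw [hE1, mul_sm]
      refine sum_le fun l => ?_
      rw [sum_comm, mul_sm]
      exact sum_le fun a => g1 (fun i => H l i a))
    (g2 u J)
    (fun r hr => by
      have h1 := g3 J H r hr
      have h2 := Finset.sum_le_sum fun l (_ : l ∈ Finset.univ) => g2 (J l) (H l) r hr
      rw [← mul_sm, ← mul_sm, sum_ad, ← mul_sm, ← sum_div] at h2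
      rw [mul_add, add_mul]
      linarith)
    (g4 u)
    (by
      rw [mul_sm]
      exact sum_le fun l => g4 (J l))
    (by
      rw [mul_sm, ← sum_ad]
      exact sum_le fun a => by nlinarith [sq_nonneg (u a - e a)])
    (by
      rw [mul_sm, ← sum_ad]
      refine sum_le fun l => ?_
      rw [mul_sm, ← sum_ad]
      exact sum_le fun a => by nlinarith [sq_nonneg (J l a - e' l a)])
    g5 (g6 u J)
    (by
      have hsq : √(a * th) * √(a * th) = a * th := mul_self_sqrt hat
      have h1 := qcs hW (K := Fin m ⊕ (Fin d × Fin m)) (Sum.elim u fun k => √(a * th) * J k.1 k.2)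
        (Sum.elim (fun a i => J i a) fun k i => √(a * th) * H k.1 i k.2)
      simp only [Fintype.sum_sum_type, Sum.elim_inl, Sum.elim_inr, Fintype.sum_prod_type] at h1
      have e1 : ∀ i, (∑ a, u a * J i a) + ∑ l, ∑ a', √(a * th) * J l a' * (√(a * th) * H l i a') = wi i / 2 := by
        intro i
        have : ∑ l, ∑ a', √(a * th) * J l a' * (√(a * th) * H l i a') = a * th * ∑ l, ∑ a, J l a * H l i a := by
          simp only [mul_sm]
          exact sum_cg fun l => Finset.sum_congr rfl fun a' _ => by linear_combination (J l a' * H l i a') * hsq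
        rw [hwi, this]; ring
      have e2 : ∑ l, ∑ a', (√(a * th) * J l a') ^ 2 = a * th * ∑ l, ∑ a', J l a' ^ 2 := by
        simp only [mul_sm]
        exact sum_cg fun l => Finset.sum_congr rfl fun a' _ => by linear_combination (J l a' ^ 2) * hsq
      have e3 : ∑ l, ∑ a', qf Q (fun i => √(a * th) * H l i a') (fun i => √(a * th) * H l i a') = a * th * E1 := by
        rw [hE1]; unfold qf
        simp only [mul_sm]
        exact sum_cg fun l => Finset.sum_congr rfl fun a' _ => sum_cg fun i => sum_cg fun j => by
          linear_combination (Q i j * H l i a' * H l j a') * hsq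
      rw [e2, e3] at h1
      simp only [e1] at h1
      change _ ≤ _ * ((∑ a, qf Q (fun i => J i a) (fun i => J i a)) + a * th * E1) at h1
      rw [← hE0] at h1
      have e4 : qf Q (fun i => wi i / 2) (fun i => wi i / 2) = (∑ i, ∑ j, Q i j * wi i * wi j) / 4 := by
        unfold qf; simp only [sum_div]
        exact sum_cg fun l => Finset.sum_congr rfl fun a' _ => by ring
      rw [e4] at h1
      have hE0' : 0 ≤ E0 + a * th * E1 := by
        have h1 : 0 ≤ E0 := by
          rw [hE0]; refine Finset.sum_nonneg fun a' _ => le_trans ?_ (g1 _); positivity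
        have h2 : 0 ≤ E1 := by
          rw [hE1]; refine sum_nn fun l => Finset.sum_nonneg fun a' _ => le_trans ?_ (g1 _); positivity
        positivity
      have : (∑ i, ∑ j, Q i j * wi i * wi j) ≤ 4 * (w - ε) * (E0 + a * th * E1) := by rw [hw]; linarith
      have := mul_nonneg hε.le hE0'
      linarith)
  refine le_trans (le_of_eq ?_) key
  congr 1
  have p1 : ∑ i, ∑ j, Q i j * wij i j = 2 * E0 + 2 * (∑ a, u a * ∑ i, ∑ j, Q i j * H i j a) + 2 * a * th * (E1 + ∑ l, ∑ a, J l a * ∑ i, ∑ j, Q i j * T l i j a) := by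
    have q1 : ∀ i j, Q i j * wij i j = 2 * (Q i j * ∑ a, 1 * (J i a * J j a)) + 2 * (Q i j * ∑ a, u a * H i j a) +
        2 * a * th * (Q i j * ∑ k : Fin d × Fin m, 1 * (H k.1 i k.2 * H k.1 j k.2)) + 2 * a * th * (Q i j * ∑ k : Fin d × Fin m, J k.1 k.2 * T k.1 i j k.2) := by
      intro i j
      rw [hwij]; simp only [sum_ad, one_mul, Fintype.sum_prod_type]; ring
    rw [sum_cg fun i => sum_cg fun j => q1 i j, lin4, swap3 Q (fun _ => 1) (fun a i j => J i a * J j a), swap3 Q u (fun a i j => H i j a),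
      swap3 Q (fun _ => 1) (fun (k : Fin d × Fin m) i j => H k.1 i k.2 * H k.1 j k.2), swap3 Q (fun k : Fin d × Fin m => J k.1 k.2) (fun (k : Fin d × Fin m) i j => T k.1 i j k.2)]
    rw [hE0, hE1]; unfold qf
    simp only [Fintype.sum_prod_type, one_mul, mul_assoc]; ring
  have p2 : ∑ i, V i * wi i = 2 * (∑ a, u a * ∑ i, V i * J i a) + 2 * a * th * ∑ l, ∑ a, J l a * ∑ i, V i * H l i a := by
    have q1 : ∀ i, V i * wi i = 2 * (V i * ∑ a, u a * J i a) + 2 * a * th * (V i * ∑ k : Fin d × Fin m, J k.1 k.2 * H k.1 i k.2) := by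
      intro i
      rw [hwi]; simp only [Fintype.sum_prod_type]; ring
    rw [sum_cg fun i => q1 i, sum_ad, ← mul_sm, ← mul_sm, swap2 V u (fun a i => J i a), swap2 V (fun k : Fin d × Fin m => J k.1 k.2) (fun (k : Fin d × Fin m) i => H k.1 i k.2)]
    simp only [Fintype.sum_prod_type]
  have hdl : ∀ (P : MJ d m) a, ∑ i, ∑ b, (A i a b - V i * dl a b) * P i b = (∑ i, ∑ b, A i a b * P i b) - ∑ i, V i * P i a := by
    intro P a
    rw [← sum_sub_distrib]
    refine sum_cg fun i => ?_
    simp only [sub_mul, sum_sub_distrib, dl, mul_ite, mul_one, mul_zero, ite_mul, zero_mul, sum_ite_eq, Finset.mem_univ, if_true]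
  have p3 : ∑ a, u a * G a = (∑ a, u a * ∑ i, ∑ j, Q i j * H i j a) + (∑ a, u a * ∑ i, ∑ b, (A i a b - V i * dl a b) * J i b) + (∑ a, u a * ∑ i, V i * J i a)
      + (∑ a, u a * ∑ b, C a b * u b) + ∑ a, u a * e a := by
    simp only [← sum_ad]
    refine sum_cg fun a => ?_
    rw [hdl, hG]; ring
  have p4 : ∑ l, ∑ a, J l a * GJ l a = (∑ l, ∑ a, J l a * ∑ i, ∑ j, DQ l i j * H i j a) + (∑ l, ∑ a, J l a * ∑ i, ∑ j, Q i j * T l i j a)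
      + (∑ l, ∑ a, J l a * ∑ i, ∑ b, DA l i a b * J i b) + (∑ l, ∑ a, J l a * ∑ i, ∑ b, (A i a b - V i * dl a b) * H l i b) + (∑ l, ∑ a, J l a * ∑ i, V i * H l i a)
      + (∑ l, ∑ a, J l a * ∑ b, DC l a b * u b) + (∑ l, ∑ a, J l a * ∑ b, C a b * J l b) + ∑ l, ∑ a, J l a * e' l a := by
    simp only [← sum_ad]
    refine sum_cg fun l => sum_cg fun a => ?_
    rw [hdl, hGJ]; simp only [sum_ad]; ring
  rw [p1, p2, hwt, p3, p4]
  ring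
end PB

section cutoffs
variable {d : ℕ}

theorem nsq (x : EE d) : ‖x‖ ^ 2 = ∑ i, x i ^ 2 := by
  rw [EuclideanSpace.norm_sq_eq]; simp

theorem pd_nsq (x : EE d) (l : Fin d) : pd (fun y : EE d => ‖y‖ ^ 2) x l = 2 * x l := by
  have h : HasFDerivAt (fun y : EE d => ‖y‖ ^ 2) (2 • (innerSL ℝ x)) x := (hasStrictFDerivAt_norm_sq x).hasFDerivAt
  rw [pd_eq_of_hasFDerivAt h]
  simp [EuclideanSpace.inner_single_right]

theorem smooth_nsq : ContDiff ℝ ∞ (fun y : EE d => ‖y‖ ^ 2) := contDiff_norm_sq ℝ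

noncomputable def cut (ρ : ℝ) (x : EE d) : ℝ := 1 - Real.smoothTransition (‖x‖ ^ 2 - ρ)

theorem cut_smooth (ρ : ℝ) : ContDiff ℝ ∞ (cut (d := d) ρ) := by
  unfold cut
  exact contDiff_const.sub (Real.smoothTransition.contDiff.comp (smooth_nsq.sub contDiff_const))
theorem cut_nonneg (ρ : ℝ) (x : EE d) : 0 ≤ cut ρ x := sub_nonneg.2 (Real.smoothTransition.le_one _)
theorem cut_le (ρ : ℝ) (x : EE d) : cut ρ x ≤ 1 := by
  unfold cut; linarith [Real.smoothTransition.nonneg (‖x‖ ^ 2 - ρ)]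
theorem cut_one {ρ : ℝ} {x : EE d} (h : ‖x‖ ^ 2 ≤ ρ) : cut ρ x = 1 := by
  unfold cut; rw [Real.smoothTransition.zero_of_nonpos (by linarith)]; simp
theorem cut_zero {ρ : ℝ} {x : EE d} (h : ρ + 1 ≤ ‖x‖ ^ 2) : cut ρ x = 0 := by
  unfold cut; rw [Real.smoothTransition.one_of_one_le (by linarith)]; simp
theorem pd_cut_one {ρ : ℝ} {x : EE d} (h : ‖x‖ ^ 2 ≤ ρ) (l : Fin d) : pd (cut ρ) x l = 0 := by
  have : IsLocalMax (cut ρ) x := Filter.Eventually.of_forall fun y => by rw [cut_one h]; exact cut_le _ _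
  simp [pd, this.fderiv_eq_zero]
theorem pd_cut_zero {ρ : ℝ} {x : EE d} (h : ρ + 1 ≤ ‖x‖ ^ 2) (l : Fin d) : pd (cut ρ) x l = 0 := by
  have : IsLocalMin (cut ρ) x := Filter.Eventually.of_forall fun y => by rw [cut_zero h]; exact cut_nonneg _ _
  simp [pd, this.fderiv_eq_zero]
theorem cut_cs (ρ : ℝ) : HasCompactSupport (cut (d := d) ρ) := by
  refine HasCompactSupport.intro (isCompact_closedBall (0 : EE d) (1 + |ρ|)) fun x hx => cut_zero ?_
  simp at hx
  nlinarith [le_abs_self ρ, abs_nonneg ρ]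
theorem pd_cut (ρ : ℝ) (x : EE d) (l : Fin d) : pd (cut ρ) x l = -(2 * deriv Real.smoothTransition (‖x‖ ^ 2 - ρ) * x l) := by
  have hd : HasDerivAt (fun y => 1 - Real.smoothTransition (y - ρ)) (-(deriv Real.smoothTransition (‖x‖ ^ 2 - ρ))) (‖x‖ ^ 2) := by
    have h1 : HasDerivAt Real.smoothTransition (deriv Real.smoothTransition (‖x‖ ^ 2 - ρ)) (‖x‖ ^ 2 - ρ) :=
      ((Real.smoothTransition.contDiff (n := 1)).differentiable (by simp)).differentiableAt.hasDerivAt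
    have h2 := h1.comp (‖x‖ ^ 2) ((hasDerivAt_id (‖x‖ ^ 2)).sub_const ρ)
    refine (h2.const_sub 1).congr_deriv (by simp)
  have := pd_comp_real (g := fun y : EE d => ‖y‖ ^ 2) hd (smooth_diff smooth_nsq x) l
  unfold cut
  rw [this, pd_nsq]; ring

noncomputable def nin (x : EE d) : ℝ := (√(1 + ‖x‖ ^ 2))⁻¹

theorem nin_pos (x : EE d) : 0 < nin x := by unfold nin; positivity
theorem nin_sq (x : EE d) : nin x ^ 2 * (1 + ‖x‖ ^ 2) = 1 := by
  unfold nin; rw [inv_pow, sq_sqrt (pz)]; field_simp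
theorem nin_smooth : ContDiff ℝ ∞ (nin (d := d)) := by
  unfold nin
  refine ContDiff.inv (ContDiff.sqrt (contDiff_const.add smooth_nsq) fun x => pz) fun x => pz
theorem nin_le (x : EE d) : nin x ≤ 1 := by
  have h1 := nin_sq x; have h2 := nin_pos x
  nlinarith [sq_nonneg (nin x * ‖x‖)]
theorem pd_nin (x : EE d) (l : Fin d) : pd nin x l = -(x l * nin x ^ 3) := by
  have h0 : (0:ℝ) < 1 + ‖x‖ ^ 2 := pz
  have hd : HasDerivAt (fun y => (√(1 + y))⁻¹) (-(1 / 2 * nin x ^ 3)) (‖x‖ ^ 2) := by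
    have h1 : HasDerivAt (fun y : ℝ => √(1 + y)) (1 / (2 * √(1 + ‖x‖ ^ 2))) (‖x‖ ^ 2) :=
      ((hasDerivAt_id (‖x‖ ^ 2)).const_add 1).sqrt (by simpa using h0.ne')
    refine (h1.inv (pz)).congr_deriv ?_
    unfold nin
    field_simp
  have := pd_comp_real (g := fun y : EE d => ‖y‖ ^ 2) hd (smooth_diff smooth_nsq x) l
  unfold nin at *
  rw [this, pd_nsq]; ring

theorem nin_coord (x : EE d) (i : Fin d) : |x i * nin x| ≤ 1 := by
  have h : x i ^ 2 ≤ ‖x‖ ^ 2 := by rw [nsq]; exact single_le_sum (f := fun i => x i ^ 2) (fun _ _ => sq_nonneg _) (Finset.mem_univ i)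
  have h1 := nin_sq x
  rw [abs_le_one_iff_mul_self_le_one]
  nlinarith [mul_le_l h (sq_nonneg (nin x)), sq_nonneg (nin x)]
theorem coord_smooth (i : Fin d) : ContDiff ℝ ∞ (fun y : EE d => y i) := (EuclideanSpace.proj i : EE d →L[ℝ] ℝ).contDiff
theorem pd_nc (x : EE d) (i l : Fin d) : pd (fun y : EE d => y i * nin y) x l = dl i l * nin x + (-1) * ((x i * nin x) * (x l * nin x) * nin x) := by
  rw [pd_mul (smooth_diff (coord_smooth i) x) (smooth_diff nin_smooth x), pd_coord, pd_nin]; unfold dl; ring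

theorem nin_SB {Ω : Type*} : SB (fun (_ : Ω) => nin (d := d)) ∧ ∀ i, SB (fun (_ : Ω) (x : EE d) => x i * nin x) := by
  have s1 : Sm (fun (_ : Ω) => nin (d := d)) := fun _ => nin_smooth
  have s2 : ∀ i, Sm (fun (_ : Ω) (x : EE d) => x i * nin x) := fun i _ => (coord_smooth i).mul nin_smooth
  have key : ∀ n, BB n (fun (_ : Ω) => nin (d := d)) ∧ ∀ i, BB n (fun (_ : Ω) (x : EE d) => x i * nin x) := by
    intro n
    have b1 : ∃ C, ∀ (o : Ω) (x : EE d), |nin x| ≤ C := ⟨1, fun _ x => by rw [abs_of_pos (nin_pos x)]; exact nin_le x⟩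
    have b2 : ∀ i, ∃ C, ∀ (o : Ω) (x : EE d), |x i * nin x| ≤ C := fun i => ⟨1, fun _ x => nin_coord x i⟩
    induction n with
    | zero => exact ⟨b1, b2⟩
    | succ n ih =>
      refine ⟨⟨b1, fun l => ?_⟩, fun i => ⟨b2 i, fun l => ?_⟩⟩
      · have : (fun (_ : Ω) (x : EE d) => pd nin x l) = fun (o : Ω) x => (fun _ _ => (-1:ℝ)) o x * ((fun _ x => (x l * nin x) * (nin x * nin x)) o x) := by
          funext _ x; rw [pd_nin]; ring
        rw [this]
        exact BB.mul (fun _ => contDiff_const) (fun o => (s2 l o).mul ((s1 o).mul (s1 o))) (BB.const (C := 1) fun _ => by norm_num)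
          (BB.mul (s2 l) (fun o => (s1 o).mul (s1 o)) (ih.2 l) (BB.mul s1 s1 ih.1 ih.1))
      · simp only [pd_nc]
        refine BB.add (fun o => contDiff_const.mul (s1 o)) (fun o => contDiff_const.mul (((s2 i o).mul (s2 l o)).mul (s1 o)))
          (BB.mul (fun _ => contDiff_const) s1 (BB.const (C := |dl i l|) fun _ => le_rfl) ih.1)
          (BB.mul (fun _ => contDiff_const) (fun o => ((s2 i o).mul (s2 l o)).mul (s1 o)) (BB.const (C := 1) fun _ => by norm_num)
            (BB.mul (fun o => (s2 i o).mul (s2 l o)) s1 (BB.mul (s2 i) (s2 l) (ih.2 i) (ih.2 l)) ih.1))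
  exact ⟨⟨s1, fun n => (key n).1⟩, fun i => ⟨s2 i, fun n => (key n).2 i⟩⟩

noncomputable def Psi (ρ : ℝ) (i : Fin d) (x : EE d) : ℝ := (1 - cut ρ x) * (x i * nin x)

theorem cut_SB {Ω : Type*} (ρ : ℝ) : SB (fun (_ : Ω) => cut (d := d) ρ) := SB.of_compact (cut_smooth ρ) (cut_cs ρ)
theorem Psi_SB {Ω : Type*} (ρ : ℝ) (i : Fin d) : SB (fun (_ : Ω) => Psi ρ i) :=
  ((SB.cst 1).sub (cut_SB ρ)).mul (nin_SB.2 i)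
theorem Psi_SU {κ : Type*} [PseudoMetricSpace κ] (ρ : ℝ) (i : Fin d) : SU (fun (_ : κ) => Psi ρ i) := by
  refine ⟨Psi_SB ρ i, ?_⟩
  obtain ⟨C, _, h⟩ := (Psi_SB (Ω := Unit) ρ i).bdd
  exact UC.of_const (C := C) fun x => h () x
theorem cut_SU {κ : Type*} [PseudoMetricSpace κ] (ρ : ℝ) : SU (fun (_ : κ) => cut (d := d) ρ) := by
  refine ⟨cut_SB ρ, ?_⟩
  obtain ⟨C, _, h⟩ := (cut_SB (d := d) (Ω := Unit) ρ).bdd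
  exact UC.of_const (C := C) fun x => h () x
theorem Psi_zero {ρ : ℝ} {x : EE d} (h : ‖x‖ ^ 2 ≤ ρ) (i : Fin d) : Psi ρ i x = 0 := by unfold Psi; rw [cut_one h]; ring
theorem pd_Psi (ρ : ℝ) (i l : Fin d) (x : EE d) : pd (Psi ρ i) x l = (2 * deriv Real.smoothTransition (‖x‖ ^ 2 - ρ) * nin x) * (x l * x i)
    + (1 - cut ρ x) * (dl i l * nin x + (-1) * ((x i * nin x) * (x l * nin x) * nin x)) := by
  have h1 : DifferentiableAt ℝ (fun y : EE d => 1 - cut ρ y) x := smooth_diff (contDiff_const.sub (cut_smooth ρ)) x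
  unfold Psi
  rw [pd_mul h1 (smooth_diff ((coord_smooth i).mul nin_smooth) x), pd_nc, pd_sub (by fun_prop) (smooth_diff (cut_smooth ρ) x), pd_cut]
  simp; ring

/-- lower bound for the derivative of the confining field -/
theorem Psi_psd (ρ : ℝ) (x : EE d) (w : Fin d → ℝ) : (1 - cut ρ x) * nin x ^ 3 * ∑ i, w i ^ 2 ≤ ∑ l, ∑ i, pd (Psi ρ i) x l * w l * w i := by
  have e : ∑ l, ∑ i, pd (Psi ρ i) x l * w l * w i = (2 * deriv Real.smoothTransition (‖x‖ ^ 2 - ρ) * nin x) * ((∑ l, x l * w l) * ∑ i, x i * w i)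
      + (1 - cut ρ x) * (nin x * (∑ i, w i ^ 2) - nin x ^ 3 * ((∑ l, x l * w l) * ∑ i, x i * w i)) := by
    have h1 : ∑ i, w i ^ 2 = ∑ l, ∑ i, dl i l * w l * w i := by
      refine sum_cg fun l => ?_
      simp [dl, sq]
    rw [h1, sum_mul_sum]
    simp only [mul_sm, ← sum_sub_distrib, ← sum_ad]
    refine sum_cg fun l => sum_cg fun i => ?_
    rw [pd_Psi]; ring
  have hst : 0 ≤ deriv Real.smoothTransition (‖x‖ ^ 2 - ρ) := Real.smoothTransition.monotone.deriv_nonneg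
  have hn := nin_pos x
  have hcs : (∑ l, x l * w l) * (∑ i, x i * w i) ≤ ‖x‖ ^ 2 * ∑ i, w i ^ 2 := by
    rw [nsq, ← sq]; exact Finset.sum_mul_sq_le_sq_mul_sq _ _ _
  have hsq := mul_self_nonneg (∑ l, x l * w l)
  have h0 : 0 ≤ 1 - cut ρ x := by linarith [cut_le ρ x]
  rw [e, mul_assoc]
  have h2 : nin x ^ 3 * ∑ i, w i ^ 2 ≤ nin x * (∑ i, w i ^ 2) - nin x ^ 3 * ((∑ l, x l * w l) * ∑ i, x i * w i) := by
    have h3 := mul_le_l hcs (pow_pos hn 3).le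
    have h4 : nin x ^ 3 * (1 + ‖x‖ ^ 2) = nin x := by linear_combination nin x * nin_sq x
    have h5 : nin x ^ 3 * (1 + ‖x‖ ^ 2) * (∑ i, w i ^ 2) = nin x * ∑ i, w i ^ 2 := by rw [h4]
    linarith
  have h6 := mul_le_l h2 h0
  have h7 : 0 ≤ (2 * deriv Real.smoothTransition (‖x‖ ^ 2 - ρ) * nin x) * ((∑ l, x l * w l) * ∑ i, x i * w i) := pz
  linarith
end cutoffs

section goodalg
variable {d m : ℕ}

theorem absSum_sq {ι : Type*} [Fintype ι] (f : ι → ℝ) : (∑ i, |f i|) ^ 2 ≤ Fintype.card ι * ∑ i, f i ^ 2 := by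
  have := sq_sum_le_card_mul_sum_sq (s := Finset.univ) (f := fun i => |f i|)
  simpa [sq_abs] using this

theorem young2 {c : ℝ} {M : MA d m} (hd : 1 ≤ d) (hc : ∀ i a b, |M i a b| ≤ c) (u : Fin m → ℝ) (J : MJ d m) (r : ℝ) (hr : 0 < r) (hc0 : 0 ≤ c) :
    2 * ∑ a, u a * ∑ i, ∑ b, M i a b * J i b ≤ (√d * m * c) * (r * ∑ a, u a ^ 2 + (∑ i, ∑ a, J i a ^ 2) / r) := by
  have hd0 : (0:ℝ) < d := by exact_mod_cast hd
  set D := √d with hD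
  have hD0 : 0 < D := Real.sqrt_pos.2 hd0
  have hDD : D ^ 2 = d := sq_sqrt hd0.le
  have h1 : ∑ a, u a * ∑ i, ∑ b, M i a b * J i b ≤ c * ((∑ a, |u a|) * ∑ k : Fin d × Fin m, |J k.1 k.2|) := by
    rw [sum_mul, mul_sm]
    refine sum_le fun a => ?_
    have : |∑ i, ∑ b, M i a b * J i b| ≤ c * ∑ k : Fin d × Fin m, |J k.1 k.2| := by
      rw [Fintype.sum_prod_type, mul_sm]
      refine (abs_sum_le_sum_abs _ _).trans (sum_le fun i => ?_)
      rw [mul_sm]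
      refine (abs_sum_le_sum_abs _ _).trans (sum_le fun b => ?_)
      rw [abs_mul]; exact mul_le_r (hc i a b) (abs_nonneg _)
    calc u a * ∑ i, ∑ b, M i a b * J i b ≤ |u a| * |∑ i, ∑ b, M i a b * J i b| := (le_abs_self _).trans (abs_mul _ _).le
      _ ≤ |u a| * (c * ∑ k : Fin d × Fin m, |J k.1 k.2|) := mul_le_l this (abs_nonneg _)
      _ = _ := by ring
  have h2 := absSum_sq u
  have h3 := absSum_sq (fun k : Fin d × Fin m => J k.1 k.2)
  simp only [Fintype.card_fin, Fintype.card_prod, Nat.cast_mul] at h2 h3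
  have h4 : ∑ k : Fin d × Fin m, J k.1 k.2 ^ 2 = ∑ i, ∑ a, J i a ^ 2 := by rw [Fintype.sum_prod_type]
  rw [h4] at h3
  generalize (∑ a, |u a|) = U1 at *
  generalize ∑ k : Fin d × Fin m, |J k.1 k.2| = J1 at *
  have h5 : 2 * (U1 * J1) ≤ D * r * U1 ^ 2 + J1 ^ 2 / (D * r) := by
    have : 0 ≤ (D * r * U1 - J1) ^ 2 / (D * r) := pz
    have e : (D * r * U1 - J1) ^ 2 / (D * r) = D * r * U1 ^ 2 + J1 ^ 2 / (D * r) - 2 * (U1 * J1) := by field_simp; ring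
    linarith
  have h6 : D * r * U1 ^ 2 + J1 ^ 2 / (D * r) ≤ D * r * (m * ∑ a, u a ^ 2) + (d * m * ∑ i, ∑ a, J i a ^ 2) / (D * r) := by gcongr
  have h7 : D * r * (m * ∑ a, u a ^ 2) + (d * m * ∑ i, ∑ a, J i a ^ 2) / (D * r) = D * m * (r * ∑ a, u a ^ 2 + (∑ i, ∑ a, J i a ^ 2) / r) := by
    rw [← hDD]; field_simp
  calc 2 * ∑ a, u a * ∑ i, ∑ b, M i a b * J i b ≤ c * (2 * (U1 * J1)) := by linarith
    _ ≤ c * (D * m * (r * ∑ a, u a ^ 2 + (∑ i, ∑ a, J i a ^ 2) / r)) := mul_le_l (by linarith) hc0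
    _ = _ := by ring

theorem young3 {κ : ℝ} {D : Fin d → MM d} (hd : 1 ≤ d) (hκ : 0 ≤ κ) (hD : ∀ i j, ∑ l, D l i j ^ 2 ≤ κ ^ 2) (J : MJ d m) (H : Fin d → MJ d m) (r : ℝ) (hr : 0 < r) :
    2 * ∑ l, ∑ a, J l a * ∑ i, ∑ j, D l i j * H i j a ≤ (d * κ) * (r * ∑ i, ∑ a, J i a ^ 2 + (∑ i, ∑ j, ∑ a, H i j a ^ 2) / r) := by
  have hd0 : (0:ℝ) < d := by exact_mod_cast hd
  have e1 : ∑ l, ∑ a, J l a * ∑ i, ∑ j, D l i j * H i j a = ∑ i, ∑ j, ∑ a, (∑ l, J l a * D l i j) * H i j a := by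
    simp only [mul_sm, sum_mul]
    rw [sum_comm]
    calc ∑ a, ∑ l, ∑ i, ∑ j, J l a * (D l i j * H i j a) = ∑ a, ∑ i, ∑ j, ∑ l, J l a * D l i j * H i j a := by
          refine sum_cg fun a => ?_
          rw [sum_comm]
          refine sum_cg fun i => ?_
          rw [sum_comm]
          exact sum_cg fun j => sum_cg fun l => by ring
      _ = _ := by
          rw [sum_comm]
          refine sum_cg fun i => ?_
          rw [sum_comm]
  have key : ∀ i j a, 2 * ((∑ l, J l a * D l i j) * H i j a) ≤ κ * (r / d * ∑ l, J l a ^ 2) + κ * (d / r * H i j a ^ 2) := by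
    intro i j a
    have h1 : (∑ l, J l a * D l i j) ^ 2 ≤ (∑ l, J l a ^ 2) * κ ^ 2 :=
      (Finset.sum_mul_sq_le_sq_mul_sq _ _ _).trans (mul_le_l (hD i j) (sum_nn fun _ => sq_nonneg _))
    rcases hκ.eq_or_lt with h0 | h0
    · rw [← h0] at h1
      have : (∑ l, J l a * D l i j) = 0 := by nlinarith
      rw [this, ← h0]; simp
    · set S := ∑ l, J l a * D l i j
      set N := ∑ l, J l a ^ 2
      set h := H i j a
      have h2 : 2 * (S * h) ≤ r / (d * κ) * S ^ 2 + (d * κ) / r * h ^ 2 := by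
        have : 0 ≤ (r * S - d * κ * h) ^ 2 / (r * (d * κ)) := pz
        have e : (r * S - d * κ * h) ^ 2 / (r * (d * κ)) = r / (d * κ) * S ^ 2 + (d * κ) / r * h ^ 2 - 2 * (S * h) := by field_simp; ring
        linarith
      have h3 : r / (d * κ) * S ^ 2 ≤ r / (d * κ) * (N * κ ^ 2) := by gcongr
      have h4 : r / (d * κ) * (N * κ ^ 2) = κ * (r / d * N) := by field_simp
      have h5 : (d * κ) / r * h ^ 2 = κ * (d / r * h ^ 2) := by ring
      linarith
  rw [e1, mul_sm]
  have e2 : (d * κ) * (r * ∑ i, ∑ a, J i a ^ 2 + (∑ i, ∑ j, ∑ a, H i j a ^ 2) / r) = ∑ i : Fin d, ∑ j : Fin d, ∑ a, (κ * (r / d * ∑ l, J l a ^ 2) + κ * (d / r * H i j a ^ 2)) := by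
    simp only [sum_ad, ← mul_sm, sum_const, card_univ, Fintype.card_fin, nsmul_eq_mul]
    rw [sum_comm (f := fun i a => J i a ^ 2)]
    field_simp
  rw [e2]
  refine sum_le fun i => ?_
  rw [mul_sm]
  refine sum_le fun j => ?_
  rw [mul_sm]
  exact sum_le fun a => key i j a

theorem quadpert {n : ℕ} {e : ℝ} {E : MM n} (h : ∀ i j, |E i j| ≤ e) (w : Fin n → ℝ) : |∑ i, ∑ j, E i j * w i * w j| ≤ n * e * ∑ i, w i ^ 2 := by
  rcases Nat.eq_zero_or_pos n with h0 | h0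
  · subst h0; simp
  have he : 0 ≤ e := (abs_nonneg _).trans (h ⟨0, h0⟩ ⟨0, h0⟩)
  have h1 : |∑ i, ∑ j, E i j * w i * w j| ≤ e * ((∑ i, |w i|) * ∑ i, |w i|) := by
    rw [sum_mul_sum, mul_sm]
    refine (abs_sum_le_sum_abs _ _).trans (sum_le fun i => ?_)
    rw [mul_sm]
    refine (abs_sum_le_sum_abs _ _).trans (sum_le fun j => ?_)
    rw [abs_mul, abs_mul, mul_assoc]
    exact mul_le_r (h i j) (pz)
  have h2 := absSum_sq w
  rw [Fintype.card_fin] at h2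
  rw [← sq] at h1
  nlinarith [mul_le_l h2 he]

theorem quot {ν₀ M tol : ℝ} (hν : 0 < ν₀) (ht : 0 < tol) : ∃ η > 0, η ≤ ν₀ / 2 ∧ η ≤ 1 ∧ ∀ x x' l l', 0 ≤ x → 0 ≤ x' → x' ≤ M → ν₀ ≤ l' → x ≤ x' + η → l' - η ≤ l → x ^ 2 / l ≤ x' ^ 2 / l' + tol := by
  set P := 2 * (2 * |M| + 1) / ν₀ + 2 * M ^ 2 / ν₀ ^ 2 + 1 with hP
  have hP0 : 0 < P := pz
  refine ⟨min (min (ν₀ / 2) 1) (tol / P), pz, (min_le_left _ _).trans (min_le_left _ _), (min_le_left _ _).trans (min_le_right _ _), ?_⟩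
  intro x x' l l' hx hx' hM hl' hxx hl
  have h3 : min (min (ν₀ / 2) 1) (tol / P) ≤ tol / P := min_le_right _ _
  have h1 : min (min (ν₀ / 2) 1) (tol / P) ≤ ν₀ / 2 := (min_le_left _ _).trans (min_le_left _ _)
  have h2 : min (min (ν₀ / 2) 1) (tol / P) ≤ 1 := (min_le_left _ _).trans (min_le_right _ _)
  have h0 : 0 < min (min (ν₀ / 2) 1) (tol / P) := pz
  generalize min (min (ν₀ / 2) 1) (tol / P) = η at *
  have hlη : ν₀ / 2 ≤ l' - η := by linarith
  have hl0 : 0 < l' - η := by linarith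
  have hl'0 : 0 < l' := by linarith
  have hMM : x' ≤ |M| := hM.trans (le_abs_self _)
  have s1 : x ^ 2 / l ≤ (x' + η) ^ 2 / (l' - η) := by gcongr
  have s2 : (x' + η) ^ 2 / (l' - η) = x' ^ 2 / l' + η * ((2 * x' + η) / (l' - η) + x' ^ 2 / (l' * (l' - η))) := by field_simp; ring
  have s3 : (2 * x' + η) / (l' - η) ≤ (2 * |M| + 1) / (ν₀ / 2) := by gcongr
  have s4 : x' ^ 2 / (l' * (l' - η)) ≤ |M| ^ 2 / (ν₀ * (ν₀ / 2)) := by gcongr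
  have s5 : (2 * |M| + 1) / (ν₀ / 2) + |M| ^ 2 / (ν₀ * (ν₀ / 2)) ≤ P := by
    rw [sq_abs, hP]
    have : (2 * |M| + 1) / (ν₀ / 2) + M ^ 2 / (ν₀ * (ν₀ / 2)) = 2 * (2 * |M| + 1) / ν₀ + 2 * M ^ 2 / ν₀ ^ 2 := by field_simp
    linarith
  have s6 : η * ((2 * x' + η) / (l' - η) + x' ^ 2 / (l' * (l' - η))) ≤ tol / P * P := by
    refine mul_le_mul h3 (by linarith) (pz) (pz)
  have s7 : tol / P * P = tol := by field_simp
  linarith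

theorem good_mk {ν₀ γ K om η χ lam X0 Lc L Y : ℝ} {M tol : ℝ} (hd : 1 ≤ d) (hm : 1 ≤ m) (hν : 0 < ν₀) (hγ : 0 < γ) (hom : 0 < om) (hχ0 : 0 ≤ χ) (hχ1 : χ ≤ 1)
    (hlam : ν₀ ≤ lam) (hX0 : 0 ≤ X0) (hη : η ≤ ν₀ / 2) (hM : √d * m * X0 ≤ M)
    (hquot : ∀ x x' l l', 0 ≤ x → 0 ≤ x' → x' ≤ M → ν₀ ≤ l' → x ≤ x' + η → l' - η ≤ l → x ^ 2 / l ≤ x' ^ 2 / l' + tol)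
    (htol : 2 * γ * tol + m * om ≤ 1) (hom1 : d * om ≤ η) (hom2 : √d * m * om ≤ η) (hY : 0 ≤ Y)
    {q Qd : MM d} {Ad : MA d m} {C0 Cd : MM m} {b bd Ps : Fin d → ℝ}
    (hq : ∀ i j, |Qd i j - q i j| ≤ om) (hqp : ∀ w : Fin d → ℝ, lam * ∑ i, w i ^ 2 ≤ ∑ i, ∑ j, q i j * w i * w j)
    (hA : ∀ i a b', |Ad i a b' - dl a b' * (b i + bd i)| ≤ X0 + om)
    (hC : ∀ i j, |Cd i j - C0 i j| ≤ om) (hCp : ∀ w : Fin m → ℝ, ∑ i, ∑ j, C0 i j * w i * w j ≤ Lc * ∑ i, w i ^ 2)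
    (hdiss : Lc ≤ -(2 * γ * (√d * m * X0) ^ 2 / lam))
    {DQ : Fin d → MM d} {DA : Fin d → MA d m} {DC : MA d m}
    (g3 : ∀ (J : MJ d m) (H : Fin d → MJ d m), ∀ r > 0, 2 * ∑ l, ∑ a, J l a * ∑ i, ∑ j, DQ l i j * H i j a ≤ Y * (r * ∑ i, ∑ a, J i a ^ 2 + (∑ i, ∑ j, ∑ a, H i j a ^ 2) / r))
    (g6 : ∀ (u : Fin m → ℝ) (J : MJ d m), (∑ l, ∑ a, J l a * ∑ i, ∑ b, DA l i a b * J i b) + ∑ l, ∑ a, J l a * ∑ b, DC l a b * u b ≤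
      (K - (χ * Lc + m * om) - γ * (√d * m * (χ * X0 + om) + Y) ^ 2 / (χ * lam + (1 - χ) * ν₀ - d * om)) * (∑ i, ∑ a, J i a ^ 2) + 1 / 2 * (K - 2 * (χ * Lc + m * om)) * ∑ a, u a ^ 2) :
    Good ν₀ γ K (fun i j => ν₀ * dl i j + χ * (Qd i j - ν₀ * dl i j)) (fun i a b => χ * Ad i a b - L * Ps i * dl a b) (fun a b => χ * Cd a b) DQ DA DC
      (fun i => χ * b i + (χ * bd i - L * Ps i)) := by
  have hm0 : (0:ℝ) < m := by exact_mod_cast hm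
  have hd0 : (0:ℝ) < d := by exact_mod_cast hd
  have hsd : 0 < √d := Real.sqrt_pos.2 hd0
  have hell : ν₀ ≤ χ * lam + (1 - χ) * ν₀ := by
    have := mul_le_l hlam hχ0; linarith
  refine ⟨χ * lam + (1 - χ) * ν₀ - d * om, √d * m * (χ * X0 + om), Y, χ * Lc + m * om, by linarith, pz, hY, ?_, ?_, g3, ?_, ?_, g6⟩
  · intro w
    have h1 := quadpert hq w
    have h2 := hqp w
    have e : ∑ i, ∑ j, (ν₀ * dl i j + χ * (Qd i j - ν₀ * dl i j)) * w i * w j = (1 - χ) * ν₀ * (∑ i, w i ^ 2) + χ * ((∑ i, ∑ j, q i j * w i * w j) + ∑ i, ∑ j, (Qd i j - q i j) * w i * w j) := by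
      have e0 : ∑ i, w i ^ 2 = ∑ i, ∑ j, dl i j * w i * w j := by
        refine sum_cg fun l => ?_
        simp [dl, sq]
      rw [e0]
      simp only [mul_sm, ← sum_ad]
      exact sum_cg fun l => sum_cg fun i => by ring
    rw [e]
    have h3 := (abs_le.1 h1).1
    have h4 := mul_le_l (add_le_add h2 h3) hχ0
    have hS : 0 ≤ d * om * ∑ i, w i ^ 2 := pz
    have h5 := mul_le_r hχ1 hS
    nlinarith
  · intro u J r hr
    refine young2 hd (fun i a b' => ?_) u J r hr (pz)
    have e : χ * Ad i a b' - L * Ps i * dl a b' - (χ * b i + (χ * bd i - L * Ps i)) * dl a b' = χ * (Ad i a b' - dl a b' * (b i + bd i)) := by ring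
    rw [e, abs_mul, abs_of_nonneg hχ0]
    have h1 := mul_le_l (hA i a b') hχ0
    have h2 := mul_le_r hχ1 hom.le
    linarith
  · intro u
    have h1 := quadpert hC u
    have h2 := hCp u
    have e : ∑ a, u a * ∑ b, χ * Cd a b * u b = χ * ((∑ i, ∑ j, C0 i j * u i * u j) + ∑ i, ∑ j, (Cd i j - C0 i j) * u i * u j) := by
      simp only [mul_sm, ← sum_ad]
      exact sum_cg fun l => sum_cg fun i => by ring
    rw [e]
    have h3 := (abs_le.1 h1).2
    have h4 := mul_le_l (add_le_add h2 h3) hχ0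
    have hS : 0 ≤ m * om * ∑ i, u i ^ 2 := pz
    have h5 := mul_le_r hχ1 hS
    nlinarith
  · have hx0 : 0 ≤ √d * m * X0 := pz
    have h1 := hquot (√d * m * (χ * X0 + om)) (χ * (√d * m * X0)) (χ * lam + (1 - χ) * ν₀ - d * om) (χ * lam + (1 - χ) * ν₀) (pz) (pz)
      ((mul_le_of_le_one_left hx0 hχ1).trans hM) hell (by linarith) (by linarith)
    have h2 : (χ * (√d * m * X0)) ^ 2 / (χ * lam + (1 - χ) * ν₀) ≤ χ * ((√d * m * X0) ^ 2 / lam) := by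
      rw [div_le_iff₀ (by linarith)]
      generalize √d * m * X0 = x at *
      have e : χ * (x ^ 2 / lam) * (χ * lam + (1 - χ) * ν₀) = (χ * x) ^ 2 + χ * (x ^ 2 / lam) * ((1 - χ) * ν₀) := by
        have : lam ≠ 0 := by linarith
        field_simp
      rw [e]
      have : 0 ≤ χ * (x ^ 2 / lam) * ((1 - χ) * ν₀) := by
        have : 0 < lam := by linarith
        have : 0 ≤ 1 - χ := by linarith
        positivity
      linarith
    have h3 := mul_le_l hdiss hχ0
    have h4 := mul_le_l (h1.trans (add_le_add_left h2 tol)) (show 0 ≤ 2 * γ by linarith)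
    have e1 : 2 * γ * (√d * m * (χ * X0 + om)) ^ 2 / (χ * lam + (1 - χ) * ν₀ - d * om) = 2 * γ * ((√d * m * (χ * X0 + om)) ^ 2 / (χ * lam + (1 - χ) * ν₀ - d * om)) := by ring
    have e2 : χ * -(2 * γ * (√d * m * X0) ^ 2 / lam) = -(2 * γ * (χ * ((√d * m * X0) ^ 2 / lam))) := by ring
    rw [e1]; rw [e2] at h3
    linarith
end goodalg

section loc
variable {d m : ℕ}

/-- locally bounded, uniformly in time -/
def LB (s T : ℝ) (g : CF d) : Prop := ∀ R : ℝ, ∀ᶠ M in atTop, ∀ t ∈ Icc s T, ∀ x, ‖x‖ ≤ R → |g t x| ≤ M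

/-- locally uniformly continuous in space, uniformly in time -/
def LX (s T : ℝ) (g : CF d) : Prop := ∀ R ε : ℝ, 0 < ε → ∀ᶠ δ in nhdsWithin (0:ℝ) (Ioi 0), ∀ t ∈ Icc s T, ∀ x y, ‖x‖ ≤ R → ‖y - x‖ ≤ δ → |g t y - g t x| ≤ ε

/-- continuous in time, locally uniformly in space -/
def LTm (s T : ℝ) (g : CF d) : Prop := ∀ R ε : ℝ, 0 < ε → ∃ δ > 0, ∀ t ∈ Icc s T, ∀ t' ∈ Icc s T, |t - t'| < δ → ∀ x, ‖x‖ ≤ R → |g t x - g t' x| ≤ ε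

/-- coefficient class -/
structure Cf (s T : ℝ) (g : CF d) : Prop where
  lb : LB s T g
  lx : LX s T g
  lt : LTm s T g
  df : ∀ t ∈ Icc s T, Differentiable ℝ (g t)
  pb : ∀ l, LB s T (fun t x => pd (g t) x l)

/-- truncation -/
noncomputable def tr (ρ : ℝ) (g : EE d → ℝ) (x : EE d) : ℝ := cut ρ x * g x

theorem tr_diff {ρ : ℝ} {g : EE d → ℝ} (hg : Differentiable ℝ g) : Differentiable ℝ (tr ρ g) :=
  fun x => (smooth_diff (cut_smooth ρ) x).fun_mul (hg x)

theorem tr_eq {ρ : ℝ} {g : EE d → ℝ} {x : EE d} (h : ‖x‖ ^ 2 ≤ ρ) : tr ρ g x = g x := by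
  unfold tr; rw [cut_one h, one_mul]

theorem pd_tr_eq {ρ : ℝ} {g : EE d → ℝ} {x : EE d} (hg : Differentiable ℝ g) (h : ‖x‖ ^ 2 ≤ ρ) (l : Fin d) : pd (tr ρ g) x l = pd g x l := by
  have := pd_mul (smooth_diff (cut_smooth ρ) x) (hg x) l
  unfold tr
  rw [this, cut_one h, pd_cut_one h]; ring

theorem Cf.UC {s T : ℝ} {g : CF d} (h : Cf s T g) (ρ : ℝ) : UC (fun (t : Icc s T) x => tr ρ (g t) x) := by
  have hz : ∀ x : EE d, ¬ ‖x‖ ≤ √(|ρ| + 1) → cut ρ x = 0 := by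
    intro x hx
    refine cut_zero ?_
    rw [not_le] at hx
    have := sq_sqrt (show 0 ≤ |ρ| + 1 by positivity)
    have h2 := pow_le_pow_left₀ (sqrt_nonneg _) hx.le 2
    linarith [le_abs_self ρ]
  obtain ⟨M, hM, hM0⟩ := ((h.lb (√(|ρ| + 1))).and (eventually_ge_atTop 0)).exists
  refine ⟨⟨M, hM0, fun t x => ?_⟩, fun ε hε => ?_⟩
  · by_cases hx : ‖x‖ ≤ √(|ρ| + 1)
    · unfold tr; rw [abs_mul, abs_of_nonneg (cut_nonneg _ _)]
      exact (mul_le_of_le_one_left (abs_nonneg _) (cut_le _ _)).trans (hM t t.2 x hx)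
    · simp only [tr, hz x hx]; simpa using hM0
  · obtain ⟨δ, hδ, h1⟩ := h.lt (√(|ρ| + 1)) ε hε
    refine ⟨δ, hδ, fun t t' htt x => ?_⟩
    by_cases hx : ‖x‖ ≤ √(|ρ| + 1)
    · unfold tr; rw [← mul_sub, abs_mul, abs_of_nonneg (cut_nonneg _ _)]
      exact (mul_le_of_le_one_left (abs_nonneg _) (cut_le _ _)).trans (h1 t t.2 t' t'.2 htt x hx)
    · simp only [tr, hz x hx]; simpa using hε.le

theorem Cf.SU {s T : ℝ} {g : CF d} (h : Cf s T g) (ρ : ℝ) {δ : ℝ} {k : EE d → ℝ} (hk : IsKer δ k) : SU (fun (t : Icc s T) x => mol k (tr ρ (g t)) x) :=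
  mol_SU hk.sm hk.cs (fun t => (tr_diff (h.df t t.2)).continuous) (h.UC ρ)

theorem ball_sub1 {r δ : ℝ} {x y : EE d} (hx : ‖x‖ ≤ r) (hδ : δ ≤ 1) (hy : ‖y - x‖ ≤ δ) : ‖y‖ ≤ r + 1 := by
  have := norm_add_le (y - x) x
  rw [sub_add_cancel] at this; linarith

theorem ball_sq {r δ : ℝ} {x y : EE d} (hx : ‖x‖ ≤ r) (hδ : δ ≤ 1) (hy : ‖y - x‖ ≤ δ) : ‖y‖ ^ 2 ≤ (r + 1) ^ 2 :=
  pow_le_pow_left₀ (norm_nonneg _) (ball_sub1 hx hδ hy) 2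

theorem tr_close {r δ : ℝ} {k g : EE d → ℝ} (hk : IsKer δ k) (hδ : δ ≤ 1) (hg : Differentiable ℝ g) {x : EE d} (hx : ‖x‖ ≤ r) {K c : ℝ} (h : ∀ y, ‖y - x‖ ≤ δ → |g y - c| ≤ K) :
    |mol k (tr ((r + 1) ^ 2) g) x - c| ≤ K :=
  mol_close hk (tr_diff hg).continuous fun y hy => by rw [tr_eq (ball_sq hx hδ hy)]; exact h y hy

theorem tr_pd_close {r δ : ℝ} {k g : EE d → ℝ} (hk : IsKer δ k) (hδ : δ ≤ 1) (hg : Differentiable ℝ g) {x : EE d} (hx : ‖x‖ ≤ r) {l : Fin d} {K c : ℝ} (h : ∀ y, ‖y - x‖ ≤ δ → |pd g y l - c| ≤ K) :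
    |pd (mol k (tr ((r + 1) ^ 2) g)) x l - c| ≤ K :=
  mol_pd_close hk (tr_diff hg) fun y hy => by rw [pd_tr_eq hg (ball_sq hx hδ hy)]; exact h y hy

/-- coefficient data of the problem on a time interval -/
structure Dat (s T ν₀ γ K : ℝ) (q : CQ d) (A : CA d m) (C : CM d m)
    (β b : CV d) (lam Lc X0 k0 : CF d) : Prop where
  hq : ∀ i j, Cf s T (fun t x => q t x i j)
  hqx : ∀ i j l, LX s T (fun t x => pd (fun y => q t y i j) x l)
  hqs : ∀ t ∈ Icc s T, ∀ x i j, q t x i j = q t x j i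
  hA : ∀ i a b, Cf s T (fun t x => A t x i a b)
  hC : ∀ a b, Cf s T (fun t x => C t x a b)
  hβ : ∀ i, Cf s T (fun t x => β t x i)
  hb : ∀ i, LB s T (fun t x => b t x i)
  hlx : LX s T lam
  hLx : LX s T Lc
  hXx : LX s T X0
  hkx : LX s T k0
  hXb : LB s T X0
  hkb : LB s T k0
  hlam : ∀ t ∈ Icc s T, ∀ x, ν₀ ≤ lam t x
  hX0 : ∀ t ∈ Icc s T, ∀ x, 0 ≤ X0 t x
  hk0 : ∀ t ∈ Icc s T, ∀ x, 0 ≤ k0 t x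
  hqp : ∀ t ∈ Icc s T, ∀ x (w : Fin d → ℝ), lam t x * ∑ i, w i ^ 2 ≤ ∑ i, ∑ j, q t x i j * w i * w j
  hAX : ∀ t ∈ Icc s T, ∀ x i a b', |A t x i a b' - dl a b' * (b t x i + β t x i)| ≤ X0 t x
  hqk : ∀ t ∈ Icc s T, ∀ x i j, ∑ l, pd (fun y => q t y i j) x l ^ 2 ≤ k0 t x ^ 2
  hCL : ∀ t ∈ Icc s T, ∀ x (w : Fin m → ℝ), ∑ i, ∑ j, C t x i j * w i * w j ≤ Lc t x * ∑ i, w i ^ 2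
  hds : ∀ t ∈ Icc s T, ∀ x, Lc t x ≤ -(2 * γ * (√d * m * X0 t x) ^ 2 / lam t x)
  hsf : ∀ t ∈ Icc s T, ∀ x (u : Fin m → ℝ) (J : MJ d m),
    (∑ l, ∑ a, J l a * ∑ i, ∑ b, pd (fun y => A t y i a b) x l * J i b) + ∑ l, ∑ a, J l a * ∑ b, pd (fun y => C t y a b) x l * u b ≤
      (K - Lc t x - γ * (√d * m * X0 t x + d * k0 t x) ^ 2 / lam t x) * (∑ i, ∑ a, J i a ^ 2) + 1 / 2 * (K - 2 * Lc t x) * ∑ a, u a ^ 2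

theorem crude_sum {M e : ℝ} (hM : 0 ≤ M) {DA : Fin d → MA d m} {DC : MA d m} (hA : ∀ l i a b, |DA l i a b| ≤ M) (hC : ∀ l a b, |DC l a b| ≤ M)
    (u : Fin m → ℝ) (J : MJ d m) :
    (∑ l, ∑ a, J l a * ∑ i, ∑ b, DA l i a b * J i b) + ∑ l, ∑ a, J l a * ∑ b, DC l a b * u b ≤
      (M * (d * m) + 1 / 2 * m * M ^ 2 * (d * m)) * (∑ i, ∑ a, J i a ^ 2) + 1 / 2 * ∑ a, u a ^ 2 := by
  set N := ∑ k : Fin d × Fin m, |J k.1 k.2| with hN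
  have hNN : N = ∑ l, ∑ a, |J l a| := by rw [hN, Fintype.sum_prod_type]
  set U := ∑ a, |u a| with hU
  have h2 : U ^ 2 ≤ m * ∑ a, u a ^ 2 := by simpa using absSum_sq u
  have h3 : N ^ 2 ≤ (d * m) * ∑ i, ∑ a, J i a ^ 2 := by
    have := absSum_sq (fun k : Fin d × Fin m => J k.1 k.2)
    rw [hNN]; simpa [Fintype.sum_prod_type] using this
  have a1 : (∑ l, ∑ a, J l a * ∑ i, ∑ b, DA l i a b * J i b) ≤ N * (M * N) := by
    rw [hNN, sum_mul]
    refine sum_le fun l => ?_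
    rw [sum_mul]
    refine sum_le fun a => ?_
    refine (le_abs_self _).trans ?_
    rw [abs_mul]
    refine mul_le_l ?_ (abs_nonneg _)
    rw [mul_sm]
    refine (abs_sum_le_sum_abs _ _).trans (sum_le fun i => ?_)
    rw [mul_sm]
    refine (abs_sum_le_sum_abs _ _).trans (sum_le fun b => ?_)
    rw [abs_mul]; exact mul_le_r (hA _ _ _ _) (abs_nonneg _)
  have a2 : (∑ l, ∑ a, J l a * ∑ b, DC l a b * u b) ≤ N * (M * U) := by
    rw [hNN, sum_mul]
    refine sum_le fun l => ?_
    rw [sum_mul]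
    refine sum_le fun a => ?_
    refine (le_abs_self _).trans ?_
    rw [abs_mul]
    refine mul_le_l ?_ (abs_nonneg _)
    rw [mul_sm]
    refine (abs_sum_le_sum_abs _ _).trans (sum_le fun i => ?_)
    rw [abs_mul]; exact mul_le_r (hC _ _ _) (abs_nonneg _)
  clear_value N U
  rcases Nat.eq_zero_or_pos m with h0 | h0
  · subst h0; simp
  have hm : (0:ℝ) < m := by exact_mod_cast h0
  have a3 : N * (M * U) ≤ 1 / 2 * m * M ^ 2 * N ^ 2 + 1 / (2 * m) * U ^ 2 := by
    have : 0 ≤ (m * (M * N) - U) ^ 2 / (2 * m) := pz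
    have e : (m * (M * N) - U) ^ 2 / (2 * m) = 1 / 2 * m * M ^ 2 * N ^ 2 + 1 / (2 * m) * U ^ 2 - N * (M * U) := by field_simp; ring
    linarith
  have a4 := mul_le_l h3 (show 0 ≤ M + 1 / 2 * m * M ^ 2 by positivity)
  have a5 := mul_le_l h2 (show (0:ℝ) ≤ 1 / (2 * m) by positivity)
  have e5 : 1 / (2 * m) * (m * ∑ a, u a ^ 2) = 1 / 2 * ∑ a, u a ^ 2 := by field_simp
  nlinarith

theorem sq_pert {k e : ℝ} (hk : 0 ≤ k) (he : 0 ≤ e) {D D' : Fin d → ℝ} (h : ∑ l, D l ^ 2 ≤ k ^ 2) (hD : ∀ l, |D' l - D l| ≤ e) : ∑ l, D' l ^ 2 ≤ (k + d * e) ^ 2 := by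
  have h1 : ∀ l, |D l| ≤ k := fun l => abs_le_of_sq_le_sq ((single_le_sum (f := fun l => D l ^ 2) (fun _ _ => sq_nonneg _) (Finset.mem_univ l)).trans h) hk
  have h2 : ∀ l, D' l ^ 2 ≤ D l ^ 2 + (2 * k * e + e ^ 2) := by
    intro l
    have a := hD l
    have e1 : D' l ^ 2 = D l ^ 2 + 2 * (D l * (D' l - D l)) + (D' l - D l) ^ 2 := by ring
    have e2 : D l * (D' l - D l) ≤ k * e := (le_abs_self _).trans (by rw [abs_mul]; exact mul_le_mul (h1 l) a (abs_nonneg _) hk)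
    have e3 : (D' l - D l) ^ 2 ≤ e ^ 2 := sq_le_sq' (abs_le.1 a).1 (abs_le.1 a).2
    linarith
  have h3 := Finset.sum_le_sum fun l (_ : l ∈ Finset.univ) => h2 l
  rw [sum_ad] at h3
  simp only [sum_const, card_univ, Fintype.card_fin, nsmul_eq_mul] at h3
  have h4 : (d:ℝ) * e ^ 2 ≤ d ^ 2 * e ^ 2 := by
    refine mul_le_r ?_ (sq_nonneg _)
    have : d ≤ d ^ 2 := Nat.le_self_pow (by norm_num) d
    exact_mod_cast this
  nlinarith
end loc

section coef
variable {d m : ℕ}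

/-- left side of the structural inequality -/
def sfL (DA : Fin d → MA d m) (DC : MA d m) (u : Fin m → ℝ) (J : MJ d m) : ℝ :=
  (∑ l, ∑ a, J l a * ∑ i, ∑ b, DA l i a b * J i b) + ∑ l, ∑ a, J l a * ∑ b, DC l a b * u b

theorem mol_sf {δ : ℝ} {k : EE d → ℝ} (hk : IsKer δ k) {gA : Fin d → Fin m → Fin m → EE d → ℝ} {gC : Fin m → Fin m → EE d → ℝ} (hA : ∀ i a b, Differentiable ℝ (gA i a b)) (hC : ∀ a b, Differentiable ℝ (gC a b))
    {x : EE d} {M S : ℝ} (u : Fin m → ℝ) (J : MJ d m) (bA : ∀ i a b l y, ‖y - x‖ ≤ δ → |pd (gA i a b) y l| ≤ M) (bC : ∀ a b l y, ‖y - x‖ ≤ δ → |pd (gC a b) y l| ≤ M)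
    (h : ∀ y, ‖y - x‖ ≤ δ → sfL (fun l i a b => pd (gA i a b) y l) (fun l a b => pd (gC a b) y l) u J ≤ S) :
    sfL (fun l i a b => pd (mol k (gA i a b)) x l) (fun l a b => pd (mol k (gC a b)) x l) u J ≤ S := by
  have conv : ∀ F : (EE d → ℝ) → Fin d → ℝ, sfL (fun l i a b => F (gA i a b) l) (fun l a b => F (gC a b) l) u J =
      ∑ j : (Fin d × Fin m × Fin d × Fin m) ⊕ (Fin d × Fin m × Fin m),
        Sum.elim (fun p : Fin d × Fin m × Fin d × Fin m => J p.1 p.2.1 * J p.2.2.1 p.2.2.2) (fun p : Fin d × Fin m × Fin m => J p.1 p.2.1 * u p.2.2) j *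
        F (Sum.elim (fun p : Fin d × Fin m × Fin d × Fin m => gA p.2.2.1 p.2.1 p.2.2.2) (fun p : Fin d × Fin m × Fin m => gC p.2.1 p.2.2) j) (Sum.elim (fun p : Fin d × Fin m × Fin d × Fin m => p.1) (fun p : Fin d × Fin m × Fin m => p.1) j) := by
    intro F
    rw [Fintype.sum_sum_type]
    simp only [Sum.elim_inl, Sum.elim_inr, Fintype.sum_prod_type, sfL, mul_sm]
    congr 1
    · refine sum_cg fun _ => sum_cg fun _ => sum_cg fun _ => sum_cg fun _ => by ring
    · refine sum_cg fun _ => sum_cg fun _ => sum_cg fun _ => by ring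
  rw [conv (fun g l => pd (mol k g) x l)]
  refine mol_pd_sum_le hk ?_ (C := M) ?_ ?_
  · rintro (p | p); exacts [hA _ _ _, hC _ _]
  · rintro (p | p) y hy; exacts [bA _ _ _ _ y hy, bC _ _ _ y hy]
  · intro y hy
    rw [← conv (fun g l => pd g y l)]; exact h y hy

variable {s T ν₀ γ K : ℝ} {q : CQ d} {A : CA d m} {C : CM d m}
    {β b : CV d} {lam Lc X0 k0 : CF d}

/-- closeness of all the coefficients at two points -/
def Near (q : CQ d) (A : CA d m) (C : CM d m)
    (β : CV d) (lam Lc X0 k0 : CF d) (e t : ℝ) (x y : EE d) : Prop :=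
  (∀ i j, |q t y i j - q t x i j| ≤ e) ∧ (∀ i j l, |pd (fun z => q t z i j) y l - pd (fun z => q t z i j) x l| ≤ e) ∧
  (∀ i a b, |A t y i a b - A t x i a b| ≤ e) ∧ (∀ a b, |C t y a b - C t x a b| ≤ e) ∧ (∀ i, |β t y i - β t x i| ≤ e) ∧
  |lam t y - lam t x| ≤ e ∧ |Lc t y - Lc t x| ≤ e ∧ |X0 t y - X0 t x| ≤ e ∧ |k0 t y - k0 t x| ≤ e

theorem Dat.near (D : Dat s T ν₀ γ K q A C β b lam Lc X0 k0) (r : ℝ) {e : ℝ} (he : 0 < e) :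
    ∀ᶠ δ in nhdsWithin (0:ℝ) (Ioi 0), ∀ t ∈ Icc s T, ∀ x y, ‖x‖ ≤ r → ‖y - x‖ ≤ δ → Near q A C β lam Lc X0 k0 e t x y := by
  have h1 := eventually_all.2 fun i => eventually_all.2 fun j => (D.hq i j).lx r e he
  have h2 := eventually_all.2 fun i => eventually_all.2 fun j => eventually_all.2 fun l => D.hqx i j l r e he
  have h3 := eventually_all.2 fun i => eventually_all.2 fun a => eventually_all.2 fun b => (D.hA i a b).lx r e he
  have h4 := eventually_all.2 fun a => eventually_all.2 fun b => (D.hC a b).lx r e he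
  have h5 := eventually_all.2 fun i => (D.hβ i).lx r e he
  filter_upwards [h1, h2, h3, h4, h5, D.hlx r e he, D.hLx r e he, D.hXx r e he, D.hkx r e he] with δ a1 a2 a3 a4 a5 a6 a7 a8 a9 t ht x y hx hy
  exact ⟨fun i j => a1 i j t ht x y hx hy, fun i j l => a2 i j l t ht x y hx hy, fun i a b => a3 i a b t ht x y hx hy, fun a b => a4 a b t ht x y hx hy, fun i => a5 i t ht x y hx hy, a6 t ht x y hx hy, a7 t ht x y hx hy, a8 t ht x y hx hy, a9 t ht x y hx hy⟩

/-- local bounds -/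
def Bdd (q : CQ d) (A : CA d m) (C : CM d m)
    (β b : CV d) (X0 k0 : CF d) (M t : ℝ) (x : EE d) : Prop :=
  (∀ i j, |q t x i j| ≤ M) ∧ (∀ i j l, |pd (fun z => q t z i j) x l| ≤ M) ∧
  (∀ i a b, |A t x i a b| ≤ M) ∧ (∀ i a b l, |pd (fun z => A t z i a b) x l| ≤ M) ∧ (∀ a b, |C t x a b| ≤ M) ∧ (∀ a b l, |pd (fun z => C t z a b) x l| ≤ M) ∧
  (∀ i, |β t x i| ≤ M) ∧ (∀ i, |b t x i| ≤ M) ∧ |X0 t x| ≤ M ∧ |k0 t x| ≤ M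

theorem Dat.bdd (D : Dat s T ν₀ γ K q A C β b lam Lc X0 k0) (r : ℝ) :
    ∃ M ≥ 0, ∀ t ∈ Icc s T, ∀ x, ‖x‖ ≤ r → Bdd q A C β b X0 k0 M t x := by
  have h1 := eventually_all.2 fun i => eventually_all.2 fun j => (D.hq i j).lb r
  have h2 := eventually_all.2 fun i => eventually_all.2 fun j => eventually_all.2 fun l => (D.hq i j).pb l r
  have h3 := eventually_all.2 fun i => eventually_all.2 fun a => eventually_all.2 fun b => (D.hA i a b).lb r
  have h4 := eventually_all.2 fun i => eventually_all.2 fun a => eventually_all.2 fun b => eventually_all.2 fun l => (D.hA i a b).pb l r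
  have h5 := eventually_all.2 fun a => eventually_all.2 fun b => (D.hC a b).lb r
  have h6 := eventually_all.2 fun a => eventually_all.2 fun b => eventually_all.2 fun l => (D.hC a b).pb l r
  have h7 := eventually_all.2 fun i => (D.hβ i).lb r
  have h8 := eventually_all.2 fun i => D.hb i r
  have h := h1.and (h2.and (h3.and (h4.and (h5.and (h6.and (h7.and (h8.and ((D.hXb r).and ((D.hkb r).and (eventually_ge_atTop 0))))))))))
  obtain ⟨M, a1, a2, a3, a4, a5, a6, a7, a8, a9, a10, hM⟩ := h.exists
  exact ⟨M, hM, fun t ht x hx => ⟨fun i j => a1 i j t ht x hx, fun i j l => a2 i j l t ht x hx, fun i a b => a3 i a b t ht x hx, fun i a b l => a4 i a b l t ht x hx, fun a b => a5 a b t ht x hx,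
    fun a b l => a6 a b l t ht x hx, fun i => a7 i t ht x hx, fun i => a8 i t ht x hx, a9 t ht x hx, a10 t ht x hx⟩⟩

theorem sfL_psi (ρ L c : ℝ) (x : EE d) (u : Fin m → ℝ) (J : MJ d m) (DA : Fin d → MA d m) (DC : MA d m) (hL : 0 ≤ L)
    (hc : c ≤ (1 - cut ρ x) * nin x ^ 3) :
    sfL (fun l i a b => DA l i a b - L * pd (Psi ρ i) x l * dl a b) DC u J ≤ sfL DA DC u J - L * c * ∑ i, ∑ a, J i a ^ 2 := by
  have e : sfL (fun l i a b => DA l i a b - L * pd (Psi ρ i) x l * dl a b) DC u J = sfL DA DC u J - L * ∑ a, ∑ l, ∑ i, pd (Psi ρ i) x l * J l a * J i a := by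
    unfold sfL
    rw [sum_comm (f := fun a l => ∑ i, pd (Psi ρ i) x l * J l a * J i a)]
    have : ∀ l a, J l a * ∑ i, ∑ b, (DA l i a b - L * pd (Psi ρ i) x l * dl a b) * J i b = (J l a * ∑ i, ∑ b, DA l i a b * J i b) - L * ∑ i, pd (Psi ρ i) x l * J l a * J i a := by
      intro l a
      simp only [sub_mul, sum_sub_distrib, mul_sub, dl, mul_ite, mul_one, mul_zero, ite_mul, zero_mul, sum_ite_eq, Finset.mem_univ, if_true]
      rw [mul_sm (b := L)]
      congr 1
      rw [mul_sm]
      exact sum_cg fun i => by ring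
    simp only [this, sum_sub_distrib, mul_sm]
    ring
  rw [e, mul_assoc]
  refine sub_le_sub_left (mul_le_l ?_ hL) _
  rw [sum_comm, mul_sm]
  refine sum_le fun a => ?_
  exact (mul_le_r hc (sum_nn fun _ => sq_nonneg _)).trans (Psi_psd ρ x fun l => J l a)
end coef

section coef2
variable {d m : ℕ}
variable {s T ν₀ γ K : ℝ} {q : CQ d} {A : CA d m} {C : CM d m}
    {β b : CV d} {lam Lc X0 k0 : CF d}

theorem good_out {R e η M L tol : ℝ} (hd : 1 ≤ d) (hm : 1 ≤ m) (hν : 0 < ν₀) (hγ : 0 < γ) (hK : 0 ≤ K) (hM : 0 ≤ M) (htol : γ * tol ≤ 1 / 4) (hη : η ≤ ν₀ / 2) (hL : 0 ≤ L)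
    (hquot : ∀ x x' l l', 0 ≤ x → 0 ≤ x' → x' ≤ M → ν₀ ≤ l' → x ≤ x' + η → l' - η ≤ l → x ^ 2 / l ≤ x' ^ 2 / l' + tol)
    (he : 0 < e) (c1 : 20 * m * e ≤ 1) (c3 : 5 * d * e + e ≤ η) (c4 : √d * m * (6 * e) ≤ η) (x : EE d) (bz bd : Fin d → ℝ) :
    Good ν₀ γ (K + 3) (fun i j => ν₀ * dl i j) (fun i (a b : Fin m) => - L * Psi (R ^ 2) i x * dl a b) (fun _ _ => 0) (fun _ _ _ => 0)
      (fun l i a b => - L * pd (Psi (R ^ 2) i) x l * dl a b) (fun _ _ _ => 0) (fun i => - L * Psi (R ^ 2) i x) := by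
  have hsd : 0 ≤ √d := sqrt_nonneg _
  have hp : 0 ≤ √d * m * e := pz
  have := good_mk (ν₀ := ν₀) (γ := γ) (K := K + 3) (om := 5 * e) (η := η) (χ := 0) (lam := ν₀) (X0 := 0) (Lc := 0) (L := L) (Y := 0) (M := M) (tol := tol) hd hm hν hγ (by linarith) le_rfl zero_le_one le_rfl le_rfl hη
    (by simpa using hM) hquot (by linarith) (by linarith) (by linarith) le_rfl (q := fun i j => ν₀ * dl i j) (Qd := fun i j => ν₀ * dl i j) (Ad := fun i (a b : Fin m) => dl a b * (bz i + bd i)) (C0 := fun _ _ => 0) (Cd := fun _ _ => 0) (b := bz) (bd := bd)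
    (Ps := fun i => Psi (R ^ 2) i x) (fun i j => by simp; linarith) (fun w => by
      rw [mul_sm]
      refine sum_le fun i => ?_
      simp [dl]; nlinarith) (fun i a b => by simp; linarith) (fun i j => by simp; linarith) (fun w => by simp) (by simp) (DQ := fun _ _ _ => 0)
      (DA := fun l i a b => - L * pd (Psi (R ^ 2) i) x l * dl a b) (DC := fun _ _ _ => 0) (fun J H r hr => by simp) (fun u J => ?_)
  · simpa using this
  · have h1 := sfL_psi (R ^ 2) L 0 x u J (fun _ _ _ _ => 0) (fun _ _ _ => 0) hL (by have := sub_nonneg.2 (cut_le (R ^ 2) x); have := (nin_pos x).le; positivity)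
    have h2 := hquot (√d * m * (0 * 0 + 5 * e) + 0) 0 (0 * ν₀ + (1 - 0) * ν₀ - d * (5 * e)) ν₀ (pz) le_rfl hM le_rfl (by linarith) (by linarith)
    have h3 := mul_le_l h2 hγ.le
    have hJ : 0 ≤ ∑ i, ∑ a, J i a ^ 2 := pz
    have hU : 0 ≤ ∑ a, u a ^ 2 := pz
    have h0 : sfL (fun (_ _ : Fin d) (_ _ : Fin m) => (0:ℝ)) (fun _ _ _ => 0) u J = 0 := by simp [sfL]
    rw [h0] at h1
    have e1 : (fun l i a b => - L * pd (Psi (R ^ 2) i) x l * dl a b) = fun (l i : Fin d) (a b : Fin m) => 0 - L * pd (Psi (R ^ 2) i) x l * dl a b := by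
      funext l i a b; ring
    refine le_trans (le_of_eq (by rw [← e1]; rfl)) (h1.trans ?_)
    have e2 : γ * (√d * m * (0 * 0 + 5 * e) + 0) ^ 2 / (0 * ν₀ + (1 - 0) * ν₀ - d * (5 * e)) = γ * ((√d * m * (0 * 0 + 5 * e) + 0) ^ 2 / (0 * ν₀ + (1 - 0) * ν₀ - d * (5 * e))) := by ring
    rw [e2]
    have e3 : (0:ℝ) ^ 2 / ν₀ + tol = tol := by simp
    rw [e3] at h3
    generalize (√d * m * (0 * 0 + 5 * e) + 0) ^ 2 / (0 * ν₀ + (1 - 0) * ν₀ - d * (5 * e)) = G at *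
    have p1 := mul_nonneg (show 0 ≤ K + 3 - (0 * 0 + m * (5 * e)) - γ * G by linarith) hJ
    have p2 := mul_nonneg (show 0 ≤ 1 / 2 * (K + 3 - 2 * (0 * 0 + m * (5 * e))) by linarith) hU
    linarith

theorem good_in (D : Dat s T ν₀ γ K q A C β b lam Lc X0 k0) {R e η M M1 L tol δ ϖ t : ℝ} {k : EE d → ℝ} {x z : EE d} (hd : 1 ≤ d) (hm : 1 ≤ m) (hν : 0 < ν₀) (hγ : 0 < γ) (hK : 0 ≤ K) (hM : 0 ≤ M) (hM1 : 0 ≤ M1)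
    (htol : γ * tol ≤ 1 / 4) (hη : η ≤ ν₀ / 2) (hL : 0 ≤ L) (hR : 0 ≤ R)
    (hquot : ∀ x x' l l', 0 ≤ x → 0 ≤ x' → x' ≤ √d * m * M + d * M → ν₀ ≤ l' → x ≤ x' + η → l' - η ≤ l → x ^ 2 / l ≤ x' ^ 2 / l' + tol)
    (he : 0 < e) (c1 : 20 * m * e ≤ 1) (c2 : 5 * e ≤ 1) (c3 : 5 * d * e + e ≤ η) (c4 : √d * m * (6 * e) + d * (e + d * e) ≤ η)
    (ht : t ∈ Icc s T) (hk : IsKer δ k) (hδ : δ ≤ 1) (hδϖ : δ ≤ ϖ) (hx : ‖x‖ ≤ R + 2) (hx2 : ‖x‖ ^ 2 ≤ R ^ 2 + 2) (hz : ‖z - x‖ ≤ ϖ) (hnear : ∀ y, ‖y - x‖ ≤ ϖ → Near q A C β lam Lc X0 k0 e t x y)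
    (hbdd : ∀ y, ‖y‖ ≤ R + 3 → Bdd q A C β b X0 k0 M t y)
    (hp1 : ∀ l, |pd (cut (R ^ 2 + 1)) x l| ≤ M1)
    (hLL : (M1 * (M + ν₀) + M) * (d * m) + 1 / 2 * m * (M1 * (M + ν₀) + M) ^ 2 * (d * m) + γ * (√d * m * (M + 1) + d * (d * (M1 * (M + ν₀) + M))) ^ 2 / (ν₀ / 2) ≤ L * ((√(1 + (R + 2) ^ 2))⁻¹) ^ 3)
    (gq : Fin d → Fin d → EE d → ℝ) (hgq : gq = fun i j => mol k (tr ((R + 2 + 1) ^ 2) fun y => q t y i j))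
    (gA : Fin d → Fin m → Fin m → EE d → ℝ) (hgA : gA = fun i a b => mol k (tr ((R + 2 + 1) ^ 2) fun y => A t y i a b))
    (gC : Fin m → Fin m → EE d → ℝ) (hgC : gC = fun a b => mol k (tr ((R + 2 + 1) ^ 2) fun y => C t y a b))
    (gb : Fin d → EE d → ℝ) (hgb : gb = fun i => mol k (tr ((R + 2 + 1) ^ 2) fun y => β t y i)) :
    Good ν₀ γ (K + 3) (fun i j => ν₀ * dl i j + cut (R ^ 2 + 1) x * (gq i j x - ν₀ * dl i j)) (fun i a b => cut (R ^ 2 + 1) x * gA i a b x - L * Psi (R ^ 2) i x * dl a b) (fun a b => cut (R ^ 2 + 1) x * gC a b x)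
      (fun l i j => pd (cut (R ^ 2 + 1)) x l * (gq i j x - ν₀ * dl i j) + cut (R ^ 2 + 1) x * pd (gq i j) x l)
      (fun l i a b => (pd (cut (R ^ 2 + 1)) x l * gA i a b x + cut (R ^ 2 + 1) x * pd (gA i a b) x l) - L * pd (Psi (R ^ 2) i) x l * dl a b)
      (fun l a b => pd (cut (R ^ 2 + 1)) x l * gC a b x + cut (R ^ 2 + 1) x * pd (gC a b) x l)
      (fun i => cut (R ^ 2 + 1) x * b t z i + (cut (R ^ 2 + 1) x * gb i x - L * Psi (R ^ 2) i x)) := by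
  have hsd : 0 ≤ √d := sqrt_nonneg _
  have hpe : 0 ≤ √d * m * e := pz
  have hde : 0 ≤ (d:ℝ) * (e + d * e) := pz
  have hnk : ∀ y, ‖y - x‖ ≤ δ → Near q A C β lam Lc X0 k0 e t x y := fun y hy => hnear y (hy.trans hδϖ)
  have hbk : ∀ y, ‖y - x‖ ≤ δ → Bdd q A C β b X0 k0 M t y := fun y hy => hbdd y (by have := ball_sub1 hx hδ hy; linarith)
  have hbx := hbdd x (by linarith)
  have dq : ∀ i j, Differentiable ℝ (fun y => q t y i j) := fun i j => (D.hq i j).df t ht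
  have dA : ∀ i a b, Differentiable ℝ (fun y => A t y i a b) := fun i a b => (D.hA i a b).df t ht
  have dC : ∀ a b, Differentiable ℝ (fun y => C t y a b) := fun a b => (D.hC a b).df t ht
  have db : ∀ i, Differentiable ℝ (fun y => β t y i) := fun i => (D.hβ i).df t ht
  have cq : ∀ i j, |gq i j x - q t x i j| ≤ e := fun i j => by rw [hgq]; exact tr_close hk hδ (dq i j) hx fun y hy => (hnk y hy).1 i j
  have cA : ∀ i a b, |gA i a b x - A t x i a b| ≤ e := fun i a b => by rw [hgA]; exact tr_close hk hδ (dA i a b) hx fun y hy => (hnk y hy).2.2.1 i a b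
  have cC : ∀ a b, |gC a b x - C t x a b| ≤ e := fun a b => by rw [hgC]; exact tr_close hk hδ (dC a b) hx fun y hy => (hnk y hy).2.2.2.1 a b
  have cb : ∀ i, |gb i x - β t x i| ≤ e := fun i => by rw [hgb]; exact tr_close hk hδ (db i) hx fun y hy => (hnk y hy).2.2.2.2.1 i
  have cpq : ∀ i j l, |pd (gq i j) x l - pd (fun y => q t y i j) x l| ≤ e := fun i j l => by rw [hgq]; exact tr_pd_close hk hδ (dq i j) hx fun y hy => (hnk y hy).2.1 i j l
  have hX0x := D.hX0 t ht x
  have hk0x := D.hk0 t ht x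
  have hlamx := D.hlam t ht x
  have hX0M : X0 t x ≤ M := (le_abs_self _).trans hbx.2.2.2.2.2.2.2.2.1
  have hk0M : k0 t x ≤ M := (le_abs_self _).trans hbx.2.2.2.2.2.2.2.2.2
  have hAz : ∀ i a b', |gA i a b' x - dl a b' * (b t z i + gb i x)| ≤ X0 t x + 5 * e := by
    intro i a b'
    have h1 := D.hAX t ht z i a b'
    obtain ⟨-, -, n3, -, n5, -, -, n8, -⟩ := hnear z hz
    have h3 := cA i a b'
    have h4 := n3 i a b'
    have h5 := cb i
    have h6 := n5 i
    have hdl : |dl a b'| ≤ 1 := by unfold dl; split_ifs <;> simp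
    have e1 : gA i a b' x - dl a b' * (b t z i + gb i x) = (gA i a b' x - A t x i a b') - (A t z i a b' - A t x i a b') + (A t z i a b' - dl a b' * (b t z i + β t z i)) + dl a b' * ((β t z i - β t x i) - (gb i x - β t x i)) := by ring
    have h7 : |dl a b' * ((β t z i - β t x i) - (gb i x - β t x i))| ≤ 2 * e := by
      rw [abs_mul]
      refine (mul_le_of_le_one_left (abs_nonneg _) hdl).trans ((abs_sub _ _).trans (by linarith))
    rw [e1]
    have h8 := (abs_le.1 n8).2
    refine (abs_add_le _ _).trans ?_
    refine (add_le_add_left ((abs_add_le _ _).trans (add_le_add_left (abs_sub _ _) _)) _).trans ?_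
    linarith
  have hχ0 := cut_nonneg (R ^ 2 + 1) x
  have hχ1 := cut_le (R ^ 2 + 1) x
  have hMM : √d * m * X0 t x ≤ √d * m * M + d * M := by
    have : √d * m * X0 t x ≤ √d * m * M := mul_le_l hX0M (pz)
    have : 0 ≤ d * M := pz
    linarith
  have hds := D.hds t ht x
  have hLc0 : Lc t x ≤ 0 := hds.trans (by have : 0 < lam t x := by linarith
                                          have : 0 ≤ 2 * γ * (√d * m * X0 t x) ^ 2 / lam t x := pz
                                          linarith)
  have mk := fun (Y : ℝ) (hY : 0 ≤ Y) DQ DA DC g3 g6 => good_mk (ν₀ := ν₀) (γ := γ) (K := K + 3) (om := 5 * e) (η := η) (χ := cut (R ^ 2 + 1) x) (lam := lam t x) (X0 := X0 t x) (Lc := Lc t x) (L := L) (Y := Y) (tol := tol) (M := √d * m * M + d * M)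
    hd hm hν hγ (by linarith) hχ0 hχ1 hlamx hX0x hη hMM hquot (by linarith) (by linarith) (by linarith) hY (q := q t x) (Qd := fun i j => gq i j x) (Ad := fun i a b => gA i a b x) (C0 := C t x) (Cd := fun a b => gC a b x) (b := b t z) (bd := fun i => gb i x)
    (Ps := fun i => Psi (R ^ 2) i x) (fun i j => (cq i j).trans (by linarith)) (D.hqp t ht x) hAz (fun i j => (cC i j).trans (by linarith)) (D.hCL t ht x) hds (DQ := DQ) (DA := DA) (DC := DC) g3 g6
  by_cases hcase : ‖x‖ ^ 2 ≤ R ^ 2 + 1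
  · -- inner region
    refine mk (d * (k0 t x + d * e)) (pz) _ _ _ ?_ ?_
    · intro J H r hr
      refine young3 hd (κ := k0 t x + d * e) (pz) (fun i j => ?_) J H r hr
      refine sq_pert hk0x he.le (D.hqk t ht x i j) fun l => ?_
      rw [pd_cut_one hcase, cut_one hcase, zero_mul, zero_add, one_mul]; exact cpq i j l
    · intro u J
      have hJ : 0 ≤ ∑ i, ∑ a, J i a ^ 2 := pz
      have hU : 0 ≤ ∑ a, u a ^ 2 := pz
      simp only [pd_cut_one hcase, cut_one hcase, zero_mul, zero_add, one_mul]
      have h1 := sfL_psi (R ^ 2) L 0 x u J (fun l i a b => pd (gA i a b) x l) (fun l a b => pd (gC a b) x l) hL (by have := sub_nonneg.2 (cut_le (R ^ 2) x); have := (nin_pos x).le; positivity)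
      refine h1.trans ?_
      rw [mul_zero, zero_mul, sub_zero, hgA, hgC]
      refine mol_sf hk (gA := fun i a b => tr ((R + 2 + 1) ^ 2) fun y => A t y i a b) (gC := fun a b => tr ((R + 2 + 1) ^ 2) fun y => C t y a b) (fun i a b => tr_diff (dA i a b)) (fun a b => tr_diff (dC a b)) (M := M) u J ?_ ?_ ?_
      · intro i a b l y hy
        rw [pd_tr_eq (dA i a b) (ball_sq hx hδ hy)]; exact (hbk y hy).2.2.2.1 i a b l
      · intro a b l y hy
        rw [pd_tr_eq (dC a b) (ball_sq hx hδ hy)]; exact (hbk y hy).2.2.2.2.2.1 a b l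
      · intro y hy
        have e1 : (fun (l i : Fin d) (a b : Fin m) => pd (tr ((R + 2 + 1) ^ 2) fun y => A t y i a b) y l) = fun l i a b => pd (fun y => A t y i a b) y l := by
          funext l i a b; exact pd_tr_eq (dA i a b) (ball_sq hx hδ hy) l
        have e2 : (fun (l : Fin d) (a b : Fin m) => pd (tr ((R + 2 + 1) ^ 2) fun y => C t y a b) y l) = fun l a b => pd (fun y => C t y a b) y l := by
          funext l a b; exact pd_tr_eq (dC a b) (ball_sq hx hδ hy) l
        rw [e1, e2]
        have h2 := D.hsf t ht y u J
        refine le_trans h2 ?_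
        obtain ⟨-, -, -, -, -, n6, n7, n8, n9⟩ := hnk y hy
        have hyb := hbk y hy
        have hX0y : X0 t y ≤ M := (le_abs_self _).trans hyb.2.2.2.2.2.2.2.2.1
        have hk0y : k0 t y ≤ M := (le_abs_self _).trans hyb.2.2.2.2.2.2.2.2.2
        have y1 := D.hX0 t ht y
        have y2 := D.hk0 t ht y
        have n8' := mul_le_l (abs_le.1 n8).1 (show 0 ≤ √d * m by positivity)
        have n9' := mul_le_l (abs_le.1 n9).1 (show (0:ℝ) ≤ d by positivity)
        have h3 := hquot (√d * m * (X0 t x + 5 * e) + d * (k0 t x + d * e)) (√d * m * X0 t y + d * k0 t y) (lam t x + (1 - 1) * ν₀ - d * (5 * e)) (lam t y) (pz) (pz)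
          (by gcongr) (D.hlam t ht y) (by linarith) (by linarith [(abs_le.1 n6).2])
        have h4 := mul_le_l h3 hγ.le
        have e3 : ∀ a b : ℝ, γ * a ^ 2 / b = γ * (a ^ 2 / b) := fun a b => by ring
        rw [e3, e3]
        generalize (√d * m * (X0 t x + 5 * e) + d * (k0 t x + d * e)) ^ 2 / (lam t x + (1 - 1) * ν₀ - d * (5 * e)) = G at *
        generalize (√d * m * X0 t y + d * k0 t y) ^ 2 / (lam t y) = G' at *
        have n7' := (abs_le.1 n7).1
        refine add_le_add (mul_le_r ?_ hJ) (mul_le_r ?_ hU)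
        · linarith
        · linarith
  · -- outer region
    have hcut0 : cut (R ^ 2) x = 0 := cut_zero (by linarith)
    obtain ⟨M3, hM3⟩ : ∃ M3, M3 = M1 * (M + ν₀) + M := ⟨_, rfl⟩
    rw [← hM3] at hLL
    have hM30 : 0 ≤ M3 := by rw [hM3]; positivity
    have bq : ∀ i j, |gq i j x| ≤ M := fun i j => by
      rw [hgq]; simpa using tr_close hk hδ (dq i j) hx (c := 0) fun y hy => by simpa using (hbk y hy).1 i j
    have bA : ∀ i a b, |gA i a b x| ≤ M := fun i a b => by
      rw [hgA]; simpa using tr_close hk hδ (dA i a b) hx (c := 0) fun y hy => by simpa using (hbk y hy).2.2.1 i a b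
    have bC : ∀ a b, |gC a b x| ≤ M := fun a b => by
      rw [hgC]; simpa using tr_close hk hδ (dC a b) hx (c := 0) fun y hy => by simpa using (hbk y hy).2.2.2.2.1 a b
    have bpq : ∀ i j l, |pd (gq i j) x l| ≤ M := fun i j l => by
      rw [hgq]; simpa using tr_pd_close hk hδ (dq i j) hx (l := l) (c := 0) fun y hy => by simpa using (hbk y hy).2.1 i j l
    have bpA : ∀ i a b l, |pd (gA i a b) x l| ≤ M := fun i a b l => by
      rw [hgA]; simpa using tr_pd_close hk hδ (dA i a b) hx (l := l) (c := 0) fun y hy => by simpa using (hbk y hy).2.2.2.1 i a b l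
    have bpC : ∀ a b l, |pd (gC a b) x l| ≤ M := fun a b l => by
      rw [hgC]; simpa using tr_pd_close hk hδ (dC a b) hx (l := l) (c := 0) fun y hy => by simpa using (hbk y hy).2.2.2.2.2.1 a b l
    have gen : ∀ (l : Fin d) (g g' : ℝ), |g| ≤ M + ν₀ → |g'| ≤ M → |pd (cut (R ^ 2 + 1)) x l * g + cut (R ^ 2 + 1) x * g'| ≤ M3 := by
      intro l g g' h1 h2
      rw [hM3]
      refine (abs_add_le _ _).trans (add_le_add ?_ ?_)
      · rw [abs_mul]; exact mul_le_mul (hp1 l) h1 (abs_nonneg _) hM1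
      · rw [abs_mul, abs_of_nonneg hχ0]; exact (mul_le_of_le_one_left (abs_nonneg _) hχ1).trans h2
    refine mk (d * (d * M3)) (pz) _ _ _ ?_ ?_
    · intro J H r hr
      refine young3 hd (κ := d * M3) (pz) (fun i j => ?_) J H r hr
      have := sq_pert (d := d) (k := 0) (e := M3) le_rfl hM30 (D := fun _ => 0) (D' := fun l => pd (cut (R ^ 2 + 1)) x l * (gq i j x - ν₀ * dl i j) + cut (R ^ 2 + 1) x * pd (gq i j) x l) (by simp) fun l => by
        rw [sub_zero]
        refine gen l _ _ ((abs_sub _ _).trans (add_le_add (bq i j) ?_)) (bpq i j l)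
        rw [abs_mul, abs_of_pos hν]
        refine mul_le_of_le_one_right hν.le ?_
        unfold dl; split_ifs <;> simp
      simpa using this
    · intro u J
      have hJ : 0 ≤ ∑ i, ∑ a, J i a ^ 2 := pz
      have hU : 0 ≤ ∑ a, u a ^ 2 := pz
      have hn : ((√(1 + (R + 2) ^ 2))⁻¹) ^ 3 ≤ (1 - cut (R ^ 2) x) * nin x ^ 3 := by
        rw [hcut0, sub_zero, one_mul]; unfold nin; gcongr
      have h1 := sfL_psi (R ^ 2) L _ x u J (fun l i a b => pd (cut (R ^ 2 + 1)) x l * gA i a b x + cut (R ^ 2 + 1) x * pd (gA i a b) x l) (fun l a b => pd (cut (R ^ 2 + 1)) x l * gC a b x + cut (R ^ 2 + 1) x * pd (gC a b) x l) hL hn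
      refine h1.trans ?_
      have h2 := crude_sum (e := 0) hM30 (DA := fun l i a b => pd (cut (R ^ 2 + 1)) x l * gA i a b x + cut (R ^ 2 + 1) x * pd (gA i a b) x l) (DC := fun l a b => pd (cut (R ^ 2 + 1)) x l * gC a b x + cut (R ^ 2 + 1) x * pd (gC a b) x l)
        (fun l i a b => gen l _ _ ((bA i a b).trans (by linarith)) (bpA i a b l)) (fun l a b => gen l _ _ ((bC a b).trans (by linarith)) (bpC a b l)) u J
      have h3 : γ * (√d * m * (cut (R ^ 2 + 1) x * X0 t x + 5 * e) + d * (d * M3)) ^ 2 / (cut (R ^ 2 + 1) x * lam t x + (1 - cut (R ^ 2 + 1) x) * ν₀ - d * (5 * e)) ≤ γ * (√d * m * (M + 1) + d * (d * M3)) ^ 2 / (ν₀ / 2) := by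
        have : cut (R ^ 2 + 1) x * X0 t x ≤ M := (mul_le_of_le_one_left hX0x hχ1).trans hX0M
        have h5 : ν₀ / 2 ≤ cut (R ^ 2 + 1) x * lam t x + (1 - cut (R ^ 2 + 1) x) * ν₀ - d * (5 * e) := by
          have := mul_le_l hlamx hχ0
          linarith
        gcongr
      have h4 : cut (R ^ 2 + 1) x * Lc t x ≤ 0 := mul_nonpos_of_nonneg_of_nonpos hχ0 hLc0
      generalize γ * (√d * m * (cut (R ^ 2 + 1) x * X0 t x + 5 * e) + d * (d * M3)) ^ 2 / (cut (R ^ 2 + 1) x * lam t x + (1 - cut (R ^ 2 + 1) x) * ν₀ - d * (5 * e)) = G at *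
      have p1 := mul_nonneg (show 0 ≤ K + 3 - (cut (R ^ 2 + 1) x * Lc t x + m * (5 * e)) - G + L * ((√(1 + (R + 2) ^ 2))⁻¹) ^ 3 - (M3 * (d * m) + 1 / 2 * m * M3 ^ 2 * (d * m)) by linarith) hJ
      have p2 := mul_nonneg (show 0 ≤ 1 / 2 * (K + 3 - 2 * (cut (R ^ 2 + 1) x * Lc t x + m * (5 * e))) - 1 / 2 by linarith) hU
      unfold sfL
      linarith
end coef2

section coef3
variable {d m : ℕ}

/-- smooth bounded approximation of the coefficients -/
structure Appr (s T ν₀ γ K R ϖ κ : ℝ) (q : CQ d) (A : CA d m) (C : CM d m)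
    (β b : CV d) (Qm : Icc s T → EE d → MM d) (Am : Icc s T → EE d → MA d m) (Cm : Icc s T → EE d → MM m)
    (βm : Icc s T → EE d → Fin d → ℝ) (χ : EE d → ℝ) : Prop where
  suq : ∀ i j, SU (fun t x => Qm t x i j)
  sua : ∀ i a b, SU (fun t x => Am t x i a b)
  suc : ∀ a b, SU (fun t x => Cm t x a b)
  sym : ∀ t x i j, Qm t x i j = Qm t x j i
  good : ∀ (t : Icc s T) (x z : EE d), ‖z - x‖ ≤ ϖ → Good ν₀ γ K (Qm t x) (Am t x) (Cm t x) (fun l i j => pd (fun y => Qm t y i j) x l) (fun l i a b => pd (fun y => Am t y i a b) x l)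
    (fun l a b => pd (fun y => Cm t y a b) x l) (fun i => χ x * b t z i + βm t x i)
  one : ∀ x, ‖x‖ ≤ R → χ x = 1
  cq : ∀ (t : Icc s T) x, ‖x‖ ≤ R → ∀ i j, |Qm t x i j - q t x i j| ≤ κ
  cA : ∀ (t : Icc s T) x, ‖x‖ ≤ R → ∀ i a b, |Am t x i a b - A t x i a b| ≤ κ
  cC : ∀ (t : Icc s T) x, ‖x‖ ≤ R → ∀ a b, |Cm t x a b - C t x a b| ≤ κ
  cb : ∀ (t : Icc s T) x, ‖x‖ ≤ R → ∀ i, |βm t x i - β t x i| ≤ κ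
  vb : ∃ Mv, ∀ (t : Icc s T) x i, |χ x * b t x i + βm t x i| ≤ Mv

theorem SU.mul' {κ : Type*} [PseudoMetricSpace κ] {F G : κ → EE d → ℝ} (h : SU F) (h' : SU G) : SU (fun t x => F t x * G t x) := ⟨h.1.mul h'.1, h.2.mul h'.2⟩
theorem SU.add' {κ : Type*} [PseudoMetricSpace κ] {F G : κ → EE d → ℝ} (h : SU F) (h' : SU G) : SU (fun t x => F t x + G t x) := ⟨h.1.add h'.1, h.2.add h'.2⟩
theorem SU.cst' {κ : Type*} [PseudoMetricSpace κ] (c : ℝ) : SU (fun (_ : κ) (_ : EE d) => c) := ⟨SB.cst c, UC.of_const (C := |c|) fun _ => le_rfl⟩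
theorem SU.sub' {κ : Type*} [PseudoMetricSpace κ] {F G : κ → EE d → ℝ} (h : SU F) (h' : SU G) : SU (fun t x => F t x - G t x) := by
  have := h.add' ((SU.cst' (-1)).mul' h')
  simpa [sub_eq_add_neg] using this

variable {s T ν₀ γ K : ℝ} {q : CQ d} {A : CA d m} {C : CM d m}
    {β b : CV d} {lam Lc X0 k0 : CF d}

set_option maxHeartbeats 800000 in
theorem COEF (D : Dat s T ν₀ γ K q A C β b lam Lc X0 k0) (hd : 1 ≤ d) (hm : 1 ≤ m) (hν : 0 < ν₀) (hγ : 0 < γ) (hK : 0 ≤ K) {R : ℝ} (hR : 0 ≤ R) :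
    ∃ ϖ > 0, ∀ κ > 0, ∃ Qm Am Cm βm χ, Appr s T ν₀ γ (K + 3) R ϖ κ q A C β b Qm Am Cm βm χ := by
  obtain ⟨M, hM, hB⟩ := D.bdd (R + 3)
  obtain ⟨M1, hM1, hp1⟩ : ∃ M1, 0 ≤ M1 ∧ ∀ x l, |pd (cut (d := d) (R ^ 2 + 1)) x l| ≤ M1 := by
    obtain ⟨M1, h0, h1⟩ := fin_bdd (F := fun (l : Fin d) (_ : Unit) x => pd (cut (d := d) (R ^ 2 + 1)) x l) fun l => ((cut_SB (R ^ 2 + 1)).pd l).bdd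
    exact ⟨M1, h0, fun x l => h1 l () x⟩
  obtain ⟨η, hη0, hη, hη1, hquot⟩ := quot (ν₀ := ν₀) (M := √d * m * M + d * M) (tol := 1 / (4 * γ)) hν (pz)
  have htol : γ * (1 / (4 * γ)) ≤ 1 / 4 := by
    have : γ * (1 / (4 * γ)) = 1 / 4 := by field_simp
    exact this.le
  have hsd : 0 ≤ √d := sqrt_nonneg _
  obtain ⟨P, hP⟩ : ∃ P, P = 20 * m + 5 * d + 6 * (√d * m) + d + d * d + 5 + (1:ℝ) := ⟨_, rfl⟩
  have hP0 : 0 < P := by rw [hP]; positivity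
  obtain ⟨e, he⟩ : ∃ e, e = min 1 η / P := ⟨_, rfl⟩
  have he0 : 0 < e := by rw [he]; positivity
  have heP : e * P = min 1 η := by rw [he]; field_simp
  have hc1 : e * P ≤ 1 := heP.trans_le (min_le_left _ _)
  have hc2 : e * P ≤ η := heP.trans_le (min_le_right _ _)
  have t1 : 0 ≤ m * e := pz
  have t2 : 0 ≤ d * e := pz
  have t3 : 0 ≤ √d * m * e := pz
  have t4 : 0 ≤ d * d * e := pz
  have heE : e * P = 20 * (m * e) + 5 * (d * e) + 6 * (√d * m * e) + d * e + d * d * e + 5 * e + e := by rw [hP]; ring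
  rw [heE] at hc1 hc2
  have c1 : 20 * m * e ≤ 1 := by linarith
  have c2 : 5 * e ≤ 1 := by linarith
  have c3 : 5 * d * e + e ≤ η := by linarith
  have c4 : √d * m * (6 * e) + d * (e + d * e) ≤ η := by linarith
  have c4' : √d * m * (6 * e) ≤ η := by linarith
  obtain ⟨L, hL, hLL⟩ : ∃ L, 0 ≤ L ∧ (M1 * (M + ν₀) + M) * (d * m) + 1 / 2 * m * (M1 * (M + ν₀) + M) ^ 2 * (d * m) + γ * (√d * m * (M + 1) + d * (d * (M1 * (M + ν₀) + M))) ^ 2 / (ν₀ / 2) ≤ L * ((√(1 + (R + 2) ^ 2))⁻¹) ^ 3 := by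
    have h0 : 0 < ((√(1 + (R + 2) ^ 2))⁻¹) ^ 3 := pz
    exact ⟨((M1 * (M + ν₀) + M) * (d * m) + 1 / 2 * m * (M1 * (M + ν₀) + M) ^ 2 * (d * m) + γ * (√d * m * (M + 1) + d * (d * (M1 * (M + ν₀) + M))) ^ 2 / (ν₀ / 2)) / ((√(1 + (R + 2) ^ 2))⁻¹) ^ 3, pz, by rw [div_mul_cancel₀ _ h0.ne']⟩
  obtain ⟨ϖ, hnear, hϖ⟩ := ((D.near (R + 2) he0).and self_mem_nhdsWithin).exists
  refine ⟨ϖ, hϖ, fun κ hκ => ?_⟩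
  obtain ⟨δ₁, hnκ, hδ₁⟩ := ((D.near (R + 2) hκ).and self_mem_nhdsWithin).exists
  obtain ⟨δ, hδ0, hδ1, hδ2, hδ3⟩ : ∃ δ > 0, δ ≤ 1 ∧ δ ≤ ϖ ∧ δ ≤ δ₁ := ⟨min 1 (min ϖ δ₁), pz, min_le_left _ _, (min_le_right _ _).trans (min_le_left _ _), (min_le_right _ _).trans (min_le_right _ _)⟩
  obtain ⟨k, hk⟩ := exists_ker d hδ0
  let gq : ℝ → Fin d → Fin d → EE d → ℝ := fun t i j => mol k (tr ((R + 2 + 1) ^ 2) fun y => q t y i j)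
  let gA : ℝ → Fin d → Fin m → Fin m → EE d → ℝ := fun t i a b => mol k (tr ((R + 2 + 1) ^ 2) fun y => A t y i a b)
  let gC : ℝ → Fin m → Fin m → EE d → ℝ := fun t a b => mol k (tr ((R + 2 + 1) ^ 2) fun y => C t y a b)
  let gb : ℝ → Fin d → EE d → ℝ := fun t i => mol k (tr ((R + 2 + 1) ^ 2) fun y => β t y i)
  have sq : ∀ i j, SU (fun (t : Icc s T) x => gq t i j x) := fun i j => (D.hq i j).SU _ hk
  have sA : ∀ i a b, SU (fun (t : Icc s T) x => gA t i a b x) := fun i a b => (D.hA i a b).SU _ hk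
  have sC : ∀ a b, SU (fun (t : Icc s T) x => gC t a b x) := fun a b => (D.hC a b).SU _ hk
  have sb : ∀ i, SU (fun (t : Icc s T) x => gb t i x) := fun i => (D.hβ i).SU _ hk
  have hcut : SU (fun (_ : Icc s T) => cut (d := d) (R ^ 2 + 1)) := cut_SU _
  have hPsi : ∀ i, SU (fun (_ : Icc s T) => Psi (d := d) (R ^ 2) i) := fun i => Psi_SU _ i
  have dcut : ∀ x, DifferentiableAt ℝ (cut (d := d) (R ^ 2 + 1)) x := fun x => smooth_diff (cut_smooth _) x
  have dPsi : ∀ i x, DifferentiableAt ℝ (Psi (d := d) (R ^ 2) i) x := fun i x => (Psi_SB (Ω := Unit) (R ^ 2) i).diff () x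
  have in1 : ∀ x : EE d, ‖x‖ ≤ R → ‖x‖ ^ 2 ≤ R ^ 2 := fun x hx => pow_le_pow_left₀ (norm_nonneg _) hx 2
  have hβSU : ∀ i, SU (fun (t : Icc s T) x => cut (R ^ 2 + 1) x * gb t i x - L * Psi (R ^ 2) i x) := fun i => (hcut.mul' (sb i)).sub' ((SU.cst' L).mul' (hPsi i))
  refine ⟨fun t x i j => ν₀ * dl i j + cut (R ^ 2 + 1) x * (gq t i j x - ν₀ * dl i j), fun t x i a b => cut (R ^ 2 + 1) x * gA t i a b x - L * Psi (R ^ 2) i x * dl a b, fun t x a b => cut (R ^ 2 + 1) x * gC t a b x,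
    fun t x i => cut (R ^ 2 + 1) x * gb t i x - L * Psi (R ^ 2) i x, cut (R ^ 2 + 1), ?_⟩
  constructor
  · intro i j; exact (SU.cst' _).add' (hcut.mul' ((sq i j).sub' (SU.cst' _)))
  · intro i a b; exact (hcut.mul' (sA i a b)).sub' (((SU.cst' L).mul' (hPsi i)).mul' (SU.cst' _))
  · intro a b; exact hcut.mul' (sC a b)
  · intro t x i j
    have : gq t i j = gq t j i := by
      show mol k (tr _ fun y => q t y i j) = mol k (tr _ fun y => q t y j i)
      congr 2; funext y; exact D.hqs t t.2 y i j
    have h2 : dl i j = dl j i := by unfold dl; simp [eq_comm]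
    simp only [this, h2]
  · intro t x z hz
    have e1 : (fun l i j => pd (fun y => ν₀ * dl i j + cut (R ^ 2 + 1) y * (gq t i j y - ν₀ * dl i j)) x l) = fun l i j => pd (cut (R ^ 2 + 1)) x l * (gq t i j x - ν₀ * dl i j) + cut (R ^ 2 + 1) x * pd (gq t i j) x l := by
      funext l i j
      have hd1 := (sq i j).1.diff t x
      rw [pd_add (differentiableAt_const _) ((dcut x).fun_mul (hd1.fun_sub (differentiableAt_const _))), pd_const, pd_mul (dcut x) (hd1.fun_sub (differentiableAt_const _)), pd_sub hd1 (differentiableAt_const _), pd_const]; ring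
    have e2 : (fun l i a b => pd (fun y => cut (R ^ 2 + 1) y * gA t i a b y - L * Psi (R ^ 2) i y * dl a b) x l) = fun l i a b => (pd (cut (R ^ 2 + 1)) x l * gA t i a b x + cut (R ^ 2 + 1) x * pd (gA t i a b) x l) - L * pd (Psi (R ^ 2) i) x l * dl a b := by
      funext l i a b
      have hd1 := (sA i a b).1.diff t x
      have e3 : (fun y => cut (R ^ 2 + 1) y * gA t i a b y - L * Psi (R ^ 2) i y * dl a b) = fun y => cut (R ^ 2 + 1) y * gA t i a b y - (L * dl a b) * Psi (R ^ 2) i y := by funext y; ring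
      rw [e3, pd_sub ((dcut x).fun_mul hd1) ((dPsi i x).const_mul _), pd_mul (dcut x) hd1, pd_const_mul _ (dPsi i x)]; ring
    have e4 : (fun l a b => pd (fun y => cut (R ^ 2 + 1) y * gC t a b y) x l) = fun l a b => pd (cut (R ^ 2 + 1)) x l * gC t a b x + cut (R ^ 2 + 1) x * pd (gC t a b) x l := by
      funext l a b
      rw [pd_mul (dcut x) ((sC a b).1.diff t x)]
    show Good ν₀ γ (K + 3) _ _ _ (fun l i j => pd (fun y => ν₀ * dl i j + cut (R ^ 2 + 1) y * (gq t i j y - ν₀ * dl i j)) x l) (fun l i a b => pd (fun y => cut (R ^ 2 + 1) y * gA t i a b y - L * Psi (R ^ 2) i y * dl a b) x l) (fun l a b => pd (fun y => cut (R ^ 2 + 1) y * gC t a b y) x l) _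
    rw [e1, e2, e4]
    by_cases hx2 : ‖x‖ ^ 2 ≤ R ^ 2 + 2
    · have hx : ‖x‖ ≤ R + 2 := abs_le_of_sq_le_sq' (by nlinarith) (by linarith) |>.2
      exact good_in D hd hm hν hγ hK hM hM1 htol hη hL hR hquot he0 c1 c2 c3 c4 t.2 hk hδ1 hδ2 hx hx2 hz (fun y hy => hnear t t.2 x y hx hy) (fun y hy => hB t t.2 y hy) (hp1 x) hLL (gq t) rfl (gA t) rfl (gC t) rfl (gb t) rfl
    · have h0 : cut (R ^ 2 + 1) x = 0 := cut_zero (by linarith)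
      have h1 : ∀ l, pd (cut (R ^ 2 + 1)) x l = 0 := pd_cut_zero (by linarith)
      simp only [h0, h1, zero_mul, add_zero, zero_add, zero_sub]
      have := good_out (K := K) (R := R) hd hm hν hγ hK (show 0 ≤ √d * m * M + d * M by positivity) htol hη hL hquot he0 c1 c3 c4' x (fun _ => 0) (fun _ => 0)
      simpa only [neg_mul] using this
  · intro x hx; exact cut_one (by have := in1 x hx; linarith)
  · intro t x hx i j
    have := in1 x hx
    have h1 : |gq t i j x - q t x i j| ≤ κ := tr_close hk hδ1 ((D.hq i j).df t t.2) (by linarith) fun y hy => (hnκ t t.2 x y (by linarith) (hy.trans hδ3)).1 i j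
    rw [cut_one (by linarith)]
    convert h1 using 2; ring
  · intro t x hx i a b'
    have := in1 x hx
    have h1 : |gA t i a b' x - A t x i a b'| ≤ κ := tr_close hk hδ1 ((D.hA i a b').df t t.2) (by linarith) fun y hy => (hnκ t t.2 x y (by linarith) (hy.trans hδ3)).2.2.1 i a b'
    rw [cut_one (by linarith), Psi_zero this]
    convert h1 using 2; ring
  · intro t x hx a b'
    have := in1 x hx
    have h1 : |gC t a b' x - C t x a b'| ≤ κ := tr_close hk hδ1 ((D.hC a b').df t t.2) (by linarith) fun y hy => (hnκ t t.2 x y (by linarith) (hy.trans hδ3)).2.2.2.1 a b'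
    rw [cut_one (by linarith)]
    convert h1 using 2; ring
  · intro t x hx i
    have := in1 x hx
    have h1 : |gb t i x - β t x i| ≤ κ := tr_close hk hδ1 ((D.hβ i).df t t.2) (by linarith) fun y hy => (hnκ t t.2 x y (by linarith) (hy.trans hδ3)).2.2.2.2.1 i
    rw [cut_one (by linarith), Psi_zero this]
    convert h1 using 2; ring
  · obtain ⟨N, hN0, hN⟩ := fin_bdd (F := fun i (t : Icc s T) x => cut (R ^ 2 + 1) x * gb t i x - L * Psi (R ^ 2) i x) fun i => (hβSU i).1.bdd
    refine ⟨M + N, fun t x i => (abs_add_le _ _).trans (add_le_add ?_ (hN i t x))⟩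
    by_cases hx2 : ‖x‖ ^ 2 ≤ R ^ 2 + 2
    · have hx : ‖x‖ ≤ R + 2 := abs_le_of_sq_le_sq' (by nlinarith) (by linarith) |>.2
      rw [abs_mul, abs_of_nonneg (cut_nonneg _ _)]
      exact (mul_le_of_le_one_left (abs_nonneg _) (cut_le _ _)).trans ((hB t t.2 x (by linarith)).2.2.2.2.2.2.2.1 i)
    · rw [cut_zero (by linarith)]; simpa using hM
end coef3

section maxp

/-- second derivative test -/
theorem sec1D {g g' : ℝ → ℝ} {c : ℝ} (hg : ∀ r, HasDerivAt g (g' r) r) (hc : HasDerivAt g' c 0) (hmax : ∀ r, g r ≤ g 0) : c ≤ 0 := by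
  by_contra h
  push Not at h
  have hd : deriv g = g' := funext fun r => (hg r).deriv
  have hm : IsLocalMax g 0 := Eventually.of_forall hmax
  have h0 : deriv g 0 = 0 := hm.deriv_eq_zero
  have hmin : IsLocalMin g 0 := isLocalMin_of_deriv_deriv_pos (by rw [hd, hc.deriv]; exact h) h0 (hg 0).continuousAt
  have he : g =ᶠ[nhds 0] fun _ => g 0 := by
    filter_upwards [hmin] with r hr
    exact le_antisymm (hmax r) hr
  have h1 : deriv g =ᶠ[nhds 0] fun _ => 0 := by
    have := he.deriv
    simpa using this
  have h2 : deriv (deriv g) 0 = 0 := by rw [h1.deriv_eq]; simp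
  rw [hd, hc.deriv] at h2
  linarith

theorem left_nonneg {g : ℝ → ℝ} {c s t : ℝ} (hst : s < t) (hg : HasDerivWithinAt g c (Iic t) t) (hmax : ∀ r ∈ Icc s t, g r ≤ g t) : 0 ≤ c := by
  have h1 := hg.mono (Iio_subset_Iic_self (a := t))
  have h2 := (hasDerivWithinAt_iff_tendsto_slope' (by simp)).1 h1
  refine ge_of_tendsto h2 ?_
  have : Ico s t ∈ nhdsWithin t (Iio t) := Ico_mem_nhdsLT hst
  filter_upwards [this] with r hr
  rw [slope_def_field]
  exact div_nonneg_of_nonpos (by linarith [hmax r ⟨hr.1, hr.2.le⟩]) (by linarith [hr.2])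

theorem pd_zero_of_max {d : ℕ} {f : EE d → ℝ} {x : EE d} (hmax : ∀ y, f y ≤ f x) (i : Fin d) : pd f x i = 0 := by
  have hm : IsLocalMax f x := Eventually.of_forall hmax
  rw [pd, hm.fderiv_eq_zero]; rfl

theorem trace_nonpos {d : ℕ} {f : EE d → ℝ} {x : EE d} (hf : ContDiff ℝ 2 f) (hmax : ∀ y, f y ≤ f x) {Q W : MM d} (h : ∀ i j, Q i j = ∑ a, W i a * W j a) :
    ∑ i, ∑ j, Q i j * pdd f x i j ≤ 0 := by
  have key : ∀ a, ∑ i, ∑ j, pdd f x i j * W i a * W j a ≤ 0 := by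
    intro a
    have h2 := hasDerivAt_line2 hf x (WithLp.toLp 2 fun i => W i a) 0
    simp only [zero_smul, add_zero] at h2
    refine sec1D (g := fun τ : ℝ => f (x + τ • (WithLp.toLp 2 fun i => W i a))) (fun r => hasDerivAt_line (hf.differentiable (by norm_num)).differentiableAt) h2 fun r => ?_
    simpa using hmax _
  have : ∑ i, ∑ j, Q i j * pdd f x i j = ∑ a, ∑ i, ∑ j, pdd f x i j * W i a * W j a := by
    rw [sum_comm]
    rw [sum_comm (γ := Fin d) (s := Finset.univ) (t := Finset.univ)]
    simp only [h, sum_mul]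
    conv_rhs => rw [sum_comm]
    refine sum_cg fun i => ?_
    rw [sum_comm]
    exact sum_cg fun i => sum_cg fun i => by ring
  rw [this]
  exact Finset.sum_nonpos fun a _ => key a

/-- attainment of the maximum of a function which is small off a compact set -/
theorem attain {X : Type*} [TopologicalSpace X] {S : Set X} (hS : IsClosed S) {Z : X → ℝ} (hZ : ContinuousOn Z S) {x0 : X} (h0 : x0 ∈ S) {K : Set X} (hK : IsCompact K)
    (hout : ∀ x ∈ S, x ∉ K → Z x ≤ Z x0) : ∃ x ∈ S, ∀ y ∈ S, Z y ≤ Z x := by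
  by_cases hne : (S ∩ K).Nonempty
  · obtain ⟨x, hx, hmx⟩ := (hK.inter_left hS).exists_isMaxOn hne (hZ.mono inter_subset_left)
    by_cases hxx : Z x ≤ Z x0
    · refine ⟨x0, h0, fun y hy => ?_⟩
      by_cases hyK : y ∈ K
      · exact (hmx ⟨hy, hyK⟩ : Z y ≤ Z x).trans hxx
      · exact hout y hy hyK
    · refine ⟨x, hx.1, fun y hy => ?_⟩
      by_cases hyK : y ∈ K
      · exact hmx ⟨hy, hyK⟩
      · exact (hout y hy hyK).trans (not_le.1 hxx).le
  · exact ⟨x0, h0, fun y hy => hout y hy fun hyK => hne ⟨y, hy, hyK⟩⟩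

end maxp

section wfun
variable {d m : ℕ}

/-- the Bernstein function -/
noncomputable def wf (c ε : ℝ) (U : EE d → Fin m → ℝ) (x : EE d) : ℝ :=
  (∑ a, U x a ^ 2) + c * (∑ l, ∑ a, pd (fun z => U z a) x l ^ 2) + ε

theorem wf_smooth (c ε : ℝ) {U : EE d → Fin m → ℝ} (hU : ∀ a, ContDiff ℝ ∞ (fun x => U x a)) : ContDiff ℝ ∞ (wf c ε U) := by
  unfold wf
  exact ((ContDiff.sum fun a _ => (hU a).pow 2).add (contDiff_const.mul (ContDiff.sum fun l _ => ContDiff.sum fun a _ => (smooth_pd (hU a) l).pow 2))).add contDiff_const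

theorem wf_pd (c ε : ℝ) {U : EE d → Fin m → ℝ} (hU : ∀ a, ContDiff ℝ ∞ (fun x => U x a)) (x : EE d) (i : Fin d) :
    pd (wf c ε U) x i = 2 * (∑ a, U x a * pd (fun z => U z a) x i) + 2 * c * ∑ l, ∑ a, pd (fun z => U z a) x l * pdd (fun z => U z a) x l i := by
  have h1 : ∀ a, DifferentiableAt ℝ (fun z => U z a) x := fun a => smooth_diff (hU a) x
  have h2 : ∀ a l, DifferentiableAt ℝ (fun y => pd (fun z => U z a) y l) x := fun a l => smooth_diff (smooth_pd (hU a) l) x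
  have e : wf c ε U = fun y => ((∑ a, U y a * U y a) + c * (∑ l, ∑ a, pd (fun z => U z a) y l * pd (fun z => U z a) y l)) + ε := by
    funext y; simp only [wf, sq]
  have g1 : DifferentiableAt ℝ (fun y => ∑ a, U y a * U y a) x := DifferentiableAt.fun_sum fun a _ => (h1 a).fun_mul (h1 a)
  have g2 : DifferentiableAt ℝ (fun y => ∑ l, ∑ a, pd (fun z => U z a) y l * pd (fun z => U z a) y l) x := DifferentiableAt.fun_sum fun l _ => DifferentiableAt.fun_sum fun a _ => (h2 a l).fun_mul (h2 a l)
  rw [e, pd_add (g1.fun_add (g2.const_mul c)) (differentiableAt_const _), pd_const, add_zero, pd_add g1 (g2.const_mul c), pd_const_mul c g2,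
    pd_sum _ (fun a _ => (h1 a).fun_mul (h1 a)), pd_sum _ (fun l _ => DifferentiableAt.fun_sum fun a _ => (h2 a l).fun_mul (h2 a l))]
  congr 1
  · rw [mul_sm]
    refine sum_cg fun a => ?_
    rw [pd_mul (h1 a) (h1 a)]; ring
  · rw [mul_comm 2 c, mul_assoc, mul_sm (b := 2)]
    congr 1
    refine sum_cg fun l => ?_
    rw [pd_sum _ (fun a _ => (h2 a l).fun_mul (h2 a l)), mul_sm]
    refine sum_cg fun a => ?_
    rw [pd_mul (h2 a l) (h2 a l)]; ring

theorem wf_pd2 (c ε : ℝ) {U : EE d → Fin m → ℝ} (hU : ∀ a, ContDiff ℝ ∞ (fun x => U x a)) (x : EE d) (i j : Fin d) :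
    pdd (wf c ε U) x i j = 2 * (∑ a, (pd (fun z => U z a) x i * pd (fun z => U z a) x j + U x a * pdd (fun z => U z a) x i j)) +
      2 * c * ∑ l, ∑ a, (pdd (fun z => U z a) x l i * pdd (fun z => U z a) x l j + pd (fun z => U z a) x l * pd (fun y' => pdd (fun z => U z a) y' l i) x j) := by
  have h1 : ∀ a, DifferentiableAt ℝ (fun z => U z a) x := fun a => smooth_diff (hU a) x
  have h2 : ∀ a l, DifferentiableAt ℝ (fun y => pd (fun z => U z a) y l) x := fun a l => smooth_diff (smooth_pd (hU a) l) x
  have h3 : ∀ a l i, DifferentiableAt ℝ (fun y' => pdd (fun z => U z a) y' l i) x := fun a l i => smooth_diff (smooth_pd (smooth_pd (hU a) l) i) x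
  have e : (fun y => pd (wf c ε U) y i) = fun y => 2 * (∑ a, U y a * pd (fun z => U z a) y i) + 2 * c * ∑ l, ∑ a, pd (fun z => U z a) y l * pdd (fun z => U z a) y l i := by
    funext y; exact wf_pd c ε hU y i
  have g1 : DifferentiableAt ℝ (fun y => ∑ a, U y a * pd (fun z => U z a) y i) x := DifferentiableAt.fun_sum fun a _ => (h1 a).fun_mul (h2 a i)
  have g2 : DifferentiableAt ℝ (fun y' => ∑ l, ∑ a, pd (fun z => U z a) y' l * pdd (fun z => U z a) y' l i) x := DifferentiableAt.fun_sum fun l _ => DifferentiableAt.fun_sum fun a _ => (h2 a l).fun_mul (h3 a l i)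
  rw [e, pd_add (g1.const_mul 2) (g2.const_mul _), pd_const_mul _ g2, pd_const_mul _ g1,
    pd_sum _ (fun a _ => (h1 a).fun_mul (h2 a i)), pd_sum _ (fun l _ => DifferentiableAt.fun_sum fun a _ => (h2 a l).fun_mul (h3 a l i))]
  congr 2
  · refine sum_cg fun a => ?_
    rw [pd_mul (h1 a) (h2 a i)]; ring
  · refine sum_cg fun l => ?_
    rw [pd_sum _ (fun a _ => (h2 a l).fun_mul (h3 a l i))]
    refine sum_cg fun a => ?_
    rw [pd_mul (h2 a l) (h3 a l i)]; ring

/-- derivative of the operator -/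
theorem pd_opL {Q : EE d → MM d} {A : EE d → MA d m} {C : EE d → MM m} {U : EE d → Fin m → ℝ}
    (hU : ∀ a, ContDiff ℝ ∞ (fun x => U x a)) (x : EE d) (hQ : ∀ i j, DifferentiableAt ℝ (fun y => Q y i j) x) (hA : ∀ i a b, DifferentiableAt ℝ (fun y => A y i a b) x)
    (hC : ∀ a b, DifferentiableAt ℝ (fun y => C y a b) x) (a : Fin m) (l : Fin d) :
    DifferentiableAt ℝ (fun y => opL Q A C U y a) x ∧ pd (fun y => opL Q A C U y a) x l =
      (∑ i, ∑ j, (pd (fun y => Q y i j) x l * pdd (fun z => U z a) x i j + Q x i j * pd (fun y' => pdd (fun z => U z a) y' l i) x j)) +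
      (∑ i, ∑ b, (pd (fun y => A y i a b) x l * pd (fun z => U z b) x i + A x i a b * pdd (fun z => U z b) x l i)) +
      ∑ b, (pd (fun y => C y a b) x l * U x b + C x a b * pd (fun z => U z b) x l) := by
  have h1 : ∀ a, DifferentiableAt ℝ (fun z => U z a) x := fun a => smooth_diff (hU a) x
  have h2 : ∀ a l, DifferentiableAt ℝ (fun y => pd (fun z => U z a) y l) x := fun a l => smooth_diff (smooth_pd (hU a) l) x
  have h3 : ∀ a l i, DifferentiableAt ℝ (fun y' => pdd (fun z => U z a) y' l i) x := fun a l i => smooth_diff (smooth_pd (smooth_pd (hU a) l) i) x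
  have s2 : ∀ b i l x, pdd (fun z => U z b) x i l = pdd (fun z => U z b) x l i := fun b i l x => pd_pd_symm (contDiff_infty.1 (hU b) 2) x i l
  have s3 : ∀ i j, pd (fun y' => pdd (fun z => U z a) y' i j) x l = pd (fun y' => pdd (fun z => U z a) y' l i) x j := by
    intro i j
    rw [pd_pd_symm (contDiff_infty.1 (smooth_pd (hU a) i) 2)]
    congr 1; funext y'; exact s2 a i l y'
  have g1 : ∀ i j, DifferentiableAt ℝ (fun y' => Q y' i j * pdd (fun z => U z a) y' i j) x := fun i j => (hQ i j).fun_mul (h3 a i j)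
  have g2 : ∀ i b, DifferentiableAt ℝ (fun y => A y i a b * pd (fun z => U z b) y i) x := fun i b => (hA i a b).fun_mul (h2 b i)
  have g3 : ∀ b, DifferentiableAt ℝ (fun y => C y a b * U y b) x := fun b => (hC a b).fun_mul (h1 b)
  have G1 : DifferentiableAt ℝ (fun y' => ∑ i, ∑ j, Q y' i j * pdd (fun z => U z a) y' i j) x := DifferentiableAt.fun_sum fun i _ => DifferentiableAt.fun_sum fun j _ => g1 i j
  have G2 : DifferentiableAt ℝ (fun y => ∑ i, ∑ b, A y i a b * pd (fun z => U z b) y i) x := DifferentiableAt.fun_sum fun i _ => DifferentiableAt.fun_sum fun j _ => g2 i j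
  have G3 : DifferentiableAt ℝ (fun y => ∑ b, C y a b * U y b) x := DifferentiableAt.fun_sum fun j _ => g3 j
  unfold opL
  refine ⟨(G1.fun_add G2).fun_add G3, ?_⟩
  rw [pd_add (G1.fun_add G2) G3, pd_add G1 G2, pd_sum _ (fun i _ => DifferentiableAt.fun_sum fun j _ => g1 i j), pd_sum _ (fun i _ => DifferentiableAt.fun_sum fun j _ => g2 i j), pd_sum _ (fun i _ => g3 i)]
  congr 1
  · congr 1
    · refine sum_cg fun i => ?_
      rw [pd_sum _ (fun j _ => g1 i j)]
      refine sum_cg fun j => ?_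
      rw [pd_mul (hQ i j) (h3 a i j), s3]
    · refine sum_cg fun i => ?_
      rw [pd_sum _ (fun j _ => g2 i j)]
      refine sum_cg fun j => ?_
      rw [pd_mul (hA i a j) (h2 j i), s2 j i l]
  · refine sum_cg fun b => ?_
    rw [pd_mul (hC a b) (h1 b)]

end wfun

section wineq
variable {d m : ℕ}

theorem wf_pos {c ε : ℝ} (hc : 0 ≤ c) (hε : 0 < ε) (U : EE d → Fin m → ℝ) (x : EE d) : 0 < wf c ε U x := by
  unfold wf; positivity

theorem wf_ineq {ν₀ γ K a c ε s T M κ : ℝ} (hν : 0 < ν₀) (hγ : 0 < γ) (hK : 0 ≤ K)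
    (ha : 0 < a) (ha1 : a ≤ 1 / 3) (ha2 : a ≤ ν₀ / (16 * γ)) (hc : 0 ≤ c) (hc1 : 1 / (2 * γ) ≤ 2 - 4 * c) (hε : 0 < ε)
    {Q : Icc s T → EE d → MM d} {A : Icc s T → EE d → MA d m} {C : Icc s T → EE d → MM m}
    {f : EE d → Fin m → ℝ} {u : CU d m} (S : AppSol s T Q A C f M κ u)
    (hQ : ∀ i j, SU (fun t x => Q t x i j)) (hA : ∀ i a b, SU (fun t x => A t x i a b)) (hC : ∀ a b, SU (fun t x => C t x a b))
    (hs : ∀ t x i j, Q t x i j = Q t x j i) {t : ℝ} (ht : t ∈ Ioc s T) {x : EE d} {V : Fin d → ℝ} {τ : Icc s T} (hτ : (τ : ℝ) = t)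
    (hg : Good ν₀ γ K (Q τ x) (A τ x) (C τ x) (fun l i j => pd (fun y => Q τ y i j) x l) (fun l i a b => pd (fun y => A τ y i a b) x l) (fun l a b => pd (fun y => C τ y a b) x l) V)
    {th : ℝ → ℝ} {th' : ℝ} (hth : HasDerivWithinAt th th' (Iic t) t) (h0 : 0 ≤ th t) (h1 : th t ≤ 1) (h2 : th' ≤ 1) :
    ∃ wt, HasDerivWithinAt (fun r => wf (a * th r) ε (u r) x) wt (Iic t) t ∧
      wt - (∑ i, ∑ j, Q τ x i j * pdd (wf (a * th t) ε (u t)) x i j) - (∑ i, V i * pd (wf (a * th t) ε (u t)) x i) +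
        c * ((∑ i, ∑ j, Q τ x i j * pd (wf (a * th t) ε (u t)) x i * pd (wf (a * th t) ε (u t)) x j) / wf (a * th t) ε (u t) x) ≤ (3 + 2 * K) * wf (a * th t) ε (u t) x + (m + d * m) * κ ^ 2 := by
  obtain rfl : τ = ⟨t, ht.1.le, ht.2⟩ := Subtype.ext hτ
  obtain ⟨G, hGs, hG1, hG2, hG3, hG4⟩ := S.eq t ht
  obtain ⟨τ, hτ'⟩ : ∃ τ : Icc s T, τ = ⟨t, ht.1.le, ht.2⟩ := ⟨_, rfl⟩
  rw [← hτ'] at hg hG3 hG4 ⊢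
  have hop := fun b l => pd_opL (Q := Q τ) (A := A τ) (C := C τ) (S.sm t) x (fun i j => (hQ i j).1.diff τ x) (fun i a b => (hA i a b).1.diff τ x) (fun a b => (hC a b).1.diff τ x) b l
  refine ⟨2 * (∑ b, u t x b * G x b) + 2 * a * th t * (∑ l, ∑ b, pd (fun z => u t z b) x l * pd (fun z => G z b) x l) + a * th' * ∑ l, ∑ b, pd (fun z => u t z b) x l ^ 2, ?_, ?_⟩
  · unfold wf
    have k1 := HasDerivWithinAt.fun_sum (u := Finset.univ) fun b (_ : b ∈ Finset.univ) => (hG1 x b).fun_pow 2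
    have k2 := HasDerivWithinAt.fun_sum (u := Finset.univ) fun l (_ : l ∈ Finset.univ) => HasDerivWithinAt.fun_sum (u := Finset.univ) fun b (_ : b ∈ Finset.univ) => (hG2 x b l).fun_pow 2
    refine ((k1.fun_add ((hth.const_mul a).fun_mul k2)).add_const ε).congr_deriv ?_
    have e1 : ∑ b, (2:ℕ) * u t x b ^ (2 - 1) * G x b = 2 * (∑ b, u t x b * G x b) := by
      rw [mul_sm]; refine sum_cg fun b => ?_
      norm_num; ring
    have e2 : ∑ l, ∑ b, (2:ℕ) * pd (fun z => u t z b) x l ^ (2 - 1) * pd (fun z => G z b) x l = 2 * (∑ l, ∑ b, pd (fun z => u t z b) x l * pd (fun z => G z b) x l) := by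
      simp only [mul_sm]; refine sum_cg fun b => sum_cg fun b => ?_
      norm_num; ring
    rw [e1, e2]; ring
  · have key := PBalg (a := a) (th := th t) (th' := th') (c := c) (ε := ε) hν hγ hK ha ha1 ha2 h0 h1 h2 hc hc1 hε (fun i j => hs τ x i j) hg
      (u := u t x) (G := G x) (e := fun b => G x b - opL (Q τ) (A τ) (C τ) (u t) x b) (J := fun l b => pd (fun z => u t z b) x l) (GJ := fun l b => pd (fun z => G z b) x l)
      (e' := fun l b => pd (fun y => G y b - opL (Q τ) (A τ) (C τ) (u t) y b) x l) (H := fun l i b => pdd (fun z => u t z b) x l i)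
      (T := fun l i j b => pd (fun y' => pdd (fun z => u t z b) y' l i) x j) (w := wf (a * th t) ε (u t) x)
      (wi := fun i => pd (wf (a * th t) ε (u t)) x i) (wij := fun i j => pdd (wf (a * th t) ε (u t)) x i j)
      (fun b => by simp only [opL]; ring) (fun l b => by
        rw [pd_sub (smooth_diff (hGs b) x) (hop b l).1, (hop b l).2]; ring) rfl rfl
      (fun i => by rw [wf_pd _ _ (S.sm t)]; ring) (fun i j => by rw [wf_pd2 _ _ (S.sm t)]; ring)
    refine key.trans (add_le_add le_rfl ?_)
    have q1 : ∑ b, (G x b - opL (Q τ) (A τ) (C τ) (u t) x b) ^ 2 ≤ m * κ ^ 2 := by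
      refine (sum_le_card_nsmul _ _ (κ ^ 2) fun b _ => ?_).trans (by simp)
      exact sq_le_sq' (abs_le.1 (hG3 x b)).1 (abs_le.1 (hG3 x b)).2
    have q2 : ∑ l, ∑ b, (pd (fun y => G y b - opL (Q τ) (A τ) (C τ) (u t) y b) x l) ^ 2 ≤ d * m * κ ^ 2 := by
      refine (sum_le_card_nsmul _ _ (m * κ ^ 2) fun l _ => (sum_le_card_nsmul _ _ (κ ^ 2) fun b _ => ?_).trans (by simp)).trans (by simp [mul_assoc])
      exact sq_le_sq' (abs_le.1 (hG4 x b l)).1 (abs_le.1 (hG4 x b l)).2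
    linarith

end wineq

section pow
variable {d m : ℕ}

theorem pd_pow {w : EE d → ℝ} (hw : ContDiff ℝ ∞ w) (hpos : ∀ x, 0 < w x) (E r : ℝ) (x : EE d) (i : Fin d) :
    pd (fun y => E * w y ^ r) x i = E * (r * w x ^ (r - 1)) * pd w x i := by
  have h1 := (Real.hasDerivAt_rpow_const (x := w x) (p := r) (Or.inl (hpos x).ne')).const_mul E
  rw [pd_comp_real (f := fun v => E * v ^ r) (g := w) h1 (smooth_diff hw x)]

theorem pow_smooth {w : EE d → ℝ} (hw : ContDiff ℝ ∞ w) (hpos : ∀ x, 0 < w x) (E r : ℝ) : ContDiff ℝ ∞ (fun y => E * w y ^ r) :=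
  contDiff_const.mul (hw.rpow_const_of_ne fun x => (hpos x).ne')

theorem pd_pow2 {w : EE d → ℝ} (hw : ContDiff ℝ ∞ w) (hpos : ∀ x, 0 < w x) (E r : ℝ) (x : EE d) (i j : Fin d) :
    pdd (fun y => E * w y ^ r) x i j = E * (r * w x ^ (r - 1)) * (pdd w x i j + (r - 1) * (pd w x i * pd w x j / w x)) := by
  have e : (fun y => pd (fun y => E * w y ^ r) y i) = fun y => (E * r * w y ^ (r - 1)) * pd w y i := by
    funext y; rw [pd_pow hw hpos]; ring
  have hs := smooth_diff (pow_smooth hw hpos (E * r) (r - 1)) x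
  rw [e, pd_mul hs (smooth_diff (smooth_pd hw i) x), pd_pow hw hpos, Real.rpow_sub_one (hpos x).ne' (r - 1)]
  field_simp
  ring

theorem pow_ineq {w : EE d → ℝ} (hw : ContDiff ℝ ∞ w) (hpos : ∀ x, 0 < w x) {Q : MM d} {V : Fin d → ℝ} {x : EE d} {c r E H0 wt : ℝ}
    (hQ : 0 ≤ ∑ i, ∑ j, Q i j * pd w x i * pd w x j) (hc : 1 - r ≤ c) (hr : 0 < r) (hE : 0 < E)
    (h : wt - (∑ i, ∑ j, Q i j * pdd w x i j) - (∑ i, V i * pd w x i) + c * ((∑ i, ∑ j, Q i j * pd w x i * pd w x j) / w x) ≤ H0 * w x) :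
    E * (r * w x ^ (r - 1)) * wt - E * (r * H0) * w x ^ r - (∑ i, ∑ j, Q i j * pdd (fun y => E * w y ^ r) x i j) - (∑ i, V i * pd (fun y => E * w y ^ r) x i) ≤ 0 := by
  have hp := hpos x
  obtain ⟨S, hS⟩ : ∃ S, S = E * (r * w x ^ (r - 1)) := ⟨_, rfl⟩
  have hS0 : 0 < S := by rw [hS]; positivity
  have e1 : E * (r * H0) * w x ^ r = S * (H0 * w x) := by
    have := Real.rpow_sub_one hp.ne' r
    rw [hS, this]; field_simp
  have e2 : ∑ i, V i * pd (fun y => E * w y ^ r) x i = S * ∑ i, V i * pd w x i := by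
    rw [mul_sm]; refine sum_cg fun i => ?_
    rw [pd_pow hw hpos, ← hS]; ring
  have e3 : ∑ i, ∑ j, Q i j * pdd (fun y => E * w y ^ r) x i j = S * ((∑ i, ∑ j, Q i j * pdd w x i j) + (r - 1) * ((∑ i, ∑ j, Q i j * pd w x i * pd w x j) / w x)) := by
    simp only [mul_sm, sum_div, ← sum_ad]
    refine sum_cg fun i => sum_cg fun j => ?_
    rw [pd_pow2 hw hpos, ← hS]; ring
  rw [e1, e2, e3, ← hS]
  have h3 : 0 ≤ (∑ i, ∑ j, Q i j * pd w x i * pd w x j) / w x := div_nonneg hQ hp.le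
  have h4 := mul_le_r hc h3
  have h5 : wt - ((∑ i, ∑ j, Q i j * pdd w x i j) + (r - 1) * ((∑ i, ∑ j, Q i j * pd w x i * pd w x j) / w x)) - (∑ i, V i * pd w x i) - H0 * w x ≤ 0 := by linarith
  have h6 := mul_le_l h5 hS0.le
  linarith

theorem wf_cont {s T M κ : ℝ} {Q : Icc s T → EE d → MM d} {A : Icc s T → EE d → MA d m} {C : Icc s T → EE d → MM m}
    {f : EE d → Fin m → ℝ} {u : CU d m} (S : AppSol s T Q A C f M κ u) {c : ℝ → ℝ} (hc : ContinuousOn c (Icc s T)) (ε : ℝ) :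
    ContinuousOn (fun p : ℝ × EE d => wf (c p.1) ε (u p.1) p.2) (Icc s T ×ˢ univ) := by
  unfold wf
  have h1 : Continuous fun p : ℝ × EE d => ∑ a, u p.1 p.2 a ^ 2 := continuous_finset_sum _ fun a _ => (S.cu a).pow 2
  have h2 : Continuous fun p : ℝ × EE d => ∑ l, ∑ a, pd (fun z => u p.1 z a) p.2 l ^ 2 := continuous_finset_sum _ fun l _ => continuous_finset_sum _ fun a _ => (S.cpd a l).pow 2
  have h3 : ContinuousOn (fun p : ℝ × EE d => c p.1) (Icc s T ×ˢ univ) := hc.comp continuousOn_fst fun p hp => hp.1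
  exact (h1.continuousOn.add (h3.mul h2.continuousOn)).add continuousOn_const

theorem wf_le {M c ε : ℝ} (hc : 0 ≤ c) {U : EE d → Fin m → ℝ} {x : EE d} (h : ∀ a, |U x a| ≤ M ∧ ∀ l, |pd (fun z => U z a) x l| ≤ M) : wf c ε U x ≤ m * M ^ 2 + c * (d * (m * M ^ 2)) + ε := by
  unfold wf
  have q1 : ∑ b, U x b ^ 2 ≤ m * M ^ 2 := by
    refine (sum_le_card_nsmul _ _ (M ^ 2) fun b _ => ?_).trans (by simp)
    exact sq_le_sq' (abs_le.1 (h b).1).1 (abs_le.1 (h b).1).2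
  have q2 : ∑ l, ∑ b, pd (fun z => U z b) x l ^ 2 ≤ d * (m * M ^ 2) := by
    refine (sum_le_card_nsmul _ _ (m * M ^ 2) fun l _ => (sum_le_card_nsmul _ _ (M ^ 2) fun b _ => ?_).trans (by simp)).trans (by simp)
    exact sq_le_sq' (abs_le.1 ((h b).2 l)).1 (abs_le.1 ((h b).2 l)).2
  have := mul_le_l q2 hc
  linarith

theorem pd_quad (E D : ℝ) {w : EE d → ℝ} (hw : ContDiff ℝ ∞ w) (x : EE d) (i : Fin d) : pd (fun y : EE d => E * w y - D * (1 + ‖y‖ ^ 2)) x i = E * pd w x i - D * (2 * x i) := by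
  have hn := smooth_diff (smooth_nsq (d := d)) x
  have hw' := smooth_diff hw x
  rw [pd_sub (hw'.const_mul E) (((differentiableAt_const (1:ℝ)).fun_add hn).const_mul D), pd_const_mul _ hw', pd_const_mul _ ((differentiableAt_const (1:ℝ)).fun_add hn), pd_add (differentiableAt_const _) hn, pd_const, pd_nsq]; ring

theorem pd_quad2 (E D : ℝ) {w : EE d → ℝ} (hw : ContDiff ℝ ∞ w) (x : EE d) (i j : Fin d) :
    pd (fun y => pd (fun y : EE d => E * w y - D * (1 + ‖y‖ ^ 2)) y i) x j = E * pdd w x i j - D * 2 * dl i j := by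
  have e : (fun y => pd (fun y : EE d => E * w y - D * (1 + ‖y‖ ^ 2)) y i) = fun y => E * pd w y i - (D * 2) * y i := by
    funext y; rw [pd_quad E D hw]; ring
  have h1 := smooth_diff (smooth_pd hw i) x
  have h2 : DifferentiableAt ℝ (fun y : EE d => y i) x := ((EuclideanSpace.proj i : EE d →L[ℝ] ℝ).hasFDerivAt (x := x)).differentiableAt
  rw [e, pd_sub (h1.const_mul E) (h2.const_mul _), pd_const_mul _ h1, pd_const_mul _ h2, pd_coord]; rfl

end pow

section step1
variable {d m : ℕ}

theorem unif {s T ν₀ γ K R ϖ κ κ' M a W0 : ℝ} {q : CQ d} {A : CA d m} {C : CM d m}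
    {β b : CV d} {Qm : Icc s T → EE d → MM d} {Am : Icc s T → EE d → MA d m} {Cm : Icc s T → EE d → MM m}
    {βm : Icc s T → EE d → Fin d → ℝ} {χ : EE d → ℝ} {f : EE d → Fin m → ℝ} {u : CU d m} (P : Appr s T ν₀ γ K R ϖ κ q A C β b Qm Am Cm βm χ)
    (S : AppSol s T Qm Am Cm f M κ' u) (hϖ : 0 ≤ ϖ) (hν : 0 < ν₀) (hγ : 1 / 4 ≤ γ) (hK : 0 ≤ K) (ha : 0 < a) (ha1 : a ≤ 1 / 3) (ha2 : a ≤ ν₀ / (16 * γ)) (hκ : (m + d * m) * κ' ^ 2 ≤ 1)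
    (hW : ∀ x, wf a 1 f x ≤ W0) {t : ℝ} (ht : t ∈ Icc s T) (x : EE d) : wf a 1 (u t) x ≤ exp ((4 + 2 * K) * (t - s)) * W0 := by
  obtain ⟨H, hH⟩ : ∃ H, H = 4 + 2 * K := ⟨_, rfl⟩
  rw [← hH]
  by_contra hlt
  push Not at hlt
  have hsT : s ≤ T := ht.1.trans ht.2
  obtain ⟨Mv, hMv⟩ := P.vb
  obtain ⟨MQ, hMQ0, hMQ⟩ := fin_bdd (F := fun (ij : Fin d × Fin d) t x => Qm t x ij.1 ij.2) fun ij => (P.suq ij.1 ij.2).1.bdd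
  obtain ⟨L, hL⟩ : ∃ L, L = 2 * d * MQ + d * Mv ^ 2 + 2 := ⟨_, rfl⟩
  have hE0 : 0 < exp (-(H * (t - s))) := exp_pos _
  have hgap : 0 < exp (-(H * (t - s))) * wf a 1 (u t) x - W0 := by
    have := mul_lt_mul_of_pos_left hlt hE0
    rw [← mul_assoc, ← Real.exp_add, neg_add_cancel, Real.exp_zero, one_mul] at this
    linarith
  obtain ⟨ε, hε0, hε⟩ : ∃ ε > 0, W0 < exp (-(H * (t - s))) * wf a 1 (u t) x - ε * exp (L * (t - s)) * (1 + ‖x‖ ^ 2) := by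
    refine ⟨(exp (-(H * (t - s))) * wf a 1 (u t) x - W0) / (2 * (exp (L * (t - s)) * (1 + ‖x‖ ^ 2))), pz, ?_⟩
    have hpos : 0 < exp (L * (t - s)) * (1 + ‖x‖ ^ 2) := pz
    have : (exp (-(H * (t - s))) * wf a 1 (u t) x - W0) / (2 * (exp (L * (t - s)) * (1 + ‖x‖ ^ 2))) * exp (L * (t - s)) * (1 + ‖x‖ ^ 2) = (exp (-(H * (t - s))) * wf a 1 (u t) x - W0) / 2 := by
      field_simp
    rw [this]; linarith
  let Z : ℝ × EE d → ℝ := fun p => exp (-(H * (p.1 - s))) * wf a 1 (u p.1) p.2 - ε * exp (L * (p.1 - s)) * (1 + ‖p.2‖ ^ 2)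
  have hZc : ContinuousOn Z (Icc s T ×ˢ univ) := by
    refine ContinuousOn.sub (ContinuousOn.mul (by fun_prop) (wf_cont S (c := fun _ => a) continuousOn_const 1)) (by fun_prop)
  obtain ⟨Mw, hMw⟩ : ∃ Mw, Mw = m * M ^ 2 + a * (d * (m * M ^ 2)) + 1 := ⟨_, rfl⟩
  have hwM : ∀ p ∈ Icc s T ×ˢ (univ : Set (EE d)), wf a 1 (u p.1) p.2 ≤ Mw := fun p hp => by rw [hMw]; exact wf_le ha.le fun a => S.bd p.1 hp.1 p.2 a
  have hMw0 : 0 ≤ Mw := by rw [hMw]; positivity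
  have hL0 : 0 ≤ L := by rw [hL]; positivity
  have hHp : 0 ≤ H := by rw [hH]; positivity
  obtain ⟨⟨t1, x1⟩, hp1, hmax⟩ := attain (S := Icc s T ×ˢ (univ : Set (EE d))) (isClosed_Icc.prod isClosed_univ) hZc (x0 := (t, x)) ⟨ht, mem_univ _⟩
    (K := Icc s T ×ˢ Metric.closedBall 0 (1 + |Mw - Z (t, x)| / ε)) (isCompact_Icc.prod (isCompact_closedBall _ _)) (fun p hp hpK => by
      have hn : 1 + |Mw - Z (t, x)| / ε < ‖p.2‖ := by
        by_contra h
        exact hpK ⟨hp.1, by simpa using not_lt.1 h⟩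
      have h1 : 1 ≤ ‖p.2‖ := by
        have : 0 ≤ |Mw - Z (t, x)| / ε := pz
        linarith
      have h2 : |Mw - Z (t, x)| / ε ≤ 1 + ‖p.2‖ ^ 2 := by nlinarith
      rw [div_le_iff₀ hε0] at h2
      have h3 : exp (-(H * (p.1 - s))) * wf a 1 (u p.1) p.2 ≤ 1 * Mw :=
        mul_le_mul (Real.exp_le_one_iff.2 (by have := mul_nonneg hHp (sub_nonneg.2 hp.1.1); linarith)) (hwM p hp) (wf_pos ha.le one_pos _ _).le zero_le_one
      have h4 : ε * 1 * (1 + ‖p.2‖ ^ 2) ≤ ε * exp (L * (p.1 - s)) * (1 + ‖p.2‖ ^ 2) := by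
        gcongr
        exact Real.one_le_exp (mul_nonneg hL0 (sub_nonneg.2 hp.1.1))
      have h5 := le_abs_self (Mw - Z (t, x))
      show exp (-(H * (p.1 - s))) * wf a 1 (u p.1) p.2 - ε * exp (L * (p.1 - s)) * (1 + ‖p.2‖ ^ 2) ≤ _
      linarith)
  have ht1 : t1 ∈ Icc s T := hp1.1
  have hZ1 : W0 < Z (t1, x1) := lt_of_lt_of_le hε (hmax (t, x) ⟨ht, mem_univ _⟩)
  rcases eq_or_lt_of_le ht1.1 with h | hst
  · subst h
    have : Z (s, x1) ≤ W0 := by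
      have h1 := hW x1
      have h2 : wf a 1 (u s) x1 = wf a 1 f x1 := by
        have : u s = f := funext S.ini
        rw [this]
      show exp (-(H * (s - s))) * wf a 1 (u s) x1 - ε * exp (L * (s - s)) * (1 + ‖x1‖ ^ 2) ≤ W0
      rw [h2, sub_self]
      simp only [mul_zero, neg_zero, Real.exp_zero, one_mul, mul_one]
      have : 0 ≤ ε * (1 + ‖x1‖ ^ 2) := pz
      linarith
    linarith
  have htI : t1 ∈ Ioc s T := ⟨hst, ht1.2⟩
  have hγ0 : 0 < γ := by linarith
  obtain ⟨τ, hτ⟩ : ∃ τ : Icc s T, (τ : ℝ) = t1 := ⟨⟨t1, ht1⟩, rfl⟩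
  have hgood := P.good τ x1 x1 (by simpa using hϖ)
  obtain ⟨wt, hwt, hineq⟩ := wf_ineq (a := a) (c := 0) (ε := 1) hν hγ0 hK ha ha1 ha2 le_rfl (by rw [div_le_iff₀ (pz)]; linarith) one_pos S P.suq P.sua P.suc P.sym htI hτ
    hgood (th := fun _ => 1) (th' := 0) (hasDerivWithinAt_const _ _ _) zero_le_one le_rfl zero_le_one
  simp only [mul_one, zero_mul, add_zero] at hwt hineq
  obtain ⟨w, hw⟩ : ∃ w, w = wf a 1 (u t1) := ⟨_, rfl⟩
  have hws : ContDiff ℝ ∞ w := hw ▸ wf_smooth a 1 (S.sm t1)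
  obtain ⟨E, hE⟩ : ∃ E, E = exp (-(H * (t1 - s))) := ⟨_, rfl⟩
  obtain ⟨D, hD⟩ : ∃ D, D = ε * exp (L * (t1 - s)) := ⟨_, rfl⟩
  have hEp : 0 < E := hE ▸ exp_pos _
  have hDp : 0 < D := hD ▸ mul_pos hε0 (exp_pos _)
  have hx : ∀ y, E * w y - D * (1 + ‖y‖ ^ 2) ≤ E * w x1 - D * (1 + ‖x1‖ ^ 2) := by
    intro y; rw [hE, hD, hw]; exact hmax (t1, y) ⟨ht1, mem_univ _⟩
  have hgr := fun i => pd_zero_of_max hx i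
  obtain ⟨lam, _, _, _, hlam, _, _, hell, _⟩ := hgood
  obtain ⟨W, hWr⟩ := exists_root (by linarith : 0 < lam) (fun i j => P.sym τ x1 i j) hell
  have htr := trace_nonpos (f := fun y : EE d => E * w y - D * (1 + ‖y‖ ^ 2)) (contDiff_infty.1 ((contDiff_const.mul hws).sub (contDiff_const.mul (contDiff_const.add smooth_nsq))) 2) hx hWr
  simp only [pd_quad2 E D hws] at htr
  simp only [pd_quad E D hws] at hgr
  have hdt : HasDerivWithinAt (fun r => Z (r, x1)) ((E * (-H)) * w x1 + E * wt - (D * L) * (1 + ‖x1‖ ^ 2)) (Iic t1) t1 := by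
    have k1 : HasDerivAt (fun r => exp (-(H * (r - s)))) (E * (-H)) t1 := by
      have := (((hasDerivAt_id t1).sub_const s).const_mul H).neg.exp
      simpa [hE] using this
    have k2 : HasDerivAt (fun r => ε * exp (L * (r - s))) (D * L) t1 := by
      have := ((((hasDerivAt_id t1).sub_const s).const_mul L).exp).const_mul ε
      simpa [hD, mul_assoc] using this
    have := (k1.hasDerivWithinAt.fun_mul hwt).fun_sub (k2.hasDerivWithinAt.mul_const (1 + ‖x1‖ ^ 2))
    refine this.congr_deriv ?_
    rw [← hE, ← hw]
  have hleft := left_nonneg hst hdt fun r hr => hmax (r, x1) ⟨⟨hr.1, hr.2.trans ht1.2⟩, mem_univ _⟩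
  rw [← hw] at hineq
  -- assemble
  have e1 : ∑ i, ∑ j, Qm τ x1 i j * (E * pdd w x1 i j - D * 2 * dl i j) = E * (∑ i, ∑ j, Qm τ x1 i j * pdd w x1 i j) - D * 2 * ∑ i, Qm τ x1 i i := by
    simp only [mul_sub, sum_sub_distrib, mul_sm]
    congr 1
    · exact sum_cg fun i => sum_cg fun j => by ring
    · refine sum_cg fun i => ?_
      simp [dl]; ring
  have e2 : E * (∑ i, (χ x1 * b τ x1 i + βm τ x1 i) * pd w x1 i) = D * ∑ i, 2 * (χ x1 * b τ x1 i + βm τ x1 i) * x1 i := by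
    simp only [mul_sm]
    refine sum_cg fun i => ?_
    have := hgr i
    have h2 : E * pd w x1 i = D * (2 * x1 i) := by linarith
    calc E * ((χ x1 * b τ x1 i + βm τ x1 i) * pd w x1 i) = (χ x1 * b τ x1 i + βm τ x1 i) * (E * pd w x1 i) := by ring
      _ = _ := by rw [h2]; ring
  have e3 : ∑ i, Qm τ x1 i i ≤ d * MQ := by
    refine (sum_le_card_nsmul _ _ MQ fun i _ => (le_abs_self _).trans (hMQ (i, i) τ x1)).trans (by simp)
  have e4 : ∑ i, 2 * (χ x1 * b τ x1 i + βm τ x1 i) * x1 i ≤ d * Mv ^ 2 + ‖x1‖ ^ 2 := by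
    calc ∑ i, 2 * (χ x1 * b τ x1 i + βm τ x1 i) * x1 i ≤ ∑ i, (Mv ^ 2 + x1 i ^ 2) := sum_le fun i => by
          have h1 := two_mul_le_add_sq (χ x1 * b τ x1 i + βm τ x1 i) (x1 i)
          have h2 : (χ x1 * b τ x1 i + βm τ x1 i) ^ 2 ≤ Mv ^ 2 := sq_le_sq' (abs_le.1 (hMv τ x1 i)).1 (abs_le.1 (hMv τ x1 i)).2
          linarith
      _ = d * Mv ^ 2 + ‖x1‖ ^ 2 := by rw [sum_ad, nsq]; simp
  rw [e1] at htr
  have hw1 : 1 ≤ w x1 := by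
    rw [hw]; unfold wf
    have : 0 ≤ (∑ b, u t1 x1 b ^ 2) + a * ∑ l, ∑ b, pd (fun z => u t1 z b) x1 l ^ 2 := pz
    linarith
  have f1 := mul_le_l hineq hEp.le
  have f2 : E * ((3 + 2 * K) * w x1 + (m + d * m) * κ' ^ 2) ≤ E * (H * w x1) := by
    refine mul_le_l ?_ hEp.le
    rw [hH]; linarith
  have f3 := mul_le_l e3 (by positivity : 0 ≤ D * 2)
  have f4 := mul_le_l e4 hDp.le
  have f5 : 0 ≤ D * L * ‖x1‖ ^ 2 - D * ‖x1‖ ^ 2 := by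
    have : 1 ≤ L := by rw [hL]; have : 0 ≤ 2 * d * MQ + d * Mv ^ 2 := pz
                       linarith
    have := mul_nonneg (mul_nonneg hDp.le (sub_nonneg.2 this)) (sq_nonneg ‖x1‖)
    linarith
  have f6 : D * L = D * (2 * d * MQ + d * Mv ^ 2 + 2) := by rw [hL]
  linarith

end step1

section AS
variable {d m : ℕ}

/-- the Bernstein subsolution -/
noncomputable def Ff (r H s a ε : ℝ) (u : CU d m) (t : ℝ) (x : EE d) : ℝ :=
  exp (-(H * (t - s))) * wf (a * ((t - s) / (1 + (t - s)))) ε (u t) x ^ r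

/-- approximate solutions with all the properties used in the comparison arguments -/
structure ApS (s T ν₀ R ϖ κ C0 a ε r H : ℝ) (q : CQ d) (A : CA d m) (C : CM d m)
    (β b : CV d) (f : EE d → Fin m → ℝ) (u : CU d m) (Qm : Icc s T → EE d → MM d) (βm : Icc s T → EE d → Fin d → ℝ) : Prop where
  ini : ∀ x, u s x = f x
  cu : ∀ k, Continuous (fun p : ℝ × EE d => u p.1 p.2 k)
  sm : ∀ t k, ContDiff ℝ ∞ (fun x => u t x k)
  bd : ∀ t ∈ Icc s T, ∀ x k, |u t x k| ≤ C0 ∧ ∀ l, |pd (fun z => u t z k) x l| ≤ C0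
  sym : ∀ t x i j, Qm t x i j = Qm t x j i
  ell : ∀ t x (w : Fin d → ℝ), ν₀ / 2 * ∑ i, w i ^ 2 ≤ ∑ i, ∑ j, Qm t x i j * w i * w j
  cq : ∀ (t : Icc s T) x, ‖x‖ ≤ R → ∀ i j, |Qm t x i j - q t x i j| ≤ κ
  cb : ∀ (t : Icc s T) x, ‖x‖ ≤ R → ∀ i, |βm t x i - β t x i| ≤ κ
  eqn : ∀ (t : Icc s T), s < t → ∀ x, ‖x‖ ≤ R → ∀ k, ∃ G, HasDerivWithinAt (fun τ => u τ x k) G (Iic (t : ℝ)) t ∧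
    |G - ((∑ i, ∑ j, Qm t x i j * pdd (fun z => u t z k) x i j) + (∑ i, ∑ l, A t x i k l * pd (fun z => u t z l) x i) + ∑ l, C t x k l * u t x l)| ≤ κ
  Fc : ContinuousOn (fun p : ℝ × EE d => Ff r H s a ε u p.1 p.2) (Icc s T ×ˢ univ)
  Fs : ∀ t ∈ Icc s T, ContDiff ℝ ∞ (Ff r H s a ε u t)
  sub : ∀ (t : Icc s T), s < t → ∀ x z : EE d, ‖x‖ ≤ R → ‖z - x‖ ≤ ϖ → ∃ Ft, HasDerivWithinAt (fun τ => Ff r H s a ε u τ x) Ft (Iic (t : ℝ)) t ∧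
    Ft - (∑ i, ∑ j, Qm t x i j * pdd (Ff r H s a ε u t) x i j) - (∑ i, (b t z i + βm t x i) * pd (Ff r H s a ε u t) x i) ≤ 0

variable {s T ν₀ γ K : ℝ} {q : CQ d} {A : CA d m} {C : CM d m}
    {β b : CV d} {lam Lc X0 k0 : CF d}

theorem theta_deriv {s t : ℝ} (h : s ≤ t) : HasDerivAt (fun r => (r - s) / (1 + (r - s))) (1 / (1 + (t - s)) ^ 2) t := by
  have h0 : 1 + (t - s) ≠ 0 := by linarith
  have h1 := ((hasDerivAt_id t).sub_const s)
  refine (h1.fun_div (h1.const_add 1) h0).congr_deriv ?_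
  simp

theorem AS (D : Dat s T ν₀ γ K q A C β b lam Lc X0 k0) (hd : 1 ≤ d) (hm : 1 ≤ m) (hsT : s < T) (hν : 0 < ν₀) (hγ : 1 / 4 ≤ γ) (hK : 0 ≤ K) {a r : ℝ}
    (ha : 0 < a) (ha1 : a ≤ 1 / 3) (ha2 : a ≤ ν₀ / (16 * γ)) (hr : 0 < r) (hr1 : 1 / (2 * γ) ≤ 2 - 4 * (1 - r)) {f : EE d → Fin m → ℝ} (hf : ∀ k, SB (fun (_ : Unit) x => f x k)) :
    ∃ C0, 0 ≤ C0 ∧ ∀ R, 0 ≤ R → ∃ ϖ > 0, ∀ ε > 0, ∀ κ > 0, ∃ u Qm βm, ApS s T ν₀ R ϖ κ C0 a ε r (r * (4 + 2 * (K + 3))) q A C β b f u Qm βm := by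
  have hγ0 : 0 < γ := by linarith
  obtain ⟨M1, hM1, h1⟩ := fin_bdd (F := fun k (_ : Unit) x => f x k) fun k => (hf k).bdd
  obtain ⟨M2, hM2, h2⟩ := fin_bdd (F := fun (kl : Fin m × Fin d) (_ : Unit) x => pd (fun z => f z kl.1) x kl.2) fun kl => ((hf kl.1).pd kl.2).bdd
  obtain ⟨W0, hW0, hW⟩ : ∃ W0, 0 ≤ W0 ∧ ∀ x, wf a 1 f x ≤ W0 := by
    refine ⟨m * (M1 + M2) ^ 2 + a * (d * (m * (M1 + M2) ^ 2)) + 1, pz, fun x => ?_⟩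
    refine wf_le ha.le fun k => ⟨(h1 k () x).trans (by linarith), fun l => (h2 (k, l) () x).trans (by linarith)⟩
  obtain ⟨Y, hY⟩ : ∃ Y, Y = exp ((4 + 2 * (K + 3)) * (T - s)) * W0 := ⟨_, rfl⟩
  have hY0 : 0 ≤ Y := by rw [hY]; positivity
  have hYa : 0 ≤ Y / a := pz
  refine ⟨√(Y + Y / a), sqrt_nonneg _, fun R hR => ?_⟩
  obtain ⟨C0, hC0⟩ : ∃ C0, C0 = √(Y + Y / a) := ⟨_, rfl⟩
  rw [← hC0]
  have hC00 : 0 ≤ C0 := hC0 ▸ sqrt_nonneg _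
  obtain ⟨ϖ, hϖ, hco⟩ := COEF D hd hm hν hγ0 hK hR
  refine ⟨ϖ, hϖ, fun ε hε κ hκ => ?_⟩
  obtain ⟨κ₁, hκ₁⟩ : ∃ κ₁, κ₁ = κ / (2 * (1 + (d * m + m) * C0)) := ⟨_, rfl⟩
  have hk1 : 0 < κ₁ := by rw [hκ₁]; positivity
  have hk1e : 2 * κ₁ + 2 * ((d * m + m) * C0 * κ₁) = κ := by rw [hκ₁]; field_simp
  have hk1p : 0 ≤ (d * m + m) * C0 * κ₁ := pz
  obtain ⟨Qm, Am, Cm, βm, χ, P⟩ := hco κ₁ hk1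
  obtain ⟨M, hM⟩ := EX2 hd hm hsT (half_pos hν) Qm Am Cm f P.suq P.sua P.suc P.sym (fun t x w => by
    obtain ⟨lam, _, _, _, hlam, _, _, hell, _⟩ := P.good t x x (by simpa using hϖ.le)
    exact (mul_le_r hlam (pz)).trans (hell w)) hf
  obtain ⟨κ₂, hk2, hk21, hk22, hk23, hk24⟩ : ∃ κ₂ > 0, κ₂ ≤ κ / 2 ∧ κ₂ ≤ 1 ∧ (m + d * m) * κ₂ ≤ 1 ∧ (m + d * m) * κ₂ ≤ ε := by
    have hmd : (0:ℝ) < 1 + (m + d * m) := pz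
    have e : (m + d * m : ℝ) * (min 1 ε / (1 + (m + d * m))) ≤ min 1 ε := by
      rw [mul_div_assoc', div_le_iff₀ hmd]
      have : 0 ≤ min 1 ε := pz
      linarith
    have hn : (0:ℝ) ≤ m + d * m := pz
    have e2 : (m + d * m : ℝ) * min (min (κ / 2) 1) (min 1 ε / (1 + (m + d * m))) ≤ min 1 ε := (mul_le_l (min_le_right _ _) hn).trans e
    exact ⟨min (min (κ / 2) 1) (min 1 ε / (1 + (m + d * m))), pz, (min_le_left _ _).trans (min_le_left _ _), (min_le_left _ _).trans (min_le_right _ _), e2.trans (min_le_left _ _), e2.trans (min_le_right _ _)⟩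
  have hsq : (m + d * m : ℝ) * κ₂ ^ 2 ≤ (m + d * m) * κ₂ := by
    refine mul_le_l ?_ (pz)
    nlinarith
  obtain ⟨u, S⟩ := hM κ₂ hk2
  have hu := fun t (ht : t ∈ Icc s T) x => unif P S hϖ.le hν hγ (by linarith : 0 ≤ K + 3) ha ha1 ha2 (hsq.trans hk23) hW ht x
  have hbd : ∀ t ∈ Icc s T, ∀ x k, |u t x k| ≤ C0 ∧ ∀ l, |pd (fun z => u t z k) x l| ≤ C0 := by
    intro t ht x k
    have h3 : wf a 1 (u t) x ≤ Y := by
      refine (hu t ht x).trans ?_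
      rw [hY]
      refine mul_le_r (Real.exp_le_exp.2 (mul_le_l (by linarith [ht.2]) (by linarith))) hW0
    unfold wf at h3
    have h4 : u t x k ^ 2 ≤ ∑ k, u t x k ^ 2 := single_le_sum (f := fun k => u t x k ^ 2) (fun _ _ => sq_nonneg _) (Finset.mem_univ k)
    have h5 : ∀ l, pd (fun z => u t z k) x l ^ 2 ≤ ∑ l, ∑ k, pd (fun z => u t z k) x l ^ 2 := fun l =>
      (single_le_sum (f := fun k => pd (fun z => u t z k) x l ^ 2) (fun _ _ => sq_nonneg _) (Finset.mem_univ k)).trans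
        (single_le_sum (f := fun l => ∑ k, pd (fun z => u t z k) x l ^ 2) (fun _ _ => sum_nn fun _ => sq_nonneg _) (Finset.mem_univ l))
    have h6 : 0 ≤ ∑ k, u t x k ^ 2 := sum_nn fun _ => sq_nonneg _
    have h7 : 0 ≤ a * ∑ l, ∑ k, pd (fun z => u t z k) x l ^ 2 := pz
    refine ⟨?_, fun l => ?_⟩
    · rw [hC0]; refine abs_le_sqrt ?_; linarith
    · rw [hC0]; refine abs_le_sqrt ?_
      have : pd (fun z => u t z k) x l ^ 2 ≤ Y / a := by
        rw [le_div_iff₀ ha]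
        have := mul_le_l (h5 l) ha.le
        linarith
      linarith
  have hth0 : ∀ t, s ≤ t → 0 ≤ (t - s) / (1 + (t - s)) := fun t ht => div_nonneg (by linarith) (by linarith)
  have hell : ∀ t x (w : Fin d → ℝ), ν₀ / 2 * ∑ i, w i ^ 2 ≤ ∑ i, ∑ j, Qm t x i j * w i * w j := by
    intro t x w
    obtain ⟨lam, _, _, _, hlam, _, _, hell, _⟩ := P.good t x x (by simpa using hϖ.le)
    exact (mul_le_r hlam (pz)).trans (hell w)
  refine ⟨u, Qm, βm, S.ini, S.cu, S.sm, hbd, P.sym, hell, fun t x hx i j => (P.cq t x hx i j).trans (by linarith), fun t x hx i => (P.cb t x hx i).trans (by linarith), ?_, ?_, ?_, ?_⟩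
  · intro t hst x hx k
    have htI : (t : ℝ) ∈ Ioc s T := ⟨hst, t.2.2⟩
    obtain ⟨G, hGs, hG1, hG2, hG3, hG4⟩ := S.eq t htI
    refine ⟨G x k, hG1 x k, ?_⟩
    have hh := hG3 x k
    have e : (⟨(t : ℝ), htI.1.le, htI.2⟩ : Icc s T) = t := rfl
    rw [e] at hh
    unfold opL at hh
    have d1 : |∑ i, ∑ l, Am t x i k l * pd (fun z => u t z l) x i - ∑ i, ∑ l, A t x i k l * pd (fun z => u t z l) x i| ≤ d * m * C0 * κ₁ := by
      rw [← sum_sub_distrib]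
      simp only [← sum_sub_distrib]
      refine (abs_sum_le_sum_abs _ _).trans ((sum_le_card_nsmul _ _ (m * (κ₁ * C0)) fun i _ => ?_).trans (by simp; linarith))
      refine (abs_sum_le_sum_abs _ _).trans ((sum_le_card_nsmul _ _ (κ₁ * C0) fun l _ => ?_).trans (by simp))
      rw [← sub_mul, abs_mul]
      exact mul_le_mul (P.cA t x hx i k l) ((hbd t t.2 x l).2 i) (abs_nonneg _) hk1.le
    have d2 : |∑ l, Cm t x k l * u t x l - ∑ l, C t x k l * u t x l| ≤ m * C0 * κ₁ := by
      rw [← sum_sub_distrib]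
      refine (abs_sum_le_sum_abs _ _).trans ((sum_le_card_nsmul _ _ (κ₁ * C0) fun l _ => ?_).trans (by simp; linarith))
      rw [← sub_mul, abs_mul]
      exact mul_le_mul (P.cC t x hx k l) ((hbd t t.2 x l).1) (abs_nonneg _) hk1.le
    rw [abs_le] at hh d1 d2 ⊢
    constructor <;> linarith
  · unfold Ff
    refine ContinuousOn.mul (by fun_prop) (ContinuousOn.rpow_const (wf_cont S (c := fun t => a * ((t - s) / (1 + (t - s)))) ?_ ε) fun p hp => Or.inl (wf_pos (mul_nonneg ha.le (hth0 _ hp.1.1)) hε _ _).ne')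
    exact continuousOn_const.mul fun t ht => (theta_deriv ht.1).continuousAt.continuousWithinAt
  · intro t ht
    exact pow_smooth (wf_smooth _ _ (S.sm t)) (fun x => wf_pos (mul_nonneg ha.le (hth0 _ ht.1)) hε _ _) _ _
  · intro t hst x z hx hz
    have htI : (t : ℝ) ∈ Ioc s T := ⟨hst, t.2.2⟩
    have hgood := P.good t x z hz
    have hth1 : ((t : ℝ) - s) / (1 + ((t : ℝ) - s)) ≤ 1 := by rw [div_le_one (by linarith)]; linarith
    have hth2 : 1 / (1 + ((t : ℝ) - s)) ^ 2 ≤ 1 := by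
      rw [div_le_one (by nlinarith)]; nlinarith
    have hc0 : (0:ℝ) ≤ max 0 (1 - r) := le_max_left _ _
    have hc1 : 1 / (2 * γ) ≤ 2 - 4 * max 0 (1 - r) := by
      rcases max_choice 0 (1 - r) with h | h <;> rw [h]
      · rw [div_le_iff₀ (pz)]; linarith
      · exact hr1
    obtain ⟨wt, hwt, hineq⟩ := wf_ineq (a := a) (c := max 0 (1 - r)) (ε := ε) hν hγ0 (by linarith : 0 ≤ K + 3) ha ha1 ha2 hc0 hc1 hε S P.suq P.sua P.suc P.sym htI rfl
      hgood (theta_deriv hst.le).hasDerivWithinAt (hth0 t hst.le) hth1 hth2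
    have hwpos : ∀ y, 0 < wf (a * (((t : ℝ) - s) / (1 + ((t : ℝ) - s)))) ε (u t) y := fun y => wf_pos (mul_nonneg ha.le (hth0 _ hst.le)) hε _ _
    have hweps : ε ≤ wf (a * (((t : ℝ) - s) / (1 + ((t : ℝ) - s)))) ε (u t) x := by
      unfold wf
      have := mul_nonneg ha.le (hth0 _ hst.le)
      have : 0 ≤ (∑ b, u t x b ^ 2) + a * (((t : ℝ) - s) / (1 + ((t : ℝ) - s))) * ∑ l, ∑ b, pd (fun z => u t z b) x l ^ 2 := pz
      linarith
    have key := pow_ineq (wf_smooth _ _ (S.sm t)) hwpos (Q := Qm t x) (V := fun i => χ x * b t z i + βm t x i) (x := x) (c := max 0 (1 - r)) (r := r) (E := exp (-(r * (4 + 2 * (K + 3)) * (t - s)))) (H0 := 4 + 2 * (K + 3)) (wt := wt)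
      (le_trans (pz) (hell t x _)) (le_max_right _ _) hr (exp_pos _) (hineq.trans (by linarith [hsq.trans hk24]))
    rw [P.one x hx] at key
    simp only [one_mul] at key
    refine ⟨_, ?_, key⟩
    have k1 : HasDerivAt (fun τ : ℝ => exp (-(r * (4 + 2 * (K + 3)) * (τ - s)))) (exp (-(r * (4 + 2 * (K + 3)) * (t - s))) * (-(r * (4 + 2 * (K + 3))))) t := by
      have := (((hasDerivAt_id (t:ℝ)).sub_const s).const_mul (r * (4 + 2 * (K + 3)))).neg.exp
      simpa using this
    refine (k1.hasDerivWithinAt.fun_mul (hwt.rpow_const (p := r) (Or.inl (hwpos x).ne'))).congr_deriv ?_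
    ring
end AS

section dbl
variable {d m : ℕ}

theorem Cf.lip {s T : ℝ} {g : CF d} (h : Cf s T g) (R : ℝ) : ∃ L, 0 ≤ L ∧ ∀ t ∈ Icc s T, ∀ x y, ‖x‖ ≤ R → ‖y‖ ≤ R → |g t x - g t y| ≤ L * ‖x - y‖ := by
  have hM : ∀ l, ∃ M, 0 ≤ M ∧ ∀ t ∈ Icc s T, ∀ x, ‖x‖ ≤ R → |pd (g t) x l| ≤ M := fun l => by
    obtain ⟨M, h1, h2⟩ := ((h.pb l R).and (eventually_ge_atTop 0)).exists
    exact ⟨M, h2, h1⟩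
  choose M hM0 hM using hM
  refine ⟨∑ l, M l, sum_nn fun l => hM0 l, fun t ht x y hx hy => ?_⟩
  have hc : Convex ℝ (Metric.closedBall (0 : EE d) R) := convex_closedBall _ _
  have := hc.norm_image_sub_le_of_norm_fderiv_le (𝕜 := ℝ) (f := g t) (C := ∑ l, M l) (x := y) (y := x) (fun z _ => h.df t ht z) (fun z hz => ?_) (by simpa using hy) (by simpa using hx)
  · simpa using this
  · refine ContinuousLinearMap.opNorm_le_bound _ (sum_nn fun l => hM0 l) fun a => ?_
    rw [fderiv_eq_sum', Real.norm_eq_abs, sum_mul]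
    refine (abs_sum_le_sum_abs _ _).trans (sum_le fun l => ?_)
    rw [abs_mul]
    exact mul_le_mul (hM l t ht z (by simpa using hz)) (by simpa using PiLp.norm_apply_le a l) (abs_nonneg _) (hM0 l)

theorem Cf.lip_fin {J : Type*} [Finite J] {s T : ℝ} {g : J → CF d} (h : ∀ j, Cf s T (g j)) (R : ℝ) : ∃ L, 0 ≤ L ∧ ∀ j, ∀ t ∈ Icc s T, ∀ x y, ‖x‖ ≤ R → ‖y‖ ≤ R → |g j t x - g j t y| ≤ L * ‖x - y‖ := by
  have := Fintype.ofFinite J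
  choose L hL0 hL using fun j => (h j).lip R
  refine ⟨∑ j, L j, sum_nn fun j => hL0 j, fun j t ht x y hx hy => (hL j t ht x y hx hy).trans ?_⟩
  exact mul_le_r (single_le_sum (fun j _ => hL0 j) (Finset.mem_univ j)) (norm_nonneg _)

theorem Cf.bd_fin {J : Type*} [Finite J] {s T : ℝ} {g : J → CF d} (h : ∀ j, Cf s T (g j)) (R : ℝ) : ∃ L, 0 ≤ L ∧ ∀ j, ∀ t ∈ Icc s T, ∀ x, ‖x‖ ≤ R → |g j t x| ≤ L := by
  have := Fintype.ofFinite J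
  have hM : ∀ j, ∃ M, 0 ≤ M ∧ ∀ t ∈ Icc s T, ∀ x, ‖x‖ ≤ R → |g j t x| ≤ M := fun l => by
    obtain ⟨M, h1, h2⟩ := (((h l).lb R).and (eventually_ge_atTop 0)).exists
    exact ⟨M, h2, h1⟩
  choose L hL0 hL using hM
  refine ⟨∑ j, L j, sum_nn fun j => hL0 j, fun j t ht x hx => (hL j t ht x hx).trans ?_⟩
  exact single_le_sum (fun j _ => hL0 j) (Finset.mem_univ j)

theorem root_trace {Q W M : MM d} (h : ∀ i j, Q i j = ∑ a, W i a * W j a) :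
    ∑ a, ∑ i, ∑ j, M i j * W i a * W j a = ∑ i, ∑ j, Q i j * M i j := by
  rw [sum_comm]
  refine sum_cg fun i => ?_
  rw [sum_comm]
  refine sum_cg fun j => ?_
  rw [h, sum_mul]
  exact sum_cg fun a => by ring

theorem nsq_sub (y z : EE d) : ‖y - z‖ ^ 2 = ∑ i, (y i - z i) ^ 2 := by rw [nsq]; rfl

theorem nsq_line (y z a a' : EE d) (r : ℝ) : ‖(y + r • a) - (z + r • a')‖ ^ 2 = ‖y - z‖ ^ 2 + r * (2 * ∑ i, (y i - z i) * (a i - a' i)) + r ^ 2 * ∑ i, (a i - a' i) ^ 2 := by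
  rw [nsq_sub, nsq_sub, mul_sm, mul_sm, mul_sm, ← sum_ad, ← sum_ad]
  refine sum_cg fun i => ?_
  simp only [PiLp.add_apply, PiLp.smul_apply, smul_eq_mul]; ring

theorem nsq_line_d (y z a a' : EE d) (r : ℝ) : HasDerivAt (fun r : ℝ => ‖(y + r • a) - (z + r • a')‖ ^ 2) (2 * (∑ i, (y i - z i) * (a i - a' i)) + 2 * r * ∑ i, (a i - a' i) ^ 2) r := by
  simp only [nsq_line]
  have h1 := ((hasDerivAt_id r).mul_const (2 * ∑ i, (y i - z i) * (a i - a' i)))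
  have h2 := ((hasDerivAt_pow 2 r).mul_const (∑ i, (a i - a' i) ^ 2))
  refine ((h1.fun_add h2).const_add (‖y - z‖ ^ 2)).congr_deriv ?_ |>.congr_of_eventuallyEq (Eventually.of_forall fun r => ?_)
  · simp
  · simp only [id]; ring

variable {S : EE d → EE d → ℝ} {φ : EE d → ℝ} {D n : ℝ} {y z : EE d}

/-- first order information along a line -/
theorem dbl_one (hφ : ContDiff ℝ 2 φ) (hmax : ∀ y' z', S y' z' - D * φ z' - n * ‖y' - z'‖ ^ 2 ≤ S y z - D * φ z - n * ‖y - z‖ ^ 2) {a a' : EE d} {c : ℝ}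
    (h : HasDerivAt (fun r : ℝ => S (y + r • a) (z + r • a')) c 0) : c = D * (∑ i, pd φ z i * a' i) + 2 * n * ∑ i, (y i - z i) * (a i - a' i) := by
  have h1 := hasDerivAt_line (x := z) (a := a') (t := 0) (hφ.differentiable (by norm_num)).differentiableAt
  simp only [zero_smul, add_zero] at h1
  have h2 := nsq_line_d y z a a' 0
  have h3 := (h.fun_sub (h1.const_mul D)).fun_sub (h2.const_mul n)
  have h4 : IsLocalMax (fun r : ℝ => S (y + r • a) (z + r • a') - D * φ (z + r • a') - n * ‖(y + r • a) - (z + r • a')‖ ^ 2) 0 :=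
    Eventually.of_forall fun r => by simpa using hmax (y + r • a) (z + r • a')
  have := h4.hasDerivAt_eq_zero h3
  linarith

theorem dbl_Y (hφ : ContDiff ℝ 2 φ) (hmax : ∀ y' z', S y' z' - D * φ z' - n * ‖y' - z'‖ ^ 2 ≤ S y z - D * φ z - n * ‖y - z‖ ^ 2) (i : Fin d) {c : ℝ}
    (h : HasDerivAt (fun r : ℝ => S (y + r • EuclideanSpace.single i (1:ℝ)) z) c 0) : c = 2 * n * (y i - z i) := by
  rw [dbl_one (c := c) (a := EuclideanSpace.single i 1) (a' := 0) hφ hmax (by simpa using h)]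
  simp

theorem dbl_Z (hφ : ContDiff ℝ 2 φ) (hmax : ∀ y' z', S y' z' - D * φ z' - n * ‖y' - z'‖ ^ 2 ≤ S y z - D * φ z - n * ‖y - z‖ ^ 2) (i : Fin d) {c : ℝ}
    (h : HasDerivAt (fun r : ℝ => S y (z + r • EuclideanSpace.single i (1:ℝ))) c 0) : c = D * pd φ z i - 2 * n * (y i - z i) := by
  rw [dbl_one (c := c) (a := 0) (a' := EuclideanSpace.single i 1) hφ hmax (by simpa using h)]
  simp; ring

theorem dbl_two (hφ : ContDiff ℝ 2 φ) (hmax : ∀ y' z', S y' z' - D * φ z' - n * ‖y' - z'‖ ^ 2 ≤ S y z - D * φ z - n * ‖y - z‖ ^ 2) {a a' : EE d} {h : ℝ → ℝ} {c : ℝ}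
    (h1 : ∀ r, HasDerivAt (fun r : ℝ => S (y + r • a) (z + r • a')) (h r) r) (h2 : HasDerivAt h c 0) :
    c ≤ D * (∑ i, ∑ j, pdd φ z i j * a' i * a' j) + 2 * n * ∑ i, (a i - a' i) ^ 2 := by
  have g1 := fun r => ((h1 r).fun_sub ((hasDerivAt_line (x := z) (a := a') (t := r) (hφ.differentiable (by norm_num)).differentiableAt).const_mul D)).fun_sub ((nsq_line_d y z a a' r).const_mul n)
  have g2 := hasDerivAt_line2 hφ z a' 0
  simp only [zero_smul, add_zero] at g2
  have g3 : HasDerivAt (fun r : ℝ => 2 * (∑ i, (y i - z i) * (a i - a' i)) + 2 * r * ∑ i, (a i - a' i) ^ 2) (2 * ∑ i, (a i - a' i) ^ 2) 0 := by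
    refine ((((hasDerivAt_id (0:ℝ)).const_mul 2).mul_const (∑ i, (a i - a' i) ^ 2)).const_add (2 * (∑ i, (y i - z i) * (a i - a' i)))).congr_deriv (by simp)
  have := sec1D g1 ((h2.fun_sub (g2.const_mul D)).fun_sub (g3.const_mul n)) fun r => by simpa using hmax (y + r • a) (z + r • a')
  linarith

end dbl

section dbl2
variable {d m : ℕ}

/-- the doubling-of-variables comparison scheme -/
theorem DBL {s T lam₀ : ℝ} (hsT : s < T) (hl : 0 < lam₀) {φ : EE d → ℝ} (hφ : ContDiff ℝ 2 φ) (hφ0 : ∀ x, 0 < φ x) (hφb : Tendsto φ (cocompact (EE d)) atTop)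
    {CS η ρ δ₀ : ℝ} (hCS : 0 ≤ CS) (hη : 0 < η) (hδ₀ : 0 < δ₀) : ∃ R₂, 0 ≤ R₂ ∧ ∀ R, R₂ ≤ R → ∀ c1 c2 ϖ : ℝ, 0 ≤ c1 → 0 ≤ c2 → 0 < ϖ → ∃ κ₀ > 0, ∀ κ, 0 < κ → κ ≤ κ₀ → ∀ S : ℝ → EE d → EE d → ℝ,
      ContinuousOn (fun p : ℝ × EE d × EE d => S p.1 p.2.1 p.2.2) (Icc s T ×ˢ univ) → (∀ t ∈ Icc s T, ∀ y z, S t y z ≤ CS) →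
      (∀ y z, ‖y - z‖ ≤ δ₀ → S s y z ≤ η) →
      (∀ t ∈ Ioc s T, ∀ y z, ‖y‖ ≤ R → ‖z‖ ≤ R → ‖y - z‖ ≤ ϖ → ‖y - z‖ ≤ 1 → ∀ D n, 0 < D → 0 < n →
        (∀ y' z', S t y' z' - D * φ z' - n * ‖y' - z'‖ ^ 2 ≤ S t y z - D * φ z - n * ‖y - z‖ ^ 2) →
        ∃ G, HasDerivWithinAt (fun τ => S τ y z) G (Iic t) t ∧ G ≤ D * (lam₀ * φ z) + c1 * (κ + ‖y - z‖) + c2 * n * (κ + ‖y - z‖) ^ 2) →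
      ∀ t ∈ Icc s T, ∀ y, ‖y‖ ≤ ρ → S t y y ≤ 3 * η := by
  obtain ⟨P, hP0, hP⟩ : ∃ P, 0 < P ∧ ∀ x : EE d, ‖x‖ ≤ ρ → φ x ≤ P := by
    obtain ⟨P, hP⟩ := (isCompact_closedBall (0 : EE d) ρ).bddAbove_image hφ.continuous.continuousOn
    refine ⟨max P 1, pz, fun x hx => le_max_of_le_left (hP ⟨x, by simpa using hx, rfl⟩)⟩
  have hτ : 0 < T - s := by linarith
  obtain ⟨ε₂, hε₂0, hε₂⟩ : ∃ e, 0 < e ∧ e * (exp (lam₀ * (T - s)) * P) = η := ⟨η / (exp (lam₀ * (T - s)) * P), pz, by field_simp⟩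
  obtain ⟨ε₁, hε₁0, hε₁⟩ : ∃ e, 0 < e ∧ e * (T - s) = η := ⟨η / (T - s), pz, by field_simp⟩
  obtain ⟨R₁, hR₁⟩ : ∃ R₁, ∀ x : EE d, R₁ < ‖x‖ → CS / ε₂ ≤ φ x := by
    have h1 := hφb.eventually (eventually_ge_atTop (CS / ε₂))
    rw [Filter.Eventually, Metric.mem_cocompact_iff_closedBall_compl_subset (0 : EE d)] at h1
    obtain ⟨r, hr⟩ := h1
    exact ⟨r, fun x hx => hr (by simpa using hx)⟩
  refine ⟨max R₁ 0 + 1, pz, fun R hR c1 c2 ϖ hc1 hc2 hϖ => ?_⟩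
  obtain ⟨K, hK⟩ : ∃ K, K = 2 * c2 + 1 := ⟨_, rfl⟩
  have hK0 : 0 < K := by linarith
  obtain ⟨w, hw, hw1, hw2, hw3⟩ : ∃ w, 0 < w ∧ w ≤ 1 ∧ w ≤ ϖ ∧ w ≤ δ₀ := ⟨min 1 (min ϖ δ₀), pz, min_le_left _ _, (min_le_right _ _).trans (min_le_left _ _), (min_le_right _ _).trans (min_le_right _ _)⟩
  -- the penalisation parameter
  obtain ⟨N, hN0, hN1, hN2⟩ : ∃ N, 0 < N ∧ CS ≤ N * w ^ 2 ∧ c1 ^ 2 ≤ N * ε₁ := by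
    refine ⟨CS / w ^ 2 + c1 ^ 2 / ε₁ + 1, pz, ?_, ?_⟩
    · have : CS / w ^ 2 * w ^ 2 = CS := by field_simp
      have h2 : 0 ≤ (c1 ^ 2 / ε₁ + 1) * w ^ 2 := pz
      linarith
    · have : c1 ^ 2 / ε₁ * ε₁ = c1 ^ 2 := by field_simp
      have h2 : 0 ≤ (CS / w ^ 2 + 1) * ε₁ := pz
      linarith
  obtain ⟨N', hN'⟩ : ∃ N', N' = N * exp (K * (T - s)) := ⟨_, rfl⟩
  have hN'0 : 0 < N' := by rw [hN']; positivity
  refine ⟨min 1 (ε₁ / (4 * (c1 + 2 * c2 * N' + 1))), pz, fun κ hκ hκ1 S hSc hS hini hkey t₀ ht₀ y₀ hy₀ => ?_⟩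
  have hk1 : κ ≤ 1 := hκ1.trans (min_le_left _ _)
  have hk2 : κ * (4 * (c1 + 2 * c2 * N' + 1)) ≤ ε₁ := (le_div_iff₀ (pz)).1 (hκ1.trans (min_le_right _ _))
  by_contra hcon
  push Not at hcon
  obtain ⟨Z, hZ⟩ : ∃ Z : ℝ × EE d × EE d → ℝ, Z = fun p => S p.1 p.2.1 p.2.2 - ε₂ * exp (lam₀ * (p.1 - s)) * φ p.2.2 - N * exp (K * (p.1 - s)) * ‖p.2.1 - p.2.2‖ ^ 2 - ε₁ * (p.1 - s) := ⟨_, rfl⟩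
  have hZc : ContinuousOn Z (Icc s T ×ˢ univ) := by
    have := hφ.continuous
    rw [hZ]
    refine ((hSc.sub ?_).sub ?_).sub ?_ <;> exact Continuous.continuousOn (by fun_prop)
  have hexp : ∀ t ∈ Icc s T, 1 ≤ exp (lam₀ * (t - s)) ∧ 1 ≤ exp (K * (t - s)) := fun t ht =>
    ⟨Real.one_le_exp (mul_nonneg hl.le (by linarith [ht.1])), Real.one_le_exp (mul_nonneg hK0.le (by linarith [ht.1]))⟩
  have hZ0 : η < Z (t₀, y₀, y₀) := by
    rw [hZ]; simp only [sub_self, norm_zero]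
    have e1 : ε₂ * exp (lam₀ * (t₀ - s)) * φ y₀ ≤ η := by
      rw [← hε₂, mul_assoc]
      have : exp (lam₀ * (t₀ - s)) ≤ exp (lam₀ * (T - s)) := Real.exp_le_exp.2 (mul_le_l (by linarith [ht₀.2]) hl.le)
      exact mul_le_l (mul_le_mul this (hP _ hy₀) (hφ0 _).le (exp_pos _).le) hε₂0.le
    have e2 : ε₁ * (t₀ - s) ≤ η := by
      rw [← hε₁]; exact mul_le_l (by linarith [ht₀.2]) hε₁0.le
    norm_num; linarith
  -- bounds at points with positive Z
  have hloc : ∀ p ∈ Icc s T ×ˢ (univ : Set (EE d × EE d)), 0 < Z p → ‖p.2.2‖ ≤ R - 1 ∧ ‖p.2.1 - p.2.2‖ ≤ w := by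
    rintro ⟨t, y, z⟩ ⟨ht, -⟩ hp
    rw [hZ] at hp
    simp only at hp ht ⊢
    have hts : 0 ≤ ε₁ * (t - s) := mul_nonneg hε₁0.le (by linarith [ht.1])
    have a1 := hS t ht y z
    obtain ⟨e1, e2⟩ := hexp t ht
    have b1 : 0 ≤ ε₂ * exp (lam₀ * (t - s)) * φ z := by have := hφ0 z; positivity
    have b2 : 0 ≤ N * exp (K * (t - s)) * ‖y - z‖ ^ 2 := pz
    constructor
    · by_contra hz
      have hz' : CS / ε₂ ≤ φ z := hR₁ z (by have := le_max_left R₁ 0; linarith)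
      rw [div_le_iff₀ hε₂0] at hz'
      have : ε₂ * φ z * 1 ≤ ε₂ * φ z * exp (lam₀ * (t - s)) := mul_le_l e1 (by have := hφ0 z; positivity)
      linarith
    · by_contra hz
      push Not at hz
      have h3 : w ^ 2 ≤ ‖y - z‖ ^ 2 := pow_le_pow_left₀ hw.le hz.le 2
      have h4 : N * ‖y - z‖ ^ 2 * 1 ≤ N * ‖y - z‖ ^ 2 * exp (K * (t - s)) := mul_le_l e2 (pz)
      have h5 := mul_le_l h3 hN0.le
      linarith
  obtain ⟨⟨t, y, z⟩, ⟨ht, -⟩, hmx⟩ := attain (isClosed_Icc.prod isClosed_univ) hZc (x0 := (t₀, y₀, y₀)) ⟨ht₀, mem_univ _⟩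
    (K := Icc s T ×ˢ (Metric.closedBall (0 : EE d) R ×ˢ Metric.closedBall (0 : EE d) R)) (isCompact_Icc.prod ((isCompact_closedBall _ _).prod (isCompact_closedBall _ _))) (fun p hp hpK => by
      by_contra hlt
      push Not at hlt
      obtain ⟨g1, g2⟩ := hloc p hp (by linarith)
      refine hpK ⟨hp.1, ?_, ?_⟩
      · have := norm_add_le (p.2.1 - p.2.2) p.2.2
        rw [sub_add_cancel] at this
        simp only [mem_closedBall_zero_iff]; linarith
      · simp only [mem_closedBall_zero_iff]; linarith)
  simp only at ht
  have hZp : η < Z (t, y, z) := hZ0.trans_le (hmx _ ⟨ht₀, mem_univ _⟩)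
  obtain ⟨g1, g2⟩ := hloc (t, y, z) ⟨ht, mem_univ _⟩ (by linarith)
  simp only at g1 g2
  have hyR : ‖y‖ ≤ R := by
    have := norm_add_le (y - z) z
    rw [sub_add_cancel] at this; linarith
  obtain ⟨e1, e2⟩ := hexp t ht
  rcases eq_or_lt_of_le ht.1 with rfl | hst
  · have := hini y z (g2.trans hw3)
    rw [hZ] at hZp
    simp only [sub_self, mul_zero, Real.exp_zero, mul_one, sub_zero] at hZp
    have b1 : 0 ≤ ε₂ * φ z := by have := hφ0 z; positivity
    have b2 : 0 ≤ N * ‖y - z‖ ^ 2 := pz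
    linarith
  obtain ⟨n, hn⟩ : ∃ n, n = N * exp (K * (t - s)) := ⟨_, rfl⟩
  have hn0 : 0 < n := by rw [hn]; positivity
  obtain ⟨G, hG, hGle⟩ := hkey t ⟨hst, ht.2⟩ y z hyR (by linarith) (g2.trans hw2) (g2.trans hw1) (ε₂ * exp (lam₀ * (t - s))) n (pz) hn0 (fun y' z' => by
    have := hmx (t, y', z') ⟨ht, mem_univ _⟩
    rw [hZ] at this; simp only [← hn] at this
    linarith)
  have hD1 : HasDerivAt (fun τ => exp (lam₀ * (τ - s))) (exp (lam₀ * (t - s)) * lam₀) t := by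
    refine (((hasDerivAt_id t).sub_const s).const_mul lam₀).exp.congr_deriv (by simp)
  have hD2 : HasDerivAt (fun τ => exp (K * (τ - s))) (exp (K * (t - s)) * K) t := by
    refine (((hasDerivAt_id t).sub_const s).const_mul K).exp.congr_deriv (by simp)
  have hD3 : HasDerivAt (fun τ => ε₁ * (τ - s)) ε₁ t := by
    refine (((hasDerivAt_id t).sub_const s).const_mul ε₁).congr_deriv (by simp)
  have hD := ((hG.fun_sub ((hD1.const_mul ε₂).mul_const (φ z)).hasDerivWithinAt).fun_sub ((hD2.const_mul N).mul_const (‖y - z‖ ^ 2)).hasDerivWithinAt).fun_sub hD3.hasDerivWithinAt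
  have hfin := left_nonneg hst hD fun r hr => by
    have := hmx (r, y, z) ⟨⟨hr.1, hr.2.trans ht.2⟩, mem_univ _⟩
    rw [hZ] at this; exact this
  have hnN : N ≤ n := by rw [hn]; linarith [mul_le_l e2 hN0.le]
  have hnN' : n ≤ N' := by
    rw [hn, hN']
    exact mul_le_l (Real.exp_le_exp.2 (mul_le_l (by linarith [ht.2]) hK0.le)) hN0.le
  obtain ⟨δ, hδ⟩ : ∃ δ, δ = ‖y - z‖ := ⟨_, rfl⟩
  rw [← hδ] at hGle hfin
  have hmain : 0 ≤ c1 * (κ + δ) + c2 * n * (κ + δ) ^ 2 - K * n * δ ^ 2 - ε₁ := by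
    have : N * (exp (K * (t - s)) * K) * δ ^ 2 = K * n * δ ^ 2 := by rw [hn]; ring
    linarith
  have s1 : c2 * n * (κ + δ) ^ 2 ≤ c2 * n * (2 * κ ^ 2 + 2 * δ ^ 2) := mul_le_l (by linarith [sq_nonneg (κ - δ)]) (pz)
  have s2 : c1 * δ ≤ n * δ ^ 2 + ε₁ / 4 := by
    have h1 : c1 ^ 2 ≤ n * ε₁ := hN2.trans (mul_le_r hnN hε₁0.le)
    have h2 : n * (n * δ ^ 2 + ε₁ / 4 - c1 * δ) = (n * δ - c1 / 2) ^ 2 + (n * ε₁ - c1 ^ 2) / 4 := by ring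
    have h3 : 0 ≤ n * (n * δ ^ 2 + ε₁ / 4 - c1 * δ) := by rw [h2]; have := sq_nonneg (n * δ - c1 / 2); linarith
    linarith [nonneg_of_mul_nonneg_right h3 hn0]
  have s3 : c2 * n * κ ^ 2 ≤ c2 * N' * κ := by
    have h1 : c2 * n ≤ c2 * N' := mul_le_l hnN' hc2
    have h2 : κ ^ 2 ≤ κ := by rw [sq]; exact mul_le_of_le_one_left hκ.le hk1
    exact mul_le_mul h1 h2 (pz) (pz)
  rw [hK] at hmain
  linarith

/-- Lipschitz roots of the two diffusion matrices -/
theorem roots {s T ν₀ : ℝ} (hν : 0 < ν₀) {q : CQ d} (hq : ∀ i j, Cf s T (fun t x => q t x i j)) (hqs : ∀ t ∈ Icc s T, ∀ x i j, q t x i j = q t x j i)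
    (hqp : ∀ t ∈ Icc s T, ∀ x (w : Fin d → ℝ), ν₀ / 2 * ∑ i, w i ^ 2 ≤ ∑ i, ∑ j, q t x i j * w i * w j) (R : ℝ) : ∃ L, 0 ≤ L ∧ ∀ κ, 0 ≤ κ → κ ≤ 1 → ∀ t ∈ Icc s T, ∀ y z : EE d, ‖y‖ ≤ R → ‖z‖ ≤ R →
      ∀ Q : MM d, (∀ i j, Q i j = Q j i) → (∀ w : Fin d → ℝ, ν₀ / 2 * ∑ i, w i ^ 2 ≤ ∑ i, ∑ j, Q i j * w i * w j) → (∀ i j, |Q i j - q t y i j| ≤ κ) →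
      ∃ σ σ' : MM d, (∀ i j, Q i j = ∑ a, σ i a * σ j a) ∧ (∀ i j, q t z i j = ∑ a, σ' i a * σ' j a) ∧ ∀ i a, |σ i a - σ' i a| ≤ L * (κ + ‖y - z‖) := by
  obtain ⟨L1, hL10, hL1⟩ := Cf.lip_fin (g := fun (ij : Fin d × Fin d) t x => q t x ij.1 ij.2) (fun ij => hq ij.1 ij.2) R
  obtain ⟨M, hM0, hM⟩ := Cf.bd_fin (g := fun (ij : Fin d × Fin d) t x => q t x ij.1 ij.2) (fun ij => hq ij.1 ij.2) R
  obtain ⟨W, L, hL, hW1, hW2⟩ := lip_root d (show 0 < ν₀ / 2 by positivity) (M + 1)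
  refine ⟨L * (d * (d * (1 + L1))), pz, fun κ hκ hκ1 t ht y z hy hz Q hs he hc => ⟨W Q, W (q t z), ?_, ?_, fun i a => ?_⟩⟩
  · refine hW1 Q hs (fun i j => ?_) he
    have h1 := hc i j
    have h2 := hM (i, j) t ht y hy
    have := abs_add_le (Q i j - q t y i j) (q t y i j)
    rw [sub_add_cancel] at this
    simp only at h2; linarith
  · exact hW1 _ (hqs t ht z) (fun i j => (hM (i, j) t ht z hz).trans (by linarith)) (hqp t ht z)
  · refine (hW2 Q (q t z) hs (fun i j => ?_) he (hqs t ht z) (fun i j => (hM (i, j) t ht z hz).trans (by linarith)) (hqp t ht z) i a).trans ?_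
    · have h1 := hc i j
      have h2 := hM (i, j) t ht y hy
      have := abs_add_le (Q i j - q t y i j) (q t y i j)
      rw [sub_add_cancel] at this
      simp only at h2; linarith
    · rw [mul_assoc]
      refine mul_le_l ?_ hL
      have : ∀ i j, |Q i j - q t z i j| ≤ (1 + L1) * (κ + ‖y - z‖) := fun i j => by
        have h1 := hc i j
        have h2 := hL1 (i, j) t ht y z hy hz
        have h3 := abs_sub_le (Q i j) (q t y i j) (q t z i j)
        have h4 : 0 ≤ L1 * κ := pz
        have h5 := norm_nonneg (y - z)
        simp only at h2; linarith
      refine (sum_le fun i => sum_le fun j => this i j).trans (le_of_eq ?_)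
      simp; ring

end dbl2

section dbl3
variable {d m : ℕ} {s T ν₀ γ K : ℝ} {q : CQ d} {A : CA d m} {C : CM d m}
    {β b : CV d} {lam Lc X0 k0 : CF d}

theorem sum2_le {M : MM d} {c : ℝ} (h : ∀ i a, |M i a| ≤ c) : ∑ a, ∑ i, (M i a) ^ 2 ≤ d ^ 2 * c ^ 2 := by
  refine (sum_le fun a => sum_le fun i => sq_le_sq' (neg_le_of_abs_le (h i a)) (le_of_abs_le (h i a))).trans (le_of_eq ?_)
  simp; ring

theorem coord_sub_le (y z : EE d) (i : Fin d) : |y i - z i| ≤ ‖y - z‖ := by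
  simpa using PiLp.norm_apply_le (y - z) i

theorem dot_le {a g : Fin d → ℝ} {A G : ℝ} (ha : ∀ i, |a i| ≤ A) (hg : ∀ i, |g i| ≤ G) (hA : 0 ≤ A) : ∑ i, a i * g i ≤ d * (A * G) := by
  refine (sum_le fun i => ?_).trans (le_of_eq (by simp) : ∑ _i : Fin d, A * G ≤ d * (A * G))
  refine (le_abs_self _).trans ?_
  rw [abs_mul]; exact mul_le_mul (ha i) (hg i) (abs_nonneg _) hA

theorem Dat.ell2 (D : Dat s T ν₀ γ K q A C β b lam Lc X0 k0) (hν : 0 < ν₀) : ∀ t ∈ Icc s T, ∀ x (w : Fin d → ℝ), ν₀ / 2 * ∑ i, w i ^ 2 ≤ ∑ i, ∑ j, q t x i j * w i * w j := fun t ht x w => by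
  refine le_trans ?_ (D.hqp t ht x w)
  exact mul_le_r (by linarith [D.hlam t ht x]) (sum_nn fun i => sq_nonneg _)

/-- key inequality of the scalar comparison -/
theorem key2 (D : Dat s T ν₀ γ K q A C β b lam Lc X0 k0) (hν : 0 < ν₀) {lam₀ : ℝ} {φ : EE d → ℝ} (hφ : ContDiff ℝ 2 φ)
    (hly : ∀ t ∈ Icc s T, ∀ x, (∑ i, ∑ j, q t x i j * pdd φ x i j) + (∑ i, (b t x i + β t x i) * pd φ x i) ≤ lam₀ * φ x)
    {v : CF d} (hv2 : ∀ t ∈ Ioc s T, ContDiff ℝ 2 (v t))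
    (hve : ∀ t ∈ Ioc s T, ∀ x, HasDerivWithinAt (fun τ => v τ x) ((∑ i, ∑ j, q t x i j * pdd (v t) x i j) + (∑ i, (b t x i + β t x i) * pd (v t) x i)) (Iic t) t) (R : ℝ) :
    ∃ c2, 0 ≤ c2 ∧ ∀ ϖ κ C0 a ε r H : ℝ, 0 < κ → κ ≤ 1 → ∀ (f : EE d → Fin m → ℝ) (u : CU d m) Qm βm, ApS s T ν₀ R ϖ κ C0 a ε r H q A C β b f u Qm βm →
      ∀ t ∈ Ioc s T, ∀ y z, ‖y‖ ≤ R → ‖z‖ ≤ R → ‖y - z‖ ≤ ϖ → ∀ D n, 0 < D → 0 < n →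
        (∀ y' z', (Ff r H s a ε u t y' - v t z') - D * φ z' - n * ‖y' - z'‖ ^ 2 ≤ (Ff r H s a ε u t y - v t z) - D * φ z - n * ‖y - z‖ ^ 2) →
        ∃ G, HasDerivWithinAt (fun τ => Ff r H s a ε u τ y - v τ z) G (Iic t) t ∧ G ≤ D * (lam₀ * φ z) + 0 * (κ + ‖y - z‖) + c2 * n * (κ + ‖y - z‖) ^ 2 := by
  obtain ⟨L, hL0, hL⟩ := roots hν D.hq D.hqs (D.ell2 hν) R
  obtain ⟨Lb, hLb0, hLb⟩ := Cf.lip_fin (g := fun (i : Fin d) t x => β t x i) D.hβ R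
  refine ⟨2 * (d ^ 2 * L ^ 2) + 2 * (d * (1 + Lb)), pz, fun ϖ κ C0 a ε r H hκ hκ1 f u Qm βm P t ht y z hy hz hyz D' n hD hn hmax => ?_⟩
  have ht' : t ∈ Icc s T := ⟨ht.1.le, ht.2⟩
  obtain ⟨Ft, hF1, hF2⟩ := P.sub ⟨t, ht'⟩ ht.1 y z hy (by rwa [norm_sub_rev])
  simp only at hF1 hF2
  refine ⟨_, hF1.fun_sub (hve t ht z), ?_⟩
  obtain ⟨F, hF⟩ : ∃ F, F = Ff r H s a ε u t := ⟨_, rfl⟩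
  have hFs : ContDiff ℝ 2 F := by rw [hF]; exact contDiff_infty.1 (P.Fs t ht') 2
  have hvs := hv2 t ht
  rw [← hF] at hF2 hmax
  obtain ⟨σ, σ', hσ, hσ', hd⟩ := hL κ hκ.le hκ1 t ht' y z hy hz (Qm ⟨t, ht'⟩ y) (P.sym _ _) (P.ell _ _) (P.cq ⟨t, ht'⟩ y hy)
  have g1 : ∀ i, pd F y i = 2 * n * (y i - z i) := fun i => by
    refine dbl_Y (S := fun y z => F y - v t z) hφ hmax i ?_
    have := hasDerivAt_line (f := F) (x := y) (a := EuclideanSpace.single i (1:ℝ)) (t := 0) (hFs.differentiable (by norm_num)).differentiableAt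
    refine (this.sub_const (v t z)).congr_deriv ?_
    simp
  have g2 : ∀ i, pd (v t) z i = 2 * n * (y i - z i) - D' * pd φ z i := fun i => by
    have : - pd (v t) z i = D' * pd φ z i - 2 * n * (y i - z i) := by
      refine dbl_Z (S := fun y z => F y - v t z) hφ hmax i ?_
      have := hasDerivAt_line (f := v t) (x := z) (a := EuclideanSpace.single i (1:ℝ)) (t := 0) (hvs.differentiable (by norm_num)).differentiableAt
      refine (this.const_sub (F y)).congr_deriv ?_
      simp
    linarith
  have g3 : ∀ k, (∑ i, ∑ j, pdd F y i j * σ i k * σ j k) - (∑ i, ∑ j, pdd (v t) z i j * σ' i k * σ' j k) ≤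
      D' * (∑ i, ∑ j, pdd φ z i j * σ' i k * σ' j k) + 2 * n * ∑ i, (σ i k - σ' i k) ^ 2 := fun k => by
    have e1 := hasDerivAt_line2 hFs y (WithLp.toLp 2 fun i => σ i k) 0
    have e2 := hasDerivAt_line2 hvs z (WithLp.toLp 2 fun i => σ' i k) 0
    simp only [zero_smul, add_zero] at e1 e2
    exact dbl_two (S := fun y z => F y - v t z) hφ hmax (a := WithLp.toLp 2 fun i => σ i k) (a' := WithLp.toLp 2 fun i => σ' i k)
      (fun r => (hasDerivAt_line (hFs.differentiable (by norm_num)).differentiableAt).fun_sub (hasDerivAt_line (hvs.differentiable (by norm_num)).differentiableAt)) (e1.fun_sub e2)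
  have g4 := Finset.sum_le_sum fun k (_ : k ∈ Finset.univ) => g3 k
  rw [sum_sub_distrib, sum_ad, ← mul_sm, ← mul_sm, root_trace hσ, root_trace hσ', root_trace hσ'] at g4
  have g5 := mul_le_l (sum2_le hd) (show 0 ≤ 2 * n by positivity)
  have hl := mul_le_l (hly t ht' z) hD.le
  have h6 : (∑ i, (b t z i + βm ⟨t, ht'⟩ y i) * pd F y i) - (∑ i, (b t z i + β t z i) * pd (v t) z i) = D' * (∑ i, (b t z i + β t z i) * pd φ z i) + ∑ i, (βm ⟨t, ht'⟩ y i - β t z i) * (2 * n * (y i - z i)) := by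
    rw [mul_sm, ← sum_sub_distrib, ← sum_ad]
    refine sum_cg fun i => ?_
    rw [g1, g2]; ring
  have hδ := norm_nonneg (y - z)
  have h7 : ∑ i, (βm ⟨t, ht'⟩ y i - β t z i) * (2 * n * (y i - z i)) ≤ d * (((1 + Lb) * (κ + ‖y - z‖)) * (2 * n * (κ + ‖y - z‖))) := by
    refine dot_le (fun i => ?_) (fun i => ?_) (pz)
    · have a1 := P.cb ⟨t, ht'⟩ y hy i
      have a2 := hLb i t ht' y z hy hz
      have a3 := abs_sub_le (βm ⟨t, ht'⟩ y i) (β t y i) (β t z i)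
      have a4 : 0 ≤ Lb * κ := pz
      simp only at a1 a2; linarith
    · rw [abs_mul, abs_of_pos (pz)]
      exact mul_le_l ((coord_sub_le y z i).trans (by linarith)) (pz)
  have h8 : 2 * n * (d ^ 2 * (L * (κ + ‖y - z‖)) ^ 2) + d * (((1 + Lb) * (κ + ‖y - z‖)) * (2 * n * (κ + ‖y - z‖))) = (2 * (d ^ 2 * L ^ 2) + 2 * (d * (1 + Lb))) * n * (κ + ‖y - z‖) ^ 2 := by ring
  linarith

end dbl3

section dbl4
variable {d m : ℕ}

theorem k3_second {p : Fin m → ℝ} {Dd U W : Fin m → Fin d → ℝ} {σ σ' Q : MM d} {lam c C0 : ℝ} (hC0 : 0 ≤ C0) (hc : 0 ≤ c) (hW : ∀ k i, W k i = U k i - Dd k i)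
    (hU : ∀ k i, |U k i| ≤ C0) (hs : ∀ i a, |σ i a - σ' i a| ≤ c) (hQ : ∀ i j, Q i j = ∑ a, σ' i a * σ' j a)
    (hell : ∀ w : Fin d → ℝ, lam * ∑ i, w i ^ 2 ≤ ∑ i, ∑ j, Q i j * w i * w j) :
    lam * (∑ k, ∑ i, Dd k i ^ 2) - 2 * (m * (d * (d * (c * C0)) ^ 2)) ≤ ∑ a, ∑ k, 2 * ((∑ i, U k i * σ i a) - ∑ i, W k i * σ' i a) ^ 2 := by
  have h1 : ∀ k a, (∑ i, Dd k i * σ' i a) ^ 2 - 2 * (d * (c * C0)) ^ 2 ≤ 2 * ((∑ i, U k i * σ i a) - ∑ i, W k i * σ' i a) ^ 2 := fun k a => by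
    have e : (∑ i, U k i * σ i a) - ∑ i, W k i * σ' i a = (∑ i, Dd k i * σ' i a) + ∑ i, (σ i a - σ' i a) * U k i := by
      rw [← sum_sub_distrib, ← sum_ad]
      refine sum_cg fun i => ?_
      rw [hW]; ring
    have e2 := dot_le (fun i => hs i a) (hU k) hc
    have e3 := dot_le (a := fun i => -(σ i a - σ' i a)) (fun i => by rw [abs_neg]; exact hs i a) (hU k) hc
    simp only [neg_mul, Finset.sum_neg_distrib] at e3
    have e4 : (∑ i, (σ i a - σ' i a) * U k i) ^ 2 ≤ (d * (c * C0)) ^ 2 := sq_le_sq' (by linarith) e2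
    rw [e]
    have := sq_nonneg ((∑ i, Dd k i * σ' i a) + 2 * ∑ i, (σ i a - σ' i a) * U k i)
    linarith
  have h2 : ∀ k, lam * ∑ i, Dd k i ^ 2 ≤ ∑ a, (∑ i, Dd k i * σ' i a) ^ 2 := fun k => by
    refine (hell (Dd k)).trans (le_of_eq ?_)
    have := root_trace (M := fun i j => Dd k i * Dd k j) hQ
    calc ∑ i, ∑ j, Q i j * Dd k i * Dd k j = ∑ i, ∑ j, Q i j * (Dd k i * Dd k j) := by simp only [mul_assoc]
      _ = _ := this.symm
      _ = _ := sum_cg fun a => by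
        rw [sq, sum_mul_sum]
        exact sum_cg fun i => sum_cg fun j => by ring
  have h3 := Finset.sum_le_sum fun k (_ : k ∈ Finset.univ) => h2 k
  rw [← mul_sm] at h3
  have h4 := Finset.sum_le_sum fun a (_ : a ∈ (Finset.univ : Finset (Fin d))) => Finset.sum_le_sum fun k (_ : k ∈ (Finset.univ : Finset (Fin m))) => h1 k a
  refine le_trans ?_ h4
  simp only [sum_sub_distrib, sum_const, card_univ, Fintype.card_fin, nsmul_eq_mul]
  have h5 : ∑ k, ∑ a, (∑ i, Dd k i * σ' i a) ^ 2 = ∑ a, ∑ k, (∑ i, Dd k i * σ' i a) ^ 2 := sum_comm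
  linarith

theorem k3_btil {p : Fin m → ℝ} {Dd : Fin m → Fin d → ℝ} {B : MA d m} {X lam : ℝ} (hd : 1 ≤ d) (hm : 1 ≤ m) (hX : 0 ≤ X) (hl : 0 < lam) (hB : ∀ i k l, |B i k l| ≤ X) :
    ∑ k, 2 * p k * ∑ i, ∑ l, B i k l * Dd l i ≤ lam * (∑ k, ∑ i, Dd k i ^ 2) + (√d * m * X) ^ 2 / lam * ∑ k, p k ^ 2 := by
  have h1 : ∑ k, 2 * p k * ∑ i, ∑ l, B i k l * Dd l i ≤ 2 * (X * ∑ k, |p k|) * (∑ l, ∑ i, |Dd l i|) := by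
    have : ∀ k, 2 * p k * ∑ i, ∑ l, B i k l * Dd l i ≤ 2 * |p k| * (X * ∑ l, ∑ i, |Dd l i|) := fun k => by
      refine (le_abs_self _).trans ?_
      rw [abs_mul, abs_mul, abs_two]
      refine mul_le_l ?_ (pz)
      rw [sum_comm, mul_sm]
      refine (abs_sum_le_sum_abs _ _).trans (sum_le fun l => ?_)
      rw [mul_sm]
      refine (abs_sum_le_sum_abs _ _).trans (sum_le fun i => ?_)
      rw [abs_mul]; exact mul_le_r (hB i k l) (abs_nonneg _)
    refine (sum_le fun k => this k).trans (le_of_eq ?_)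
    rw [← sum_mul, ← mul_sm]; ring
  obtain ⟨x, hx⟩ : ∃ x, x = X * ∑ k, |p k| := ⟨_, rfl⟩
  obtain ⟨y, hy⟩ : ∃ y, y = ∑ l, ∑ i, |Dd l i| := ⟨_, rfl⟩
  have hd0 : (0:ℝ) < d := by exact_mod_cast hd
  have hm0 : (0:ℝ) < m := by exact_mod_cast hm
  have h2 : x ^ 2 ≤ X ^ 2 * (m * ∑ k, p k ^ 2) := by
    rw [hx, mul_pow]
    refine mul_le_l ?_ (sq_nonneg _)
    have := sq_sum_le_card_mul_sum_sq (s := (Finset.univ : Finset (Fin m))) (f := fun k => |p k|)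
    simpa using this
  have h3 : y ^ 2 ≤ d * m * ∑ k, ∑ i, Dd k i ^ 2 := by
    have := sq_sum_le_card_mul_sum_sq (s := (Finset.univ : Finset (Fin m × Fin d))) (f := fun k => |Dd k.1 k.2|)
    rw [Fintype.sum_prod_type, Fintype.sum_prod_type] at this
    rw [hy]; refine this.trans (le_of_eq ?_)
    simp only [sq_abs, card_univ, Fintype.card_prod, Fintype.card_fin]; push_cast; ring
  rw [← hx, ← hy] at h1
  have h4 : 2 * x * y ≤ lam / (d * m) * y ^ 2 + (d * m) / lam * x ^ 2 := by
    have e : lam / (d * m) * y ^ 2 + (d * m) / lam * x ^ 2 - 2 * x * y = (lam * y - (d * m) * x) ^ 2 / (lam * (d * m)) := by field_simp; ring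
    have : 0 ≤ (lam * y - (d * m) * x) ^ 2 / (lam * (d * m)) := pz
    linarith
  have h5 := mul_le_l h3 (show 0 ≤ lam / (d * m) by positivity)
  have h6 := mul_le_l h2 (show 0 ≤ (d * m) / lam by positivity)
  have e5 : lam / (d * m) * (d * m * ∑ k, ∑ i, Dd k i ^ 2) = lam * ∑ k, ∑ i, Dd k i ^ 2 := by field_simp
  have e6 : (d * m) / lam * (X ^ 2 * (m * ∑ k, p k ^ 2)) = (√d * m * X) ^ 2 / lam * ∑ k, p k ^ 2 := by
    rw [mul_pow, mul_pow, sq_sqrt hd0.le]; field_simp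
  linarith

/-- bound for a vector error term -/
theorem k3_err {p e : Fin m → ℝ} {Mp E : ℝ} (hp : ∀ k, |p k| ≤ Mp) (he : ∀ k, |e k| ≤ E) (hMp : 0 ≤ Mp) : ∑ k, 2 * p k * e k ≤ 2 * m * (Mp * E) := by
  have := dot_le hp he hMp
  have h2 : ∑ k, 2 * p k * e k = 2 * ∑ k, p k * e k := by rw [mul_sm]; exact sum_cg fun k => by ring
  rw [h2]; linarith

theorem sum_abs_le1 {n : ℕ} {g : Fin n → ℝ} {c : ℝ} (h : ∀ i, |g i| ≤ c) : |∑ i, g i| ≤ n * c :=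
  (abs_sum_le_sum_abs _ _).trans ((sum_le fun i => h i).trans (le_of_eq (by simp)))

theorem k3_alg (hd : 1 ≤ d) (hm : 1 ≤ m) {p U0 W0 GU GW SU SW : Fin m → ℝ} {Dd U W : Fin m → Fin d → ℝ} {σ σ' Q : MM d} {Ay Az : MA d m} {Cy Cz : MM m}
    {bb φ1 : Fin d → ℝ} {lam X Lc γ n L LA C0 Mp e D' φ2 : ℝ} (hγ : 1 / 4 ≤ γ) (hl : 0 < lam) (hX : 0 ≤ X) (hC0 : 0 ≤ C0) (hMp : 0 ≤ Mp) (hn : 0 < n) (hL : 0 ≤ L) (hLA : 0 ≤ LA) (he : 0 ≤ e) (he2 : e ≤ 2)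
    (hp0 : ∀ k, p k = U0 k - W0 k) (hW : ∀ k i, W k i = U k i - Dd k i) (hU0 : ∀ k, |U0 k| ≤ C0) (hU : ∀ k i, |U k i| ≤ C0) (hp : ∀ k, |p k| ≤ Mp)
    (hs : ∀ i a, |σ i a - σ' i a| ≤ L * e) (hQ : ∀ i j, Q i j = ∑ a, σ' i a * σ' j a) (hell : ∀ w : Fin d → ℝ, lam * ∑ i, w i ^ 2 ≤ ∑ i, ∑ j, Q i j * w i * w j)
    (hA : ∀ i k l, |Ay i k l - Az i k l| ≤ LA * e) (hC : ∀ k l, |Cy k l - Cz k l| ≤ LA * e) (hAX : ∀ i k l, |Az i k l - dl k l * bb i| ≤ X)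
    (hCL : ∀ w : Fin m → ℝ, ∑ i, ∑ j, Cz i j * w i * w j ≤ Lc * ∑ i, w i ^ 2) (hds : Lc ≤ -(2 * γ * (√d * m * X) ^ 2 / lam))
    (h1 : ∀ i, ∑ k, 2 * p k * Dd k i = D' * φ1 i)
    (h2 : (∑ a, ∑ k, 2 * ((∑ i, U k i * σ i a) - ∑ i, W k i * σ' i a) ^ 2) + (∑ k, 2 * p k * (SU k - SW k)) ≤ D' * φ2 + 2 * n * ∑ a, ∑ i, (σ i a - σ' i a) ^ 2)
    (hGU : ∀ k, |GU k - (SU k + (∑ i, ∑ l, Ay i k l * U l i) + ∑ l, Cy k l * U0 l)| ≤ e)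
    (hGW : ∀ k, GW k = SW k + (∑ i, ∑ l, Az i k l * W l i) + ∑ l, Cz k l * W0 l) :
    ∑ k, 2 * p k * (GU k - GW k) ≤ D' * (φ2 + ∑ i, bb i * φ1 i) + (4 * (m * (d * (d * (L * C0)) ^ 2)) + 2 * m * (Mp * (1 + d * (m * (LA * C0)) + m * (LA * C0)))) * e + 2 * (d ^ 2 * L ^ 2) * n * e ^ 2 := by
  have a1 := k3_second (p := p) hC0 (mul_nonneg hL he) hW hU hs hQ hell
  have a2 := k3_btil (p := p) (Dd := Dd) hd hm hX hl hAX
  have a3 := hCL p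
  have hp2 : 0 ≤ ∑ k, p k ^ 2 := sum_nn fun _ => sq_nonneg _
  have a4 := mul_le_r hds hp2
  have a5 : (√d * m * X) ^ 2 / lam * ∑ k, p k ^ 2 ≤ 2 * (2 * γ * (√d * m * X) ^ 2 / lam) * ∑ k, p k ^ 2 := by
    refine mul_le_r ?_ hp2
    have : 0 ≤ (√d * m * X) ^ 2 / lam := pz
    have h := mul_le_r (show 1 ≤ 4 * γ by linarith) this
    have e : 2 * (2 * γ * (√d * m * X) ^ 2 / lam) = 4 * γ * ((√d * m * X) ^ 2 / lam) := by ring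
    linarith
  have a6 := mul_le_l (sum2_le hs) (show 0 ≤ 2 * n by positivity)
  -- error vector
  obtain ⟨er, her⟩ : ∃ er : Fin m → ℝ, ∀ k, er k = (GU k - (SU k + (∑ i, ∑ l, Ay i k l * U l i) + ∑ l, Cy k l * U0 l)) + (∑ i, ∑ l, (Ay i k l - Az i k l) * U l i) + ∑ l, (Cy k l - Cz k l) * U0 l := ⟨_, fun k => rfl⟩
  have her' : ∀ k, |er k| ≤ (1 + d * (m * (LA * C0)) + m * (LA * C0)) * e := fun k => by
    rw [her]
    have b1 := hGU k
    have b2 : |∑ i, ∑ l, (Ay i k l - Az i k l) * U l i| ≤ d * (m * (LA * e * C0)) := sum_abs_le1 fun i => sum_abs_le1 fun l => by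
      rw [abs_mul]; exact mul_le_mul (hA i k l) (hU l i) (abs_nonneg _) (pz)
    have b3 : |∑ l, (Cy k l - Cz k l) * U0 l| ≤ m * (LA * e * C0) := sum_abs_le1 fun l => by
      rw [abs_mul]; exact mul_le_mul (hC k l) (hU0 l) (abs_nonneg _) (pz)
    have b4 := abs_add_three (GU k - (SU k + (∑ i, ∑ l, Ay i k l * U l i) + ∑ l, Cy k l * U0 l)) (∑ i, ∑ l, (Ay i k l - Az i k l) * U l i) (∑ l, (Cy k l - Cz k l) * U0 l)
    linarith
  have a7 := k3_err hp her' hMp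
  have dec : ∀ k, GU k - GW k = (SU k - SW k) + er k + (∑ i, ∑ l, (Az i k l - dl k l * bb i) * Dd l i) + (∑ i, bb i * Dd k i) + ∑ l, Cz k l * p l := fun k => by
    have c1 : ∑ i, ∑ l, (Az i k l - dl k l * bb i) * Dd l i = (∑ i, ∑ l, Az i k l * U l i) - (∑ i, ∑ l, Az i k l * W l i) - ∑ i, bb i * Dd k i := by
      rw [← sum_sub_distrib, ← sum_sub_distrib]
      refine sum_cg fun i => ?_
      have : bb i * Dd k i = ∑ l, dl k l * bb i * Dd l i := by simp [dl]
      rw [this, ← sum_sub_distrib, ← sum_sub_distrib]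
      exact sum_cg fun l => by rw [hW]; ring
    have c2 : ∑ l, Cz k l * p l = (∑ l, Cz k l * U0 l) - ∑ l, Cz k l * W0 l := by
      rw [← sum_sub_distrib]; exact sum_cg fun l => by rw [hp0]; ring
    have c3 : ∑ i, ∑ l, (Ay i k l - Az i k l) * U l i = (∑ i, ∑ l, Ay i k l * U l i) - ∑ i, ∑ l, Az i k l * U l i := by
      simp only [sub_mul, sum_sub_distrib]
    have c4 : ∑ l, (Cy k l - Cz k l) * U0 l = (∑ l, Cy k l * U0 l) - ∑ l, Cz k l * U0 l := by
      simp only [sub_mul, sum_sub_distrib]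
    rw [her, hGW, c1, c2, c3, c4]; ring
  have dec2 : ∑ k, 2 * p k * (GU k - GW k) = (∑ k, 2 * p k * (SU k - SW k)) + (∑ k, 2 * p k * er k) + (∑ k, 2 * p k * ∑ i, ∑ l, (Az i k l - dl k l * bb i) * Dd l i) + (∑ i, bb i * (D' * φ1 i)) + 2 * ∑ i, ∑ j, Cz i j * p i * p j := by
    have c1 : ∑ i, bb i * (D' * φ1 i) = ∑ k, 2 * p k * ∑ i, bb i * Dd k i := by
      simp only [← h1, mul_sm]
      rw [sum_comm]
      exact sum_cg fun i => sum_cg fun j => by ring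
    have c2 : 2 * ∑ i, ∑ j, Cz i j * p i * p j = ∑ k, 2 * p k * ∑ l, Cz k l * p l := by
      simp only [mul_sm]
      exact sum_cg fun i => sum_cg fun j => by ring
    rw [c1, c2, ← sum_ad, ← sum_ad, ← sum_ad, ← sum_ad]
    exact sum_cg fun k => by rw [dec]; ring
  have c3 : ∑ i, bb i * (D' * φ1 i) = D' * ∑ i, bb i * φ1 i := by
    rw [mul_sm]; exact sum_cg fun i => by ring
  have c4 : 2 * (m * (d * (d * (L * e * C0)) ^ 2)) ≤ 4 * (m * (d * (d * (L * C0)) ^ 2)) * e := by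
    have : 0 ≤ 2 * (m * (d * (d * (L * C0)) ^ 2)) * e * (2 - e) := by
      have : 0 ≤ 2 - e := by linarith
      positivity
    linarith
  rw [dec2, c3]
  linarith

end dbl4

section dbl5
variable {d m : ℕ} {s T ν₀ γ K : ℝ} {q : CQ d} {A : CA d m} {C : CM d m}
    {β b : CV d} {lam Lc X0 k0 : CF d}

/-- key inequality of the vector comparison -/
theorem key3 (D : Dat s T ν₀ γ K q A C β b lam Lc X0 k0) (hd : 1 ≤ d) (hm : 1 ≤ m) (hν : 0 < ν₀) (hγ : 1 / 4 ≤ γ) {lam₀ : ℝ} {φ : EE d → ℝ} (hφ : ContDiff ℝ 2 φ)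
    (hly : ∀ t ∈ Icc s T, ∀ x, (∑ i, ∑ j, q t x i j * pdd φ x i j) + (∑ i, (b t x i + β t x i) * pd φ x i) ≤ lam₀ * φ x)
    {v : CU d m} {Mv : ℝ} (hMv : 0 ≤ Mv) (hvb : ∀ t ∈ Icc s T, ∀ x k, |v t x k| ≤ Mv) (hv2 : ∀ t ∈ Ioc s T, ∀ k, ContDiff ℝ 2 (fun z => v t z k))
    (hve : ∀ t ∈ Ioc s T, ∀ x k, HasDerivWithinAt (fun τ => v τ x k) ((∑ i, ∑ j, q t x i j * pdd (fun z => v t z k) x i j) + (∑ i, ∑ l, A t x i k l * pd (fun z => v t z l) x i) + ∑ l, C t x k l * v t x l) (Iic t) t) (R C0 : ℝ) (hC0 : 0 ≤ C0) :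
    ∃ c1 c2, 0 ≤ c1 ∧ 0 ≤ c2 ∧ ∀ ϖ κ a ε r H : ℝ, 0 < κ → κ ≤ 1 → ∀ (f : EE d → Fin m → ℝ) (u : CU d m) Qm βm, ApS s T ν₀ R ϖ κ C0 a ε r H q A C β b f u Qm βm →
      ∀ t ∈ Ioc s T, ∀ y z, ‖y‖ ≤ R → ‖z‖ ≤ R → ‖y - z‖ ≤ 1 → ∀ D n, 0 < D → 0 < n →
        (∀ y' z', (∑ k, (u t y' k - v t z' k) ^ 2) - D * φ z' - n * ‖y' - z'‖ ^ 2 ≤ (∑ k, (u t y k - v t z k) ^ 2) - D * φ z - n * ‖y - z‖ ^ 2) →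
        ∃ G, HasDerivWithinAt (fun τ => ∑ k, (u τ y k - v τ z k) ^ 2) G (Iic t) t ∧ G ≤ D * (lam₀ * φ z) + c1 * (κ + ‖y - z‖) + c2 * n * (κ + ‖y - z‖) ^ 2 := by
  obtain ⟨L, hL0, hL⟩ := roots hν D.hq D.hqs (D.ell2 hν) R
  obtain ⟨L1, hL10, hL1⟩ := Cf.lip_fin (g := fun (i : Fin d × Fin m × Fin m) t x => A t x i.1 i.2.1 i.2.2) (fun i => D.hA i.1 i.2.1 i.2.2) R
  obtain ⟨L2, hL20, hL2⟩ := Cf.lip_fin (g := fun (i : Fin m × Fin m) t x => C t x i.1 i.2) (fun i => D.hC i.1 i.2) R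
  refine ⟨4 * (m * (d * (d * (L * C0)) ^ 2)) + 2 * m * ((C0 + Mv) * (1 + d * (m * ((L1 + L2) * C0)) + m * ((L1 + L2) * C0))), 2 * (d ^ 2 * L ^ 2), ?_, pz, fun ϖ κ a ε r H hκ hκ1 f u Qm βm P t ht y z hy hz hyz D' n hD hn hmax => ?_⟩
  rotate_left
  · have ht' : t ∈ Icc s T := ⟨ht.1.le, ht.2⟩
    choose GU hGU1 hGU2 using P.eqn ⟨t, ht'⟩ ht.1 y hy
    simp only at hGU1 hGU2
    obtain ⟨σ, σ', hσ, hσ', hds⟩ := hL κ hκ.le hκ1 t ht' y z hy hz (Qm ⟨t, ht'⟩ y) (P.sym _ _) (P.ell _ _) (P.cq ⟨t, ht'⟩ y hy)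
    have hus : ∀ k, ContDiff ℝ 2 (fun x => u t x k) := fun k => contDiff_infty.1 (P.sm t k) 2
    have hvs := hv2 t ht
    obtain ⟨GW, hGW⟩ : ∃ GW : Fin m → ℝ, ∀ k, GW k = (∑ i, ∑ j, q t z i j * pdd (fun z => v t z k) z i j) + (∑ i, ∑ l, A t z i k l * pd (fun z => v t z l) z i) + ∑ l, C t z k l * v t z l := ⟨_, fun k => rfl⟩
    have hδ := norm_nonneg (y - z)
    -- derivatives along lines
    have l1 : ∀ (e e' : EE d) (r : ℝ), HasDerivAt (fun r : ℝ => ∑ k, (u t (y + r • e) k - v t (z + r • e') k) ^ 2)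
        (∑ k, 2 * (u t (y + r • e) k - v t (z + r • e') k) * ((∑ i, pd (fun x => u t x k) (y + r • e) i * e i) - ∑ i, pd (fun x => v t x k) (z + r • e') i * e' i)) r := fun e e' r => by
      refine HasDerivAt.fun_sum fun k _ => ?_
      have h1 := hasDerivAt_line (f := fun x => u t x k) (x := y) (a := e) (t := r) ((hus k).differentiable (by norm_num)).differentiableAt
      have h2 := hasDerivAt_line (f := fun x => v t x k) (x := z) (a := e') (t := r) ((hvs k).differentiable (by norm_num)).differentiableAt
      refine ((h1.fun_sub h2).fun_pow 2).congr_deriv ?_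
      simp
    refine ⟨∑ k, 2 * (u t y k - v t z k) * (GU k - GW k), ?_, ?_⟩
    · refine HasDerivWithinAt.fun_sum fun k _ => ?_
      have h2 := hve t ht z k
      rw [← hGW] at h2
      refine (((hGU1 k).fun_sub h2).fun_pow 2).congr_deriv ?_
      simp
    have fin := k3_alg (p := fun k => u t y k - v t z k) (U0 := u t y) (W0 := v t z) (GU := GU) (GW := GW)
      (SU := fun k => ∑ i, ∑ j, Qm ⟨t, ht'⟩ y i j * pdd (fun z => u t z k) y i j)
      (SW := fun k => ∑ i, ∑ j, q t z i j * pdd (fun z => v t z k) z i j)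
      (Dd := fun k i => pd (fun x => u t x k) y i - pd (fun x => v t x k) z i) (U := fun k i => pd (fun x => u t x k) y i) (W := fun k i => pd (fun x => v t x k) z i)
      (σ := σ) (σ' := σ') (Q := q t z) (Ay := A t y) (Az := A t z) (Cy := C t y) (Cz := C t z) (bb := fun i => b t z i + β t z i) (φ1 := fun i => pd φ z i) (φ2 := ∑ i, ∑ j, q t z i j * pdd φ z i j)
      (lam := lam t z) (X := X0 t z) (Lc := Lc t z) (n := n) (L := L) (LA := L1 + L2) (C0 := C0) (Mp := C0 + Mv) (e := κ + ‖y - z‖) (D' := D')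
      hd hm hγ (by linarith [D.hlam t ht' z]) (D.hX0 t ht' z) hC0 (pz) hn hL0 (pz) (pz) (by linarith)
      (fun k => rfl) (fun k i => by ring) (fun k => (P.bd t ht' y k).1) (fun k i => (P.bd t ht' y k).2 i)
      (fun k => (abs_sub _ _).trans (add_le_add (P.bd t ht' y k).1 (hvb t ht' z k))) hds hσ' (D.hqp t ht' z)
      (fun i k l => (hL1 (i, k, l) t ht' y z hy hz).trans (by
        have : 0 ≤ L1 * κ + L2 * (κ + ‖y - z‖) := pz
        linarith))
      (fun k l => (hL2 (k, l) t ht' y z hy hz).trans (by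
        have : 0 ≤ L2 * κ + L1 * (κ + ‖y - z‖) := pz
        linarith))
      (fun i k l => D.hAX t ht' z i k l) (D.hCL t ht' z) (D.hds t ht' z)
      (fun i => by
        have h := l1 (EuclideanSpace.single i 1) (EuclideanSpace.single i 1) 0
        have := dbl_one (S := fun y z => ∑ k, (u t y k - v t z k) ^ 2) hφ hmax h
        simpa using this) ?_ (fun k => (hGU2 k).trans (by linarith)) hGW
    · have hl := mul_le_l (hly t ht' z) hD.le
      exact fin.trans (by linarith)
    · have g3 : ∀ a, (∑ k, (2 * ((∑ i, pd (fun x => u t x k) y i * σ i a) - ∑ i, pd (fun x => v t x k) z i * σ' i a) ^ 2 + 2 * (u t y k - v t z k) * ((∑ i, ∑ j, pdd (fun z => u t z k) y i j * σ i a * σ j a) - ∑ i, ∑ j, pdd (fun z => v t z k) z i j * σ' i a * σ' j a))) ≤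
          D' * (∑ i, ∑ j, pdd φ z i j * σ' i a * σ' j a) + 2 * n * ∑ i, (σ i a - σ' i a) ^ 2 := fun a => by
        refine dbl_two (S := fun y z => ∑ k, (u t y k - v t z k) ^ 2) hφ hmax (a := WithLp.toLp 2 fun i => σ i a) (a' := WithLp.toLp 2 fun i => σ' i a) (l1 _ _) ?_
        refine HasDerivAt.fun_sum fun k _ => ?_
        have h1 := hasDerivAt_line (f := fun x => u t x k) (x := y) (a := WithLp.toLp 2 fun i => σ i a) (t := 0) ((hus k).differentiable (by norm_num)).differentiableAt
        have h2 := hasDerivAt_line (f := fun x => v t x k) (x := z) (a := WithLp.toLp 2 fun i => σ' i a) (t := 0) ((hvs k).differentiable (by norm_num)).differentiableAt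
        have e1 := hasDerivAt_line2 (hus k) y (WithLp.toLp 2 fun i => σ i a) 0
        have e2 := hasDerivAt_line2 (hvs k) z (WithLp.toLp 2 fun i => σ' i a) 0
        refine (((h1.fun_sub h2).const_mul 2).fun_mul (e1.fun_sub e2)).congr_deriv ?_
        simp only [zero_smul, add_zero]; ring
      have g4 := Finset.sum_le_sum fun k (_ : k ∈ Finset.univ) => g3 k
      simp only [sum_ad, ← mul_sm] at g4
      rw [root_trace hσ', sum_comm (f := fun a k => 2 * (u t y k - v t z k) * ((∑ i, ∑ j, pdd (fun z => u t z k) y i j * σ i a * σ j a) - ∑ i, ∑ j, pdd (fun z => v t z k) z i j * σ' i a * σ' j a))] at g4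
      simp only [← mul_sm, sum_sub_distrib] at g4
      simp only [root_trace hσ, root_trace hσ'] at g4
      simp only [← mul_sm]
      exact g4
  · positivity

end dbl5

section dbl6
variable {d m : ℕ} {s T ν₀ γ K : ℝ} {q : CQ d} {A : CA d m} {C : CM d m}
    {β b : CV d} {lam Lc X0 k0 : CF d}

theorem Ff_le {r H a ε C0 t : ℝ} {u : CU d m} (hH : 0 ≤ H) (ha : 0 < a) (hr : 0 < r) (hε : 0 < ε) (hε1 : ε ≤ 1) (ht : s ≤ t) {x : EE d} (h : ∀ k, |u t x k| ≤ C0 ∧ ∀ l, |pd (fun z => u t z k) x l| ≤ C0) :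
    Ff r H s a ε u t x ≤ (m * C0 ^ 2 + a * (d * (m * C0 ^ 2)) + 1) ^ r := by
  have hts : 0 ≤ t - s := by linarith
  have hθ0 : 0 ≤ (t - s) / (1 + (t - s)) := pz
  have hθ1 : (t - s) / (1 + (t - s)) ≤ 1 := by rw [div_le_one (by linarith)]; linarith
  have h1 : wf (a * ((t - s) / (1 + (t - s)))) ε (u t) x ≤ m * C0 ^ 2 + a * (d * (m * C0 ^ 2)) + 1 := by
    refine (wf_le (pz) h).trans ?_
    have : a * ((t - s) / (1 + (t - s))) * (d * (m * C0 ^ 2)) ≤ a * 1 * (d * (m * C0 ^ 2)) := mul_le_r (mul_le_l hθ1 ha.le) (pz)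
    linarith
  have h0 := wf_pos (c := a * ((t - s) / (1 + (t - s)))) (pz) hε (u t) x
  unfold Ff
  have h2 := Real.rpow_le_rpow h0.le h1 hr.le
  have h3 : exp (-(H * (t - s))) ≤ 1 := Real.exp_le_one_iff.2 (by have := mul_nonneg hH hts; linarith)
  calc _ ≤ 1 * wf (a * ((t - s) / (1 + (t - s)))) ε (u t) x ^ r := mul_le_r h3 (Real.rpow_nonneg h0.le _)
    _ ≤ _ := by rw [one_mul]; exact h2

theorem APPROX (D : Dat s T ν₀ γ K q A C β b lam Lc X0 k0) (hd : 1 ≤ d) (hm : 1 ≤ m) (hsT : s < T) (hν : 0 < ν₀) (hγ : 1 / 4 ≤ γ) (hK : 0 ≤ K) {a r : ℝ}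
    (ha : 0 < a) (ha1 : a ≤ 1 / 3) (ha2 : a ≤ ν₀ / (16 * γ)) (hr : 0 < r) (hr1 : 1 / (2 * γ) ≤ 2 - 4 * (1 - r)) {f : EE d → Fin m → ℝ} (hf : ∀ k, SB (fun (_ : Unit) x => f x k))
    (hfu : ∀ k, UniformContinuous (fun x => f x k)) (hfr : UniformContinuous (fun x => (∑ k, f x k ^ 2) ^ r))
    {lam₀ : ℝ} (hl : 0 < lam₀) {φ : EE d → ℝ} (hφ : ContDiff ℝ 2 φ) (hφ0 : ∀ x, 0 < φ x) (hφb : Tendsto φ (cocompact (EE d)) atTop)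
    (hly : ∀ t ∈ Icc s T, ∀ x, (∑ i, ∑ j, q t x i j * pdd φ x i j) + (∑ i, (b t x i + β t x i) * pd φ x i) ≤ lam₀ * φ x)
    {u : CU d m} {Mu : ℝ} (hMu : 0 ≤ Mu) (hub : ∀ t ∈ Icc s T, ∀ x k, |u t x k| ≤ Mu) (hu2 : ∀ t ∈ Ioc s T, ∀ k, ContDiff ℝ 2 (fun z => u t z k))
    (huc : ∀ k, ContinuousOn (fun p : ℝ × EE d => u p.1 p.2 k) (Icc s T ×ˢ univ)) (hu0 : ∀ x, u s x = f x)
    (hue : ∀ t ∈ Ioc s T, ∀ x k, HasDerivWithinAt (fun τ => u τ x k) ((∑ i, ∑ j, q t x i j * pdd (fun z => u t z k) x i j) + (∑ i, ∑ l, A t x i k l * pd (fun z => u t z l) x i) + ∑ l, C t x k l * u t x l) (Iic t) t)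
    {v : CF d} {Mv : ℝ} (hMv : 0 ≤ Mv) (hvb : ∀ t ∈ Icc s T, ∀ x, |v t x| ≤ Mv) (hv2 : ∀ t ∈ Ioc s T, ContDiff ℝ 2 (v t))
    (hvc : ContinuousOn (fun p : ℝ × EE d => v p.1 p.2) (Icc s T ×ˢ univ)) (hv0 : ∀ x, v s x = (∑ k, f x k ^ 2) ^ r)
    (hve : ∀ t ∈ Ioc s T, ∀ x, HasDerivWithinAt (fun τ => v τ x) ((∑ i, ∑ j, q t x i j * pdd (v t) x i j) + (∑ i, (b t x i + β t x i) * pd (v t) x i)) (Iic t) t)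
    {η : ℝ} (hη : 0 < η) (ρ : ℝ) :
    ∃ ε > 0, ∃ w : CU d m, (∀ t k, ContDiff ℝ ∞ (fun x => w t x k)) ∧ ∀ t ∈ Icc s T, ∀ y, ‖y‖ ≤ ρ →
      Ff r (r * (4 + 2 * (K + 3))) s a ε w t y ≤ v t y + 3 * η ∧ ∑ k, (w t y k - u t y k) ^ 2 ≤ 3 * η := by
  obtain ⟨C0, hC0, hAS⟩ := AS D hd hm hsT hν hγ hK ha ha1 ha2 hr hr1 hf
  have hm0 : (0:ℝ) < m := by exact_mod_cast hm
  obtain ⟨B, hB⟩ : ∃ B, B = (m * C0 ^ 2 + a * (d * (m * C0 ^ 2)) + 1) ^ r := ⟨_, rfl⟩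
  have hB0 : 0 ≤ B := by rw [hB]; positivity
  -- initial modulus
  obtain ⟨G, hG0, hG⟩ : ∃ G, 0 ≤ G ∧ ∀ x, ∑ k, f x k ^ 2 ≤ G := by
    obtain ⟨M1, hM1, h1⟩ := fin_bdd (F := fun k (_ : Unit) x => f x k) fun k => (hf k).bdd
    refine ⟨m * M1 ^ 2, pz, fun x => (sum_le fun k => sq_le_sq' (neg_le_of_abs_le (h1 k () x)) (le_of_abs_le (h1 k () x))).trans (le_of_eq (by simp))⟩
  obtain ⟨ε, hε, hε1, hεr⟩ : ∃ ε, 0 < ε ∧ ε ≤ 1 ∧ ∀ τ, 0 ≤ τ → τ ≤ G → (τ + ε) ^ r - τ ^ r ≤ η / 2 := by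
    have huc := (isCompact_Icc (a := (0:ℝ)) (b := G + 1)).uniformContinuousOn_of_continuous (f := fun τ : ℝ => τ ^ r) (Real.continuous_rpow_const hr.le).continuousOn
    rw [Metric.uniformContinuousOn_iff] at huc
    obtain ⟨δ, hδ, h⟩ := huc (η / 2) (pz)
    refine ⟨min 1 (δ / 2), pz, min_le_left _ _, fun τ h0 h1 => ?_⟩
    have hp : 0 < min 1 (δ / 2) := pz
    have hq : min 1 (δ / 2) ≤ 1 := min_le_left _ _
    have := h (τ + min 1 (δ / 2)) ⟨by linarith, by linarith⟩ τ ⟨h0, by linarith⟩ (by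
      rw [Real.dist_eq, add_sub_cancel_left, abs_of_pos hp]
      exact (min_le_right _ _).trans_lt (by linarith))
    rw [Real.dist_eq] at this
    exact (le_abs_self _).trans this.le
  obtain ⟨δ₁, hδ₁, hin1⟩ : ∃ δ > 0, ∀ y z : EE d, ‖y - z‖ ≤ δ → (∑ k, f y k ^ 2) ^ r - (∑ k, f z k ^ 2) ^ r ≤ η / 2 := by
    rw [Metric.uniformContinuous_iff] at hfr
    obtain ⟨δ, hδ, h⟩ := hfr (η / 2) (pz)
    refine ⟨δ / 2, pz, fun y z hyz => ?_⟩
    have := h (a := y) (b := z) (by rw [dist_eq_norm]; linarith)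
    rw [Real.dist_eq] at this
    exact (le_abs_self _).trans this.le
  obtain ⟨δ₂, hδ₂, hin2⟩ : ∃ δ > 0, ∀ y z : EE d, ‖y - z‖ ≤ δ → ∑ k, (f y k - f z k) ^ 2 ≤ η := by
    have hg : UniformContinuous (fun x => f x) := uniformContinuous_pi.2 hfu
    rw [Metric.uniformContinuous_iff] at hg
    obtain ⟨e, he, he2⟩ : ∃ e : ℝ, 0 < e ∧ m * e ^ 2 ≤ η := ⟨√(η / m), pz, by rw [sq_sqrt (pz)]; field_simp; rfl⟩
    obtain ⟨δ, hδ, h⟩ := hg e he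
    refine ⟨δ / 2, pz, fun y z hyz => ?_⟩
    have h1 := h (a := y) (b := z) (by rw [dist_eq_norm]; linarith)
    refine le_trans (sum_le fun k => ?_ : _ ≤ ∑ k : Fin m, e ^ 2) (by simpa using he2)
    have h2 : |f y k - f z k| ≤ e := by
      have := (dist_le_pi_dist (f y) (f z) k).trans h1.le
      rwa [Real.dist_eq] at this
    exact sq_le_sq' (neg_le_of_abs_le h2) (le_of_abs_le h2)
  obtain ⟨Ra, hRa0, hRa⟩ := DBL (T := T) (ρ := ρ) (CS := B + Mv) hsT hl hφ hφ0 hφb (pz) hη hδ₁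
  obtain ⟨Rb, hRb0, hRb⟩ := DBL (T := T) (ρ := ρ) (CS := m * (C0 + Mu) ^ 2) hsT hl hφ hφ0 hφb (pz) hη hδ₂
  obtain ⟨R, hR⟩ : ∃ R, R = max Ra Rb := ⟨_, rfl⟩
  obtain ⟨ϖ, hϖ, hAS⟩ := hAS R (by rw [hR]; exact le_max_of_le_left hRa0)
  obtain ⟨c2, hc2, hk2⟩ := key2 D hν hφ hly hv2 hve R
  obtain ⟨e1, e2, he1, he2, hk3⟩ := key3 D hd hm hν hγ hφ hly hMu hub hu2 hue R C0 hC0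
  obtain ⟨κa, hκa, hDa⟩ := hRa R (by rw [hR]; exact le_max_left _ _) 0 c2 ϖ le_rfl hc2 hϖ
  obtain ⟨κb, hκb, hDb⟩ := hRb R (by rw [hR]; exact le_max_right _ _) e1 e2 ϖ he1 he2 hϖ
  obtain ⟨κ, hκ, hκ1, hκ2, hκ3⟩ : ∃ κ, 0 < κ ∧ κ ≤ 1 ∧ κ ≤ κa ∧ κ ≤ κb := ⟨min 1 (min κa κb), pz, min_le_left _ _, (min_le_right _ _).trans (min_le_left _ _), (min_le_right _ _).trans (min_le_right _ _)⟩
  obtain ⟨w, Qm, βm, P⟩ := hAS ε hε κ hκ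
  have hpr1 : MapsTo (fun p : ℝ × EE d × EE d => (p.1, p.2.1)) (Icc s T ×ˢ univ) (Icc s T ×ˢ (univ : Set (EE d))) := fun p hp => ⟨hp.1, mem_univ _⟩
  have hpr2 : MapsTo (fun p : ℝ × EE d × EE d => (p.1, p.2.2)) (Icc s T ×ˢ univ) (Icc s T ×ˢ (univ : Set (EE d))) := fun p hp => ⟨hp.1, mem_univ _⟩
  have hcp1 : Continuous (fun p : ℝ × EE d × EE d => (p.1, p.2.1)) := by fun_prop
  have hcp2 : Continuous (fun p : ℝ × EE d × EE d => (p.1, p.2.2)) := by fun_prop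
  refine ⟨ε, hε, w, P.sm, fun t ht y hy => ⟨?_, ?_⟩⟩
  · have := hDa κ hκ hκ2 (fun t y z => Ff r (r * (4 + 2 * (K + 3))) s a ε w t y - v t z) ?_ ?_ ?_ ?_ t ht y hy
    · linarith
    · exact (P.Fc.comp hcp1.continuousOn hpr1).sub (hvc.comp hcp2.continuousOn hpr2)
    · intro t ht y z
      have h1 := Ff_le (r := r) (H := r * (4 + 2 * (K + 3))) (pz) ha hr hε hε1 ht.1 (P.bd t ht y)
      rw [← hB] at h1
      have := (abs_le.1 (hvb t ht z)).1
      linarith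
    · intro y z hyz
      have h1 := hin1 y z hyz
      have h2 := hεr (∑ k, f y k ^ 2) (sum_nn fun k => sq_nonneg _) (hG y)
      have h3 : Ff r (r * (4 + 2 * (K + 3))) s a ε w s y = ((∑ k, f y k ^ 2) + ε) ^ r := by
        simp [Ff, wf, P.ini]
      rw [hv0, h3]; linarith
    · intro t ht y z hy hz hyz _ D' n hD hn hmx
      exact hk2 ϖ κ C0 a ε r _ hκ hκ1 f w Qm βm P t ht y z hy hz hyz D' n hD hn hmx
  · refine hDb κ hκ hκ3 (fun t y z => ∑ k, (w t y k - u t z k) ^ 2) ?_ ?_ ?_ ?_ t ht y hy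
    · refine continuousOn_finset_sum _ fun k _ => ContinuousOn.pow (ContinuousOn.sub ?_ ((huc k).comp hcp2.continuousOn hpr2)) 2
      exact ((P.cu k).comp hcp1).continuousOn
    · intro t ht y z
      refine (sum_le fun k => ?_ : _ ≤ ∑ k : Fin m, (C0 + Mu) ^ 2).trans (le_of_eq (by simp))
      have : |w t y k - u t z k| ≤ C0 + Mu := (abs_sub _ _).trans (add_le_add (P.bd t ht y k).1 (hub t ht z k))
      exact sq_le_sq' (neg_le_of_abs_le this) (le_of_abs_le this)
    · intro y z hyz
      simpa only [P.ini, hu0] using hin2 y z hyz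
    · intro t ht y z hy hz hyz hyz1 D' n hD hn hmx
      exact hk3 ϖ κ a ε r _ hκ hκ1 f w Qm βm P t ht y z hy hz hyz1 D' n hD hn hmx

end dbl6

section grad
variable {d m : ℕ}

theorem GRAD {Φ : ℝ → ℝ} (hΦ : Continuous Φ) {U V : EE d → ℝ} (hU : Differentiable ℝ U) (hV : Continuous V) {x0 : EE d} {l : Fin d}
    (h : ∀ η > 0, ∃ W : EE d → ℝ, Differentiable ℝ W ∧ ∀ y, ‖y - x0‖ ≤ 1 → Φ (pd W y l) ≤ V y + η ∧ |W y - U y| ≤ η) : Φ (pd U x0 l) ≤ V x0 := by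
  refine le_of_forall_pos_le_add fun δ hδ => ?_
  obtain ⟨e, he⟩ : ∃ e : EE d, e = EuclideanSpace.single l 1 := ⟨_, rfl⟩
  have hen : ‖e‖ = 1 := by rw [he]; simp
  have hsum : ∀ g : Fin d → ℝ, ∑ i, g i * e i = g l := fun g => by rw [he]; simp
  -- continuity of V along the line
  have hVl : ∀ᶠ c : ℝ in nhds 0, V (x0 + c • e) < V x0 + δ := by
    have h1 : Continuous fun c : ℝ => V (x0 + c • e) := by fun_prop
    have h2 := h1.tendsto 0
    simp only [zero_smul, add_zero] at h2
    exact h2.eventually (gt_mem_nhds (by linarith))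
  obtain ⟨h0, hh0, hVl⟩ := Metric.eventually_nhds_iff.1 hVl
  have key : ∀ c : ℝ, 0 < c → c < h0 → c ≤ 1 → Φ (c⁻¹ * (U (x0 + c • e) - U x0)) ≤ V x0 + δ := by
    intro c hc hc0 hc1
    choose W hW1 hW2 using fun n : ℕ => h (1 / ((n:ℝ) + 1)) (pz)
    have hlim : ∀ y, ‖y - x0‖ ≤ 1 → Tendsto (fun n => W n y) atTop (nhds (U y)) := fun y hy => by
      rw [tendsto_iff_dist_tendsto_zero]
      refine squeeze_zero (fun _ => dist_nonneg) (fun n => ?_) tendsto_one_div_add_atTop_nhds_zero_nat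
      rw [Real.dist_eq]; exact (hW2 n y hy).2
    have l1 := hlim (x0 + c • e) (by rw [add_sub_cancel_left, norm_smul, hen, mul_one, Real.norm_eq_abs, abs_of_pos hc]; exact hc1)
    have l2 := hlim x0 (by simp)
    have l3 := (hΦ.tendsto _).comp ((l1.sub l2).const_mul c⁻¹)
    have l4 : Tendsto (fun n : ℕ => V x0 + δ + 1 / ((n:ℝ) + 1)) atTop (nhds (V x0 + δ + 0)) := tendsto_one_div_add_atTop_nhds_zero_nat.const_add _
    rw [add_zero] at l4
    refine le_of_tendsto_of_tendsto' l3 l4 fun n => ?_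
    obtain ⟨c', hc', hd'⟩ := exists_hasDerivAt_eq_slope (fun c : ℝ => W n (x0 + c • e)) (fun c => ∑ i, pd (W n) (x0 + c • e) i * e i) hc
      (by have := (hW1 n).continuous; fun_prop) (fun c _ => hasDerivAt_line (hW1 n).differentiableAt)
    rw [hsum] at hd'
    simp only [zero_smul, add_zero, sub_zero] at hd'
    have e1 : c⁻¹ * (W n (x0 + c • e) - W n x0) = pd (W n) (x0 + c' • e) l := by rw [hd']; field_simp
    simp only [Function.comp, e1]
    have h5 := (hW2 n (x0 + c' • e) (by rw [add_sub_cancel_left, norm_smul, hen, mul_one, Real.norm_eq_abs, abs_of_pos hc'.1]; exact hc'.2.le.trans hc1)).1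
    have h6 := hVl (y := c') (by rw [Real.dist_eq, sub_zero, abs_of_pos hc'.1]; linarith [hc'.2])
    linarith
  have hd1 : HasDerivAt (fun c : ℝ => U (x0 + c • e)) (pd U x0 l) 0 := by
    have := hasDerivAt_line (f := U) (x := x0) (a := e) (t := 0) hU.differentiableAt
    rw [hsum] at this
    simpa using this
  have hsl := hd1.tendsto_slope_zero_right
  simp only [zero_add, zero_smul, add_zero, smul_eq_mul] at hsl
  refine le_of_tendsto ((hΦ.tendsto _).comp hsl) ?_
  have : Ioo (0:ℝ) (min h0 1) ∈ nhdsWithin (0:ℝ) (Ioi 0) := Ioo_mem_nhdsGT (pz)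
  filter_upwards [this] with c hc
  exact key c hc.1 (hc.2.trans_le (min_le_left _ _)) (hc.2.le.trans (min_le_right _ _))

theorem FIN {s t r H a : ℝ} (hd : 1 ≤ d) (hm : 1 ≤ m) (hst : s < t) (ha : 0 < a) (hr : 0 < r) {U : EE d → Fin m → ℝ} {V : EE d → ℝ} (hU : ∀ k, Differentiable ℝ (fun x => U x k)) (hV : Continuous V)
    (h : ∀ η > 0, ∀ ρ, ∃ ε > 0, ∃ w : CU d m, (∀ t k, ContDiff ℝ ∞ (fun x => w t x k)) ∧ ∀ y, ‖y‖ ≤ ρ → Ff r H s a ε w t y ≤ V y + 3 * η ∧ ∑ k, (w t y k - U y k) ^ 2 ≤ 3 * η) (x : EE d) :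
    (∑ i, ∑ k, (pd (fun z => U z k) x i) ^ 2) ^ r ≤ (d * m / a) ^ r * exp ((H + r) * (t - s)) * (t - s) ^ (-r) * V x := by
  have hτ : 0 < t - s := by linarith
  obtain ⟨θ, hθ⟩ : ∃ θ, θ = (t - s) / (1 + (t - s)) := ⟨_, rfl⟩
  have hθ0 : 0 < θ := by rw [hθ]; positivity
  have hd0 : (0:ℝ) < d := by exact_mod_cast hd
  have hm0 : (0:ℝ) < m := by exact_mod_cast hm
  have key : ∀ k l, exp (-(H * (t - s))) * (a * θ * (pd (fun z => U z k) x l) ^ 2) ^ r ≤ V x := fun k l => by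
    refine GRAD (Φ := fun X => exp (-(H * (t - s))) * (a * θ * X ^ 2) ^ r) ?_ (hU k) hV fun η hη => ?_
    · exact continuous_const.mul ((Real.continuous_rpow_const hr.le).comp (by fun_prop))
    · obtain ⟨η', h1, h2, h3⟩ : ∃ η', 0 < η' ∧ 3 * η' ≤ η ∧ 3 * η' ≤ η ^ 2 := ⟨min η (η ^ 2) / 3, pz, by linarith [min_le_left η (η ^ 2)], by linarith [min_le_right η (η ^ 2)]⟩
      obtain ⟨ε, hε, w, hw, hw2⟩ := h η' h1 (‖x‖ + 1)
      refine ⟨fun y => w t y k, smooth_diff (hw t k), fun y hy => ?_⟩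
      obtain ⟨g1, g2⟩ := hw2 y (by have := norm_add_le (y - x) x; rw [sub_add_cancel] at this; linarith)
      constructor
      · refine le_trans ?_ (g1.trans (by linarith))
        unfold Ff; rw [← hθ]
        refine mul_le_l (Real.rpow_le_rpow (pz) ?_ hr.le) (exp_pos _).le
        unfold wf
        have a1 : 0 ≤ ∑ k, w t y k ^ 2 := sum_nn fun _ => sq_nonneg _
        have a2 : pd (fun z => w t z k) y l ^ 2 ≤ ∑ l, ∑ k, pd (fun z => w t z k) y l ^ 2 :=
          (single_le_sum (f := fun k => pd (fun z => w t z k) y l ^ 2) (fun _ _ => sq_nonneg _) (Finset.mem_univ k)).trans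
            (single_le_sum (f := fun l => ∑ k, pd (fun z => w t z k) y l ^ 2) (fun _ _ => sum_nn fun _ => sq_nonneg _) (Finset.mem_univ l))
        have a3 := mul_le_l a2 (show 0 ≤ a * θ by positivity)
        linarith
      · refine abs_le_of_sq_le_sq ?_ hη.le
        have a1 : (w t y k - U y k) ^ 2 ≤ ∑ k, (w t y k - U y k) ^ 2 := single_le_sum (f := fun k => (w t y k - U y k) ^ 2) (fun _ _ => sq_nonneg _) (Finset.mem_univ k)
        linarith
  have hne : (Finset.univ : Finset (Fin d × Fin m)).Nonempty := ⟨(⟨0, hd⟩, ⟨0, hm⟩), Finset.mem_univ _⟩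
  obtain ⟨⟨l, k⟩, -, hmx⟩ := Finset.exists_max_image Finset.univ (fun p : Fin d × Fin m => (pd (fun z => U z p.2) x p.1) ^ 2) hne
  have hsum : ∑ i, ∑ k, (pd (fun z => U z k) x i) ^ 2 ≤ d * m / (a * θ) * (a * θ * (pd (fun z => U z k) x l) ^ 2) := by
    refine (sum_le fun i => sum_le fun j => hmx (i, j) (Finset.mem_univ _)).trans (le_of_eq ?_)
    simp; field_simp
  have h1 := Real.rpow_le_rpow (sum_nn fun i => sum_nn fun _ => sq_nonneg _) hsum hr.le
  rw [Real.mul_rpow (pz) (pz)] at h1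
  have h2 : (a * θ * (pd (fun z => U z k) x l) ^ 2) ^ r ≤ exp (H * (t - s)) * V x := by
    have := mul_le_l (key k l) (exp_pos (H * (t - s))).le
    rwa [← mul_assoc, ← Real.exp_add, add_neg_cancel, Real.exp_zero, one_mul] at this
  have hVx : 0 ≤ V x := le_trans (pz) (key k l)
  have h3 : (d * m / (a * θ)) ^ r ≤ (d * m / a) ^ r * exp (r * (t - s)) * (t - s) ^ (-r) := by
    have e : d * m / (a * θ) = (d * m / a) * ((1 + (t - s)) * (t - s)⁻¹) := by rw [hθ]; field_simp
    rw [e, Real.mul_rpow (pz) (pz), Real.mul_rpow (pz) (pz), Real.inv_rpow hτ.le, Real.rpow_neg hτ.le, mul_assoc]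
    refine mul_le_l (mul_le_r ?_ (pz)) (pz)
    have := Real.rpow_le_rpow (pz) (show 1 + (t - s) ≤ exp (t - s) by linarith [Real.add_one_le_exp (t - s)]) hr.le
    rw [← Real.exp_mul] at this
    rwa [mul_comm r]
  refine h1.trans ((mul_le_mul h3 h2 (pz) (pz)).trans (le_of_eq ?_))
  rw [add_mul, Real.exp_add]; ring

end grad

section coef
variable {d m : ℕ} {s T α : ℝ} {I : Set ℝ}

theorem LB.mk {g : CF d} (h : ∀ R : ℝ, ∃ M, ∀ t ∈ Icc s T, ∀ x, ‖x‖ ≤ R → |g t x| ≤ M) : LB s T g := by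
  intro R
  obtain ⟨M, hM⟩ := h R
  filter_upwards [eventually_ge_atTop M] with N hN t ht x hx
  exact (hM t ht x hx).trans hN

theorem LX.mk {g : CF d} (h : ∀ R ε : ℝ, 0 < ε → ∃ δ > 0, ∀ t ∈ Icc s T, ∀ x y, ‖x‖ ≤ R → ‖y - x‖ ≤ δ → |g t y - g t x| ≤ ε) : LX s T g := by
  intro R ε hε
  obtain ⟨δ, hδ, h1⟩ := h R ε hε
  filter_upwards [Ioc_mem_nhdsGT hδ] with δ' hδ' t ht x y hx hy
  exact h1 t ht x y hx (hy.trans hδ'.2)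

theorem LX.of_le {ι : Type*} [Fintype ι] {g : ι → CF d} (hg : ∀ i, LX s T (g i)) {h : CF d} {c : ℝ} (hc : 0 ≤ c)
    (hh : ∀ t ∈ Icc s T, ∀ x y, |h t y - h t x| ≤ c * ∑ i, |g i t y - g i t x|) : LX s T h := by
  intro R ε hε
  set e := ε / (c * Fintype.card ι + 1) with he
  have hpos : 0 < c * Fintype.card ι + 1 := pz
  have he0 : 0 < e := pz
  filter_upwards [eventually_all.2 fun i => hg i R e he0] with δ hδ t ht x y hx hy
  refine (hh t ht x y).trans ?_
  have h1 : ∑ i, |g i t y - g i t x| ≤ Fintype.card ι * e := by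
    refine (sum_le fun i => hδ i t ht x y hx hy).trans ?_
    simp
  have h2 := mul_le_l h1 hc
  have h3 : (c * Fintype.card ι + 1) * e = ε := by rw [he]; field_simp
  nlinarith

theorem LB.of_le {ι : Type*} [Fintype ι] {g : ι → CF d} (hg : ∀ i, LB s T (g i)) {h : CF d} {c c' : ℝ} (hc : 0 ≤ c)
    (hh : ∀ t ∈ Icc s T, ∀ x, |h t x| ≤ c' + c * ∑ i, |g i t x|) : LB s T h := by
  refine LB.mk fun R => ?_
  obtain ⟨M, hM⟩ := (eventually_all.2 fun i => hg i R).exists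
  refine ⟨c' + c * (Fintype.card ι * M), fun t ht x hx => (hh t ht x).trans ?_⟩
  have h1 : ∑ i, |g i t x| ≤ Fintype.card ι * M := by
    refine (sum_le fun i => hM i t ht x hx).trans ?_
    simp
  have h2 := mul_le_l h1 hc
  linarith

theorem Hol.add {f g : CF d} (hf : HolderLocPar d α I f) (hg : HolderLocPar d α I g) : HolderLocPar d α I (fun t x => f t x + g t x) := by
  intro K hK hKI
  obtain ⟨c, hc⟩ := hf K hK hKI
  obtain ⟨c', hc'⟩ := hg K hK hKI
  refine ⟨c + c', fun p hp q hq => ?_⟩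
  have h1 := hc p hp q hq
  have h2 := hc' p hp q hq
  have h3 := abs_add_le (f p.1 p.2 - f q.1 q.2) (g p.1 p.2 - g q.1 q.2)
  rw [show f p.1 p.2 + g p.1 p.2 - (f q.1 q.2 + g q.1 q.2) = f p.1 p.2 - f q.1 q.2 + (g p.1 p.2 - g q.1 q.2) by ring, add_mul]
  linarith

theorem Hol.cmul (a : ℝ) {f : CF d} (hf : HolderLocPar d α I f) : HolderLocPar d α I (fun t x => a * f t x) := by
  intro K hK hKI
  obtain ⟨c, hc⟩ := hf K hK hKI
  refine ⟨|a| * c, fun p hp q hq => ?_⟩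
  have h1 := mul_le_l (hc p hp q hq) (abs_nonneg a)
  rw [← mul_sub, abs_mul, mul_assoc]
  exact h1

theorem Hol.sum {κ : Type*} (S : Finset κ) {f : κ → CF d} (hf : ∀ i, HolderLocPar d α I (f i)) : HolderLocPar d α I (fun t x => ∑ i ∈ S, f i t x) := by
  classical
  induction S using Finset.induction_on with
  | empty => intro K _ _; exact ⟨0, fun p _ q _ => by simp⟩
  | insert a S ha ih =>
    have := Hol.add (hf a) ih
    simpa only [Finset.sum_insert ha] using this

theorem Hol.all (hα : 0 < α) (hs : Icc s T ⊆ I) (hsT : s < T) {g : CF d} (hg : HolderLocPar d α I g) : LB s T g ∧ LX s T g ∧ LTm s T g := by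
  have key : ∀ R : ℝ, ∃ c : ℝ, 0 < c ∧ ∀ t ∈ Icc s T, ∀ t' ∈ Icc s T, ∀ x y : EE d, ‖x‖ ≤ R → ‖y‖ ≤ R → |g t x - g t' y| ≤ c * (|t - t'| ^ (α / 2) + ‖x - y‖ ^ α) := by
    intro R
    obtain ⟨c, hc⟩ := hg (Icc s T ×ˢ Metric.closedBall 0 R) (isCompact_Icc.prod (isCompact_closedBall _ _)) fun p hp => hs hp.1
    refine ⟨|c| + 1, pz, fun t ht t' ht' x y hx hy => (hc (t, x) ⟨ht, by simpa using hx⟩ (t', y) ⟨ht', by simpa using hy⟩).trans ?_⟩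
    refine mul_le_r ((le_abs_self c).trans (by linarith)) ?_
    positivity
  have small : ∀ e β : ℝ, 0 < e → 0 < β → ∃ δ > 0, δ ≤ 1 ∧ ∀ z, 0 ≤ z → z ≤ δ → z ^ β ≤ e := by
    intro e β he hβ
    refine ⟨min 1 (e ^ (1 / β)), lt_min one_pos (Real.rpow_pos_of_pos he _), min_le_left _ _, fun z hz hz' => ?_⟩
    have := Real.rpow_le_rpow hz (hz'.trans (min_le_right _ _)) hβ.le
    rwa [← Real.rpow_mul he.le, one_div_mul_cancel hβ.ne', Real.rpow_one] at this
  refine ⟨LB.mk fun R => ?_, LX.mk fun R ε hε => ?_, fun R ε hε => ?_⟩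
  · obtain ⟨c, hc, h⟩ := key |R|
    refine ⟨|g s 0| + c * ((T - s) ^ (α / 2) + |R| ^ α), fun t ht x hx => ?_⟩
    have h1 := h t ht s ⟨le_rfl, hsT.le⟩ x 0 (hx.trans (le_abs_self _)) (by simp)
    have h2 : |t - s| ^ (α / 2) ≤ (T - s) ^ (α / 2) := by
      refine Real.rpow_le_rpow (abs_nonneg _) ?_ (pz)
      rw [abs_of_nonneg (by linarith [ht.1])]; linarith [ht.2]
    have h3 : ‖x - 0‖ ^ α ≤ |R| ^ α := by
      refine Real.rpow_le_rpow (norm_nonneg _) ?_ hα.le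
      rw [sub_zero]; exact hx.trans (le_abs_self _)
    have h4 := mul_le_l (add_le_add h2 h3) hc.le
    have h5 := abs_sub_abs_le_abs_sub (g t x) (g s 0)
    linarith
  · obtain ⟨c, hc, h⟩ := key (R + 1)
    obtain ⟨δ, hδ, hδ1, h1⟩ := small (ε / c) α (pz) hα
    refine ⟨δ, hδ, fun t ht x y hx hy => ?_⟩
    have h2 := h t ht t ht y x (ball_sub1 hx hδ1 hy) (by linarith)
    have h3 := mul_le_l (h1 _ (norm_nonneg _) hy) hc.le
    rw [sub_self, abs_zero, Real.zero_rpow (pz), zero_add] at h2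
    rw [mul_div_cancel₀ _ hc.ne'] at h3
    linarith
  · obtain ⟨c, hc, h⟩ := key R
    obtain ⟨δ, hδ, hδ1, h1⟩ := small (ε / c) (α / 2) (pz) (pz)
    refine ⟨δ, hδ, fun t ht t' ht' htt x hx => ?_⟩
    have h2 := h t ht t' ht' x x hx hx
    have h3 := mul_le_l (h1 _ (abs_nonneg _) htt.le) hc.le
    rw [sub_self, norm_zero, Real.zero_rpow hα.ne', add_zero] at h2
    rw [mul_div_cancel₀ _ hc.ne'] at h3
    linarith

theorem min_eig_le {n : ℕ} {M N : MM n} {a c : ℝ} (hM : IsMinEigen M a) (hN : IsMinEigen N c) : a - c ≤ ∑ p : Fin n × Fin n, |M p.1 p.2 - N p.1 p.2| := by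
  obtain ⟨w, hw, h1⟩ := hN.2
  have h2 := hM.1 w
  have hpos : 0 < ∑ k, w k ^ 2 := by
    obtain ⟨k, hk⟩ := Function.ne_iff.1 hw
    have : 0 < w k ^ 2 := by have : w k ≠ 0 := hk; positivity
    exact this.trans_le (single_le_sum (f := fun k => w k ^ 2) (fun i _ => sq_nonneg _) (Finset.mem_univ k))
  have hb : ∀ k l, |w k * w l| ≤ ∑ k, w k ^ 2 := by
    intro k l
    have hk := single_le_sum (f := fun k => w k ^ 2) (fun i _ => sq_nonneg _) (Finset.mem_univ k)
    have hl := single_le_sum (f := fun k => w k ^ 2) (fun i _ => sq_nonneg _) (Finset.mem_univ l)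
    rw [abs_mul]
    have := sq_nonneg (|w k| - |w l|)
    rw [sub_sq, sq_abs, sq_abs] at this
    linarith
  have h3 : (∑ k, ∑ l, M k l * w k * w l) - ∑ k, ∑ l, N k l * w k * w l ≤ (∑ p : Fin n × Fin n, |M p.1 p.2 - N p.1 p.2|) * ∑ k, w k ^ 2 := by
    rw [Fintype.sum_prod_type, sum_mul, ← sum_sub_distrib]
    refine sum_le fun k => ?_
    rw [sum_mul, ← sum_sub_distrib]
    refine sum_le fun l => ?_
    have h4 : M k l * w k * w l - N k l * w k * w l = (M k l - N k l) * (w k * w l) := by ring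
    rw [h4]
    refine (le_abs_self _).trans ?_
    rw [abs_mul]
    exact mul_le_l (hb k l) (abs_nonneg _)
  have h5 : (a - c) * ∑ k, w k ^ 2 ≤ (∑ p : Fin n × Fin n, |M p.1 p.2 - N p.1 p.2|) * ∑ k, w k ^ 2 := by
    rw [sub_mul]; linarith [show (∑ k, ∑ l, N k l * w k * w l) = c * ∑ k, w k ^ 2 from h1, show a * ∑ k, w k ^ 2 ≤ ∑ k, ∑ l, M k l * w k * w l from h2]
  exact le_of_mul_le_mul_right h5 hpos

theorem min_eig {n : ℕ} {M N : MM n} {a c : ℝ} (hM : IsMinEigen M a) (hN : IsMinEigen N c) : |a - c| ≤ ∑ p : Fin n × Fin n, |M p.1 p.2 - N p.1 p.2| := by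
  rw [abs_le]
  have h1 := min_eig_le hM hN
  have h2 := min_eig_le hN hM
  simp only [abs_sub_comm (N _ _) (M _ _)] at h2
  exact ⟨by linarith, h1⟩

theorem max_neg {n : ℕ} {M : MM n} {a : ℝ} (hM : IsMaxEigen M a) : IsMinEigen (fun i j => -M i j) (-a) := by
  obtain ⟨h1, w, hw, h2⟩ := hM
  simp only [IsMinEigen, neg_mul, Finset.sum_neg_distrib]
  exact ⟨fun w => neg_le_neg (h1 w), w, hw, by rw [h2]⟩

theorem max_eig {n : ℕ} {M N : MM n} {a c : ℝ} (hM : IsMaxEigen M a) (hN : IsMaxEigen N c) : |a - c| ≤ ∑ p : Fin n × Fin n, |M p.1 p.2 - N p.1 p.2| := by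
  have h := min_eig (max_neg hM) (max_neg hN)
  rw [show -a - -c = -(a - c) by ring, abs_neg] at h
  refine h.trans (sum_le fun p => ?_)
  rw [show -M p.1 p.2 - -N p.1 p.2 = -(M p.1 p.2 - N p.1 p.2) by ring, abs_neg]

theorem min_eig0 {n : ℕ} {M : MM n} {a : ℝ} (hM : IsMinEigen M a) : |a| ≤ ∑ p : Fin n × Fin n, |M p.1 p.2| := by
  obtain ⟨w, hw, -⟩ := hM.2
  have h0 : IsMinEigen (fun _ _ : Fin n => (0:ℝ)) 0 := ⟨fun w => by simp, w, hw, by simp⟩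
  simpa using min_eig hM h0

theorem max_eig0 {n : ℕ} {M : MM n} {a : ℝ} (hM : IsMaxEigen M a) : |a| ≤ ∑ p : Fin n × Fin n, |M p.1 p.2| := by
  simpa using min_eig0 (max_neg hM)

/-- the largest Euclidean norm of a finite family of gradients -/
noncomputable def kk (D : Fin d × Fin d → Fin d → ℝ) : ℝ := ‖fun p => vec (D p)‖

theorem kk_nonneg (D : Fin d × Fin d → Fin d → ℝ) : 0 ≤ kk D := norm_nonneg _

theorem vec_norm (f : Fin d → ℝ) : ‖vec f‖ = √(∑ l, f l ^ 2) := by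
  rw [EuclideanSpace.norm_eq]; simp

theorem kk_le {D : Fin d × Fin d → Fin d → ℝ} {c : ℝ} (hc : 0 ≤ c) (h : ∀ p, √(∑ l, D p l ^ 2) ≤ c) : kk D ≤ c :=
  (pi_norm_le_iff_of_nonneg hc).2 fun p => by rw [vec_norm]; exact h p

theorem le_kk (D : Fin d × Fin d → Fin d → ℝ) (p : Fin d × Fin d) : ∑ l, D p l ^ 2 ≤ kk D ^ 2 := by
  have h := norm_le_pi_norm (fun p => vec (D p)) p
  have h0 : 0 ≤ ∑ l, D p l ^ 2 := sum_nn fun _ => sq_nonneg _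
  rw [← sq_sqrt h0, ← vec_norm]
  exact pow_le_pow_left₀ (norm_nonneg _) h 2

theorem vec_norm_le (f : Fin d → ℝ) : ‖vec f‖ ≤ ∑ l, |f l| := by
  rw [eu_decomp (vec f)]
  refine (norm_sum_le _ _).trans (sum_le fun i => ?_)
  rw [norm_smul]; simp

theorem kk_sub (D E : Fin d × Fin d → Fin d → ℝ) : |kk D - kk E| ≤ 1 * ∑ p : (Fin d × Fin d) × Fin d, |D p.1 p.2 - E p.1 p.2| := by
  refine (abs_norm_sub_norm_le _ _).trans ?_
  rw [one_mul]
  refine (pi_norm_le_iff_of_nonneg (sum_nn fun _ => abs_nonneg _)).2 fun p => ?_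
  have h1 : (fun p => vec (D p)) p - (fun p => vec (E p)) p = vec (fun l => D p l - E p l) := by ext l; simp
  rw [Pi.sub_apply, h1]
  refine (vec_norm_le _).trans ?_
  rw [Fintype.sum_prod_type]
  exact single_le_sum (f := fun p => ∑ l, |D p l - E p l|) (fun _ _ => sum_nn fun _ => abs_nonneg _) (Finset.mem_univ p)

end coef

section alg
variable {d m : ℕ}

theorem CS2 {ι κ : Type*} [Fintype ι] [Fintype κ] (M : ι → κ → ℝ) (x : ι → ℝ) (y : κ → ℝ) :
    ∑ i, x i * ∑ k, M i k * y k ≤ √(∑ i, ∑ k, M i k ^ 2) * (√(∑ i, x i ^ 2) * √(∑ k, y k ^ 2)) := by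
  have h := Real.sum_mul_le_sqrt_mul_sqrt Finset.univ (fun p : ι × κ => M p.1 p.2) (fun p => x p.1 * y p.2)
  simp only [Fintype.sum_prod_type, mul_pow, ← mul_sm, ← sum_mul] at h
  rw [Real.sqrt_mul (sum_nn fun _ => sq_nonneg _)] at h
  refine le_of_eq_of_le ?_ h
  refine sum_cg fun i => ?_
  rw [mul_sm]
  exact sum_cg fun k => by ring

theorem CS2' {ι : Type*} [Fintype ι] (M : ι → ι → ℝ) (x : ι → ℝ) :
    ∑ i, x i * ∑ k, M i k * x k ≤ √(∑ i, ∑ k, M i k ^ 2) * ∑ i, x i ^ 2 := by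
  have h := CS2 M x x
  rwa [mul_self_sqrt (sum_nn fun _ => sq_nonneg _)] at h

theorem sf_alg {Db : MM d} {DB : Fin d → Fin m → Fin m → Fin d → ℝ} {E : Fin d → MM d} {DC : Fin m → Fin m → Fin d → ℝ} {L : ℝ}
    (hL : ∀ w : Fin d → ℝ, ∑ i, ∑ l, Db i l * w i * w l ≤ L * ∑ i, w i ^ 2) (u : Fin m → ℝ) (J : MJ d m) :
    (∑ l, ∑ a, J l a * ∑ i, ∑ b, (dl a b * Db i l + DB i a b l + dl a b * ∑ j, E j i l) * J i b) + ∑ l, ∑ a, J l a * ∑ b, DC a b l * u b ≤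
      (√d * √(∑ i, ∑ j, ∑ l, E i j l ^ 2) + √(∑ i, ∑ j, ∑ a, ∑ b, DB i a b j ^ 2) + L + 1 / 2 * √(∑ i, ∑ a, ∑ b, DC a b i ^ 2)) * (∑ i, ∑ a, J i a ^ 2)
        + 1 / 2 * √(∑ i, ∑ a, ∑ b, DC a b i ^ 2) * ∑ a, u a ^ 2 := by
  have hsplit : (∑ l, ∑ a, J l a * ∑ i, ∑ b, (dl a b * Db i l + DB i a b l + dl a b * ∑ j, E j i l) * J i b) =
      (∑ a, ∑ i, ∑ l, Db i l * J i a * J l a) + (∑ l, ∑ a, J l a * ∑ i, ∑ b, DB i a b l * J i b) + ∑ a, ∑ l, J l a * ∑ i, (∑ j, E j i l) * J i a := by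
    have h1 : (∑ a, ∑ i, ∑ l, Db i l * J i a * J l a) = ∑ l, ∑ a, J l a * ∑ i, Db i l * J i a := by
      rw [Finset.sum_comm' (t' := Finset.univ) (s' := fun _ => Finset.univ) (by simp)]
      rw [sum_comm]
      rw [sum_comm]
      simp only [mul_sm]
      rw [sum_comm]
      conv_lhs => enter [2, a]; rw [sum_comm]
      rw [sum_comm]
      exact sum_cg fun l => sum_cg fun a => sum_cg fun i => by ring
    have h2 : (∑ a, ∑ l, J l a * ∑ i, (∑ j, E j i l) * J i a) = ∑ l, ∑ a, J l a * ∑ i, (∑ j, E j i l) * J i a := sum_comm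
    rw [h1, h2, ← sum_ad, ← sum_ad]
    refine sum_cg fun l => ?_
    rw [← sum_ad, ← sum_ad]
    refine sum_cg fun a => ?_
    rw [← mul_add, ← mul_add, ← sum_ad, ← sum_ad]
    congr 1
    refine sum_cg fun i => ?_
    simp only [add_mul, sum_ad, dl, ite_mul, one_mul, zero_mul, sum_ite_eq, Finset.mem_univ, if_true]
  have e1 : (∑ a, ∑ i, ∑ l, Db i l * J i a * J l a) ≤ L * ∑ i, ∑ a, J i a ^ 2 := by
    rw [sum_comm (f := fun i a => J i a ^ 2), mul_sm]
    exact sum_le fun a => hL fun i => J i a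
  have e2 : (∑ l, ∑ a, J l a * ∑ i, ∑ b, DB i a b l * J i b) ≤ √(∑ i, ∑ j, ∑ a, ∑ b, DB i a b j ^ 2) * ∑ i, ∑ a, J i a ^ 2 := by
    have h := CS2' (fun p q : Fin d × Fin m => DB q.1 p.2 q.2 p.1) (fun p => J p.1 p.2)
    simp only [Fintype.sum_prod_type] at h
    have h3 : (∑ l, ∑ a, ∑ i, ∑ b, DB i a b l ^ 2) = ∑ i, ∑ j, ∑ a, ∑ b, DB i a b j ^ 2 := by
      conv_lhs => enter [2, l]; rw [sum_comm]
      exact sum_comm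
    rwa [h3] at h
  have e3 : (∑ a, ∑ l, J l a * ∑ i, (∑ j, E j i l) * J i a) ≤ √d * √(∑ i, ∑ j, ∑ l, E i j l ^ 2) * ∑ i, ∑ a, J i a ^ 2 := by
    rw [sum_comm (f := fun i a => J i a ^ 2), mul_sm]
    refine sum_le fun a => ?_
    refine (CS2' (fun l i => ∑ j, E j i l) (fun l => J l a)).trans ?_
    refine mul_le_r ?_ (sum_nn fun _ => sq_nonneg _)
    rw [← Real.sqrt_mul (pz)]
    refine Real.sqrt_le_sqrt ?_
    have h4 : (∑ i, ∑ j, ∑ l, E i j l ^ 2) = ∑ l, ∑ i, ∑ j, E j i l ^ 2 := by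
      conv_lhs => enter [2, i]; rw [sum_comm]
      rw [sum_comm]
      exact sum_cg fun l => sum_comm
    rw [h4, mul_sm]
    refine sum_le fun l => ?_
    rw [mul_sm]
    refine sum_le fun i => ?_
    have := sq_sum_le_card_mul_sum_sq (s := Finset.univ) (f := fun j => E j i l)
    simpa using this
  have e4 : (∑ l, ∑ a, J l a * ∑ b, DC a b l * u b) ≤ √(∑ i, ∑ a, ∑ b, DC a b i ^ 2) * (1 / 2 * (∑ i, ∑ a, J i a ^ 2) + 1 / 2 * ∑ a, u a ^ 2) := by
    have h := CS2 (fun (p : Fin d × Fin m) b => DC p.2 b p.1) (fun p => J p.1 p.2) u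
    simp only [Fintype.sum_prod_type] at h
    refine h.trans (mul_le_l ?_ (sqrt_nonneg _))
    have h5 := sq_nonneg (√(∑ i, ∑ a, J i a ^ 2) - √(∑ a, u a ^ 2))
    rw [sub_sq, sq_sqrt (sum_nn fun _ => sum_nn fun _ => sq_nonneg _), sq_sqrt (sum_nn fun _ => sq_nonneg _)] at h5
    linarith
  rw [hsplit]
  refine (add_le_add (add_le_add (add_le_add e1 e2) e3) e4).trans (le_of_eq ?_)
  ring

end alg

section mk
variable {d m : ℕ}

theorem abs_le_sqrt_sum {ι : Type*} [Fintype ι] (f : ι → ℝ) (i : ι) : |f i| ≤ √(∑ i, f i ^ 2) :=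
  abs_le_sqrt (single_le_sum (f := fun i => f i ^ 2) (fun _ _ => sq_nonneg _) (Finset.mem_univ i))

theorem mkDat (hd : 1 ≤ d) (hm : 1 ≤ m) {I : Set ℝ} {s T α ν₀ γ K : ℝ} (hsI : Icc s T ⊆ I) (hsT : s < T) (hα : 0 < α) (hν₀ : 0 < ν₀) (hγ : 1 / 4 ≤ γ)
    {ξ : ℝ → ℝ} (hξ : ∀ t ∈ I, 0 < ξ t) {q : CQ d} {lamQ : CF d} (hq_reg : ∀ i j : Fin d, Cpar1 d α I (fun t x => q t x i j))
    (hq_reg2 : ∀ t ∈ I, ∀ i j : Fin d, ContDiff ℝ 2 (fun x => q t x i j)) (hq_symm : ∀ t ∈ I, ∀ x i j, q t x i j = q t x j i)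
    (hlamQ : ∀ t ∈ I, ∀ x, IsMinEigen (q t x) (lamQ t x) ∧ ν₀ ≤ lamQ t x) {b : Fin d → CF d} {Btil Bmat : Fin d → CM d m}
    (hBmat : ∀ i t x k l, Bmat i t x k l = dl k l * b i t x + Btil i t x k l) (hB_reg : ∀ i : Fin d, ∀ k l : Fin m, Cpar1 d α I (fun t x => Bmat i t x k l))
    (hb_diff : ∀ i : Fin d, ∀ t ∈ I, Differentiable ℝ (b i t)) (hBtil_diff : ∀ i : Fin d, ∀ t ∈ I, ∀ k l : Fin m, Differentiable ℝ (fun x => Btil i t x k l))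
    (hBtil : ∀ i : Fin d, ∀ t ∈ I, ∀ x, ∀ j k : Fin m, |Btil i t x j k| ≤ ξ t * lamQ t x) {C : CM d m} {LamC : CF d}
    (hC_reg : ∀ k l : Fin m, HolderLocPar d α I (fun t x => C t x k l)) (hC_diff : ∀ t ∈ I, ∀ k l : Fin m, Differentiable ℝ (fun x => C t x k l))
    (hLamC : ∀ t ∈ I, ∀ x, IsMaxEigen (C t x) (LamC t x)) {k : CF d} (hk_nonneg : ∀ t ∈ I, ∀ x, 0 ≤ k t x)
    (hDq : ∀ t ∈ I, ∀ x, ∀ i j : Fin d, √(∑ l : Fin d, (pd (fun y => q t y i j) x l) ^ 2) ≤ k t x * lamQ t x) {LamDb : CF d}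
    (hLamDb : ∀ t ∈ I, ∀ x, IsMaxEigen (fun i j : Fin d => pd (b i t) x j) (LamDb t x))
    (hfin1 : ∀ t ∈ I, ∀ x, √d * m * ξ t * lamQ t x + √(∑ i : Fin d, ∑ k' : Fin m, ∑ l : Fin m, (pd (fun y => C t y k' l) x i) ^ 2) + 2 * LamC t x ≤ K)
    (hfin2 : ∀ t ∈ I, ∀ x, √d * √(∑ i : Fin d, ∑ j : Fin d, ∑ l : Fin d, (pdd (fun z => q t z i j) x l i) ^ 2) +
        √(∑ i : Fin d, ∑ j : Fin d, ∑ k' : Fin m, ∑ l : Fin m, (pd (fun y => Btil i t y k' l) x j) ^ 2) + LamDb t x + LamC t x +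
        (γ * (√d * m * ξ t + d * k t x) ^ 2 + 1 / 2 * (√d * m * ξ t) + 1 / (4 * γ)) * lamQ t x +
        1 / 2 * √(∑ i : Fin d, ∑ k' : Fin m, ∑ l : Fin m, (pd (fun y => C t y k' l) x i) ^ 2) ≤ K)
    (hdiss : ∀ t ∈ I, ∀ x, LamC t x ≤ -(2 * γ * d * m ^ 2 * (ξ t) ^ 2 * lamQ t x)) :
    Dat s T ν₀ γ K q (fun t x i a c => Bmat i t x a c + dl a c * ∑ j, pd (fun y => q t y j i) x j) C (fun t x i => ∑ j, pd (fun y => q t y j i) x j) (fun t x i => b i t x)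
      lamQ LamC (fun t x => ξ t * lamQ t x) (fun t x => kk fun p l => pd (fun y => q t y p.1 p.2) x l) := by
  have hlp : ∀ t ∈ I, ∀ x, 0 < lamQ t x := fun t ht x => hν₀.trans_le (hlamQ t ht x).2
  have hq0 := fun i j => Hol.all hα hsI hsT (hq_reg i j).1
  have hq1 := fun i j l => Hol.all hα hsI hsT ((hq_reg i j).2.2 l)
  have hB0 := fun i k l => Hol.all hα hsI hsT (hB_reg i k l).1
  have hB1 := fun i k l n => Hol.all hα hsI hsT ((hB_reg i k l).2.2 n)
  have hC0 := fun k l => Hol.all hα hsI hsT (hC_reg k l)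
  have hlx : LX s T lamQ := LX.of_le (fun p : Fin d × Fin d => (hq0 p.1 p.2).2.1) zero_le_one fun t ht x y => by
    rw [one_mul]; exact min_eig (hlamQ t (hsI ht) y).1 (hlamQ t (hsI ht) x).1
  have hlb : LB s T lamQ := LB.of_le (c' := 0) (fun p : Fin d × Fin d => (hq0 p.1 p.2).1) zero_le_one fun t ht x => by
    rw [one_mul, zero_add]; exact min_eig0 (hlamQ t (hsI ht) x).1
  have hLx : LX s T LamC := LX.of_le (fun p : Fin m × Fin m => (hC0 p.1 p.2).2.1) zero_le_one fun t ht x y => by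
    rw [one_mul]; exact max_eig (hLamC t (hsI ht) y) (hLamC t (hsI ht) x)
  have hLb : LB s T LamC := LB.of_le (c' := 0) (fun p : Fin m × Fin m => (hC0 p.1 p.2).1) zero_le_one fun t ht x => by
    rw [one_mul, zero_add]; exact max_eig0 (hLamC t (hsI ht) x)
  obtain ⟨X, hX0, hX⟩ : ∃ X, 0 ≤ X ∧ ∀ t ∈ Icc s T, ξ t ≤ X := by
    obtain ⟨M, hM, hM0⟩ := ((hLb 0).and (eventually_ge_atTop 0)).exists
    refine ⟨1 + 2 * M / ν₀, pz, fun t ht => ?_⟩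
    have h1 := hdiss t (hsI ht) 0
    have h2 := abs_le.1 (hM t ht 0 (by simp))
    have h3 := (hlamQ t (hsI ht) 0).2
    have hd' : (1:ℝ) ≤ d := by exact_mod_cast hd
    have hm' : (1:ℝ) ≤ m ^ 2 := by exact_mod_cast Nat.one_le_pow 2 m hm
    have h4 : 1 / 2 ≤ 2 * γ * d * m ^ 2 := by
      have a1 : 1 / 2 * 1 ≤ 2 * γ * d := mul_le_mul (by linarith) hd' zero_le_one (by linarith)
      have a2 : 1 / 2 * 1 * 1 ≤ 2 * γ * d * m ^ 2 := mul_le_mul a1 hm' zero_le_one (by linarith)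
      linarith
    have h5 : 1 / 2 * ξ t ^ 2 * ν₀ ≤ 2 * γ * d * m ^ 2 * ξ t ^ 2 * lamQ t 0 :=
      mul_le_mul (mul_le_r h4 (sq_nonneg _)) h3 hν₀.le (mul_nonneg (by linarith) (sq_nonneg _))
    have h6 : ξ t ^ 2 ≤ 2 * M / ν₀ := by rw [le_div_iff₀ hν₀]; linarith [h2.1]
    nlinarith [sq_nonneg (ξ t - 1)]
  have hXb : LB s T (fun t x => ξ t * lamQ t x) := LB.of_le (c' := 0) (fun _ : Unit => hlb) hX0 fun t ht x => by
    rw [abs_mul, abs_of_pos (hξ t (hsI ht)), zero_add]; simpa using mul_le_r (hX t ht) (abs_nonneg (lamQ t x))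
  have hXx : LX s T (fun t x => ξ t * lamQ t x) := LX.of_le (fun _ : Unit => hlx) hX0 fun t ht x y => by
    rw [← mul_sub, abs_mul, abs_of_pos (hξ t (hsI ht))]; simpa using mul_le_r (hX t ht) (abs_nonneg (lamQ t y - lamQ t x))
  have hCp : ∀ a c l, LB s T (fun t x => pd (fun y => C t y a c) x l) := fun a c l => LB.of_le (c := 2) (c' := K) (fun _ : Unit => hLb) (by norm_num) fun t ht x => by
    have h1 := hfin1 t (hsI ht) x
    have h2 := abs_le_sqrt_sum (fun p : Fin d × Fin m × Fin m => pd (fun y => C t y p.2.1 p.2.2) x p.1) (l, a, c)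
    simp only [Fintype.sum_prod_type] at h2
    have h3 : 0 ≤ √d * m * ξ t * lamQ t x := mul_nonneg (mul_nonneg (pz) (hξ t (hsI ht)).le) (hlp t (hsI ht) x).le
    have h4 := neg_abs_le (LamC t x)
    simp only [Finset.univ_unique, sum_const, Finset.card_singleton, one_smul]
    linarith
  have hMp : ∀ t ∈ I, ∀ x, 0 ≤ γ * (√d * m * ξ t + d * k t x) ^ 2 * lamQ t x ∧ 0 ≤ (1 / 2 * (√d * m * ξ t) + 1 / (4 * γ)) * lamQ t x := fun t ht x => by
    have := (hξ t ht).le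
    have := (hlp t ht x).le
    have : 0 < γ := by linarith
    constructor <;> positivity
  have hE : ∀ i j l, LB s T (fun t x => pdd (fun z => q t z i j) x l i) := by
    intro i j l
    let i0 : Fin d := ⟨0, hd⟩
    let a0 : Fin m := ⟨0, hm⟩
    refine LB.of_le (ι := Bool) (g := fun z => if z then LamC else fun t x => pd (fun y => Bmat i0 t y a0 a0) x i0) (c := 1) (c' := K) (fun z => ?_) zero_le_one fun t ht x => ?_
    · cases z
      · exact (hB1 i0 a0 a0 i0).1
      · exact hLb
    · have h1 := hfin2 t (hsI ht) x
      have h2 := abs_le_sqrt_sum (fun p : Fin d × Fin d × Fin d => pd (fun y => pd (fun z => q t z p.1 p.2.1) y p.2.2) x p.1) (i, j, l)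
      have h3 := abs_le_sqrt_sum (fun p : Fin d × Fin d × Fin m × Fin m => pd (fun y => Btil p.1 t y p.2.2.1 p.2.2.2) x p.2.1) (i0, i0, a0, a0)
      simp only [Fintype.sum_prod_type] at h2 h3
      have h4 := (hLamDb t (hsI ht) x).1 (fun i => if i = i0 then 1 else 0)
      simp at h4
      have h5 : pd (fun y => Bmat i0 t y a0 a0) x i0 = pd (b i0 t) x i0 + pd (fun y => Btil i0 t y a0 a0) x i0 := by
        rw [← pd_add (hb_diff i0 t (hsI ht) x) (hBtil_diff i0 t (hsI ht) a0 a0 x)]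
        simp [hBmat, dl]
      obtain ⟨h6, h7⟩ := hMp t (hsI ht) x
      have h8 := neg_abs_le (LamC t x)
      have h9 := neg_abs_le (pd (fun y => Bmat i0 t y a0 a0) x i0)
      have h10 := le_abs_self (pd (fun y => Btil i0 t y a0 a0) x i0)
      have h11 : 1 ≤ √d := by rw [Real.one_le_sqrt]; exact_mod_cast hd
      have h12 := le_mul_of_one_le_left (sqrt_nonneg (∑ i : Fin d, ∑ j : Fin d, ∑ l : Fin d, (pdd (fun z => q t z i j) x l i) ^ 2)) h11
      have h13 := sqrt_nonneg (∑ i : Fin d, ∑ k' : Fin m, ∑ l : Fin m, (pd (fun y => C t y k' l) x i) ^ 2)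
      simp only [Fintype.sum_bool, if_true, Bool.false_eq_true, if_false]
      linarith
  have hqd : ∀ t ∈ I, ∀ i j l x, DifferentiableAt ℝ (fun y => pd (fun z => q t z i j) y l) x := fun t ht i j l x =>
    ((contDiff_pd (hq_reg2 t ht i j) (m := 1) (by norm_num) l).differentiable (by norm_num)) x
  have hβpd : ∀ t ∈ I, ∀ i x l, pd (fun y => ∑ j, pd (fun z => q t z j i) y j) x l = ∑ j, pdd (fun z => q t z j i) x l j := fun t ht i x l => by
    rw [pd_sum _ fun j _ => hqd t ht j i j x]
    exact sum_cg fun j => pd_pd_symm (hq_reg2 t ht j i) x _ _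
  have hβd : ∀ t ∈ I, ∀ i, Differentiable ℝ (fun y => ∑ j, pd (fun z => q t z j i) y j) := fun t ht i x =>
    DifferentiableAt.fun_sum fun j _ => hqd t ht j i j x
  have hβH : ∀ i, HolderLocPar d α I (fun t x => ∑ j, pd (fun y => q t y j i) x j) := fun i => Hol.sum _ fun j => (hq_reg j i).2.2 j
  have hβL : ∀ i l, LB s T (fun t x => pd (fun y => ∑ j, pd (fun z => q t z j i) y j) x l) := fun i l =>
    LB.of_le (c' := 0) (fun j => hE j i l) zero_le_one fun t ht x => by
      rw [hβpd t (hsI ht), one_mul, zero_add]; exact abs_sum_le_sum_abs _ _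
  have hApd : ∀ t ∈ I, ∀ i a c x l, pd (fun y => Bmat i t y a c + dl a c * ∑ j, pd (fun z => q t z j i) y j) x l = pd (fun y => Bmat i t y a c) x l + dl a c * pd (fun y => ∑ j, pd (fun z => q t z j i) y j) x l := fun t ht i a c x l => by
    rw [pd_add ((hB_reg i a c).2.1 t ht x) ((hβd t ht i x).const_mul _), pd_const_mul _ (hβd t ht i x)]
  have hdl : ∀ a c : Fin m, |dl a c| ≤ 1 := fun a c => by unfold dl; split_ifs <;> simp
  refine
    { hq := fun i j => ⟨(hq0 i j).1, (hq0 i j).2.1, (hq0 i j).2.2, fun t ht => (hq_reg i j).2.1 t (hsI ht), fun l => (hq1 i j l).1⟩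
      hqx := fun i j l => (hq1 i j l).2.1
      hqs := fun t ht x i j => hq_symm t (hsI ht) x i j
      hA := fun i a c => ?_
      hC := fun a c => ⟨(hC0 a c).1, (hC0 a c).2.1, (hC0 a c).2.2, fun t ht => hC_diff t (hsI ht) a c, fun l => hCp a c l⟩
      hβ := fun i => ⟨(Hol.all hα hsI hsT (hβH i)).1, (Hol.all hα hsI hsT (hβH i)).2.1, (Hol.all hα hsI hsT (hβH i)).2.2, fun t ht => hβd t (hsI ht) i, fun l => hβL i l⟩
      hb := fun i => ?_
      hlx := hlx
      hLx := hLx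
      hXx := hXx
      hkx := LX.of_le (fun p : (Fin d × Fin d) × Fin d => (hq1 p.1.1 p.1.2 p.2).2.1) zero_le_one fun t ht x y => kk_sub _ _
      hXb := hXb
      hkb := LB.of_le (c' := 0) (fun p : (Fin d × Fin d) × Fin d => (hq1 p.1.1 p.1.2 p.2).1) zero_le_one fun t ht x => ?_
      hlam := fun t ht x => (hlamQ t (hsI ht) x).2
      hX0 := fun t ht x => mul_nonneg (hξ t (hsI ht)).le (hlp t (hsI ht) x).le
      hk0 := fun t ht x => kk_nonneg _
      hqp := fun t ht x w => (hlamQ t (hsI ht) x).1.1 w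
      hAX := fun t ht x i a c => ?_
      hqk := fun t ht x i j => le_kk (fun p l => pd (fun y => q t y p.1 p.2) x l) (i, j)
      hCL := fun t ht x w => (hLamC t (hsI ht) x).1 w
      hds := fun t ht x => ?_
      hsf := fun t ht x u J => ?_ }
  · have hH : HolderLocPar d α I (fun t x => Bmat i t x a c + dl a c * ∑ j, pd (fun y => q t y j i) x j) := Hol.add (hB_reg i a c).1 (Hol.cmul _ (hβH i))
    refine ⟨(Hol.all hα hsI hsT hH).1, (Hol.all hα hsI hsT hH).2.1, (Hol.all hα hsI hsT hH).2.2, fun t ht x => ?_, fun l => ?_⟩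
    · exact ((hB_reg i a c).2.1 t (hsI ht) x).fun_add ((hβd t (hsI ht) i x).const_mul _)
    · refine LB.of_le (ι := Bool) (g := fun z => if z then (fun t x => pd (fun y => ∑ j, pd (fun z => q t z j i) y j) x l) else fun t x => pd (fun y => Bmat i t y a c) x l) (c := 1) (c' := 0) (fun z => ?_) zero_le_one fun t ht x => ?_
      · cases z
        · exact (hB1 i a c l).1
        · exact hβL i l
      · rw [hApd t (hsI ht)]
        simp only [Fintype.sum_bool, if_true, Bool.false_eq_true, if_false]
        refine (abs_add_le _ _).trans ?_
        rw [abs_mul]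
        have := mul_le_of_le_one_left (abs_nonneg (pd (fun y => ∑ j, pd (fun z => q t z j i) y j) x l)) (hdl a c)
        linarith
  · let a0 : Fin m := ⟨0, hm⟩
    refine LB.of_le (ι := Bool) (g := fun z => if z then (fun t x => ξ t * lamQ t x) else fun t x => Bmat i t x a0 a0) (c := 1) (c' := 0) (fun z => ?_) zero_le_one fun t ht x => ?_
    · cases z
      · exact (hB0 i a0 a0).1
      · exact hXb
    · have h1 := hBmat i t x a0 a0
      have h2 := hBtil i t (hsI ht) x a0 a0
      have h3 : b i t x = Bmat i t x a0 a0 - Btil i t x a0 a0 := by rw [h1]; simp [dl]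
      simp only [Fintype.sum_bool, if_true, Bool.false_eq_true, if_false]
      rw [h3]
      have h4 := abs_sub (Bmat i t x a0 a0) (Btil i t x a0 a0)
      have h5 := le_abs_self (ξ t * lamQ t x)
      linarith
  · have h := kk_sub (fun p l => pd (fun y => q t y p.1 p.2) x l) (fun _ _ => 0)
    have h0 : kk (fun (_ : Fin d × Fin d) (_ : Fin d) => (0:ℝ)) = 0 := le_antisymm (kk_le le_rfl fun p => by simp) (kk_nonneg _)
    simpa [h0] using h
  · rw [hBmat, show dl a c * b i t x + Btil i t x a c + dl a c * ∑ j, pd (fun y => q t y j i) x j - dl a c * (b i t x + ∑ j, pd (fun y => q t y j i) x j) = Btil i t x a c by ring]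
    exact hBtil i t (hsI ht) x a c
  · refine (hdiss t (hsI ht) x).trans (le_of_eq ?_)
    have h1 := (hlp t (hsI ht) x).ne'
    have h2 := sq_sqrt (Nat.cast_nonneg (α := ℝ) d)
    congr 1
    rw [eq_div_iff h1, mul_pow, mul_pow, h2]
    ring
  · have hcalc := sf_alg (Db := fun i l => pd (b i t) x l) (DB := fun i a c l => pd (fun y => Btil i t y a c) x l) (E := fun i j l => pdd (fun z => q t z i j) x l i)
      (DC := fun a c l => pd (fun y => C t y a c) x l) (fun w => (hLamDb t (hsI ht) x).1 w) u J
    have hA' : ∀ i a c l, pd (fun y => Bmat i t y a c + dl a c * ∑ j, pd (fun z => q t z j i) y j) x l = dl a c * pd (b i t) x l + pd (fun y => Btil i t y a c) x l + dl a c * ∑ j, pdd (fun z => q t z j i) x l j := fun i a c l => by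
      rw [hApd t (hsI ht), hβpd t (hsI ht)]
      simp only [hBmat]
      rw [pd_add ((hb_diff i t (hsI ht) x).const_mul _) (hBtil_diff i t (hsI ht) a c x), pd_const_mul _ (hb_diff i t (hsI ht) x)]
    simp only [hA']
    refine hcalc.trans (add_le_add (mul_le_r ?_ (sum_nn fun _ => sum_nn fun _ => sq_nonneg _)) (mul_le_r ?_ (sum_nn fun _ => sq_nonneg _)))
    · have h1 := hfin2 t (hsI ht) x
      obtain ⟨h6, h7⟩ := hMp t (hsI ht) x
      have hl := hlp t (hsI ht) x
      have hk := kk_le (mul_nonneg (hk_nonneg t (hsI ht) x) hl.le) (fun p : Fin d × Fin d => hDq t (hsI ht) x p.1 p.2)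
      have h8 : γ * (√d * m * (ξ t * lamQ t x) + d * kk fun p l => pd (fun y => q t y p.1 p.2) x l) ^ 2 / lamQ t x ≤ γ * (√d * m * ξ t + d * k t x) ^ 2 * lamQ t x := by
        rw [div_le_iff₀ hl]
        have h9 : √d * m * (ξ t * lamQ t x) + d * kk (fun p l => pd (fun y => q t y p.1 p.2) x l) ≤ (√d * m * ξ t + d * k t x) * lamQ t x := by
          have := mul_le_l hk (Nat.cast_nonneg (α := ℝ) d)
          linarith
        have h10 := pow_le_pow_left₀ (add_nonneg (mul_nonneg (pz) (mul_nonneg (hξ t (hsI ht)).le hl.le)) (mul_nonneg (pz) (kk_nonneg _))) h9 2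
        have h11 := mul_le_l h10 (show 0 ≤ γ by linarith)
        refine h11.trans (le_of_eq ?_)
        ring
      linarith
    · have h1 := hfin1 t (hsI ht) x
      have h3 : 0 ≤ √d * m * ξ t * lamQ t x := mul_nonneg (mul_nonneg (pz) (hξ t (hsI ht)).le) (hlp t (hsI ht) x).le
      linarith

end mk

section last
variable {d m : ℕ}

theorem div_form {Q : EE d → MM d} (hQ : ∀ i j, Differentiable ℝ (fun x => Q x i j)) {g : EE d → ℝ} (hg : ContDiff ℝ 2 g) (x : EE d) :
    (∑ i, ∑ j, pd (fun y => Q y i j * pd g y j) x i) = (∑ i, ∑ j, Q x i j * pdd g x i j) + ∑ i, (∑ j, pd (fun y => Q y j i) x j) * pd g x i := by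
  have h1 : ∀ i j, pd (fun y => Q y i j * pd g y j) x i = Q x i j * pdd g x i j + pd (fun y => Q y i j) x i * pd g x j := fun i j => by
    rw [pd_mul (hQ i j x) ((contDiff_pd hg (m := 1) (by norm_num) j).differentiable (by norm_num) x), pd_pd_symm hg x i j, add_comm]
  simp only [h1, sum_ad, sum_mul]
  congr 1
  exact sum_comm

theorem deriv_left {s T t : ℝ} (ht : t ∈ Ioc s T) {g : ℝ → ℝ} {g' : ℝ} (h : HasDerivWithinAt g g' (Ioc s T) t) : HasDerivWithinAt g g' (Iic t) t :=
  h.mono_of_mem_nhdsWithin (mem_of_superset (Ioc_mem_nhdsLE ht.1) (Ioc_subset_Ioc_right ht.2))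

theorem uc_data {f : EE d → Fin m → ℝ} (hf : Continuous f) (hc : HasCompactSupport f) {r : ℝ} (hr : 0 < r) :
    (∀ k, UniformContinuous (fun x => f x k)) ∧ UniformContinuous (fun x => (∑ k, f x k ^ 2) ^ r) := by
  refine ⟨fun k => ?_, ?_⟩
  · refine Continuous.uniformContinuous_of_tendsto_cocompact (x := 0) ((continuous_apply k).comp hf) ?_
    exact (hc.comp_left (g := fun v : Fin m → ℝ => v k) rfl).is_zero_at_infty
  · refine Continuous.uniformContinuous_of_tendsto_cocompact (x := 0) ?_ ?_
    · exact Continuous.rpow_const (by fun_prop) fun x => Or.inr hr.le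
    · exact (hc.comp_left (g := fun v : Fin m → ℝ => (∑ k, v k ^ 2) ^ r) (by simp [Real.zero_rpow hr.ne'])).is_zero_at_infty

end last

end Development

/-- Smoothing pointwise gradient estimate (Theorem 5.3 of the paper):
under the hypotheses of the pointwise gradient estimate with `J = I` and the additional
dissipativity condition `Λ_C ≤ −2γ d m² ξ² λ_Q`, for every `p ≥ 1 + 1/(4(β∧γ))` there are
`k_p, h_p > 0` with `|D_x u(t,x)|^p ≤ k_p e^{h_p(t−s)} (t−s)^{−p/2} v(t,x)` whenever `u`
solves the vector system with datum `f ∈ C_c^∞` and `v` solves the scalar problem with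
datum `|f|^p`. -/
theorem stmt_14 (d m : ℕ) (hd : 1 ≤ d) (hm : 1 ≤ m)
    (I : Set ℝ) (hI : I.OrdConnected)
    (α : ℝ) (hα : α ∈ Ioo (0:ℝ) 1)
    (ν₀ β γ : ℝ) (hν₀ : 0 < ν₀) (hβ : 1 / 4 ≤ β) (hγ : 1 / 4 ≤ γ)
    (ξ : ℝ → ℝ) (hξ : ∀ t ∈ I, 0 < ξ t)
    (q : ℝ → EuclideanSpace ℝ (Fin d) → Matrix (Fin d) (Fin d) ℝ)
    (lamQ : ℝ → EuclideanSpace ℝ (Fin d) → ℝ)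
    (hq_reg : ∀ i j : Fin d, Cpar1 d α I (fun t x => q t x i j))
    (hq_reg2 : ∀ t ∈ I, ∀ i j : Fin d, ContDiff ℝ 2 (fun x => q t x i j))
    (hq_symm : ∀ t ∈ I, ∀ x, (q t x).IsSymm)
    (hlamQ : ∀ t ∈ I, ∀ x, IsMinEigen (q t x) (lamQ t x) ∧ ν₀ ≤ lamQ t x)
    (b : Fin d → ℝ → EuclideanSpace ℝ (Fin d) → ℝ)
    (Btil : Fin d → ℝ → EuclideanSpace ℝ (Fin d) → Matrix (Fin m) (Fin m) ℝ)
    (Bmat : Fin d → ℝ → EuclideanSpace ℝ (Fin d) → Matrix (Fin m) (Fin m) ℝ)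
    (hBmat : ∀ i : Fin d, ∀ t : ℝ, ∀ x,
      Bmat i t x = b i t x • (1 : Matrix (Fin m) (Fin m) ℝ) + Btil i t x)
    (hB_reg : ∀ i : Fin d, ∀ k l : Fin m, Cpar1 d α I (fun t x => Bmat i t x k l))
    (hB_symm : ∀ i : Fin d, ∀ t ∈ I, ∀ x, (Bmat i t x).IsSymm)
    (hb_diff : ∀ i : Fin d, ∀ t ∈ I, Differentiable ℝ (b i t))
    (hBtil_diff : ∀ i : Fin d, ∀ t ∈ I, ∀ k l : Fin m,
      Differentiable ℝ (fun x => Btil i t x k l))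
    (hBtil : ∀ i : Fin d, ∀ t ∈ I, ∀ x, ∀ j k : Fin m,
      |Btil i t x j k| ≤ ξ t * lamQ t x)
    (C : ℝ → EuclideanSpace ℝ (Fin d) → Matrix (Fin m) (Fin m) ℝ)
    (LamC : ℝ → EuclideanSpace ℝ (Fin d) → ℝ)
    (hC_reg : ∀ k l : Fin m, HolderLocPar d α I (fun t x => C t x k l))
    (hC_diff : ∀ t ∈ I, ∀ k l : Fin m, Differentiable ℝ (fun x => C t x k l))
    (hC_symm : ∀ t ∈ I, ∀ x, (C t x).IsSymm)
    (hLamC : ∀ t ∈ I, ∀ x, IsMaxEigen (C t x) (LamC t x))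
    (Hb : ℝ) (hHb : ∀ t ∈ I, ∀ x, LamC t x + β * d * m ^ 2 * (ξ t) ^ 2 * lamQ t x ≤ Hb)
    (lam₀ : ℝ) (hlam₀ : 0 < lam₀) (φ : EuclideanSpace ℝ (Fin d) → ℝ)
    (hφ_reg : ContDiff ℝ 2 φ) (hφ_pos : ∀ x, 0 < φ x)
    (hφ_blowup : Tendsto φ (cocompact (EuclideanSpace ℝ (Fin d))) atTop)
    (hφ_lyap : ∃ K : ℝ, ∀ t ∈ I, ∀ x,
      ((∑ i : Fin d, ∑ j : Fin d, pd (fun y => q t y i j * pd φ y j) x i) +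
        ∑ i : Fin d, b i t x * pd φ x i) - lam₀ * φ x ≤ K)
    (k : ℝ → EuclideanSpace ℝ (Fin d) → ℝ) (hk_nonneg : ∀ t ∈ I, ∀ x, 0 ≤ k t x)
    (hDq : ∀ t ∈ I, ∀ x, ∀ i j : Fin d,
      Real.sqrt (∑ l : Fin d, (pd (fun y => q t y i j) x l) ^ 2) ≤ k t x * lamQ t x)
    (LamDb : ℝ → EuclideanSpace ℝ (Fin d) → ℝ)
    (hLamDb : ∀ t ∈ I, ∀ x,
      IsMaxEigen (fun i j : Fin d => pd (b i t) x j) (LamDb t x))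
    (hfin1 : ∃ K₁ : ℝ, ∀ t ∈ I, ∀ x,
      Real.sqrt d * m * ξ t * lamQ t x +
        Real.sqrt (∑ i : Fin d, ∑ k' : Fin m, ∑ l : Fin m,
          (pd (fun y => C t y k' l) x i) ^ 2) +
        2 * LamC t x ≤ K₁)
    (hfin2 : ∃ K₂ : ℝ, ∀ t ∈ I, ∀ x,
      Real.sqrt d * Real.sqrt (∑ i : Fin d, ∑ j : Fin d, ∑ l : Fin d,
          (pd (fun y => pd (fun z => q t z i j) y l) x i) ^ 2) +
        Real.sqrt (∑ i : Fin d, ∑ j : Fin d, ∑ k' : Fin m, ∑ l : Fin m,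
          (pd (fun y => Btil i t y k' l) x j) ^ 2) +
        LamDb t x + LamC t x +
        (γ * (Real.sqrt d * m * ξ t + d * k t x) ^ 2 +
          1 / 2 * (Real.sqrt d * m * ξ t) + 1 / (4 * γ)) * lamQ t x +
        1 / 2 * Real.sqrt (∑ i : Fin d, ∑ k' : Fin m, ∑ l : Fin m,
          (pd (fun y => C t y k' l) x i) ^ 2) ≤ K₂)
    (hdiss : ∀ t ∈ I, ∀ x, LamC t x ≤ -(2 * γ * d * m ^ 2 * (ξ t) ^ 2 * lamQ t x)) :
    ∀ p : ℝ, 1 + 1 / (4 * min β γ) ≤ p →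
      ∃ kp hp : ℝ, 0 < kp ∧ 0 < hp ∧
        ∀ f : EuclideanSpace ℝ (Fin d) → Fin m → ℝ,
          ContDiff ℝ (⊤ : ℕ∞) f → HasCompactSupport f →
        ∀ s T : ℝ, s ∈ I → T ∈ I → s < T →
        ∀ u : ℝ → EuclideanSpace ℝ (Fin d) → Fin m → ℝ,
          ContinuousOn (fun pt : ℝ × EuclideanSpace ℝ (Fin d) => u pt.1 pt.2)
            (Icc s T ×ˢ (univ : Set (EuclideanSpace ℝ (Fin d)))) →
          (∃ Mu : ℝ, ∀ t ∈ Icc s T, ∀ x, ∑ k' : Fin m, (u t x k') ^ 2 ≤ Mu) →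
          (∀ x, u s x = f x) →
          (∀ t ∈ Ioc s T, ContDiff ℝ 2 (u t)) →
          (∀ t ∈ Ioc s T, ∀ x,
            HasDerivWithinAt (fun τ => u τ x)
              (fun k' : Fin m =>
                (∑ i : Fin d, ∑ j : Fin d,
                  pd (fun y => q t y i j * pd (fun z => u t z k') y j) x i) +
                (∑ i : Fin d, ∑ l : Fin m,
                  Bmat i t x k' l * pd (fun z => u t z l) x i) +
                ∑ l : Fin m, C t x k' l * u t x l)
              (Ioc s T) t) →
        ∀ v : ℝ → EuclideanSpace ℝ (Fin d) → ℝ,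
          ContinuousOn (fun pt : ℝ × EuclideanSpace ℝ (Fin d) => v pt.1 pt.2)
            (Icc s T ×ˢ (univ : Set (EuclideanSpace ℝ (Fin d)))) →
          (∃ Mv : ℝ, ∀ t ∈ Icc s T, ∀ x, |v t x| ≤ Mv) →
          (∀ x, v s x = (∑ k' : Fin m, (f x k') ^ 2) ^ (p / 2)) →
          (∀ t ∈ Ioc s T, ContDiff ℝ 2 (v t)) →
          (∀ t ∈ Ioc s T, ∀ x,
            HasDerivWithinAt (fun τ => v τ x)
              ((∑ i : Fin d, ∑ j : Fin d,
                pd (fun y => q t y i j * pd (fun z => v t z) y j) x i) +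
                ∑ i : Fin d, b i t x * pd (fun z => v t z) x i)
              (Ioc s T) t) →
        ∀ t ∈ Ioc s T, ∀ x,
          (∑ i : Fin d, ∑ k' : Fin m, (pd (fun z => u t z k') x i) ^ 2) ^ (p / 2) ≤
            kp * Real.exp (hp * (t - s)) * (t - s) ^ (-(p / 2)) * v t x := by
  intro p hp
  obtain ⟨K₁, hK₁⟩ := hfin1
  obtain ⟨K₂, hK₂⟩ := hfin2
  obtain ⟨K₃, hK₃⟩ := hφ_lyap
  set K := max 0 (max K₁ K₂) with hKdef
  have hK : 0 ≤ K := le_max_left _ _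
  have hKa : K₁ ≤ K := (le_max_left _ _).trans (le_max_right _ _)
  have hKb : K₂ ≤ K := (le_max_right _ _).trans (le_max_right _ _)
  have hγ0 : 0 < γ := by linarith
  have hmin : 0 < min β γ := lt_min (by linarith) hγ0
  have hp1 : 1 / (4 * γ) ≤ 1 / (4 * min β γ) := one_div_le_one_div_of_le (by positivity) (by linarith [min_le_right β γ])
  have hp0 : 0 < p := by
    have : 0 < 1 / (4 * min β γ) := by positivity
    linarith
  set r := p / 2 with hr
  have hr0 : 0 < r := by positivity
  have hr1 : 1 / (2 * γ) ≤ 2 - 4 * (1 - r) := by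
    have h1 : 1 / (2 * γ) = 2 * (1 / (4 * γ)) := by field_simp; norm_num
    rw [h1]; linarith
  set a := min (1 / 3) (ν₀ / (16 * γ)) with ha
  have ha0 : 0 < a := lt_min (by norm_num) (by positivity)
  have hd0 : (0:ℝ) < d := by exact_mod_cast hd
  have hm0 : (0:ℝ) < m := by exact_mod_cast hm
  refine ⟨(d * m / a) ^ r, r * (4 + 2 * (K + 3)) + r, Real.rpow_pos_of_pos (by positivity) _, by positivity, ?_⟩
  intro f hf hfc s T hs hT hsT u huc hub hu0 hu2 hue v hvc hvb hv0 hv2 hve t ht x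
  have hsI : Icc s T ⊆ I := hI.out hs hT
  have hoI : Ioc s T ⊆ I := Ioc_subset_Icc_self.trans hsI
  have hqD : ∀ t ∈ I, ∀ i j : Fin d, Differentiable ℝ (fun x => q t x i j) := fun t ht i j => (hq_reg i j).2.1 t ht
  have D := mkDat (K := K) hd hm hsI hsT hα.1 hν₀ hγ hξ hq_reg hq_reg2 (fun t ht x i j => (hq_symm t ht x).apply j i) hlamQ
    (fun i t x k l => by rw [hBmat, Matrix.add_apply, Matrix.smul_apply, Matrix.one_apply, smul_eq_mul, mul_comm]; rfl)
    hB_reg hb_diff hBtil_diff hBtil hC_reg hC_diff hLamC hk_nonneg hDq hLamDb (fun t ht x => (hK₁ t ht x).trans hKa) (fun t ht x => (hK₂ t ht x).trans hKb) hdiss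
  obtain ⟨Mu, hMu⟩ := hub
  obtain ⟨Mv, hMv⟩ := hvb
  obtain ⟨hfu, hfr⟩ := uc_data hf.continuous hfc hr0
  have hfS : ∀ k, SB (fun (_ : Unit) x => f x k) := fun k =>
    SB.of_compact (contDiff_pi.1 hf k) (hfc.comp_left (g := fun v : Fin m → ℝ => v k) rfl)
  have hu2' : ∀ t ∈ Ioc s T, ∀ k, ContDiff ℝ 2 (fun z => u t z k) := fun t ht k => contDiff_pi.1 (hu2 t ht) k
  have hc0 : 0 ≤ |K₃| / lam₀ := by positivity
  have hψ : ContDiff ℝ 2 (fun x => φ x + |K₃| / lam₀) := hφ_reg.add contDiff_const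
  have hψpd : ∀ x i, pd (fun x => φ x + |K₃| / lam₀) x i = pd φ x i := fun x i => by
    rw [pd_add (hφ_reg.differentiable (by norm_num) x) (differentiableAt_const _), pd_const, add_zero]
  have hly : ∀ t ∈ Icc s T, ∀ x, (∑ i, ∑ j, q t x i j * pd (fun y => pd (fun x => φ x + |K₃| / lam₀) y i) x j) + (∑ i, (b i t x + ∑ j, pd (fun y => q t y j i) x j) * pd (fun x => φ x + |K₃| / lam₀) x i) ≤ lam₀ * (φ x + |K₃| / lam₀) := by
    intro t ht x
    have h1 := hK₃ t (hsI ht) x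
    have h2 := div_form (Q := q t) (hqD t (hsI ht)) hφ_reg x
    simp only [hψpd, add_mul, Finset.sum_add_distrib] at h1 h2 ⊢
    rw [h2] at h1
    have h3 : lam₀ * (φ x + |K₃| / lam₀) = lam₀ * φ x + |K₃| := by field_simp
    rw [h3]
    linarith [le_abs_self K₃]
  have hub' : ∀ t ∈ Icc s T, ∀ x k, |u t x k| ≤ Real.sqrt Mu := by
    intro t ht x k
    refine Real.abs_le_sqrt ?_
    exact (Finset.single_le_sum (f := fun k => u t x k ^ 2) (fun _ _ => sq_nonneg _) (Finset.mem_univ k)).trans (hMu t ht x)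
  have huc' : ∀ k, ContinuousOn (fun p : ℝ × EE d => u p.1 p.2 k) (Icc s T ×ˢ univ) := by
    intro k
    exact (continuous_apply k).comp_continuousOn huc
  have hue' : ∀ t ∈ Ioc s T, ∀ x k, HasDerivWithinAt (fun τ => u τ x k) ((∑ i, ∑ j, q t x i j * pd (fun y => pd (fun z => u t z k) y i) x j) + (∑ i, ∑ l, (Bmat i t x k l + dl k l * ∑ j, pd (fun y => q t y j i) x j) * pd (fun z => u t z l) x i) + ∑ l, C t x k l * u t x l) (Iic t) t := by
    intro t ht x k
    have h1 := deriv_left ht (hasDerivWithinAt_pi.1 (hue t ht x) k)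
    refine h1.congr_deriv ?_
    have h2 := div_form (Q := q t) (hqD t (hoI ht)) (hu2' t ht k) x
    have h3 : (∑ i, ∑ l, (Bmat i t x k l + dl k l * ∑ j, pd (fun y => q t y j i) x j) * pd (fun z => u t z l) x i) =
        (∑ i, ∑ l, Bmat i t x k l * pd (fun z => u t z l) x i) + ∑ i, (∑ j, pd (fun y => q t y j i) x j) * pd (fun z => u t z k) x i := by
      simp only [add_mul, Finset.sum_add_distrib, dl, ite_mul, one_mul, zero_mul, Finset.sum_ite_eq, Finset.mem_univ, if_true]
    rw [h2, h3]
    ring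
  have hve' : ∀ t ∈ Ioc s T, ∀ x, HasDerivWithinAt (fun τ => v τ x) ((∑ i, ∑ j, q t x i j * pd (fun y => pd (v t) y i) x j) + (∑ i, (b i t x + ∑ j, pd (fun y => q t y j i) x j) * pd (v t) x i)) (Iic t) t := by
    intro t ht x
    have h1 := deriv_left ht (hve t ht x)
    refine h1.congr_deriv ?_
    have h2 := div_form (Q := q t) (hqD t (hoI ht)) (hv2 t ht) x
    rw [h2]
    simp only [add_mul, Finset.sum_add_distrib]
    ring
  refine FIN (U := u t) (V := v t) hd hm ht.1 ha0 hr0 (fun k => (hu2' t ht k).differentiable (by norm_num)) (hv2 t ht).continuous (fun η hη ρ => ?_) x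
  obtain ⟨ε, hε, w, hw, h⟩ := APPROX D hd hm hsT hν₀ hγ hK ha0 (min_le_left _ _) (min_le_right _ _) hr0 hr1 hfS hfu hfr hlam₀ hψ
    (fun x => add_pos_of_pos_of_nonneg (hφ_pos x) hc0) (tendsto_atTop_add_const_right _ _ hφ_blowup) hly (Real.sqrt_nonneg Mu) hub' hu2' huc' hu0 hue'
    (abs_nonneg Mv) (fun t ht x => (hMv t ht x).trans (le_abs_self _)) hv2 hvc hv0 hve' hη ρ
  exact ⟨ε, hε, w, hw, fun y hy => h t (Ioc_subset_Icc_self ht) y hy⟩
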